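/- Let A be a function on ℝ with A' ∈ BMO(ℝ) and ‖A'‖_{BMO(ℝ)} = 1. Let p_1,…,p_m ∈ (1,∞) and p ∈ (1/(m+1), 1) with 1/p = 1/p_1 + ⋯ + 1/p_m + 1. Then there is a constant C such that |{x ∈ ℝ : |C_{m+1,A}(a_1,…,a_m; f)(x)| > 1}| ≤ C ( Σ_{j=1}^m ‖a_j‖_{L^{p_j}(ℝ)}^{p_j} + ∫_ℝ |f(x)| log(e + |f(x)|) dx ). -/

import Mathlib

open MeasureTheory Filter Set
open scoped ENNReal BigOperators

noncomputable section

/-- `Adiff g x y = ∫_y^x g`, i.e. `G x - G y` for an antiderivative `G` of `g`. -/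
def Adiff (g : ℝ → ℝ) (x y : ℝ) : ℝ := ∫ t in y..x, g t

/-- `P₂(A; x, y) = A x - A y - A' y * (x - y)`. -/
def P2 (A A' : ℝ → ℝ) (x y : ℝ) : ℝ := A x - A y - A' y * (x - y)

/-- The generalized Calderón commutator `𝒞_{m+1,A}(a₁,…,a_m; f)`, defined as a
principal value. -/
def CcommA (m : ℕ) (A A' : ℝ → ℝ) (a : Fin m → ℝ → ℝ) (f : ℝ → ℝ) (x : ℝ) : ℝ :=
  limUnder (nhdsWithin 0 (Ioi 0)) fun ε : ℝ =>
    ∫ y in {y : ℝ | ε < |x - y|},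
      (P2 A A' x y * ∏ j, Adiff (a j) x y) / (x - y) ^ (m + 2) * f y

/-- The `(m+1)`-th order Calderón commutator `𝒞_{m+1}(a₁,…,a_m; f)`. -/
def Ccomm (m : ℕ) (a : Fin m → ℝ → ℝ) (f : ℝ → ℝ) (x : ℝ) : ℝ :=
  limUnder (nhdsWithin 0 (Ioi 0)) fun ε : ℝ =>
    ∫ y in {y : ℝ | ε < |x - y|},
      (∏ j, Adiff (a j) x y) / (x - y) ^ (m + 1) * f y

/-- The BMO norm of `g` over intervals in `ℝ`. -/
def bmoNorm (g : ℝ → ℝ) : ℝ :=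
  sSup {c : ℝ | ∃ u v : ℝ, u < v ∧
    c = (v - u)⁻¹ * ∫ y in Ioc u v, |g y - (v - u)⁻¹ * ∫ z in Ioc u v, g z|}

/-- Average (in `ℝ≥0∞`) of a nonnegative function over an interval. -/
def avgE (g : ℝ → ℝ) (u v : ℝ) : ℝ≥0∞ :=
  (ENNReal.ofReal (v - u))⁻¹ * ∫⁻ y in Ioc u v, ENNReal.ofReal (g y)

/-- Weighted `L^p` norm `(∫ |g|^p w)^{1/p}`. -/
def wLpNorm (p : ℝ) (w g : ℝ → ℝ) : ℝ≥0∞ :=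
  (∫⁻ x, ENNReal.ofReal (|g x| ^ p * w x)) ^ (1 / p)

/-- `L^p` norm. -/
def LpNorm (p : ℝ) (g : ℝ → ℝ) : ℝ≥0∞ :=
  (∫⁻ x, ENNReal.ofReal (|g x| ^ p)) ^ (1 / p)

/-- Weak `L^p` quasinorm. -/
def wkNorm (p : ℝ) (g : ℝ → ℝ) : ℝ≥0∞ :=
  ⨆ (t : ℝ) (_ : 0 < t), ENNReal.ofReal t * (volume {x : ℝ | t < |g x|}) ^ (1 / p)

/-- The multiple weight `ν_{→w} = ∏ w_i^{p/p_i}`. -/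
def nuW (k : ℕ) (ptot : ℝ) (p : Fin k → ℝ) (w : Fin k → ℝ → ℝ) : ℝ → ℝ :=
  fun x => ∏ i, w i x ^ (ptot / p i)

/-- The multilinear Muckenhoupt `A_{→P}` constant (for exponents `p i > 1`). -/
def APconst (k : ℕ) (ptot : ℝ) (p : Fin k → ℝ) (w : Fin k → ℝ → ℝ) : ℝ≥0∞ :=
  ⨆ (u : ℝ) (v : ℝ) (_ : u < v),
    avgE (nuW k ptot p w) u v *
      ∏ i, (avgE (fun y => w i y ^ (-(1 / (p i - 1)))) u v) ^ (ptot * (1 - 1 / p i))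

/-- Hardy–Littlewood maximal operator on `ℝ` (over intervals). -/
def Mop1 (g : ℝ → ℝ) (x : ℝ) : ℝ≥0∞ :=
  ⨆ (u : ℝ) (v : ℝ) (_ : u < v) (_ : x ∈ Ioc u v), avgE (fun y => |g y|) u v

/-- The Fujii–Wilson `A_∞` constant of a weight `u` on `ℝ`. -/
def AinfConst (u : ℝ → ℝ) : ℝ≥0∞ :=
  ⨆ (c : ℝ) (d : ℝ) (_ : c < d),
    (∫⁻ y in Ioc c d, ENNReal.ofReal (u y))⁻¹ *
      ∫⁻ x in Ioc c d, Mop1 (Set.indicator (Ioc c d) u) x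

/-- The `A_{(1,…,1)}` constant of a vector weight. -/
def A11const (k : ℕ) (w : Fin k → ℝ → ℝ) : ℝ≥0∞ :=
  ⨆ (u : ℝ) (v : ℝ) (_ : u < v),
    avgE (fun x => ∏ i, w i x ^ ((1 : ℝ) / k)) u v *
      ∏ i, ((ENNReal.ofReal (essInf (w i) (volume.restrict (Ioc u v))))⁻¹) ^ ((1 : ℝ) / k)

/-- Luxemburg norm `‖f‖_{L(log L)^γ, (u,v)}` over the interval `(u, v]`. -/
def luxNormI (γ : ℝ) (u v : ℝ) (f : ℝ → ℝ) : ℝ :=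
  sInf {t : ℝ | 0 < t ∧
    ∫⁻ y in Ioc u v, ENNReal.ofReal (|f y| / t * Real.log (Real.exp 1 + |f y| / t) ^ γ)
      ≤ ENNReal.ofReal (v - u)}

/-- The interval with the same center as `(u,v]` and `lam` times its length. -/
def scaleI (lam u v : ℝ) : ℝ × ℝ :=
  ((u + v) / 2 - lam * (v - u) / 2, (u + v) / 2 + lam * (v - u) / 2)

/-- Maximal operator `M_{L log L}` on `ℝ`. -/
def MLlogL (f : ℝ → ℝ) (x : ℝ) : ℝ≥0∞ :=
  ⨆ (u : ℝ) (v : ℝ) (_ : u < v) (_ : x ∈ Ioc u v), ENNReal.ofReal (luxNormI 1 u v f)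

/-- John–Strömberg sharp maximal operator `M^♯_{0,s}` on `ℝ`. -/
def Msharp1 (s : ℝ) (g : ℝ → ℝ) (x : ℝ) : ℝ≥0∞ :=
  ⨆ (u : ℝ) (v : ℝ) (_ : u < v) (_ : x ∈ Ioc u v),
    ⨅ (b : ℝ), ⨅ (t : ℝ) (_ : 0 < t)
      (_ : volume {y ∈ Ioc u v | t < |g y - b|} < ENNReal.ofReal s * volume (Ioc u v)),
      ENNReal.ofReal t

/-- Membership in BMO(ℝ). -/
def MemBMO (g : ℝ → ℝ) : Prop :=
  ∃ M : ℝ, ∀ u v : ℝ, u < v →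
    (v - u)⁻¹ * (∫ y in Ioc u v, |g y - (v - u)⁻¹ * ∫ z in Ioc u v, g z|) ≤ M

end

open scoped Topology

namespace CZ

open ENNReal (ofReal ofReal_mul ofReal_le_ofReal ofReal_add ofReal_ne_top ofReal_le_ofReal_iff ofReal_one ofReal_toReal ofReal_eq_zero)
open Real (exp log norm_eq_abs volume_Ioc dist_eq volume_real_Ioc_of_le)
open Finset (insertNone)

/-- Bounded-oscillation hypothesis used throughout. -/
def BMO1 (α : ℝ → ℝ) : Prop :=
  (∀ u v : ℝ, IntegrableOn α (Ioc u v)) ∧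
  ∀ u v : ℝ, u < v → ∫ y in Ioc u v, |α y - (v - u)⁻¹ * ∫ z in Ioc u v, α z| ≤ v - u

theorem bmo_le {A' : ℝ → ℝ} (hbmo : bmoNorm A' = 1) (u v : ℝ) (h : u < v) :
    ∫ y in Ioc u v, |A' y - (v - u)⁻¹ * ∫ z in Ioc u v, A' z| ≤ v - u := by
  have hb : BddAbove {c : ℝ | ∃ u v : ℝ, u < v ∧
    c = (v - u)⁻¹ * ∫ y in Ioc u v, |A' y - (v - u)⁻¹ * ∫ z in Ioc u v, A' z|} := by
    by_contra hb
    have := Real.sSup_of_not_bddAbove hb; unfold bmoNorm at hbmo; rw [this] at hbmo; norm_num at hbmo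
  have := le_csSup hb ⟨u, v, h, rfl⟩
  have h1 : sSup {c : ℝ | ∃ u v : ℝ, u < v ∧
    c = (v - u)⁻¹ * ∫ y in Ioc u v, |A' y - (v - u)⁻¹ * ∫ z in Ioc u v, A' z|} = 1 := hbmo
  rw [h1, inv_mul_le_iff₀ (by linarith)] at this
  linarith

theorem ftc_loc {A A' : ℝ → ℝ} (hA : ∀ x, HasDerivAt A (A' x) x) {u v : ℝ} (h : u ≤ v)
    (hi : IntegrableOn A' (Ioc u v)) : ∫ z in Ioc u v, A' z = A v - A u := by
  rw [← intervalIntegral.integral_of_le h]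
  exact intervalIntegral.integral_eq_sub_of_hasDerivAt (fun x _ => hA x)
    ((intervalIntegrable_iff_integrableOn_Ioc_of_le h).2 hi)

theorem abs_int_le {A A' : ℝ → ℝ} (hA : ∀ x, HasDerivAt A (A' x) x) (hbmo : bmoNorm A' = 1)
    {u v : ℝ} (h : u < v) (hi : IntegrableOn A' (Ioc u v)) :
    ∫⁻ z in Ioc u v, ofReal |A' z| ≤ ofReal (v - u + |A v - A u|) := by
  rw [← ofReal_integral_eq_lintegral_ofReal hi.abs (Eventually.of_forall fun x => abs_nonneg _)]
  apply ofReal_le_ofReal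
  have h1 := bmo_le hbmo u v h
  rw [ftc_loc hA h.le hi] at h1
  have h2 : ∫ z in Ioc u v, |A' z| ≤ ∫ z in Ioc u v, (|A' z - (v-u)⁻¹ * (A v - A u)| + (v-u)⁻¹ * |A v - A u|) := by
    apply integral_mono hi.abs
    · exact ((hi.sub (integrable_const _)).abs).add (integrable_const _)
    · intro z
      have : |A' z| ≤ |A' z - (v-u)⁻¹ * (A v - A u)| + |(v-u)⁻¹ * (A v - A u)| := by simpa using abs_add_le (A' z - (v-u)⁻¹ * (A v - A u)) ((v-u)⁻¹ * (A v - A u))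
      rw [abs_mul, abs_of_pos (inv_pos.2 (sub_pos.2 h))] at this; exact this
  have hii : Integrable (fun z => |A' z - (v-u)⁻¹ * (A v - A u)|) (volume.restrict (Ioc u v)) :=
    (hi.sub (integrable_const _)).abs
  rw [integral_add hii (integrable_const _)] at h2
  simp only [integral_const, measureReal_restrict_apply_univ, volume_real_Ioc_of_le h.le,
    smul_eq_mul] at h2
  have : (v - u) * ((v-u)⁻¹ * |A v - A u|) = |A v - A u| := by
    have : v - u ≠ 0 := by linarith
    field_simp
  linarith

theorem meas_deriv {A A' : ℝ → ℝ} (hA : ∀ x, HasDerivAt A (A' x) x) : Measurable A' := by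
  have : A' = deriv A := by ext x; exact (hA x).deriv.symm
  rw [this]; exact measurable_deriv A

theorem comp_bound {A A' : ℝ → ℝ} (hA : ∀ x, HasDerivAt A (A' x) x) (hbmo : bmoNorm A' = 1)
    {V : Set ℝ} {D : ℝ} (hVb : BddBelow V) (hVa : BddAbove V) (hVc : IsConnected V)
    (hloc : ∀ u v, u < v → Icc u v ⊆ V → IntegrableOn A' (Ioc u v))
    (hD : ∀ u ∈ V, ∀ v ∈ V, |A v - A u| ≤ D) :
    ∫⁻ z in V, ofReal |A' z| ≤ volume V + ofReal D := by
  have hsub : Ioo (sInf V) (sSup V) ⊆ V := hVc.Ioo_csInf_csSup_subset hVb hVa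
  have hsub2 : V ⊆ Icc (sInf V) (sSup V) := fun x hx => ⟨csInf_le hVb hx, le_csSup hVa hx⟩
  set a := sInf V
  set b := sSup V
  calc ∫⁻ z in V, ofReal |A' z| ≤ ∫⁻ z in Icc a b, ofReal |A' z| :=
        lintegral_mono_set hsub2
    _ = ∫⁻ z in Ioo a b, ofReal |A' z| := by rw [setLIntegral_congr Ioo_ae_eq_Icc]
    _ ≤ volume V + ofReal D := by
        by_cases hab : a < b
        swap
        · rw [Ioo_eq_empty hab]; simp
        let S : ℕ → Set ℝ := fun k => Ioc (a + (b-a)/(k+3)) (b - (b-a)/(k+3))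
        have hk : ∀ k : ℕ, 0 < (b-a)/(k+3) ∧ (b-a)/(k+3) ≤ (b-a)/3 := fun k =>
          ⟨div_pos (by linarith) (by positivity), by
            apply div_le_div_of_nonneg_left (by linarith) (by norm_num)
            have : (0:ℝ) ≤ k := by positivity
            linarith⟩
        have hmono : Monotone S := fun k l hkl => by
          have : (b-a)/((l:ℝ)+3) ≤ (b-a)/(k+3) := by
            apply div_le_div_of_nonneg_left (by linarith) (by positivity)
            have : (k:ℝ) ≤ l := by exact_mod_cast hkl
            linarith
          exact Ioc_subset_Ioc (by linarith) (by linarith)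
        have hU : Ioo a b ⊆ ⋃ k, S k := fun x hx => by
          obtain ⟨k, hk⟩ := exists_nat_gt ((b-a)/min (x-a) (b-x))
          have hm : 0 < min (x-a) (b-x) := lt_min (by linarith [hx.1]) (by linarith [hx.2])
          rw [div_lt_iff₀ hm] at hk; have h3 : (b-a)/((k:ℝ)+3) < min (x-a) (b-x) := by
            rw [div_lt_iff₀ (by positivity)]
            nlinarith
          have h4 := lt_min_iff.1 h3; exact mem_iUnion.2 ⟨k, by constructor <;> linarith [h4.1, h4.2]⟩
        calc ∫⁻ z in Ioo a b, ofReal |A' z| ≤ ∫⁻ z in ⋃ k, S k, ofReal |A' z| :=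
              lintegral_mono_set hU
          _ = ⨆ k, ∫⁻ z in S k, ofReal |A' z| :=
              setLIntegral_iUnion_of_directed _ hmono.directed_le
          _ ≤ _ := by
              apply iSup_le
              intro k; have hlt : a + (b-a)/(k+3) < b - (b-a)/(k+3) := by linarith [(hk k).1, (hk k).2]
              have hIcc : Icc (a + (b-a)/(k+3)) (b - (b-a)/(k+3)) ⊆ V := fun x hx => by exact hsub ⟨by linarith [hx.1, (hk k).1], by linarith [hx.2, (hk k).1]⟩
              have h0 := abs_int_le hA hbmo hlt (hloc _ _ hlt hIcc); refine h0.trans ?_; rw [ofReal_add (by linarith) (abs_nonneg _)]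
              gcongr
              · calc _ ≤ ofReal (b - a) := ofReal_le_ofReal (by linarith [(hk k).1])
                  _ = volume (Ioo a b) := by simp
                  _ ≤ volume V := measure_mono hsub
              · exact hD _ (hIcc ⟨le_rfl, hlt.le⟩) _ (hIcc ⟨hlt.le, le_rfl⟩)

theorem L0 {A A' : ℝ → ℝ} (hA : ∀ x, HasDerivAt A (A' x) x) (hbmo : bmoNorm A' = 1) :
    ∀ x, IntegrableAtFilter A' (nhds x) := by
  set O : Set ℝ := {x | IntegrableAtFilter A' (nhds x)} with hO
  have hOo : IsOpen O := by
    rw [isOpen_iff_mem_nhds]; rintro x ⟨s, hs, hi⟩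
    obtain ⟨t, hts, hto, hxt⟩ := mem_nhds_iff.1 hs
    filter_upwards [hto.mem_nhds hxt] with y hy
    exact ⟨t, hto.mem_nhds hy, hi.mono_set hts⟩
  have hAc : Continuous A := continuous_iff_continuousAt.2 fun x => (hA x).continuousAt
  by_contra hne
  push Not at hne
  obtain ⟨z0, hz0⟩ := hne
  set F : Set ℝ := Oᶜ with hF
  have hFc : IsClosed F := hOo.isClosed_compl
  have : CompleteSpace F := hFc.completeSpace_coe
  have : Nonempty F := ⟨⟨z0, hz0⟩⟩
  let Fn : ℕ → Set F := fun n => {x : F | ∀ t : ℝ, |t - x| < 1/((n:ℝ)+1) → |A t - A x| ≤ ((n:ℝ)+1) * |t - x|}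
  have hFn : ∀ n, IsClosed (Fn n) := fun n => by
    have : Fn n = ⋂ t : ℝ, ({x : F | 1/((n:ℝ)+1) ≤ |t - x|} ∪ {x : F | |A t - A x| ≤ ((n:ℝ)+1) * |t - x|}) := by
      ext x
      simp only [Fn, mem_ofPred_eq, mem_iInter, mem_union]; constructor
      · intro h t
        by_cases h1 : |t - x| < 1/((n:ℝ)+1)
        · exact Or.inr (h t h1)
        · exact Or.inl (not_lt.1 h1)
      · intro h t ht
        rcases h t with h1 | h1
        · exact absurd ht (not_lt.2 h1)
        · exact h1
    rw [this]; apply isClosed_iInter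
    intro t; apply IsClosed.union
    · exact isClosed_le (by fun_prop) (by fun_prop)
    · exact isClosed_le (by fun_prop) (by fun_prop)
  have hcov : ⋃ n, Fn n = univ := by
    rw [eq_univ_iff_forall]; rintro ⟨x, hx⟩
    have h1 := (hA x).isLittleO; have h2 : ∀ᶠ t in nhds x, |A t - A x| ≤ (|A' x| + 1) * |t - x| := by
      have := h1.def (c := 1) one_pos; filter_upwards [this] with t ht; simp only [norm_eq_abs, one_mul, smul_eq_mul] at ht; have h3 : |A t - A x| ≤ |A t - A x - (t - x) * A' x| + |(t-x) * A' x| := by simpa using abs_add_le (A t - A x - (t - x) * A' x) ((t-x) * A' x)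
      rw [abs_mul (t-x)] at h3; nlinarith
    obtain ⟨δ, hδ, h3⟩ := Metric.eventually_nhds_iff.1 h2
    obtain ⟨n, hn⟩ := exists_nat_gt (max (|A' x| + 1) (1/δ))
    have hn1 := (lt_max_iff.2 (Or.inl (lt_add_one _))).trans hn |> fun _ => (max_lt_iff.1 hn)
    refine mem_iUnion.2 ⟨n, ?_⟩; intro t ht
    have h4 : dist t x < δ := by
      rw [dist_eq]; refine ht.trans_le ?_
      rw [div_le_iff₀ (by positivity)]
      have := hn1.2; rw [div_lt_iff₀ hδ] at this; nlinarith
    refine (h3 h4).trans ?_; gcongr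
    linarith [hn1.1]
  obtain ⟨n, x0, hx0⟩ := nonempty_interior_of_iUnion_of_closed hFn hcov
  obtain ⟨ρ, hρ, hball⟩ := Metric.mem_nhds_iff.1 (mem_interior_iff_mem_nhds.1 hx0)
  set N : ℝ := (n:ℝ)+1 with hN
  have hNpos : 0 < N := by positivity
  obtain ⟨r, hr, hrρ, hrN⟩ : ∃ r : ℝ, 0 < r ∧ r ≤ ρ ∧ 2 * r ≤ 1/N :=
    ⟨min ρ (1/(2*N)), lt_min hρ (by positivity), min_le_left _ _, by
      have := min_le_right ρ (1/(2*N)); have h2 : 2 * (1/(2*N)) = 1/N := by field_simp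
      linarith⟩
  obtain ⟨x0, hx0F⟩ := x0
  set I : Set ℝ := Ioo (x0 - r) (x0 + r) with hI
  have key : ∀ x ∈ F, x ∈ I → ∀ t ∈ I, |A t - A x| ≤ N * |t - x| := fun x hx hxI t ht => by
    have hxb : (⟨x, hx⟩ : F) ∈ Metric.ball (⟨x0, hx0F⟩ : F) ρ := by rw [Metric.mem_ball, Subtype.dist_eq, dist_eq]; rw [abs_lt]; constructor <;> simp only <;> linarith [hxI.1, hxI.2]
    refine hball hxb t ?_; refine lt_of_lt_of_le ?_ hrN
    rw [abs_lt]; constructor <;> simp only <;> linarith [hxI.1, hxI.2, ht.1, ht.2]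
  have hder : ∀ x ∈ F, x ∈ I → |A' x| ≤ N := fun x hx hxI => by
    have := (hA x).le_of_lip' (C := N) hNpos.le (by
      filter_upwards [isOpen_Ioo.mem_nhds hxI] with t ht
      simpa [norm_eq_abs] using key x hx hxI t ht)
    simpa using this
  have hmeas := meas_deriv hA
  apply hx0F
  show IntegrableAtFilter A' (nhds x0)
  refine ⟨I, isOpen_Ioo.mem_nhds ⟨by linarith, by linarith⟩, hmeas.aestronglyMeasurable, ?_⟩
  rw [hasFiniteIntegral_iff_norm]
  simp only [norm_eq_abs]
  set U := I \ F with hU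
  have hUo : IsOpen U := isOpen_Ioo.sdiff hFc
  have hsplit : I ⊆ (I ∩ F) ∪ U := fun x hx => by
    by_cases h : x ∈ F
    · exact Or.inl ⟨hx, h⟩
    · exact Or.inr ⟨hx, h⟩
  refine lt_of_le_of_lt (lintegral_mono_set hsplit) ?_
  refine lt_of_le_of_lt (lintegral_union_le _ _ _) ?_
  have hvI : volume I < ⊤ := by simp [hI]
  apply ENNReal.add_lt_top.2
  constructor
  · calc ∫⁻ z in I ∩ F, ofReal |A' z| ≤ ∫⁻ z in I ∩ F, ofReal N := by
          apply setLIntegral_mono' (measurableSet_Ioo.inter hFc.measurableSet)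
          intro x hx; exact ofReal_le_ofReal (hder x hx.2 hx.1)
      _ = ofReal N * volume (I ∩ F) := by simp
      _ < ⊤ := ENNReal.mul_lt_top (by simp) (lt_of_le_of_lt (measure_mono inter_subset_left) hvI)
  · -- components
    let 𝒱 : Set (Set ℝ) := (fun x => connectedComponentIn U x) '' U
    have hVo : ∀ V ∈ 𝒱, IsOpen V := by rintro V ⟨x, hx, rfl⟩; exact hUo.connectedComponentIn
    have hVU : ∀ V ∈ 𝒱, V ⊆ U := by rintro V ⟨x, hx, rfl⟩; exact connectedComponentIn_subset _ _
    have hVd : 𝒱.PairwiseDisjoint id := by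
      rintro V ⟨x, hx, rfl⟩ W ⟨y, hy, rfl⟩ hVW
      rw [Function.onFun, Set.disjoint_left]; intro z hz1 hz2
      apply hVW
      simp only [id] at hz1 hz2
      show connectedComponentIn U x = connectedComponentIn U y
      rw [connectedComponentIn_eq hz1, connectedComponentIn_eq hz2]
    have hVne : ∀ V ∈ 𝒱, (V : Set ℝ).Nonempty := by rintro V ⟨x, hx, rfl⟩; exact ⟨x, mem_connectedComponentIn hx⟩
    have hVcount : 𝒱.Countable := hVd.countable_of_isOpen hVo hVne
    have hVcov : U = ⋃ V ∈ 𝒱, V := by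
      apply Subset.antisymm
      · intro x hx
        exact mem_biUnion (mem_image_of_mem _ hx) (mem_connectedComponentIn hx)
      · exact iUnion₂_subset hVU
    have hbound : ∀ V ∈ 𝒱, ∫⁻ z in V, ofReal |A' z| ≤ ofReal (1 + 2*N) * volume V := fun V hV => by
      have hVI : V ⊆ I := (hVU V hV).trans sdiff_subset
      have hpre : IsPreconnected V := by obtain ⟨x, hx, rfl⟩ := hV; exact isPreconnected_connectedComponentIn
      have hext : ∀ S : Set ℝ, IsPreconnected S → S ⊆ U → (S ∩ V).Nonempty → S ⊆ V := by
        obtain ⟨x, hx, rfl⟩ := hV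
        rintro S hS hSU ⟨y, hyS, hyV⟩
        simp only at hyV ⊢
        rw [connectedComponentIn_eq hyV]; exact hS.subset_connectedComponentIn hyS hSU
      have hVfin : volume V ≠ ⊤ := (lt_of_le_of_lt (measure_mono hVI) hvI).ne
      have h1 := comp_bound hA hbmo (V := V) (D := 2 * N * (volume V).toReal)
        (bddBelow_Ioo.mono hVI) (bddAbove_Ioo.mono hVI) ⟨hVne V hV, hpre⟩ ?_ ?_
      · refine h1.trans (le_of_eq ?_)
        rw [ofReal_mul (by positivity), ofReal_toReal hVfin,
          ofReal_add (by norm_num) (by positivity), add_mul]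
        simp
      · intro u v huv hsub
        have : LocallyIntegrableOn A' (Icc u v) := fun x hx => by
          have hxO : x ∈ O := by have := (hVU V hV (hsub hx)).2; simpa [hF] using this
          exact IntegrableAtFilter.filter_mono nhdsWithin_le_nhds hxO
        exact (this.integrableOn_isCompact isCompact_Icc).mono_set Ioc_subset_Icc_self
      · -- distance bound; find nearby point of F
        have main : ∀ u ∈ V, ∀ v ∈ V, u ≤ v → |A v - A u| ≤ 2 * N * (volume V).toReal := fun u hu v hv huv => by
          have huI := hVI hu; have hvI := hVI hv; have huvV : Icc u v ⊆ V := hpre.Icc_subset hu hv; have hx0V : x0 ∉ V := fun h => (hVU V hV h).2 hx0F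
          have hcase : x0 < u ∨ v < x0 := by
            by_contra hcon
            push Not at hcon
            exact hx0V (huvV ⟨hcon.1, hcon.2⟩)
          rcases hcase with hc | hc
          · have hcomp : IsCompact (F ∩ Icc x0 u) := isCompact_Icc.inter_left hFc
            have hnon : (F ∩ Icc x0 u).Nonempty := ⟨x0, hx0F, le_rfl, hc.le⟩
            obtain ⟨haF, ha1, ha2⟩ := hcomp.sSup_mem hnon
            set a := sSup (F ∩ Icc x0 u)
            have hsubU : Ioc a u ⊆ U := fun y hy => by
              refine ⟨⟨by linarith [hy.1], by linarith [hy.2, huI.2]⟩, fun hyF => ?_⟩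
              have : y ≤ a := le_csSup hcomp.bddAbove ⟨hyF, by linarith [hy.1], hy.2⟩
              linarith [hy.1]
            have hau : a < u := lt_of_le_of_ne ha2 (fun h => (hVU V hV hu).2 (h ▸ haF))
            have hsubV : Ioc a u ⊆ V := hext _ isPreconnected_Ioc hsubU ⟨u, ⟨hau, le_rfl⟩, hu⟩
            have hlen : v - a ≤ (volume V).toReal := by
              have : Ioc a v ⊆ V := fun y hy => by
                by_cases hyu : y ≤ u
                · exact hsubV ⟨hy.1, hyu⟩
                · exact huvV ⟨by linarith, hy.2⟩
              have h5 := measureReal_mono this hVfin; rw [volume_real_Ioc_of_le (by linarith)] at h5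
              exact h5
            have haI : a ∈ I := ⟨by linarith, by linarith [huI.2]⟩
            have k1 := key a haF haI u huI; have k2 := key a haF haI v hvI; rw [abs_of_nonneg (by linarith : 0 ≤ u - a)] at k1
            rw [abs_of_nonneg (by linarith : 0 ≤ v - a)] at k2
            have : |A v - A u| ≤ |A v - A a| + |A u - A a| := by have := abs_sub (A v - A a) (A u - A a); simpa using this
            nlinarith
          · have hcomp : IsCompact (F ∩ Icc v x0) := isCompact_Icc.inter_left hFc
            have hnon : (F ∩ Icc v x0).Nonempty := ⟨x0, hx0F, hc.le, le_rfl⟩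
            obtain ⟨haF, ha1, ha2⟩ := hcomp.sInf_mem hnon
            set a := sInf (F ∩ Icc v x0)
            have hsubU : Ico v a ⊆ U := fun y hy => by
              refine ⟨⟨by linarith [hy.1, hvI.1], by linarith [hy.2]⟩, fun hyF => ?_⟩
              have : a ≤ y := csInf_le hcomp.bddBelow ⟨hyF, hy.1, by linarith [hy.2]⟩
              linarith [hy.2]
            have hau : v < a := lt_of_le_of_ne ha1 (fun h => (hVU V hV hv).2 (h ▸ haF))
            have hsubV : Ico v a ⊆ V := hext _ isPreconnected_Ico hsubU ⟨v, ⟨le_rfl, hau⟩, hv⟩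
            have hlen : a - u ≤ (volume V).toReal := by
              have : Ico u a ⊆ V := fun y hy => by
                by_cases hyu : v ≤ y
                · exact hsubV ⟨hyu, hy.2⟩
                · exact huvV ⟨hy.1, by linarith⟩
              have h5 := measureReal_mono this hVfin; rw [Real.volume_real_Ico_of_le (by linarith)] at h5
              exact h5
            have haI : a ∈ I := ⟨by linarith [hvI.1], by linarith⟩
            have k1 := key a haF haI u huI; have k2 := key a haF haI v hvI; rw [abs_of_nonpos (by linarith : u - a ≤ 0)] at k1
            rw [abs_of_nonpos (by linarith : v - a ≤ 0)] at k2
            have : |A v - A u| ≤ |A v - A a| + |A u - A a| := by have := abs_sub (A v - A a) (A u - A a); simpa using this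
            nlinarith
        intro u hu v hv; rcases le_total u v with h | h
        · exact main u hu v hv h
        · rw [abs_sub_comm]; exact main v hv u hu h
    rw [hVcov]; rw [lintegral_biUnion hVcount (fun V hV => (hVo V hV).measurableSet) hVd]
    calc ∑' V : 𝒱, ∫⁻ z in (V : Set ℝ), ofReal |A' z|
        ≤ ∑' V : 𝒱, ofReal (1 + 2*N) * volume (V : Set ℝ) :=
          ENNReal.tsum_le_tsum fun V => hbound V V.2
      _ = ofReal (1 + 2*N) * volume (⋃ V ∈ 𝒱, V) := by
          have := measure_biUnion (μ := volume) hVcount hVd (fun V hV => (hVo V hV).measurableSet)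
          simp only [id] at this
          rw [ENNReal.tsum_mul_left, this]
      _ < ⊤ := by rw [← hVcov]; exact ENNReal.mul_lt_top (by simp) (lt_of_le_of_lt (measure_mono sdiff_subset) hvI)

theorem bmo1_of {A A' : ℝ → ℝ} (hA : ∀ x, HasDerivAt A (A' x) x) (hbmo : bmoNorm A' = 1) :
    BMO1 A' := by
  refine ⟨fun u v => ?_, bmo_le hbmo⟩
  have : LocallyIntegrable A' := L0 hA hbmo
  exact (this.integrableOn_isCompact isCompact_Icc).mono_set (Ioc_subset_Icc_self (a := u) (b := v))

theorem adiff_eq {A A' : ℝ → ℝ} (hA : ∀ x, HasDerivAt A (A' x) x) (hbmo : bmoNorm A' = 1)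
    (x y : ℝ) : Adiff A' x y = A x - A y := by
  have h := (bmo1_of hA hbmo).1
  exact intervalIntegral.integral_eq_sub_of_hasDerivAt (fun x _ => hA x) ⟨h _ _, h _ _⟩

theorem lebesgue_diff (G : ℝ → ℝ≥0∞) (hG : AEMeasurable G) (hfin : ∫⁻ y, G y ≠ ⊤) :
    ∀ᵐ x : ℝ, ∀ (l r : ℕ → ℝ), (∀ n, l n < r n) → (∀ n, x ∈ Ioc (l n) (r n)) →
      Tendsto (fun n => r n - l n) atTop (nhds 0) →
      Tendsto (fun n => (∫⁻ y in Ioc (l n) (r n), G y) / ofReal (r n - l n)) atTop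
        (nhds (G x)) := by
  have h := (IsUnifLocDoublingMeasure.vitaliFamily (volume : Measure ℝ) 1).ae_tendsto_lintegral_div hG hfin
  filter_upwards [h] with x hx l r hlr hmem hlim
  have h1 := IsUnifLocDoublingMeasure.tendsto_closedBall_filterAt (μ := (volume : Measure ℝ)) (K := 1) (x := x)
    (l := atTop) (fun n => (l n + r n)/2) (fun n => (r n - l n)/2) ?_ ?_
  · refine (hx.comp h1).congr fun n => ?_
    simp only [Function.comp]; have h2 : Metric.closedBall ((l n + r n)/2) ((r n - l n)/2) = Icc (l n) (r n) := by rw [Real.closedBall_eq_Icc]; congr 1 <;> ring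
    rw [h2, Real.volume_Icc, setLIntegral_congr Ioc_ae_eq_Icc]
  · rw [tendsto_nhdsWithin_iff]
    refine ⟨by simpa using hlim.div_const 2, Eventually.of_forall fun n => ?_⟩
    simp only [mem_Ioi]; linarith [hlr n]
  · refine Eventually.of_forall fun n => ?_
    rw [Metric.mem_closedBall, dist_eq, abs_le]; constructor <;> linarith [(hmem n).1, (hmem n).2]

/-- left endpoint of dyadic cell -/
noncomputable def dl (u v : ℝ) (n k : ℕ) : ℝ := u + (v - u) * (k / 2 ^ n)

theorem dl_len (u v : ℝ) (n k : ℕ) : dl u v n (k+1) - dl u v n k = (v-u)/2^n := by unfold dl; push_cast; ring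

theorem dl_mem {u v : ℝ} (h : u < v) (n k : ℕ) (x : ℝ) :
    x ∈ Ioc (dl u v n k) (dl u v n (k+1)) ↔ (k:ℝ) < (x-u)/(v-u)*2^n ∧ (x-u)/(v-u)*2^n ≤ k+1 := by
  have hv : 0 < v - u := by linarith
  have hp : (0:ℝ) < 2^n := by positivity
  unfold dl; simp only [mem_Ioc]
  have e1 : (x-u)/(v-u)*2^n = (x-u)*2^n/(v-u) := by ring
  rw [e1, lt_div_iff₀ hv, div_le_iff₀ hv]
  have e2 : u + (v-u)*((k:ℝ)/2^n) < x ↔ (k:ℝ)*(v-u) < (x-u)*2^n := by rw [← lt_sub_iff_add_lt', mul_div_assoc', div_lt_iff₀ hp, mul_comm (v-u)]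
  have e3 : x ≤ u + (v-u)*(((k+1:ℕ):ℝ)/2^n) ↔ (x-u)*2^n ≤ ((k:ℝ)+1)*(v-u) := by rw [← sub_le_iff_le_add', mul_div_assoc', le_div_iff₀ hp, mul_comm (v-u)]; push_cast; rfl
  rw [e2, e3]

theorem dl_uniq {u v : ℝ} (h : u < v) {n k k' : ℕ} {x : ℝ}
    (h1 : x ∈ Ioc (dl u v n k) (dl u v n (k+1))) (h2 : x ∈ Ioc (dl u v n k') (dl u v n (k'+1))) :
    k = k' := by
  rw [dl_mem h] at h1 h2
  have a1 : (k:ℝ) < k'+1 := by linarith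
  have a2 : (k':ℝ) < k+1 := by linarith
  have b1 : k < k'+1 := by exact_mod_cast a1
  have b2 : k' < k+1 := by exact_mod_cast a2
  omega

theorem dl_parent {u v : ℝ} (h : u < v) {n k d : ℕ} :
    Ioc (dl u v (n+d) k) (dl u v (n+d) (k+1)) ⊆ Ioc (dl u v n (k/2^d)) (dl u v n (k/2^d+1)) := by
  intro x hx; rw [dl_mem h] at hx ⊢
  have h1 : (k/2^d)*2^d ≤ k := Nat.div_mul_le_self _ _
  have h2 : k + 1 ≤ (k/2^d+1)*2^d := by
    have := Nat.lt_div_mul_add (a := k) (b := 2^d) (by positivity)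
    rw [Nat.add_mul]; omega
  have h1' : ((k/2^d:ℕ):ℝ)*2^d ≤ k := by exact_mod_cast h1
  have h2' : (k:ℝ) + 1 ≤ ((k/2^d:ℕ):ℝ)*2^d + 2^d := by
    have : ((k + 1 : ℕ):ℝ) ≤ (((k/2^d+1)*2^d : ℕ) : ℝ) := by exact_mod_cast h2
    push_cast at this; push_cast; linarith
  rw [pow_add, ← mul_assoc] at hx
  have hp : (0:ℝ) < 2^d := by positivity
  constructor
  · exact lt_of_mul_lt_mul_right (lt_of_le_of_lt h1' hx.1) hp.le
  · refine le_of_mul_le_mul_right (a := (2:ℝ)^d) ?_ hp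
    rw [add_mul, one_mul]; linarith [hx.2]

theorem dl_sub {u v : ℝ} (h : u < v) {n k : ℕ} (hk : k < 2^n) :
    Ioc (dl u v n k) (dl u v n (k+1)) ⊆ Ioc u v := by
  have := dl_parent h (n := 0) (d := n) (k := k)
  rw [Nat.div_eq_of_lt hk] at this
  simp only [zero_add] at this
  refine this.trans (le_of_eq ?_)
  unfold dl; simp

theorem dl_exists {u v : ℝ} (h : u < v) (n : ℕ) {x : ℝ} (hx : x ∈ Ioc u v) :
    ∃ k < 2^n, x ∈ Ioc (dl u v n k) (dl u v n (k+1)) := by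
  set s := (x-u)/(v-u)*2^n with hs
  have hv : 0 < v - u := by linarith
  have s0 : 0 < s := by
    have : 0 < x - u := by linarith [hx.1]
    positivity
  have s1 : s ≤ 2^n := by
    have : (x-u)/(v-u) ≤ 1 := by rw [div_le_one hv]; linarith [hx.2]
    calc s ≤ 1 * 2^n := mul_le_mul_of_nonneg_right this (by positivity)
      _ = 2^n := one_mul _
  have hc : 0 < ⌈s⌉₊ := Nat.ceil_pos.2 s0
  have hc2 : ⌈s⌉₊ ≤ 2^n := Nat.ceil_le.2 (by exact_mod_cast s1)
  refine ⟨⌈s⌉₊ - 1, by omega, ?_⟩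
  rw [dl_mem h]
  have e : ((⌈s⌉₊ - 1 : ℕ) : ℝ) = (⌈s⌉₊ : ℝ) - 1 := by rw [Nat.cast_sub hc]; simp
  rw [e]
  constructor
  · have := Nat.ceil_lt_add_one s0.le
    linarith
  · simpa using Nat.le_ceil s

theorem CZ_lemma {u v : ℝ} (h : u < v) (G : ℝ → ℝ≥0∞)
    (hG : AEMeasurable G (volume.restrict (Ioc u v)))
    (hle : ∫⁻ y in Ioc u v, G y ≤ ofReal (v-u)) :
    ∃ l r : ℕ × ℕ → ℝ, (∀ i, l i ≤ r i) ∧ (∀ i, Ioc (l i) (r i) ⊆ Ioc u v) ∧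
      Pairwise (fun i j => Disjoint (Ioc (l i) (r i)) (Ioc (l j) (r j))) ∧
      (∀ i, ofReal (r i - l i) ≤ ∫⁻ y in Ioc (l i) (r i), G y) ∧
      (∀ i, ∫⁻ y in Ioc (l i) (r i), G y ≤ 2 * ofReal (r i - l i)) ∧
      ∀ᵐ x : ℝ, x ∈ Ioc u v → x ∉ ⋃ i, Ioc (l i) (r i) → G x ≤ 1 := by
  classical
  let cell : ℕ → ℕ → Set ℝ := fun n k => Ioc (dl u v n k) (dl u v n (k+1))
  let Bad : ℕ → ℕ → Prop := fun n k => ofReal ((v-u)/2^n) < ∫⁻ y in cell n k, G y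
  let Sel : ℕ × ℕ → Prop := fun i => i.2 < 2^i.1 ∧ Bad i.1 i.2 ∧
    ∀ n d, n + d = i.1 → 0 < d → ¬ Bad n (i.2 / 2^d)
  let l : ℕ × ℕ → ℝ := fun i => if Sel i then dl u v i.1 i.2 else u
  let r : ℕ × ℕ → ℝ := fun i => if Sel i then dl u v i.1 (i.2+1) else u
  have hIsel : ∀ i, Sel i → Ioc (l i) (r i) = cell i.1 i.2 := fun i hi => by simp [l, r, hi, cell]
  have hIuns : ∀ i, ¬ Sel i → Ioc (l i) (r i) = ∅ := fun i hi => by simp [l, r, hi]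
  have hlen : ∀ i, Sel i → r i - l i = (v-u)/2^i.1 := fun i hi => by simp only [l, r, hi, if_true]; exact dl_len _ _ _ _
  have hlen0 : ∀ i, ¬ Sel i → r i - l i = 0 := fun i hi => by simp [l, r, hi]
  refine ⟨l, r, ?_, ?_, ?_, ?_, ?_, ?_⟩
  · intro i
    by_cases hi : Sel i
    · have := hlen i hi
      have : 0 < (v-u)/2^i.1 := div_pos (by linarith) (by positivity)
      linarith
    · linarith [hlen0 i hi]
  · intro i
    by_cases hi : Sel i
    · rw [hIsel i hi]; exact dl_sub h hi.1
    · rw [hIuns i hi]; exact empty_subset _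
  · have key : ∀ i j, Sel i → Sel j → i ≠ j → i.1 ≤ j.1 → Disjoint (cell i.1 i.2) (cell j.1 j.2) := by
      rintro ⟨n, k⟩ ⟨n', k'⟩ hi hj hij hle
      simp only at hle
      obtain ⟨d, rfl⟩ := Nat.exists_eq_add_of_le hle
      rw [Set.disjoint_left]
      intro x h1 h2
      have h3 := dl_parent h h2
      have h4 := dl_uniq h h1 h3
      rcases Nat.eq_zero_or_pos d with hd | hd
      · subst hd; simp at h4; subst h4; exact hij rfl
      · exact hj.2.2 n d rfl hd (h4 ▸ hi.2.1)
    intro i j hij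
    by_cases hi : Sel i
    swap
    · rw [hIuns i hi]; exact empty_disjoint _
    by_cases hj : Sel j
    swap
    · rw [hIuns j hj]; exact disjoint_empty _
    rw [hIsel i hi, hIsel j hj]
    rcases le_total i.1 j.1 with h1 | h1
    · exact key i j hi hj hij h1
    · exact (key j i hj hi hij.symm h1).symm
  · intro i
    by_cases hi : Sel i
    · rw [hIsel i hi, hlen i hi]; exact hi.2.1.le
    · rw [hlen0 i hi]; simp
  · intro i
    by_cases hi : Sel i
    · rw [hIsel i hi, hlen i hi]
      obtain ⟨n, k⟩ := i
      cases n with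
      | zero =>
        exfalso
        have hk : k = 0 := by have := hi.1; simp at this; exact this
        subst hk
        have := hi.2.1
        simp only [Bad, cell] at this
        have e : Ioc (dl u v 0 0) (dl u v 0 (0+1)) = Ioc u v := by unfold dl; simp
        rw [e] at this
        simp at this
        exact absurd hle (not_le.2 this)
      | succ n =>
        have h1 := hi.2.2 n 1 rfl one_pos
        simp only [Bad, not_lt] at h1
        calc ∫⁻ y in cell (n+1) k, G y ≤ ∫⁻ y in cell n (k/2^1), G y :=
              lintegral_mono_set (dl_parent h)
          _ ≤ _ := h1
          _ = 2 * ofReal ((v-u)/2^(n+1)) := by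
            rw [show (2:ℝ≥0∞) = ofReal 2 by simp, ← ofReal_mul (by norm_num)]
            congr 1; rw [pow_succ]; field_simp
    · rw [hIuns i hi]; simp
  · have hGi : AEMeasurable ((Ioc u v).indicator G) := (aemeasurable_indicator_iff measurableSet_Ioc).2 hG
    have hfin : ∫⁻ y, (Ioc u v).indicator G y ≠ ⊤ := by
      rw [lintegral_indicator measurableSet_Ioc]
      exact (lt_of_le_of_lt hle ENNReal.ofReal_lt_top).ne
    filter_upwards [lebesgue_diff _ hGi hfin] with x hx hxJ hxn
    choose k hk hkm using fun n => dl_exists h n hxJ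
    have hnb : ∀ n, ¬ Bad n (k n) := fun n => by
      induction n using Nat.strong_induction_on with
      | _ n ih =>
        intro hb
        apply hxn
        have hs : Sel (n, k n) := by
          refine ⟨hk n, hb, ?_⟩
          intro n' d hd hdpos
          simp only at hd ⊢
          have e : k n / 2^d = k n' := by
            have h1 := hkm n
            rw [← hd] at h1 
            have h2 := dl_parent h h1
            rw [hd] at h2
            exact dl_uniq h h2 (hkm n')
          rw [e]
          exact ih n' (by omega)
        refine mem_iUnion.2 ⟨(n, k n), ?_⟩
        rw [hIsel _ hs]; exact hkm n
    have hpos : ∀ n : ℕ, 0 < (v-u)/2^n := fun n => div_pos (by linarith) (by positivity)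
    have h1 := hx (fun n => dl u v n (k n)) (fun n => dl u v n (k n + 1))
      (fun n => by have := dl_len u v n (k n); have := hpos n; linarith) hkm (by
        simp only [dl_len]
        have := (tendsto_pow_atTop_nhds_zero_of_lt_one (r := (1/2:ℝ)) (by norm_num) (by norm_num)).const_mul (v-u)
        simp only [mul_zero] at this
        refine this.congr fun n => ?_
        rw [one_div, inv_pow]; rfl)
    rw [indicator_of_mem hxJ] at h1
    refine le_of_tendsto' h1 fun n => ?_
    simp only [dl_len]
    apply ENNReal.div_le_of_le_mul
    rw [one_mul]
    have := hnb n
    simp only [Bad, not_lt] at this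
    refine le_trans (lintegral_mono fun y => ?_) this
    exact indicator_le_self _ _ _

/-- average over `Ioc u v` -/
noncomputable def av (g : ℝ → ℝ) (u v : ℝ) : ℝ := (v - u)⁻¹ * ∫ z in Ioc u v, g z

theorem one_step {a b : ℝ} (h : a < b) {u : ℝ → ℝ} (hu : AEMeasurable u (volume.restrict (Ioc a b)))
    {c ω τ : ℝ} (hτ : 4 * τ ≤ 1)
    (hE : volume {x ∈ Ioc a b | ω < |u x - c|} ≤ ofReal (τ * (b - a))) :
    ∃ l r : ℕ × ℕ → ℝ, (∀ i, l i ≤ r i) ∧ (∀ i, Ioc (l i) (r i) ⊆ Ioc a b) ∧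
      Pairwise (fun i j => Disjoint (Ioc (l i) (r i)) (Ioc (l j) (r j))) ∧
      ∑' i, ofReal (r i - l i) ≤ ofReal (4 * τ * (b - a)) ∧
      (∀ᵐ x : ℝ, x ∈ Ioc a b → x ∉ ⋃ i, Ioc (l i) (r i) → |u x - c| ≤ ω) ∧
      ∀ i, volume {x ∈ Ioc (l i) (r i) | ω < |u x - c|} ≤ ofReal ((r i - l i) / 2) := by
  set E : Set ℝ := {x | ω < |u x - c|} with hEdef
  have hEm : NullMeasurableSet E (volume.restrict (Ioc a b)) :=
    nullMeasurableSet_lt aemeasurable_const (by fun_prop)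
  set G : ℝ → ℝ≥0∞ := E.indicator (fun _ => 4) with hG
  have hGm : AEMeasurable G (volume.restrict (Ioc a b)) := aemeasurable_const.indicator₀ hEm
  have hInt : ∀ S ⊆ Ioc a b, MeasurableSet S → ∫⁻ y in S, G y = 4 * volume {x ∈ S | ω < |u x - c|} := fun S hS hSm => by
    have hEm' : NullMeasurableSet E (volume.restrict S) :=
      hEm.mono_ac (Measure.absolutelyContinuous_of_le (Measure.restrict_mono hS le_rfl))
    rw [hG, lintegral_indicator₀ hEm', lintegral_const, Measure.restrict_apply_univ,
      Measure.restrict_apply' hSm, inter_comm]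
    rfl
  obtain ⟨l, r, h1, h2, h3, h4, h5, h6⟩ := CZ_lemma h G hGm (by
    rw [hInt _ Subset.rfl measurableSet_Ioc]; calc 4 * volume {x ∈ Ioc a b | ω < |u x - c|} ≤ 4 * ofReal (τ * (b-a)) := by gcongr
      _ = ofReal (4 * (τ * (b-a))) := by rw [ofReal_mul (p := 4) (by norm_num)]; simp
      _ ≤ ofReal (b - a) := ofReal_le_ofReal (by nlinarith))
  refine ⟨l, r, h1, h2, h3, ?_, ?_, ?_⟩
  · calc ∑' i, ofReal (r i - l i) ≤ ∑' i, ∫⁻ y in Ioc (l i) (r i), G y := ENNReal.tsum_le_tsum h4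
      _ = ∫⁻ y in ⋃ i, Ioc (l i) (r i), G y :=
        (lintegral_iUnion (fun i => measurableSet_Ioc) h3 _).symm
      _ ≤ ∫⁻ y in Ioc a b, G y := lintegral_mono_set (iUnion_subset h2)
      _ = 4 * volume {x ∈ Ioc a b | ω < |u x - c|} := hInt _ Subset.rfl measurableSet_Ioc
      _ ≤ 4 * ofReal (τ * (b-a)) := by gcongr
      _ = ofReal (4 * τ * (b-a)) := by rw [mul_assoc, ofReal_mul (p := 4) (by norm_num)]; simp
  · filter_upwards [h6] with x hx hxJ hxn
    have := hx hxJ hxn; by_contra hcon; have hxE : x ∈ E := not_le.1 hcon; rw [hG, indicator_of_mem hxE] at this; norm_num at this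
  · intro i
    have := h5 i; rw [hInt _ (h2 i) measurableSet_Ioc] at this; rw [ENNReal.ofReal_div_of_pos (by norm_num)]
    rw [ENNReal.le_div_iff_mul_le (by simp) (by simp)]
    have h7 : (2:ℝ≥0∞) * (2 * volume {x ∈ Ioc (l i) (r i) | ω < |u x - c|}) ≤ 2 * ofReal (r i - l i) := by rw [← mul_assoc]; norm_num; exact this
    have h8 := (ENNReal.mul_le_mul_iff_right (by norm_num) (by norm_num)).1 h7
    rw [mul_comm]; simpa using h8

theorem center_close {l r : ℝ} (h : l < r) {u : ℝ → ℝ} {c c' ω ω' τ : ℝ} (hτ : τ < 1/2)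
    (h1 : volume {x ∈ Ioc l r | ω < |u x - c|} ≤ ofReal ((r - l) / 2))
    (h2 : volume {x ∈ Ioc l r | ω' < |u x - c'|} ≤ ofReal (τ * (r - l))) :
    |c' - c| ≤ ω' + ω := by
  by_contra hcon
  have hsub : Ioc l r ⊆ {x ∈ Ioc l r | ω < |u x - c|} ∪ {x ∈ Ioc l r | ω' < |u x - c'|} := fun x hx => by
    by_contra hn
    simp only [mem_union, mem_sep_iff, hx, true_and, not_or, not_lt] at hn
    apply hcon
    have := abs_sub (u x - c) (u x - c'); have e : u x - c - (u x - c') = c' - c := by ring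
    rw [e] at this; linarith
  have := (measure_mono hsub).trans ((measure_union_le _ _).trans (add_le_add h1 h2))
  rw [volume_Ioc] at this
  by_cases hτ0 : 0 ≤ τ
  · rw [← ofReal_add (by linarith) (by nlinarith), ofReal_le_ofReal_iff (by nlinarith)] at this
    nlinarith
  · have h0 : ofReal (τ * (r-l)) = 0 := ENNReal.ofReal_of_nonpos (by nlinarith)
    rw [h0, add_zero, ofReal_le_ofReal_iff (by linarith)] at this
    linarith

theorem JN_level {α : ℝ → ℝ} (hα : BMO1 α) (k : ℕ) : ∀ a b : ℝ, a < b →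
    volume {x ∈ Ioc a b | 16 * (k:ℝ) < |α x - av α a b|} ≤ ofReal ((1/2)^k * (b - a)) := by
  have base : ∀ a b : ℝ, a < b →
    volume {x ∈ Ioc a b | 8 < |α x - av α a b|} ≤ ofReal (1/8 * (b - a)) := by
    intro a b hab
    have hi : IntegrableOn (fun x => |α x - av α a b|) (Ioc a b) :=
      ((hα.1 a b).sub (integrable_const _)).abs
    have h1 := mul_meas_ge_le_integral_of_nonneg (Eventually.of_forall fun x => abs_nonneg _) hi 8
    have h2 : ∫ y in Ioc a b, |α y - av α a b| ≤ b - a := hα.2 a b hab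
    have h3 : volume {x ∈ Ioc a b | 8 < |α x - av α a b|} ≤
      (volume.restrict (Ioc a b)) {x | 8 ≤ |α x - av α a b|} := by
      rw [Measure.restrict_apply' measurableSet_Ioc]
      apply measure_mono
      rintro x ⟨hx, hx2⟩
      exact ⟨hx2.le, hx⟩
    refine h3.trans ?_
    rw [ENNReal.le_ofReal_iff_toReal_le (measure_ne_top _ _) (by linarith)]
    have h4 : 8 * ((volume.restrict (Ioc a b)) {x | 8 ≤ |α x - av α a b|}).toReal ≤ b - a := h1.trans h2
    linarith
  induction k with
  | zero =>
    intro a b hab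
    refine (measure_mono (sep_subset _ _)).trans ?_
    simp
  | succ k ih =>
    intro a b hab
    obtain ⟨l, r, h1, h2, h3, h4, h5, h6⟩ := one_step hab (hα.1 a b).aestronglyMeasurable.aemeasurable
      (by norm_num) (base a b hab)
    have hsub : {x ∈ Ioc a b | 16 * ((k+1:ℕ):ℝ) < |α x - av α a b|} ≤ᵐ[volume]
        (⋃ i, {x ∈ Ioc (l i) (r i) | 16 * (k:ℝ) < |α x - av α (l i) (r i)|} : Set ℝ) := by
      filter_upwards [h5] with x hx hxm
      obtain ⟨hxJ, hxl⟩ := hxm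
      push_cast at hxl
      have hk0 : (0:ℝ) ≤ k := by positivity
      by_cases hxn : x ∈ ⋃ i, Ioc (l i) (r i)
      · obtain ⟨i, hi⟩ := mem_iUnion.1 hxn
        refine mem_iUnion.2 ⟨i, hi, ?_⟩
        have hlr : l i < r i := hi.1.trans_le hi.2
        have hcc := center_close hlr (by norm_num) (h6 i) (base _ _ hlr)
        have := abs_sub (α x - av α a b) (av α (l i) (r i) - av α a b)
        have e : |α x - av α a b| ≤ |α x - av α (l i) (r i)| + |av α (l i) (r i) - av α a b| := by simpa using abs_add_le (α x - av α (l i) (r i)) (av α (l i) (r i) - av α a b)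
        linarith
      · have := hx hxJ hxn
        linarith
    refine (measure_mono_ae hsub).trans ((measure_iUnion_le _).trans ?_)
    calc ∑' i, volume {x ∈ Ioc (l i) (r i) | 16 * (k:ℝ) < |α x - av α (l i) (r i)|}
        ≤ ∑' i, ofReal ((1/2)^k) * ofReal (r i - l i) := by
          apply ENNReal.tsum_le_tsum
          intro i
          rcases (h1 i).eq_or_lt with he | hl
          · simp [he]
          · rw [← ofReal_mul (by positivity)]; exact ih _ _ hl
      _ = ofReal ((1/2)^k) * ∑' i, ofReal (r i - l i) := ENNReal.tsum_mul_left
      _ ≤ ofReal ((1/2)^k) * ofReal (4 * (1/8) * (b - a)) := by gcongr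
      _ = _ := by rw [← ofReal_mul (by positivity)]; congr 1; ring

theorem JN_exp : ∃ C : ℝ, 0 < C ∧ ∀ α : ℝ → ℝ, BMO1 α → ∀ a b : ℝ, a < b →
    ∫⁻ x in Ioc a b, ofReal (exp (|α x - av α a b| / 32)) ≤ ofReal (C * (b - a)) := by
  set q := exp (1/2) / 2 with hq
  have hq0 : 0 < q := by positivity
  have hq1 : q < 1 := by
    have h1 : exp (1/2) < 2 := by
      have : exp (1/2) ^ 2 < 2^2 := by rw [← Real.exp_nat_mul]; norm_num; linarith [Real.exp_one_lt_d9]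
      exact lt_of_pow_lt_pow_left₀ 2 (by norm_num) this
    rw [hq]; linarith
  have hsum := summable_geometric_of_lt_one hq0.le hq1
  have hS0 : 0 ≤ ∑' k : ℕ, q^k := tsum_nonneg fun k => by positivity
  refine ⟨1 + exp (1/2) * ∑' k : ℕ, q^k, by positivity, ?_⟩
  intro α hα a b hab; have hm : AEMeasurable α (volume.restrict (Ioc a b)) := (hα.1 a b).aestronglyMeasurable.aemeasurable
  set t : ℝ → ℝ := fun x => |α x - av α a b| with ht
  set S : ℕ → Set ℝ := fun k => {x | 16 * (k:ℝ) < t x} with hS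
  have hSm : ∀ k, NullMeasurableSet (S k) (volume.restrict (Ioc a b)) := fun k =>
    nullMeasurableSet_lt aemeasurable_const (by fun_prop)
  have hpt : ∀ x, ofReal (exp (t x / 32)) ≤ 1 + ∑' k : ℕ, (S k).indicator
      (fun _ => ofReal (exp ((k+1)/2))) x := by
    intro x; rcases (abs_nonneg (α x - av α a b)).eq_or_lt with h0 | h0
    · simp [ht, ← h0]
    · set k := ⌈t x / 16⌉₊ - 1 with hk
      have hpos : 0 < t x / 16 := by positivity
      have hc : 0 < ⌈t x / 16⌉₊ := Nat.ceil_pos.2 hpos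
      have e : (k : ℝ) = (⌈t x/16⌉₊ : ℝ) - 1 := by rw [hk, Nat.cast_sub hc]; simp
      have b1 := Nat.ceil_lt_add_one hpos.le; have b2 := Nat.le_ceil (t x / 16); have hxS : x ∈ S k := by
        show 16 * (k:ℝ) < t x
        rw [e]; linarith
      refine le_trans ?_ (le_add_left (ENNReal.le_tsum k))
      rw [indicator_of_mem hxS]; apply ofReal_le_ofReal
      apply Real.exp_le_exp.2
      rw [e]; linarith
  calc ∫⁻ x in Ioc a b, ofReal (exp (t x / 32))
      ≤ ∫⁻ x in Ioc a b, (1 + ∑' k : ℕ, (S k).indicator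
      (fun _ => ofReal (exp ((k+1)/2))) x) := lintegral_mono hpt
    _ = ofReal (b - a) + ∑' k : ℕ, ∫⁻ x in Ioc a b, (S k).indicator
      (fun _ => ofReal (exp ((k+1)/2))) x := by
        rw [lintegral_add_left measurable_const, lintegral_tsum]
        · simp
        · intro k; exact aemeasurable_const.indicator₀ (hSm k)
    _ ≤ ofReal (b - a) + ∑' k : ℕ, ofReal ((exp (1/2) * (b - a)) * q^k) := by
        gcongr with k
        rw [lintegral_indicator₀ (hSm k), lintegral_const, Measure.restrict_apply_univ,
          Measure.restrict_apply' measurableSet_Ioc, inter_comm]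
        have := JN_level hα k a b hab; refine (mul_le_mul_right this _).trans ?_; rw [← ofReal_mul (by positivity)]
        apply ofReal_le_ofReal
        have e : exp (((k:ℝ)+1)/2) = exp (1/2) * exp (1/2)^k := by rw [← Real.exp_nat_mul, ← Real.exp_add]; congr 1; ring
        rw [e, hq, div_pow, div_pow, one_pow]; apply le_of_eq; field_simp
    _ = _ := by
        rw [← ENNReal.ofReal_tsum_of_nonneg (fun k => by have : 0 < b - a := by linarith
                                                         positivity) (hsum.mul_left _),
          tsum_mul_left, ← ofReal_add (by linarith) (by have : 0 < b - a := (by linarith); positivity)]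
        congr 1; ring

/-- The function `s log (e + s)`. -/
noncomputable def Phi (s : ℝ) : ℝ := s * log (exp 1 + s)

theorem log_ge_one {s : ℝ} (hs : 0 ≤ s) : 1 ≤ log (exp 1 + s) := by rw [Real.le_log_iff_exp_le (by positivity)]; linarith

theorem Phi_ge {s : ℝ} (hs : 0 ≤ s) : s ≤ Phi s := by
  have := log_ge_one hs
  unfold Phi; nlinarith

theorem young_LlogL {s t : ℝ} (hs : 0 ≤ s) (ht : 0 ≤ t) :
    s * t ≤ 64 * (Phi s + exp (t / 32)) := by
  have hPhi := Phi_ge hs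
  by_cases h : t ≤ 64 * log (exp 1 + s)
  · have := Real.exp_pos (t/32)
    have h2 : s * t ≤ s * (64 * log (exp 1 + s)) := by gcongr
    unfold Phi; nlinarith
  · push Not at h
    have h1 : s ≤ exp (t/64) := by
      have : log (exp 1 + s) < t/64 := by linarith
      rw [Real.log_lt_iff_lt_exp (by positivity)] at this
      linarith [Real.exp_pos 1]
    have h2 : t/64 ≤ exp (t/64) := by linarith [Real.add_one_le_exp (t/64)]
    have h3 : s * (t/64) ≤ exp (t/64) * exp (t/64) := by gcongr
    rw [← Real.exp_add, show t/64+t/64 = t/32 by ring] at h3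
    linarith

theorem JN_LlogL : ∃ C : ℝ, 0 < C ∧ ∀ α : ℝ → ℝ, BMO1 α → ∀ f : ℝ → ℝ, ∀ a b : ℝ, a < b →
    ∫⁻ x in Ioc a b, ofReal (|f x| * |α x - av α a b|) ≤
      ofReal C * ((∫⁻ x in Ioc a b, ofReal (Phi |f x|)) + ofReal (b - a)) := by
  obtain ⟨C, hC, h⟩ := JN_exp
  refine ⟨64 * (C + 1), by positivity, ?_⟩
  intro α hα f a b hab; have hm : AEMeasurable α (volume.restrict (Ioc a b)) := (hα.1 a b).aestronglyMeasurable.aemeasurable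
  calc ∫⁻ x in Ioc a b, ofReal (|f x| * |α x - av α a b|)
      ≤ ∫⁻ x in Ioc a b, (ofReal 64 * ofReal (Phi |f x|) +
          ofReal 64 * ofReal (exp (|α x - av α a b| / 32))) := by
        apply lintegral_mono
        intro x; simp only
        rw [← mul_add, ← ofReal_add ((abs_nonneg _).trans (Phi_ge (abs_nonneg _))) (Real.exp_pos _).le,
          ← ofReal_mul (by norm_num)]
        exact ofReal_le_ofReal (young_LlogL (abs_nonneg _) (abs_nonneg _))
    _ = ofReal 64 * (∫⁻ x in Ioc a b, ofReal (Phi |f x|)) +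
          ofReal 64 * ∫⁻ x in Ioc a b, ofReal (exp (|α x - av α a b| / 32)) := by
        rw [lintegral_add_right' _ (by fun_prop), lintegral_const_mul' _ _ (by simp),
          lintegral_const_mul' _ _ (by simp)]
    _ ≤ ofReal 64 * (∫⁻ x in Ioc a b, ofReal (Phi |f x|)) +
          ofReal 64 * ofReal (C * (b-a)) := by
        gcongr; exact h α hα a b hab
    _ ≤ _ := by
        rw [mul_add (ofReal _), ofReal_mul hC.le, ← mul_assoc, ← ofReal_mul (by norm_num)]
        exact add_le_add (mul_le_mul' (ofReal_le_ofReal (by linarith)) le_rfl)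
          (mul_le_mul' (ofReal_le_ofReal (by linarith)) le_rfl)

theorem JN_sq : ∃ C : ℝ, 0 < C ∧ ∀ α : ℝ → ℝ, BMO1 α → ∀ a b : ℝ, a < b →
    IntegrableOn (fun x => (α x - av α a b)^2) (Ioc a b) ∧
    ∫ x in Ioc a b, (α x - av α a b)^2 ≤ C * (b - a) := by
  obtain ⟨C, hC, h⟩ := JN_exp
  refine ⟨2048 * C, by positivity, ?_⟩
  intro α hα a b hab; have hm : AEMeasurable α (volume.restrict (Ioc a b)) := (hα.1 a b).aestronglyMeasurable.aemeasurable
  have hpt : ∀ x, (α x - av α a b)^2 ≤ 2048 * exp (|α x - av α a b| / 32) := fun x => by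
    have h0 : 0 ≤ |α x - av α a b| / 32 := by positivity
    have := Real.quadratic_le_exp_of_nonneg h0; rw [← sq_abs]; nlinarith
  have hle : ∫⁻ x in Ioc a b, ofReal ((α x - av α a b)^2) ≤ ofReal (2048 * C * (b-a)) := by
    calc ∫⁻ x in Ioc a b, ofReal ((α x - av α a b)^2)
        ≤ ∫⁻ x in Ioc a b, ofReal 2048 * ofReal (exp (|α x - av α a b| / 32)) := by
          apply lintegral_mono
          intro x; simp only
          rw [← ofReal_mul (by norm_num)]
          exact ofReal_le_ofReal (hpt x)
      _ ≤ ofReal 2048 * ofReal (C * (b-a)) := by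
          rw [lintegral_const_mul' _ _ (by simp)]
          gcongr; exact h α hα a b hab
      _ = _ := by rw [← ofReal_mul (by norm_num), mul_assoc]
  have hInt : IntegrableOn (fun x => (α x - av α a b)^2) (Ioc a b) := by
    refine ⟨AEMeasurable.aestronglyMeasurable (by fun_prop), ?_⟩
    rw [hasFiniteIntegral_iff_ofReal (Eventually.of_forall fun x => sq_nonneg _)]
    exact lt_of_le_of_lt hle ENNReal.ofReal_lt_top
  refine ⟨hInt, ?_⟩
  rw [← ofReal_le_ofReal_iff (by have : 0 < b - a := (by linarith); positivity),
    ofReal_integral_eq_lintegral_ofReal hInt (Eventually.of_forall fun x => sq_nonneg _)]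
  exact hle

theorem jensen_sq {a b : ℝ} (hab : a < b) {g : ℝ → ℝ} (h1 : IntegrableOn g (Ioc a b))
    (h2 : IntegrableOn (fun x => (g x)^2) (Ioc a b)) :
    (∫ x in Ioc a b, g x)^2 ≤ (b - a) * ∫ x in Ioc a b, (g x)^2 := by
  set m := av g a b with hm
  have hba : 0 < b - a := by linarith
  have hmi : ∫ x in Ioc a b, g x = (b - a) * m := by rw [hm]; unfold av; field_simp
  have h0 : 0 ≤ ∫ x in Ioc a b, (g x - m)^2 := integral_nonneg fun x => sq_nonneg _
  have e : ∫ x in Ioc a b, (g x - m)^2 = ∫ x in Ioc a b, ((g x)^2 - (2 * m) * g x + m^2) := by congr 1; ext x; ring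
  have hi2 : Integrable (fun x => (2*m) * g x) (volume.restrict (Ioc a b)) := h1.const_mul _
  have hi3 : Integrable (fun x => (g x)^2 - (2*m) * g x) (volume.restrict (Ioc a b)) := h2.sub hi2
  rw [e, integral_add hi3 (integrable_const _), integral_sub h2 hi2,
    integral_const_mul, hmi] at h0
  simp only [integral_const, measureReal_restrict_apply_univ, volume_real_Ioc_of_le hab.le,
    smul_eq_mul] at h0
  rw [hmi]
  nlinarith

theorem av_diff : ∃ C : ℝ, 0 < C ∧ ∀ α : ℝ → ℝ, BMO1 α → ∀ a b l r : ℝ, l < r →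
    a ≤ l → r ≤ b → |av α l r - av α a b| ≤ C * Real.sqrt ((b - a) / (r - l)) := by
  obtain ⟨C, hC, h⟩ := JN_sq
  refine ⟨Real.sqrt C, by positivity, ?_⟩
  intro α hα a b l r hlr hal hrb; have hab : a < b := by linarith
  obtain ⟨hi, hle⟩ := h α hα a b hab
  have hsub : Ioc l r ⊆ Ioc a b := Ioc_subset_Ioc hal hrb
  have hi2 := hi.mono_set hsub
  have hi1 : IntegrableOn (fun x => α x - av α a b) (Ioc l r) := (hα.1 l r).sub (integrable_const _)
  have hj := jensen_sq hlr hi1 hi2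
  have hrl : 0 < r - l := by linarith
  have hmono : ∫ x in Ioc l r, (α x - av α a b)^2 ≤ ∫ x in Ioc a b, (α x - av α a b)^2 :=
    setIntegral_mono_set hi (Eventually.of_forall fun x => sq_nonneg _) hsub.eventuallyLE
  have e : ∫ x in Ioc l r, (α x - av α a b) = (r - l) * (av α l r - av α a b) := by
    rw [integral_sub (hα.1 l r) (integrable_const _)]; simp only [integral_const, measureReal_restrict_apply_univ, volume_real_Ioc_of_le hlr.le,
      smul_eq_mul]
    rw [mul_sub]; congr 1; unfold av; field_simp
  rw [e] at hj
  rw [← Real.sqrt_mul hC.le]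
  apply Real.abs_le_sqrt
  rw [← mul_div_assoc, le_div_iff₀ hrl]
  have h3 : (r - l) * ((r-l) * (av α l r - av α a b)^2) ≤ (r-l) * (C * (b-a)) := by
    have : (r - l) * ∫ x in Ioc l r, (α x - av α a b)^2 ≤ (r - l) * (C * (b-a)) := by gcongr; exact hmono.trans hle
    nlinarith
  have := le_of_mul_le_mul_left h3 hrl
  linarith

theorem FS_ineq (s t : ℝ) : (s+t)^4 ≤ 2*s^4+200*t^4 := by nlinarith [sq_nonneg (s^2-2*s*t-6*t^2), sq_nonneg (s*t-7*t^2), sq_nonneg (t^2)]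

theorem FS_step {a0 b0 L : ℝ} {u : ℝ → ℝ}
    (hum : AEMeasurable u (volume.restrict (Ioc a0 b0)))
    (huL : ∀ x ∈ Ioc a0 b0, |u x| ≤ L) {M4 : ℝ → ℝ≥0∞} {c ω : ℝ → ℝ → ℝ}
    (hω : ∀ l r, a0 ≤ l → l < r → r ≤ b0 → 0 ≤ ω l r ∧ ω l r ≤ L ∧
      volume {x ∈ Ioc l r | ω l r < |u x - c l r|} ≤ ofReal (1/16 * (r - l)) ∧
      ∀ x ∈ Ioc l r, ofReal (ω l r ^ 4) ≤ M4 x) (n : ℕ) :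
    ∀ a b s, a0 ≤ a → a < b → b ≤ b0 → 0 ≤ s →
      ∫⁻ x in Ioc a b, ofReal ((|u x - c a b| + ω a b + s)^4) ≤
        ofReal 9000 * (∫⁻ x in Ioc a b, M4 x) + ofReal (4 * s^4 * (b - a)) +
        ofReal ((1/4)^n * (4 * L * (n+1) + s)^4 * (b - a)) := by
  induction n with
  | zero =>
    intro a b s ha hab hb hs; obtain ⟨h0, h1, h2, -⟩ := hω a b ha hab hb
    have hne : ∃ x ∈ Ioc a b, |u x - c a b| ≤ ω a b := by
      by_contra hcon
      push Not at hcon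
      have : {x ∈ Ioc a b | ω a b < |u x - c a b|} = Ioc a b := by ext x; exact ⟨fun h => h.1, fun h => ⟨h, hcon x h⟩⟩
      rw [this, volume_Ioc, ofReal_le_ofReal_iff (by linarith)] at h2
      linarith
    obtain ⟨x0, hx0, hx0'⟩ := hne
    have hsub : Ioc a b ⊆ Ioc a0 b0 := Ioc_subset_Ioc ha hb
    have hcb : |c a b| ≤ 2 * L := by have := abs_sub (u x0) (u x0 - c a b); simp only [sub_sub_cancel] at this; linarith [huL x0 (hsub hx0)]
    refine le_trans ?_ le_add_self
    calc ∫⁻ x in Ioc a b, ofReal ((|u x - c a b| + ω a b + s)^4)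
        ≤ ∫⁻ x in Ioc a b, ofReal ((4 * L + s)^4) := by
          apply setLIntegral_mono' measurableSet_Ioc
          intro x hx; apply ofReal_le_ofReal
          have := abs_sub (u x) (c a b); have h3 := huL x (hsub hx); gcongr; linarith
      _ = _ := by
          rw [lintegral_const, Measure.restrict_apply_univ, volume_Ioc,
            ← ofReal_mul (by positivity)]
          simp
  | succ n ih =>
    intro a b s ha hab hb hs; obtain ⟨h0, h1, h2, h3⟩ := hω a b ha hab hb
    have hsub : Ioc a b ⊆ Ioc a0 b0 := Ioc_subset_Ioc ha hb
    obtain ⟨l, r, k1, k2, k3, k4, k5, k6⟩ := one_step hab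
      (hum.mono_measure (Measure.restrict_mono hsub le_rfl)) (by norm_num) h2
    set Ω := ⋃ i, Ioc (l i) (r i) with hΩ
    have hΩm : MeasurableSet Ω := MeasurableSet.iUnion fun i => measurableSet_Ioc
    have hΩs : Ω ⊆ Ioc a b := iUnion_subset k2
    have hbnd : ∀ i, l i < r i → a ≤ l i ∧ r i ≤ b := fun i hi => by exact (Ioc_subset_Ioc_iff hi).1 (k2 i) |>.symm
    set ω0 := ω a b with hω0
    have hba : 0 < b - a := by linarith
    have hvolΩ : volume Ω ≤ ofReal (1/4 * (b-a)) := by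
      rw [hΩ]; refine (measure_iUnion_le _).trans ?_
      simp only [volume_Ioc]; refine k4.trans (ofReal_le_ofReal (by linarith))
    have split : ∀ F : ℝ → ℝ≥0∞, ∫⁻ x in Ioc a b, F x =
        (∫⁻ x in Ioc a b \ Ω, F x) + ∑' i, ∫⁻ x in Ioc (l i) (r i), F x := by
      intro F; rw [← lintegral_iUnion (fun i => measurableSet_Ioc) k3, ← hΩ, add_comm]
      have := lintegral_inter_add_sdiff (μ := volume) F (Ioc a b) hΩm; rw [inter_eq_right.2 hΩs] at this; exact this.symm
    -- the part off Ω
    have p1 : ∫⁻ x in Ioc a b \ Ω, ofReal ((|u x - c a b| + ω0 + s)^4) ≤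
        ofReal ((s + 2*ω0)^4 * (b-a)) := by
      calc _ ≤ ∫⁻ x in Ioc a b \ Ω, ofReal ((s + 2*ω0)^4) := by
            apply setLIntegral_mono_ae' (measurableSet_Ioc.diff hΩm)
            filter_upwards [k5] with x hx hxm
            have := hx hxm.1 hxm.2; apply ofReal_le_ofReal; refine pow_le_pow_left₀ (by positivity) ?_ 4
            linarith
        _ ≤ ∫⁻ x in Ioc a b, ofReal ((s + 2*ω0)^4) := lintegral_mono_set sdiff_subset
        _ = _ := by
          rw [lintegral_const, Measure.restrict_apply_univ, volume_Ioc,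
            ← ofReal_mul (by positivity)]
    have p2 : ∀ i, ∫⁻ x in Ioc (l i) (r i), ofReal ((|u x - c a b| + ω0 + s)^4) ≤
        ofReal 9000 * (∫⁻ x in Ioc (l i) (r i), M4 x) +
        ofReal (4 * (s+2*ω0)^4 + (1/4)^n * (4 * L * (n+1) + (s + 2*ω0))^4) * ofReal (r i - l i) := by
      intro i; rcases (k1 i).eq_or_lt with he | hl
      · simp [he]
      · obtain ⟨hb1, hb2⟩ := hbnd i hl
        obtain ⟨q0, q1, q2, q3⟩ := hω (l i) (r i) (ha.trans hb1) hl (hb2.trans hb)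
        have hcc := center_close hl (by norm_num) (k6 i) q2
        have := ih (l i) (r i) (s + 2*ω0) (ha.trans hb1) hl (hb2.trans hb) (by positivity)
        rw [add_assoc, ← ofReal_add (by have : 0 < r i - l i := (by linarith); positivity)
          (by have : 0 < r i - l i := (by linarith); positivity), ← add_mul, ofReal_mul (by positivity)] at this
        refine le_trans (lintegral_mono fun x => ofReal_le_ofReal ?_) this
        have e : |u x - c a b| ≤ |u x - c (l i) (r i)| + |c (l i) (r i) - c a b| := by simpa using abs_add_le (u x - c (l i) (r i)) (c (l i) (r i) - c a b)
        refine pow_le_pow_left₀ (by positivity) ?_ 4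
        linarith
    -- ω^4 |J| controlled
    have p3 : ofReal (ω0^4 * (b-a)) ≤ ofReal (4/3) * ∫⁻ x in Ioc a b \ Ω, M4 x := by
      have hv : ofReal (3/4 * (b-a)) ≤ volume (Ioc a b \ Ω) := by
        rw [measure_sdiff hΩs hΩm.nullMeasurableSet (lt_of_le_of_lt hvolΩ ENNReal.ofReal_lt_top).ne,
          volume_Ioc]
        refine le_trans ?_ (tsub_le_tsub_left hvolΩ _)
        rw [← ENNReal.ofReal_sub _ (by positivity)]
        exact ofReal_le_ofReal (by linarith)
      have hM : ofReal (ω0^4) * volume (Ioc a b \ Ω) ≤ ∫⁻ x in Ioc a b \ Ω, M4 x := by rw [← setLIntegral_const]; exact setLIntegral_mono' (measurableSet_Ioc.diff hΩm) fun x hx => h3 x hx.1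
      calc ofReal (ω0^4 * (b-a)) = ofReal (4/3) * (ofReal (ω0^4) * ofReal (3/4*(b-a))) := by
            rw [← ofReal_mul (by positivity), ← ofReal_mul (by positivity)]
            congr 1; ring
        _ ≤ ofReal (4/3) * (ofReal (ω0^4) * volume (Ioc a b \ Ω)) := by gcongr
        _ ≤ _ := by gcongr
    rw [split]; have hnn : 0 ≤ L := h0.trans h1
    set K : ℝ := 4 * (s+2*ω0)^4 + (1/4)^n * (4 * L * (n+1) + (s + 2*ω0))^4 with hK
    have hKnn : 0 ≤ K := by positivity
    calc _ ≤ ofReal ((s + 2*ω0)^4 * (b-a)) + ∑' i, (ofReal 9000 * (∫⁻ x in Ioc (l i) (r i), M4 x) +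
          ofReal K * ofReal (r i - l i)) := add_le_add p1 (ENNReal.tsum_le_tsum p2)
      _ = ofReal ((s + 2*ω0)^4 * (b-a)) + (ofReal 9000 * (∑' i, ∫⁻ x in Ioc (l i) (r i), M4 x) +
          ofReal K * ∑' i, ofReal (r i - l i)) := by
          rw [ENNReal.tsum_add, ENNReal.tsum_mul_left, ENNReal.tsum_mul_left]
      _ ≤ ofReal ((s + 2*ω0)^4 * (b-a)) + (ofReal 9000 * (∑' i, ∫⁻ x in Ioc (l i) (r i), M4 x) +
          ofReal K * ofReal (1/4 * (b-a))) := by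
          gcongr
          exact k4.trans (ofReal_le_ofReal (by linarith))
      _ = ofReal 9000 * (∑' i, ∫⁻ x in Ioc (l i) (r i), M4 x) +
          ofReal ((s + 2*ω0)^4 * (b-a) + K * (1/4 * (b-a))) := by
          rw [← ofReal_mul hKnn, ofReal_add (by positivity) (by positivity)]
          ring
      _ ≤ ofReal 9000 * (∑' i, ∫⁻ x in Ioc (l i) (r i), M4 x) +
          ofReal (6400 * (ω0^4 * (b-a)) + (4 * s^4 * (b-a) + (1/4)^(n+1) * (4 * L * ((n+1:ℕ)+1) + s)^4 * (b-a))) := by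
          refine add_le_add le_rfl (ofReal_le_ofReal ?_); have i1 := FS_ineq s (2*ω0)
          have i2 : (4 * L * (n+1) + (s + 2*ω0))^4 ≤ (4 * L * ((n+1:ℕ)+1) + s)^4 := by
            refine pow_le_pow_left₀ (by positivity) ?_ 4
            push_cast; nlinarith
          have i3 : (1/4:ℝ)^(n+1) = (1/4)^n * (1/4) := pow_succ _ _
          have i4 : (1/4:ℝ)^n * (4 * L * (n+1) + (s + 2*ω0))^4 ≤ (1/4:ℝ)^n * (4 * L * ((n+1:ℕ)+1) + s)^4 := by gcongr
          rw [i3, hK]; have i5 : (s + 2*ω0)^4 + (4 * (s+2*ω0)^4 + (1/4)^n * (4 * L * (n+1) + (s + 2*ω0))^4) * (1/4) ≤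
              6400 * ω0^4 + (4 * s^4 + (1/4)^n * (1/4) * (4 * L * ((n+1:ℕ)+1) + s)^4) := by
            linarith
          have := mul_le_mul_of_nonneg_right i5 hba.le; linarith
      _ = ofReal 9000 * (∑' i, ∫⁻ x in Ioc (l i) (r i), M4 x) +
          ofReal 6400 * ofReal (ω0^4 * (b-a)) + (ofReal (4 * s^4 * (b-a)) +
            ofReal ((1/4)^(n+1) * (4 * L * ((n+1:ℕ)+1) + s)^4 * (b-a))) := by
          rw [ofReal_add (by positivity) (by positivity), ofReal_add (by positivity) (by positivity),
            ofReal_mul (p := 6400) (by norm_num), add_assoc]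
      _ ≤ ofReal 9000 * (∑' i, ∫⁻ x in Ioc (l i) (r i), M4 x) +
          ofReal 9000 * (∫⁻ x in Ioc a b \ Ω, M4 x) + (ofReal (4 * s^4 * (b-a)) +
            ofReal ((1/4)^(n+1) * (4 * L * ((n+1:ℕ)+1) + s)^4 * (b-a))) := by
          gcongr ?_ + ?_ + _
          · rfl
          · refine (mul_le_mul' le_rfl p3).trans ?_
            rw [← mul_assoc, ← ofReal_mul (by norm_num)]
            gcongr; norm_num
      _ = _ := by rw [split M4, ← mul_add, add_assoc _ (ofReal _) (ofReal _)]; rw [add_comm (∑' i, ∫⁻ x in Ioc (l i) (r i), M4 x)]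

/-- Median version of the Fefferman–Stein inequality. -/
theorem FS {a0 b0 L : ℝ} (hab : a0 < b0) {u : ℝ → ℝ}
    (hum : AEMeasurable u (volume.restrict (Ioc a0 b0)))
    (huL : ∀ x ∈ Ioc a0 b0, |u x| ≤ L) {M4 : ℝ → ℝ≥0∞} {c ω : ℝ → ℝ → ℝ}
    (hω : ∀ l r, a0 ≤ l → l < r → r ≤ b0 → 0 ≤ ω l r ∧ ω l r ≤ L ∧
      volume {x ∈ Ioc l r | ω l r < |u x - c l r|} ≤ ofReal (1/16 * (r - l)) ∧
      ∀ x ∈ Ioc l r, ofReal (ω l r ^ 4) ≤ M4 x) :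
    ∫⁻ x in Ioc a0 b0, ofReal ((|u x - c a0 b0|)^4) ≤
      ofReal 9000 * (∫⁻ x in Ioc a0 b0, M4 x) := by
  have h0 := (hω a0 b0 le_rfl hab le_rfl).1
  have h1 : ∀ n : ℕ, ∫⁻ x in Ioc a0 b0, ofReal ((|u x - c a0 b0|)^4) ≤
      ofReal 9000 * (∫⁻ x in Ioc a0 b0, M4 x) +
      ofReal ((1/4)^n * (4 * L * (n+1) + 0)^4 * (b0 - a0)) := by
    intro n; have := FS_step hum huL hω n a0 b0 0 le_rfl hab le_rfl le_rfl
    simp only [ne_eq, OfNat.ofNat_ne_zero, not_false_eq_true, zero_pow, mul_zero, zero_mul,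
      ENNReal.ofReal_zero, add_zero] at this ⊢
    refine le_trans (lintegral_mono fun x => ofReal_le_ofReal ?_) this
    gcongr
    linarith
  have h2 : Tendsto (fun n : ℕ => (1/4:ℝ)^n * (4 * L * (n+1) + 0)^4 * (b0 - a0)) atTop (nhds 0) := by
    have t1 := tendsto_pow_const_mul_const_pow_of_abs_lt_one 4 (r := (1/4:ℝ)) (by norm_num [abs_of_pos])
    have t2 := ((tendsto_add_atTop_iff_nat 1).2 t1).const_mul (4 * (4*L)^4 * (b0-a0)); rw [mul_zero] at t2; refine t2.congr fun n => ?_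
    push_cast; rw [pow_succ]; ring
  have h3 : Tendsto (fun n : ℕ => ofReal 9000 * (∫⁻ x in Ioc a0 b0, M4 x) +
      ofReal ((1/4)^n * (4 * L * (n+1) + 0)^4 * (b0 - a0))) atTop
      (nhds (ofReal 9000 * (∫⁻ x in Ioc a0 b0, M4 x) + 0)) := by
    apply Tendsto.const_add
    simpa using ENNReal.tendsto_ofReal h2
  rw [add_zero] at h3
  exact ge_of_tendsto' h3 h1

def LI (b : ℝ → ℝ) : Prop := ∀ u v : ℝ, IntervalIntegrable b volume u v

theorem LI_of_integrable {b : ℝ → ℝ} (h : Integrable b) : LI b := fun _ _ => h.intervalIntegrable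

theorem LI_of_bdd {b : ℝ → ℝ} (hm : Measurable b) {K : ℝ} (hK : ∀ x, |b x| ≤ K) : LI b := by
  intro u v; rw [intervalIntegrable_iff]
  exact Measure.integrableOn_of_bounded (M := K) (by simp [uIoc]) hm.aestronglyMeasurable
    (ae_of_all _ fun x => hK x)

theorem BMO1.li {α : ℝ → ℝ} (h : BMO1 α) : LI α := by
  intro u v; rw [intervalIntegrable_iff]
  exact h.1 _ _

theorem LI.on {b : ℝ → ℝ} (h : LI b) (u v : ℝ) : IntegrableOn b (Ioc u v) := by
  rcases le_total u v with huv | huv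
  · exact (intervalIntegrable_iff_integrableOn_Ioc_of_le huv).1 (h u v)
  · simp [Ioc_eq_empty (not_lt.2 huv)]

theorem Adiff_eq {b : ℝ → ℝ} (h : LI b) (x y : ℝ) :
    Adiff b x y = (∫ t in (0:ℝ)..x, b t) - ∫ t in (0:ℝ)..y, b t := by
  unfold Adiff; rw [intervalIntegral.integral_interval_sub_left (h _ _) (h _ _)]

theorem Adiff_cont {b : ℝ → ℝ} (h : LI b) : Continuous (fun p : ℝ × ℝ => Adiff b p.1 p.2) := by
  have h1 := intervalIntegral.continuous_primitive h 0
  simp_rw [Adiff_eq h]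
  fun_prop

theorem Adiff_symm (b : ℝ → ℝ) (x y : ℝ) : Adiff b x y = - Adiff b y x := by unfold Adiff; rw [intervalIntegral.integral_symm]

theorem Adiff_add {b : ℝ → ℝ} (h : LI b) (x y z : ℝ) :
    Adiff b x z = Adiff b x y + Adiff b y z := by
  rw [Adiff_eq h, Adiff_eq h, Adiff_eq h]; ring

theorem Adiff_bound {b : ℝ → ℝ} {K : ℝ} (hK : ∀ x, |b x| ≤ K) (x y : ℝ) :
    |Adiff b x y| ≤ K * |x - y| := by
  unfold Adiff; exact intervalIntegral.norm_integral_le_of_norm_le_const (f := b) (C := K) (a := y) (b := x)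
    (fun t _ => hK t)

/-- difference quotient -/
noncomputable def Dq (b : ℝ → ℝ) (x y : ℝ) : ℝ := Adiff b x y / (x - y)

theorem Dq_symm (b : ℝ → ℝ) (x y : ℝ) : Dq b x y = Dq b y x := by unfold Dq; rw [Adiff_symm, ← neg_sub y x, neg_div_neg_eq]

theorem Dq_bound {b : ℝ → ℝ} {K : ℝ} (hK : ∀ x, |b x| ≤ K) (x y : ℝ) : |Dq b x y| ≤ K := by
  unfold Dq; rw [abs_div]
  exact div_le_of_le_mul₀ (abs_nonneg _) ((abs_nonneg _).trans (hK 0)) (Adiff_bound hK x y)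

theorem Dq_meas {b : ℝ → ℝ} (h : LI b) : Measurable (fun p : ℝ × ℝ => Dq b p.1 p.2) := by unfold Dq; exact (Adiff_cont h).measurable.div (by fun_prop)

variable {ι : Type}

/-- product of difference quotients -/
noncomputable def Pk (s : Finset ι) (b : ι → ℝ → ℝ) (x y : ℝ) : ℝ := ∏ j ∈ s, Dq (b j) x y

theorem Pk_symm (s : Finset ι) (b : ι → ℝ → ℝ) (x y : ℝ) : Pk s b x y = Pk s b y x := by unfold Pk; exact Finset.prod_congr rfl fun j _ => Dq_symm _ _ _

theorem Pk_bound {s : Finset ι} {b : ι → ℝ → ℝ} {K : ℝ} (hK : ∀ j ∈ s, ∀ x, |b j x| ≤ K) (x y : ℝ) :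
    |Pk s b x y| ≤ K ^ s.card := by
  unfold Pk; rw [Finset.abs_prod]
  rw [← Finset.prod_const]
  exact Finset.prod_le_prod (fun j _ => abs_nonneg _) fun j hj => Dq_bound (hK j hj) x y

theorem Pk_meas {s : Finset ι} {b : ι → ℝ → ℝ} (h : ∀ j ∈ s, LI (b j)) :
    Measurable (fun p : ℝ × ℝ => Pk s b p.1 p.2) := by
  unfold Pk; exact Finset.measurable_prod _ fun j hj => Dq_meas (h j hj)

/-- commutator operator (truncated) -/
noncomputable def Cop (s : Finset ι) (b : ι → ℝ → ℝ) (δ : ℝ) (f : ℝ → ℝ) (x : ℝ) : ℝ :=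
  ∫ y in {y : ℝ | δ < |x - y|}, Pk s b x y / (x - y) * f y

/-- the extra factor -/
noncomputable def Kap (lam : ℝ) (α : ℝ → ℝ) (x y : ℝ) : ℝ := lam + Dq α x y - α y

/-- general truncated operator -/
noncomputable def Uop (lam : ℝ) (α : ℝ → ℝ) (s : Finset ι) (b : ι → ℝ → ℝ) (δ : ℝ) (f : ℝ → ℝ)
    (x : ℝ) : ℝ :=
  ∫ y in {y : ℝ | δ < |x - y|}, Kap lam α x y * Pk s b x y / (x - y) * f y

theorem Kap_one_zero (x y : ℝ) : Kap 1 (fun _ => 0) x y = 1 := by simp [Kap, Dq, Adiff]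

theorem Uop_zero (s : Finset ι) (b : ι → ℝ → ℝ) (δ : ℝ) (f : ℝ → ℝ) (x : ℝ) :
    Uop 1 (fun _ => 0) s b δ f x = Cop s b δ f x := by
  simp [Uop, Cop, Kap_one_zero]

theorem BMO1_zero : BMO1 (fun _ => (0:ℝ)) := by refine ⟨fun u v => by simp, fun u v h => by simp [h.le]⟩

theorem meas_trunc (x δ : ℝ) : MeasurableSet {y : ℝ | δ < |x - y|} :=
  measurableSet_lt measurable_const (by fun_prop)

theorem meas_trunc2 (δ : ℝ) : MeasurableSet {p : ℝ × ℝ | δ < |p.1 - p.2|} :=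
  measurableSet_lt measurable_const (by fun_prop)

/-- truncated kernel -/
noncomputable def kT (s : Finset ι) (b : ι → ℝ → ℝ) (δ : ℝ) (x y : ℝ) : ℝ :=
  if δ < |x - y| then Pk s b x y / (x - y) else 0

theorem kT_meas {s : Finset ι} {b : ι → ℝ → ℝ} (h : ∀ j ∈ s, LI (b j)) (δ : ℝ) :
    Measurable (fun p : ℝ × ℝ => kT s b δ p.1 p.2) := by
  unfold kT; exact Measurable.ite (meas_trunc2 δ) ((Pk_meas h).div (by fun_prop)) measurable_const

theorem kT_anti (s : Finset ι) (b : ι → ℝ → ℝ) (δ x y : ℝ) : kT s b δ x y = - kT s b δ y x := by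
  unfold kT; rw [abs_sub_comm, Pk_symm]
  split_ifs
  · rw [← neg_sub y x, div_neg]
  · simp

theorem kT_bound {s : Finset ι} {b : ι → ℝ → ℝ} {K : ℝ} (hK : ∀ j ∈ s, ∀ x, |b j x| ≤ K) {δ : ℝ}
    (hδ : 0 < δ) (x y : ℝ) : |kT s b δ x y| ≤ |K| ^ s.card / δ := by
  unfold kT; split_ifs with h
  · rw [abs_div]
    exact div_le_div₀ (by positivity) (Pk_bound (fun j hj x => (hK j hj x).trans (le_abs_self K)) x y)
      hδ h.le
  · simp; positivity

theorem Cop_eq (s : Finset ι) (b : ι → ℝ → ℝ) (δ : ℝ) (f : ℝ → ℝ) (x : ℝ) :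
    Cop s b δ f x = ∫ y, kT s b δ x y * f y := by
  unfold Cop kT; rw [← integral_indicator (meas_trunc x δ)]
  congr 1; ext y
  by_cases h : δ < |x - y| <;> simp [h]

theorem trip_int (μ : Measure ℝ) [IsFiniteMeasure μ] {F : ℝ → ℝ → ℝ → ℝ} {B : ℝ}
    (hF : Measurable (fun p : ℝ × ℝ × ℝ => F p.1 p.2.1 p.2.2)) (hB : ∀ x y z, |F x y z| ≤ B) :
    Integrable (fun p : ℝ × ℝ × ℝ => F p.1 p.2.1 p.2.2) (μ.prod (μ.prod μ)) :=
  Integrable.of_bound hF.aestronglyMeasurable B (ae_of_all _ fun p => hB _ _ _)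

theorem trip_eq (μ : Measure ℝ) [IsFiniteMeasure μ] {F : ℝ → ℝ → ℝ → ℝ} {B : ℝ}
    (hF : Measurable (fun p : ℝ × ℝ × ℝ => F p.1 p.2.1 p.2.2)) (hB : ∀ x y z, |F x y z| ≤ B) :
    ∫ p : ℝ × ℝ × ℝ, F p.1 p.2.1 p.2.2 ∂(μ.prod (μ.prod μ)) =
      ∫ x, ∫ y, ∫ z, F x y z ∂μ ∂μ ∂μ := by
  rw [integral_prod _ (trip_int μ hF hB)]
  congr 1; ext x
  rw [integral_prod (fun q : ℝ × ℝ => F x q.1 q.2)]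
  refine Integrable.of_bound (Measurable.aestronglyMeasurable ?_) B (ae_of_all _ fun p => hB _ _ _)
  exact hF.comp (measurable_const.prodMk measurable_id)

theorem symm_id (μ : Measure ℝ) [IsFiniteMeasure μ] {k : ℝ → ℝ → ℝ} {B : ℝ}
    (hk : Measurable (fun p : ℝ × ℝ => k p.1 p.2)) (hB : ∀ x y, |k x y| ≤ B)
    {V : ℝ} (hV0 : 0 ≤ V)
    (hV : ∫⁻ x, ∫⁻ y, ∫⁻ z, ofReal |k x y * k x z + k y z * k y x + k z x * k z y|
      ∂μ ∂μ ∂μ ≤ ofReal V) {f : ℝ → ℝ} (hf : Measurable f) (hf1 : ∀ x, |f x| ≤ 1) :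
    |(∫ x, (∫ y, k x y * f y ∂μ) ^ 2 ∂μ) +
      2 * ∫ x, f x * (∫ y, k x y * f y ∂μ) * (∫ y, k x y ∂μ) ∂μ| ≤ V := by
  have hB0 : 0 ≤ B := (abs_nonneg _).trans (hB 0 0)
  have m3 : ∀ (g : ℝ × ℝ × ℝ → ℝ × ℝ), Measurable g →
      Measurable (fun p : ℝ × ℝ × ℝ => k (g p).1 (g p).2) := fun g hg => hk.comp hg
  have bd : ∀ a b c d y z : ℝ, |k a b * k c d * (f y * f z)| ≤ B ^ 2 := fun a b c d y z => by
    rw [abs_mul, abs_mul, abs_mul]; have h1 : |f y| * |f z| ≤ 1 := mul_le_one₀ (hf1 y) (abs_nonneg _) (hf1 z)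
    calc |k a b| * |k c d| * (|f y| * |f z|) ≤ (B * B) * 1 := by
          apply mul_le_mul _ h1 (by positivity) (by positivity)
          exact mul_le_mul (hB _ _) (hB _ _) (abs_nonneg _) hB0
      _ = B ^ 2 := by ring
  have mf : Measurable (fun p : ℝ × ℝ × ℝ => f p.2.1 * f p.2.2) := by fun_prop
  have M1 : Measurable (fun p : ℝ × ℝ × ℝ => k p.1 p.2.1 * k p.1 p.2.2 * (f p.2.1 * f p.2.2)) :=
    ((m3 (fun p => (p.1, p.2.1)) (by fun_prop)).mul
      (m3 (fun p => (p.1, p.2.2)) (by fun_prop))).mul mf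
  have M2 : Measurable (fun p : ℝ × ℝ × ℝ => k p.2.1 p.2.2 * k p.2.1 p.1 * (f p.2.1 * f p.2.2)) :=
    ((m3 (fun p => (p.2.1, p.2.2)) (by fun_prop)).mul
      (m3 (fun p => (p.2.1, p.1)) (by fun_prop))).mul mf
  have M3 : Measurable (fun p : ℝ × ℝ × ℝ => k p.2.2 p.1 * k p.2.2 p.2.1 * (f p.2.1 * f p.2.2)) :=
    ((m3 (fun p => (p.2.2, p.1)) (by fun_prop)).mul
      (m3 (fun p => (p.2.2, p.2.1)) (by fun_prop))).mul mf
  have i1 := trip_int μ (F := fun x y z => k x y * k x z * (f y * f z)) M1 (fun _ _ _ => bd _ _ _ _ _ _)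
  have i2 := trip_int μ (F := fun x y z => k y z * k y x * (f y * f z)) M2 (fun _ _ _ => bd _ _ _ _ _ _)
  have i3 := trip_int μ (F := fun x y z => k z x * k z y * (f y * f z)) M3 (fun _ _ _ => bd _ _ _ _ _ _)
  have e1 := trip_eq μ (F := fun x y z => k x y * k x z * (f y * f z)) M1 (fun _ _ _ => bd _ _ _ _ _ _)
  have e2 := trip_eq μ (F := fun x y z => k y z * k y x * (f y * f z)) M2 (fun _ _ _ => bd _ _ _ _ _ _)
  have e3 := trip_eq μ (F := fun x y z => k z x * k z y * (f y * f z)) M3 (fun _ _ _ => bd _ _ _ _ _ _)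
  set T : ℝ → ℝ := fun x => ∫ y, k x y * f y ∂μ with hT
  set T1 : ℝ → ℝ := fun x => ∫ y, k x y ∂μ with hT1
  have mT : Measurable T := by
    have : StronglyMeasurable (fun p : ℝ × ℝ => k p.1 p.2 * f p.2) :=
      (hk.mul (hf.comp measurable_snd)).stronglyMeasurable
    exact this.integral_prod_right.measurable
  have bT : ∀ x, |T x| ≤ B * μ.real univ := fun x => by
    refine norm_integral_le_of_norm_le_const (μ := μ) (f := fun y => k x y * f y)
      (ae_of_all _ fun y => ?_)
    rw [norm_eq_abs, abs_mul]; calc |k x y| * |f y| ≤ B * 1 := mul_le_mul (hB _ _) (hf1 _) (abs_nonneg _) hB0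
      _ = B := mul_one _
  have sw : ∫ x, ∫ y, k y x * f y * T y ∂μ ∂μ = ∫ y, f y * T y * T1 y ∂μ := by
    rw [integral_integral_swap]
    · congr 1; ext y
      rw [hT1]; simp only
      rw [← integral_const_mul]; congr 1; ext x; ring
    · refine Integrable.of_bound (C := B * 1 * (B * μ.real univ)) ?_ (ae_of_all _ fun p => ?_)
      · exact (((hk.comp (measurable_snd.prodMk measurable_fst)).mul (hf.comp measurable_snd)).mul
          (mT.comp measurable_snd)).aestronglyMeasurable
      · simp only [Function.uncurry, norm_eq_abs, abs_mul]
        apply mul_le_mul (mul_le_mul (hB _ _) (hf1 _) (abs_nonneg _) hB0) (bT _) (abs_nonneg _)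
        positivity
  have e1' : ∫ x, ∫ y, ∫ z, k x y * k x z * (f y * f z) ∂μ ∂μ ∂μ = ∫ x, T x ^ 2 ∂μ := by
    congr 1; ext x
    have : ∀ y, ∫ z, k x y * k x z * (f y * f z) ∂μ = k x y * f y * T x := by intro y; rw [hT]; simp only; rw [← integral_const_mul]; congr 1; ext z; ring
    simp_rw [this]
    rw [integral_mul_const, sq]
  have e2' : ∫ x, ∫ y, ∫ z, k y z * k y x * (f y * f z) ∂μ ∂μ ∂μ = ∫ y, f y * T y * T1 y ∂μ := by
    rw [← sw]; congr 1; ext x; congr 1; ext y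
    rw [hT]; simp only; rw [← integral_const_mul]; congr 1; ext z; ring
  have e3' : ∫ x, ∫ y, ∫ z, k z x * k z y * (f y * f z) ∂μ ∂μ ∂μ = ∫ y, f y * T y * T1 y ∂μ := by
    rw [← sw]; congr 1; ext x
    rw [integral_integral_swap]
    · congr 1; ext y
      rw [hT]; simp only; rw [← integral_const_mul]; congr 1; ext z; ring
    · exact Integrable.of_bound (C := B ^ 2)
        ((M3.comp (measurable_const.prodMk measurable_id)).aestronglyMeasurable)
        (ae_of_all _ fun p => bd _ _ _ _ _ _)
  have key : (∫ x, T x ^ 2 ∂μ) + 2 * ∫ x, f x * T x * T1 x ∂μ =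
      ∫ p : ℝ × ℝ × ℝ, ((k p.1 p.2.1 * k p.1 p.2.2 * (f p.2.1 * f p.2.2) +
        k p.2.1 p.2.2 * k p.2.1 p.1 * (f p.2.1 * f p.2.2)) +
        k p.2.2 p.1 * k p.2.2 p.2.1 * (f p.2.1 * f p.2.2)) ∂(μ.prod (μ.prod μ)) := by
    have i12 : Integrable (fun p : ℝ × ℝ × ℝ => k p.1 p.2.1 * k p.1 p.2.2 * (f p.2.1 * f p.2.2) +
        k p.2.1 p.2.2 * k p.2.1 p.1 * (f p.2.1 * f p.2.2)) (μ.prod (μ.prod μ)) := i1.add i2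
    rw [integral_add i12 i3, integral_add i1 i2, e1, e2, e3, e1', e2', e3']; ring
  rw [key]
  have := norm_integral_le_lintegral_norm (μ := μ.prod (μ.prod μ)) (fun p : ℝ × ℝ × ℝ => ((k p.1 p.2.1 * k p.1 p.2.2 * (f p.2.1 * f p.2.2) +
        k p.2.1 p.2.2 * k p.2.1 p.1 * (f p.2.1 * f p.2.2)) +
        k p.2.2 p.1 * k p.2.2 p.2.1 * (f p.2.1 * f p.2.2)))
  refine this.trans ?_
  refine ENNReal.toReal_le_of_le_ofReal hV0 (le_trans ?_ hV)
  have mS : Measurable (fun p : ℝ × ℝ × ℝ => ofReal |k p.1 p.2.1 * k p.1 p.2.2 +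
      k p.2.1 p.2.2 * k p.2.1 p.1 + k p.2.2 p.1 * k p.2.2 p.2.1|) := by
    refine ENNReal.measurable_ofReal.comp (measurable_abs.comp ?_); exact (((m3 (fun p => (p.1, p.2.1)) (by fun_prop)).mul
      (m3 (fun p => (p.1, p.2.2)) (by fun_prop))).add ((m3 (fun p => (p.2.1, p.2.2)) (by fun_prop)).mul
      (m3 (fun p => (p.2.1, p.1)) (by fun_prop)))).add ((m3 (fun p => (p.2.2, p.1)) (by fun_prop)).mul
      (m3 (fun p => (p.2.2, p.2.1)) (by fun_prop)))
  calc _ ≤ ∫⁻ p : ℝ × ℝ × ℝ, ofReal |k p.1 p.2.1 * k p.1 p.2.2 +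
      k p.2.1 p.2.2 * k p.2.1 p.1 + k p.2.2 p.1 * k p.2.2 p.2.1| ∂(μ.prod (μ.prod μ)) := by
        refine lintegral_mono fun p => ofReal_le_ofReal ?_
        rw [norm_eq_abs, ← add_mul, ← add_mul, abs_mul]; refine mul_le_of_le_one_right (abs_nonneg _) ?_
        rw [abs_mul]; exact mul_le_one₀ (hf1 _) (abs_nonneg _) (hf1 _)
    _ = _ := by
        rw [lintegral_prod _ mS.aemeasurable]; congr 1; ext x
        rw [lintegral_prod]; exact (mS.comp (measurable_const.prodMk measurable_id)).aemeasurable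

theorem symm_L2 (μ : Measure ℝ) [IsFiniteMeasure μ] {k : ℝ → ℝ → ℝ} {B : ℝ}
    (hk : Measurable (fun p : ℝ × ℝ => k p.1 p.2)) (hB : ∀ x y, |k x y| ≤ B)
    {V : ℝ} (hV0 : 0 ≤ V)
    (hV : ∫⁻ x, ∫⁻ y, ∫⁻ z, ofReal |k x y * k x z + k y z * k y x + k z x * k z y|
      ∂μ ∂μ ∂μ ≤ ofReal V) {f : ℝ → ℝ} (hf : Measurable f) (hf1 : ∀ x, |f x| ≤ 1) :
    ∫ x, (∫ y, k x y * f y ∂μ) ^ 2 ∂μ ≤ 4 * V := by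
  have hB0 : 0 ≤ B := (abs_nonneg _).trans (hB 0 0)
  have h1 := symm_id μ hk hB hV0 hV measurable_const (f := fun _ => 1) (by simp)
  have h2 := symm_id μ hk hB hV0 hV hf hf1
  simp only [mul_one, one_mul] at h1
  set T : ℝ → ℝ := fun x => ∫ y, k x y * f y ∂μ with hT
  set T1 : ℝ → ℝ := fun x => ∫ y, k x y ∂μ with hT1
  have mT : Measurable T := by
    have : StronglyMeasurable (fun p : ℝ × ℝ => k p.1 p.2 * f p.2) :=
      (hk.mul (hf.comp measurable_snd)).stronglyMeasurable
    exact this.integral_prod_right.measurable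
  have mT1 : Measurable T1 := hk.stronglyMeasurable.integral_prod_right.measurable
  have bT : ∀ x, |T x| ≤ B * μ.real univ := fun x => by
    refine norm_integral_le_of_norm_le_const (μ := μ) (f := fun y => k x y * f y)
      (ae_of_all _ fun y => ?_)
    rw [norm_eq_abs, abs_mul]; calc |k x y| * |f y| ≤ B * 1 := mul_le_mul (hB _ _) (hf1 _) (abs_nonneg _) hB0
      _ = B := mul_one _
  have bT1 : ∀ x, |T1 x| ≤ B * μ.real univ := fun x =>
    norm_integral_le_of_norm_le_const (μ := μ) (f := fun y => k x y) (ae_of_all _ fun y => hB x y)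
  have sq2 : ∀ a b : ℝ, |a| ≤ b → ‖a ^ 2‖ ≤ b ^ 2 := fun a b h => by rw [norm_eq_abs, abs_pow]; exact pow_le_pow_left₀ (abs_nonneg _) h 2
  have iT : Integrable (fun x => T x ^ 2) μ :=
    Integrable.of_bound (mT.pow_const 2).aestronglyMeasurable _ (ae_of_all _ fun x => sq2 _ _ (bT x))
  have iT1 : Integrable (fun x => T1 x ^ 2) μ :=
    Integrable.of_bound (mT1.pow_const 2).aestronglyMeasurable _
      (ae_of_all _ fun x => sq2 _ _ (bT1 x))
  have h1' : 3 * ∫ x, T1 x ^ 2 ∂μ ≤ V := by have := (le_abs_self _).trans h1; simp_rw [← sq] at this; linarith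
  have h3 : -(∫ x, f x * T x * T1 x ∂μ) ≤ 1/4 * (∫ x, T x ^ 2 ∂μ) + ∫ x, T1 x ^ 2 ∂μ := by
    rw [← integral_neg, ← integral_const_mul, ← integral_add (iT.const_mul _) iT1]; refine integral_mono ?_ ((iT.const_mul _).add iT1) fun x => ?_
    · refine (Integrable.of_bound (C := 1 * (B * μ.real univ) * (B * μ.real univ))
        ((hf.mul mT).mul mT1).aestronglyMeasurable (ae_of_all _ fun x => ?_)).neg
      simp only [norm_eq_abs, Pi.mul_apply, abs_mul]; apply mul_le_mul (mul_le_mul (hf1 _) (bT _) (abs_nonneg _) (by norm_num)) (bT1 _) (abs_nonneg _)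
      positivity
    · have hfx := abs_le.1 (hf1 x)
      have hh : (f x)^2 ≤ 1 := by nlinarith
      have : (0:ℝ) ≤ (1/2 * T x + f x * T1 x)^2 := sq_nonneg _
      have h5 : 0 ≤ (T1 x)^2 := sq_nonneg _
      simp only
      nlinarith [mul_nonneg (sub_nonneg.2 hh) h5]
  have h4 := (le_abs_self _).trans h2
  linarith

/-- approximate affinity of products -/
theorem approx_affine {ι : Type} (s : Finset ι) (K : ℝ) (hK : 0 ≤ K) : ∃ C : ℝ, 0 < C ∧
    ∀ (α β : ι → ℝ) (τ : ℝ), 0 ≤ τ → τ ≤ 1 → (∀ j ∈ s, |α j| ≤ K) → (∀ j ∈ s, |β j| ≤ K) →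
      |∏ j ∈ s, (τ * α j + (1 - τ) * β j) - τ * ∏ j ∈ s, α j - (1 - τ) * ∏ j ∈ s, β j| ≤
        C * (τ * (1 - τ) * ∑ j ∈ s, (α j - β j) ^ 2) ∧
      (∏ j ∈ s, α j - ∏ j ∈ s, β j) ^ 2 ≤ C * ∑ j ∈ s, (α j - β j) ^ 2 ∧
      |∏ j ∈ s, α j| ≤ C ∧ |∏ j ∈ s, β j| ≤ C ∧ |∏ j ∈ s, (τ * α j + (1 - τ) * β j)| ≤ C := by
  classical
  induction s using Finset.induction_on with
  | empty =>
    refine ⟨1, one_pos, fun α β τ h0 h1 _ _ => ?_⟩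
    simp
  | insert i s hi ih =>
    obtain ⟨C, hC, H⟩ := ih
    refine ⟨K * C + C + 2 * K ^ 2 * C + 2 * C ^ 2 + 1, by positivity, fun α β τ h0 h1 hα hβ => ?_⟩
    obtain ⟨a1, a2, a3, a4, a5⟩ := H α β τ h0 h1 (fun j hj => hα j (Finset.mem_insert_of_mem hj))
      (fun j hj => hβ j (Finset.mem_insert_of_mem hj))
    have hai := hα i (Finset.mem_insert_self i s); have hbi := hβ i (Finset.mem_insert_self i s); rw [Finset.prod_insert hi, Finset.prod_insert hi, Finset.prod_insert hi, Finset.sum_insert hi]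
    set E := ∑ j ∈ s, (α j - β j) ^ 2 with hE
    have hE0 : 0 ≤ E := Finset.sum_nonneg fun j _ => sq_nonneg _
    set Fa := ∏ j ∈ s, α j
    set Fb := ∏ j ∈ s, β j
    set Fg := ∏ j ∈ s, (τ * α j + (1 - τ) * β j)
    set a := α i
    set b := β i
    have ht : 0 ≤ τ * (1 - τ) := mul_nonneg h0 (by linarith)
    have hg : |τ * a + (1 - τ) * b| ≤ K := by
      rw [abs_le] at hai hbi ⊢
      constructor <;> nlinarith
    have hd : 0 ≤ (a - b)^2 := sq_nonneg _
    have prodb : ∀ u v : ℝ, |u| ≤ K → |v| ≤ C → |u * v| ≤ K * C + C + 2 * K ^ 2 * C + 2 * C ^ 2 + 1 := fun u v hu hv => by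
      rw [abs_mul]; have := mul_le_mul hu hv (abs_nonneg _) hK
      have : 0 ≤ K^2 * C := by positivity
      have : 0 ≤ C^2 := by positivity
      linarith
    refine ⟨?_, ?_, prodb _ _ hai a3, prodb _ _ hbi a4, prodb _ _ hg a5⟩
    · have e : (τ * a + (1 - τ) * b) * Fg - τ * (a * Fa) - (1 - τ) * (b * Fb) =
        (τ * a + (1 - τ) * b) * (Fg - τ * Fa - (1 - τ) * Fb) - τ * (1 - τ) * ((a - b) * (Fa - Fb)) := by
        ring
      rw [e]; have k1 : |(τ * a + (1 - τ) * b) * (Fg - τ * Fa - (1 - τ) * Fb)| ≤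
          K * (C * (τ * (1 - τ) * E)) := by
        rw [abs_mul]; exact mul_le_mul hg a1 (abs_nonneg _) hK
      have k2 : |(a - b) * (Fa - Fb)| ≤ (a-b)^2 + C * E := by rw [abs_le]; constructor <;> nlinarith [sq_nonneg (a - b - (Fa - Fb)), sq_nonneg (a - b + (Fa - Fb))]
      have k3 : |τ * (1 - τ) * ((a - b) * (Fa - Fb))| ≤ τ * (1 - τ) * ((a-b)^2 + C * E) := by rw [abs_mul, abs_of_nonneg ht]; exact mul_le_mul_of_nonneg_left k2 ht
      refine (abs_sub _ _).trans ((add_le_add k1 k3).trans ?_); have p1 : 0 ≤ (τ * (1 - τ)) * E := mul_nonneg ht hE0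
      have p2 : 0 ≤ (τ * (1 - τ)) * (a-b)^2 := mul_nonneg ht hd
      have q1 : 0 ≤ K * C := by positivity
      have q2 : 0 ≤ 2*K^2 * C + 2*C^2 := by positivity
      nlinarith [mul_nonneg q1 p2, mul_nonneg q2 p1, mul_nonneg q2 p2, mul_nonneg hC.le p2]
    · have e : a * Fa - b * Fb = a * (Fa - Fb) + (a - b) * Fb := by ring
      rw [e]; have k0 : (a * (Fa - Fb) + (a - b) * Fb)^2 ≤ 2 * (a^2 * (Fa - Fb)^2) + 2 * ((a - b)^2 * Fb^2) := by nlinarith [sq_nonneg (a * (Fa - Fb) - (a - b) * Fb)]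
      have ka : a^2 ≤ K^2 := sq_le_sq' (by linarith [abs_le.1 hai]) (abs_le.1 hai).2
      have kF : Fb^2 ≤ C^2 := sq_le_sq' (by linarith [abs_le.1 a4]) (abs_le.1 a4).2
      have k1 : a^2 * (Fa - Fb)^2 ≤ K^2 * (C * E) := mul_le_mul ka a2 (sq_nonneg _) (sq_nonneg _)
      have k2 : (a - b)^2 * Fb^2 ≤ (a-b)^2 * C^2 := mul_le_mul_of_nonneg_left kF hd
      have q1 : 0 ≤ K * C + C + 1 := by positivity
      have q2 : 0 ≤ 2*K^2 * C := by positivity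
      have q3 : 0 ≤ 2*C^2 := by positivity
      nlinarith [mul_nonneg q1 hE0, mul_nonneg q1 hd, mul_nonneg q2 hd, mul_nonneg q3 hE0]

theorem lin_scale {r : ℝ} (hr : 0 < r) (x : ℝ) {G : ℝ → ℝ≥0∞} (hG : Measurable G) :
    ∫⁻ y, G y = ofReal r * ∫⁻ t, G (x + r * t) := by
  have h1 : ∫⁻ y, G y = ∫⁻ y, G (x + y) := (lintegral_add_left_eq_self G x).symm
  rw [h1]
  have h2 := Real.smul_map_volume_mul_left hr.ne'
  rw [abs_of_pos hr] at h2
  conv_lhs => rw [← h2]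
  rw [lintegral_smul_measure, lintegral_map (f := fun y => G (x + y)) (hG.comp (measurable_const_add x)) (measurable_const_mul r), smul_eq_mul]

/-- energy -/
noncomputable def En (b : ℝ → ℝ) (r : ℝ) : ℝ≥0∞ := ∫⁻ x, ofReal (Dq b (x + r) x ^ 2)

theorem En_meas {b : ℝ → ℝ} (h : LI b) : Measurable (En b) := by
  unfold En; refine Measurable.lintegral_prod_right' (f := fun p : ℝ × ℝ => ofReal (Dq b (p.2 + p.1) p.2 ^ 2)) ?_
  exact ENNReal.measurable_ofReal.comp (((Dq_meas h).comp
    ((measurable_snd.add measurable_fst).prodMk measurable_snd)).pow_const 2)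

theorem En_le {b : ℝ → ℝ} (hm : Measurable b) {K : ℝ} (hK : ∀ x, |b x| ≤ K) {r : ℝ} (hr : 0 < r) :
    En b r ≤ ∫⁻ x, ofReal (b x ^ 2) := by
  have hLI := LI_of_bdd hm hK
  have i2 : ∀ u v, IntegrableOn (fun x => b x ^ 2) (Ioc u v) := fun u v => by
    refine Measure.integrableOn_of_bounded (M := K^2) (by simp)
      (hm.pow_const 2).aestronglyMeasurable (ae_of_all _ fun x => ?_)
    rw [norm_eq_abs, abs_pow]; exact pow_le_pow_left₀ (abs_nonneg _) (hK x) 2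
  have h1 : ∀ x, ofReal (Dq b (x + r) x ^ 2) ≤
      ofReal r⁻¹ * ∫⁻ t, (Ioc x (x + r)).indicator (fun t => ofReal (b t ^ 2)) t := by
    intro x; rw [lintegral_indicator measurableSet_Ioc,
      ← ofReal_integral_eq_lintegral_ofReal (i2 _ _) (ae_of_all _ fun t => sq_nonneg _),
      ← ofReal_mul (by positivity)]
    apply ofReal_le_ofReal
    have := jensen_sq (g := b) (a := x) (b := x + r) (by linarith) (hLI.on _ _) (i2 _ _)
    unfold Dq Adiff; rw [intervalIntegral.integral_of_le (by linarith), add_sub_cancel_left, div_pow,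
      div_le_iff₀ (by positivity)]
    rw [add_sub_cancel_left] at this; calc _ ≤ _ := this
      _ = _ := by field_simp
  calc En b r ≤ ∫⁻ x, ofReal r⁻¹ *
        ∫⁻ t, (Ioc x (x + r)).indicator (fun t => ofReal (b t ^ 2)) t := lintegral_mono h1
    _ = ofReal r⁻¹ * ∫⁻ x, ∫⁻ t,
        (Ioc x (x + r)).indicator (fun t => ofReal (b t ^ 2)) t := by
        rw [lintegral_const_mul' _ _ (by simp)]
    _ = ofReal r⁻¹ * ∫⁻ t, ∫⁻ x,
        (Ioc x (x + r)).indicator (fun t => ofReal (b t ^ 2)) t := by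
        rw [lintegral_lintegral_swap]; refine Measurable.aemeasurable ?_
        have : (Function.uncurry fun x t => (Ioc x (x + r)).indicator (fun t => ofReal (b t ^ 2)) t)
          = {p : ℝ × ℝ | p.1 < p.2 ∧ p.2 ≤ p.1 + r}.indicator (fun p => ofReal (b p.2 ^ 2)) := by
          ext p; simp [indicator, Function.uncurry, mem_Ioc]
        rw [this]; refine Measurable.indicator (by fun_prop) ?_
        exact (measurableSet_lt measurable_fst measurable_snd).inter
          (measurableSet_le measurable_snd (by fun_prop))
    _ = ofReal r⁻¹ * ∫⁻ t, ofReal r * ofReal (b t ^ 2) := by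
        congr 2; ext t
        have : (fun x => (Ioc x (x + r)).indicator (fun t => ofReal (b t ^ 2)) t) =
          (Ico (t - r) t).indicator (fun _ => ofReal (b t ^ 2)) := by
          ext x
          have : t ∈ Ioc x (x + r) ↔ x ∈ Ico (t - r) t := by simp only [mem_Ioc, mem_Ico]; constructor <;> rintro ⟨h, h'⟩ <;> constructor <;> linarith
          by_cases hx : t ∈ Ioc x (x + r)
          · rw [indicator_of_mem hx, indicator_of_mem (this.1 hx)]
          · rw [indicator_of_notMem hx, indicator_of_notMem (fun h => hx (this.2 h))]
        rw [this, lintegral_indicator measurableSet_Ico, lintegral_const,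
          Measure.restrict_apply_univ, Real.volume_Ico, mul_comm]
        congr 2; ring
    _ = _ := by
        rw [lintegral_const_mul' _ _ (by simp), ← mul_assoc, ← ofReal_mul (by positivity),
          inv_mul_cancel₀ hr.ne', ofReal_one, one_mul]

/-- squared second difference integrated -/
noncomputable def Dn (b : ℝ → ℝ) (t r : ℝ) : ℝ≥0∞ :=
  ∫⁻ x, ofReal ((Dq b (x + t * r) x - Dq b (x + r) (x + t * r)) ^ 2)

theorem En_id {b : ℝ → ℝ} (h : LI b) {t r : ℝ} (h0 : 0 < t) (h1 : t < 1) (hr : 0 < r) :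
    ofReal t * En b (t * r) + ofReal (1 - t) * En b ((1 - t) * r) =
      En b r + ofReal (t * (1 - t)) * Dn b t r := by
  have hm : ∀ g1 g2 : ℝ → ℝ, Measurable g1 → Measurable g2 → Measurable (fun x => Dq b (g1 x) (g2 x)) :=
    fun g1 g2 h1 h2 => (Dq_meas h).comp (h1.prodMk h2)
  have e2 : En b ((1 - t) * r) = ∫⁻ x, ofReal (Dq b (x + r) (x + t * r) ^ 2) := by
    unfold En; rw [← lintegral_add_right_eq_self _ (t * r)]
    congr 1; ext x; congr 3; ring
  rw [e2]
  unfold En Dn; rw [← lintegral_const_mul' _ _ (by simp), ← lintegral_const_mul' _ _ (by simp),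
    ← lintegral_const_mul' _ _ (by simp), ← lintegral_add_left, ← lintegral_add_left]
  · congr 1; ext x
    rw [← ofReal_mul h0.le, ← ofReal_mul (by linarith),
      ← ofReal_mul (mul_nonneg h0.le (by linarith)), ← ofReal_add, ← ofReal_add]
    · congr 1
      have : Dq b (x + r) x = t * Dq b (x + t * r) x + (1 - t) * Dq b (x + r) (x + t * r) := by
        unfold Dq; rw [Adiff_add h (x + r) (x + t * r) x]
        have : (1 - t) ≠ 0 := by linarith
        have e : x + r - (x + t * r) = (1 - t) * r := by ring
        have e' : x + t * r - x = t * r := by ring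
        have e'' : x + r - x = r := by ring
        rw [e, e', e'']; field_simp
        ring
      rw [this]; ring
    · positivity
    · exact mul_nonneg (mul_nonneg h0.le (by linarith)) (sq_nonneg _)
    · positivity
    · exact mul_nonneg (by linarith) (sq_nonneg _)
  · exact ENNReal.measurable_ofReal.comp ((hm _ _ (by fun_prop) (by fun_prop)).pow_const 2)
  · exact (ENNReal.measurable_ofReal.comp
      ((hm _ _ (by fun_prop) (by fun_prop)).pow_const 2)).const_mul _

theorem log_bound {t : ℝ} (h0 : 0 < t) (h1 : t < 1) : log (1/t) ≤ (1 - t) * (t ^ (-(1/2) : ℝ)) := by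
  have e : t = (t ^ (1/2:ℝ)) ^ 2 := by rw [← Real.rpow_natCast, ← Real.rpow_mul h0.le]; norm_num
  set u := t ^ (1/2:ℝ) with hu
  have hu0 : 0 < u := Real.rpow_pos_of_pos h0 _
  have hu1 : u < 1 := by rw [hu]; exact Real.rpow_lt_one h0.le h1 (by norm_num)
  rw [Real.rpow_neg h0.le, ← hu, e]
  have h2 : log (1/u^2) = 2 * log u⁻¹ := by rw [one_div, Real.log_inv, Real.log_inv, Real.log_pow]; push_cast; ring
  rw [h2]
  have h3 := Real.self_le_sinh_iff.2 (Real.log_nonneg ((one_le_inv₀ hu0).2 hu1.le))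
  rw [Real.sinh_eq, Real.exp_neg, Real.exp_log (by positivity), inv_inv] at h3
  calc _ ≤ 2 * ((u⁻¹ - u)/2) := by linarith
    _ = _ := by field_simp

theorem Dn_int {b : ℝ → ℝ} (hm : Measurable b) {K : ℝ} (hK : ∀ x, |b x| ≤ K)
    (hN : ∫⁻ x, ofReal (b x ^ 2) ≠ ⊤)
    {δ L : ℝ} (hδ : 0 < δ) (hL : δ < L) {t : ℝ} (h0 : 0 < t) (h1 : t < 1) :
    ∫⁻ r in Ioc δ L, Dn b t r * ofReal (1 / r) ≤
      (∫⁻ x, ofReal (b x ^ 2)) *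
        (ofReal (t ^ (-(1/2) : ℝ)) + ofReal ((1 - t) ^ (-(1/2) : ℝ))) := by
  have hLI := LI_of_bdd hm hK
  set N := ∫⁻ x, ofReal (b x ^ 2) with hNd
  have hEm := En_meas hLI
  have mr : Measurable (fun r : ℝ => ofReal (1 / r)) :=
    ENNReal.measurable_ofReal.comp (measurable_const.div measurable_id)
  set Aa : ℝ → ℝ≥0∞ := fun t => ∫⁻ r in Ioc δ L, En b (t * r) * ofReal (1 / r) with hA
  set A1 : ℝ≥0∞ := ∫⁻ r in Ioc δ L, En b r * ofReal (1 / r) with hA1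
  have hlog : ∀ u v : ℝ, 0 < u → u ≤ v → ∫⁻ r in Ioc u v, ofReal (1/r) =
      ofReal (log (v/u)) := by
    intro u v hu huv; rw [← ofReal_integral_eq_lintegral_ofReal, ← intervalIntegral.integral_of_le huv,
      integral_one_div_of_pos hu (by linarith)]
    · change IntegrableOn (fun r : ℝ => 1 / r) (Ioc u v)
      rw [← intervalIntegrable_iff_integrableOn_Ioc_of_le huv]; refine (intervalIntegral.intervalIntegrable_one_div (fun x hx => ?_) (by fun_prop))
      rw [uIcc_of_le huv] at hx; linarith [hx.1]
    · filter_upwards [ae_restrict_mem measurableSet_Ioc] with x hx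
      have : 0 < x := hu.trans hx.1
      positivity
  have hA1top : A1 ≠ ⊤ := by
    refine ne_top_of_le_ne_top (b := N * ofReal (log (L/δ))) (ENNReal.mul_ne_top hN (by simp)) ?_
    rw [← hlog δ L hδ hL.le, ← lintegral_const_mul _ mr]; refine setLIntegral_mono (by fun_prop) fun r hr => ?_
    gcongr
    exact En_le hm hK (hδ.trans hr.1)
  have hAle : ∀ t, 0 < t → t < 1 → Aa t ≤ N * ofReal (log (1/t)) + A1 := fun t h0 h1 => by
    have e : Aa t = ∫⁻ r in Ioc (t * δ) (t * L), En b r * ofReal (1 / r) := by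
      rw [← lintegral_indicator measurableSet_Ioc, lin_scale h0 0,
        show Aa t = ∫⁻ r in Ioc δ L, En b (t * r) * ofReal (1 / r) from rfl,
        ← lintegral_const_mul' _ _ (by simp), ← lintegral_indicator measurableSet_Ioc]
      · congr 1; ext r
        have iff : 0 + t * r ∈ Ioc (t * δ) (t * L) ↔ r ∈ Ioc δ L := by simp only [mem_Ioc, zero_add]; rw [mul_lt_mul_iff_right₀ h0, mul_le_mul_iff_right₀ h0]
        by_cases hr : r ∈ Ioc δ L
        · have hrp : 0 < r := hδ.trans hr.1
          rw [indicator_of_mem hr, indicator_of_mem (iff.2 hr), zero_add, mul_left_comm,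
            ← ofReal_mul h0.le]
          congr 2; field_simp
        · rw [indicator_of_notMem hr, indicator_of_notMem (fun h => hr (iff.1 h)), mul_zero]
      · exact (hEm.mul mr).indicator measurableSet_Ioc
    rw [e]; have hsub : Ioc (t * δ) (t * L) ⊆ Ioc (t * δ) δ ∪ Ioc δ L := fun r hr => by
      rcases le_or_gt r δ with h | h
      · exact Or.inl ⟨hr.1, h⟩
      · exact Or.inr ⟨h, hr.2.trans (by nlinarith)⟩
    refine (lintegral_mono_set hsub).trans ((lintegral_union_le _ _ _).trans ?_); refine add_le_add ?_ le_rfl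
    have := hlog (t * δ) δ (by positivity) (by nlinarith)
    rw [show δ / (t * δ) = 1/t by field_simp] at this
    rw [← this, ← lintegral_const_mul _ mr]; refine setLIntegral_mono (by fun_prop) fun r hr => ?_
    gcongr
    exact En_le hm hK ((by positivity : 0 < t * δ).trans hr.1)
  have hDm : Measurable (fun r => Dn b t r) := by
    unfold Dn; refine Measurable.lintegral_prod_right' (f := fun p : ℝ × ℝ => ofReal ((Dq b (p.2 + t * p.1) p.2 - Dq b (p.2 + p.1) (p.2 + t * p.1)) ^ 2)) ?_
    refine ENNReal.measurable_ofReal.comp ((Measurable.sub ?_ ?_).pow_const 2)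
    · exact (Dq_meas hLI).comp (Measurable.prodMk (by fun_prop) (by fun_prop))
    · exact (Dq_meas hLI).comp (Measurable.prodMk (by fun_prop) (by fun_prop))
  have hid : ofReal t * Aa t + ofReal (1 - t) * Aa (1 - t) =
      A1 + ofReal (t * (1 - t)) * ∫⁻ r in Ioc δ L, Dn b t r * ofReal (1 / r) := by
    rw [hA, hA1]; simp only
    have m1 : ∀ t : ℝ, Measurable (fun r => En b (t * r)) := fun t => hEm.comp (measurable_const_mul t)
    rw [← lintegral_const_mul' _ _ (by simp), ← lintegral_const_mul' _ _ (by simp),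
      ← lintegral_const_mul' _ _ (by simp), ← lintegral_add_left, ← lintegral_add_left]
    · refine setLIntegral_congr_fun measurableSet_Ioc fun r hr => ?_
      rw [← mul_assoc, ← mul_assoc, ← mul_assoc, ← add_mul, ← add_mul,
        En_id hLI h0 h1 (hδ.trans hr.1)]
    · exact hEm.mul mr
    · exact ((m1 t).mul mr).const_mul _
  set X := ∫⁻ r in Ioc δ L, Dn b t r * ofReal (1 / r) with hX
  have h2 : A1 + ofReal (t * (1 - t)) * X ≤
      A1 + ofReal (t * (1 - t)) * (N * (ofReal (t ^ (-(1/2) : ℝ)) + ofReal ((1 - t) ^ (-(1/2) : ℝ)))) := by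
    rw [← hid]; have k1 := hAle t h0 h1
    have k2 := hAle (1 - t) (by linarith) (by linarith)
    calc _ ≤ ofReal t * (N * ofReal ((1-t) * t ^ (-(1/2) : ℝ)) + A1) +
        ofReal (1 - t) * (N * ofReal (t * (1-t) ^ (-(1/2) : ℝ)) + A1) := by
          refine add_le_add (mul_le_mul' le_rfl (k1.trans ?_)) (mul_le_mul' le_rfl (k2.trans ?_))
          · exact add_le_add (mul_le_mul' le_rfl (ofReal_le_ofReal (log_bound h0 h1))) le_rfl
          · refine add_le_add (mul_le_mul' le_rfl (ofReal_le_ofReal ?_)) le_rfl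
            have := log_bound (t := 1 - t) (by linarith) (by linarith)
            rwa [sub_sub_cancel] at this
      _ = (ofReal t + ofReal (1 - t)) * A1 + ofReal (t * (1 - t)) * (N * (ofReal (t ^ (-(1/2) : ℝ)) + ofReal ((1 - t) ^ (-(1/2) : ℝ)))) := by
          rw [ofReal_mul (by linarith : 0 ≤ 1 - t), ofReal_mul h0.le (q := (1-t) ^ (-(1/2) : ℝ)),
            ofReal_mul h0.le]
          ring
      _ = _ := by rw [← ofReal_add h0.le (by linarith), add_sub_cancel, ofReal_one, one_mul]
  have h3 := (ENNReal.add_le_add_iff_left hA1top).1 h2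
  have hp : 0 < t * (1 - t) := mul_pos h0 (by linarith)
  exact (ENNReal.mul_le_mul_iff_right (by simpa using hp) (by simp)).1 h3

theorem tail_rpow {a c : ℝ} (ha : a < -1) (hc : 0 < c) :
    ∫⁻ t in Ioi c, ofReal (t ^ a) = ofReal (-c ^ (a + 1) / (a + 1)) := by
  rw [← integral_Ioi_rpow_of_lt ha hc, ofReal_integral_eq_lintegral_ofReal]
  · exact integrableOn_Ioi_rpow_of_lt ha hc
  · filter_upwards [ae_restrict_mem measurableSet_Ioi] with t ht
    exact Real.rpow_nonneg (hc.trans ht).le _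

theorem tail_sq {c : ℝ} (hc : 0 < c) :
    ∫⁻ t in Ioi c, ofReal (1 / t ^ 2) = ofReal (1 / c) := by
  have := tail_rpow (a := -2) (by norm_num) hc
  rw [show (-2:ℝ) + 1 = -1 by norm_num, Real.rpow_neg_one, neg_div_neg_eq, div_one] at this
  rw [one_div, ← this]
  refine setLIntegral_congr_fun measurableSet_Ioi fun t ht => ?_
  have ht0 : (0:ℝ) < t := hc.trans ht
  rw [Real.rpow_neg ht0.le, one_div]; norm_num

theorem int_rpow_half : ∫⁻ t in Ioo (0:ℝ) 1, ofReal (t ^ (-(1/2) : ℝ)) = 2 := by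
  rw [← ofReal_integral_eq_lintegral_ofReal, ← integral_Ioc_eq_integral_Ioo,
    ← intervalIntegral.integral_of_le zero_le_one, integral_rpow (Or.inl (by norm_num))]
  · norm_num
  · change IntegrableOn (fun t : ℝ => t ^ (-(1/2) : ℝ)) (Ioo 0 1)
    rw [← integrableOn_Ioc_iff_integrableOn_Ioo, ← intervalIntegrable_iff_integrableOn_Ioc_of_le zero_le_one]; exact intervalIntegral.intervalIntegrable_rpow' (by norm_num)
  · filter_upwards [ae_restrict_mem measurableSet_Ioo] with t ht
    exact Real.rpow_nonneg ht.1.le _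

theorem int_rpow_half' : ∫⁻ t in Ioo (0:ℝ) 1, ofReal ((1 - t) ^ (-(1/2) : ℝ)) = 2 := by
  rw [← int_rpow_half, ← lintegral_indicator measurableSet_Ioo, ← lintegral_indicator measurableSet_Ioo,
    ← lintegral_sub_left_eq_self _ (1:ℝ)]
  congr 1; ext t
  have : 1 - t ∈ Ioo (0:ℝ) 1 ↔ t ∈ Ioo (0:ℝ) 1 := by simp only [mem_Ioo]; constructor <;> rintro ⟨h, h'⟩ <;> constructor <;> linarith
  by_cases h : t ∈ Ioo (0:ℝ) 1
  · rw [indicator_of_mem h, indicator_of_mem (this.2 h), sub_sub_cancel]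
  · rw [indicator_of_notMem h, indicator_of_notMem (fun h' => h (this.1 h'))]

noncomputable def cv (b : ℝ → ℝ) (δ L x y z : ℝ) : ℝ≥0∞ :=
  if x < y ∧ y < z ∧ δ < z - x ∧ z - x ≤ L then
    ofReal ((Dq b y x - Dq b z y) ^ 2 / (z - x) ^ 2) else 0

theorem cv_meas {b : ℝ → ℝ} (h : LI b) (δ L : ℝ) :
    Measurable (fun p : ℝ × ℝ × ℝ => cv b δ L p.1 p.2.1 p.2.2) := by
  unfold cv; refine Measurable.ite ?_ ?_ measurable_const
  · have s1 : MeasurableSet {p : ℝ × ℝ × ℝ | p.1 < p.2.1} := measurableSet_lt (by fun_prop) (by fun_prop)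
    have s2 : MeasurableSet {p : ℝ × ℝ × ℝ | p.2.1 < p.2.2} := measurableSet_lt (by fun_prop) (by fun_prop)
    have s3 : MeasurableSet {p : ℝ × ℝ × ℝ | δ < p.2.2 - p.1} := measurableSet_lt (by fun_prop) (by fun_prop)
    have s4 : MeasurableSet {p : ℝ × ℝ × ℝ | p.2.2 - p.1 ≤ L} := measurableSet_le (by fun_prop) (by fun_prop)
    exact s1.inter (s2.inter (s3.inter s4))
  · refine ENNReal.measurable_ofReal.comp (Measurable.div ((Measurable.sub ?_ ?_).pow_const 2) (by fun_prop))
    · exact (Dq_meas h).comp (Measurable.prodMk (by fun_prop) (by fun_prop))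
    · exact (Dq_meas h).comp (Measurable.prodMk (by fun_prop) (by fun_prop))

theorem meas3 {G : ℝ → ℝ → ℝ → ℝ≥0∞} (hG : Measurable (fun p : ℝ × ℝ × ℝ => G p.1 p.2.1 p.2.2))
    {X : Type*} [MeasurableSpace X] (g1 g2 g3 : X → ℝ) (h1 : Measurable g1) (h2 : Measurable g2)
    (h3 : Measurable g3) : Measurable (fun p => G (g1 p) (g2 p) (g3 p)) :=
  hG.comp (h1.prodMk (h2.prodMk h3))

theorem curv {b : ℝ → ℝ} (hm : Measurable b) {K : ℝ} (hK : ∀ x, |b x| ≤ K)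
    (hN : ∫⁻ x, ofReal (b x ^ 2) ≠ ⊤) {δ L : ℝ} (hδ : 0 < δ) (hL : δ < L) :
    ∫⁻ x, ∫⁻ y, ∫⁻ z, cv b δ L x y z ≤ 4 * ∫⁻ x, ofReal (b x ^ 2) := by
  have hLI := LI_of_bdd hm hK
  have hcm := cv_meas hLI δ L
  set N := ∫⁻ x, ofReal (b x ^ 2) with hNd
  obtain ⟨W, hW⟩ : ∃ W : ℝ → ℝ → ℝ → ℝ≥0∞, W = fun t r x =>
    ofReal ((Dq b (x + t * r) x - Dq b (x + r) (x + t * r)) ^ 2) * ofReal (1 / r) := ⟨_, rfl⟩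
  have hWm : Measurable (fun p : ℝ × ℝ × ℝ => W p.1 p.2.1 p.2.2) := by
    rw [hW]; refine Measurable.mul (ENNReal.measurable_ofReal.comp ((Measurable.sub ?_ ?_).pow_const 2))
      (ENNReal.measurable_ofReal.comp (Measurable.div (by fun_prop) (by fun_prop)))
    · exact (Dq_meas hLI).comp (Measurable.prodMk (by fun_prop) (by fun_prop))
    · exact (Dq_meas hLI).comp (Measurable.prodMk (by fun_prop) (by fun_prop))
  have step : ∀ x, ∫⁻ y, ∫⁻ z, cv b δ L x y z = ∫⁻ r in Ioc δ L, ∫⁻ t in Ioo (0:ℝ) 1, W t r x := fun x => by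
    rw [lintegral_lintegral_swap]; swap
    · exact (hcm.comp (measurable_const.prodMk measurable_id)).aemeasurable
    rw [← lintegral_add_left_eq_self _ x, ← lintegral_indicator measurableSet_Ioc]; congr 1; ext r
    by_cases hr : r ∈ Ioc δ L
    · have hr0 : 0 < r := hδ.trans hr.1
      rw [indicator_of_mem hr, lin_scale hr0 x, ← lintegral_const_mul' _ _ (by simp),
        ← lintegral_indicator measurableSet_Ioo]
      · congr 1; ext t
        by_cases ht : t ∈ Ioo (0:ℝ) 1
        · rw [indicator_of_mem ht]
          have : x < x + r * t ∧ x + r * t < x + r ∧ δ < x + r - x ∧ x + r - x ≤ L := by refine ⟨by nlinarith [ht.1], by nlinarith [ht.2], by linarith [hr.1], by linarith [hr.2]⟩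
          rw [cv, if_pos this, hW, ← ofReal_mul hr0.le]; simp only
          rw [← ofReal_mul (sq_nonneg _), mul_comm t r]; congr 1
          rw [add_sub_cancel_left]; field_simp
        · rw [indicator_of_notMem ht, cv, if_neg, mul_zero]
          rintro ⟨h1, h2, -⟩
          exact ht ⟨by by_contra h; push Not at h; nlinarith, by by_contra h; push Not at h; nlinarith⟩
      · exact hcm.comp (measurable_const.prodMk (measurable_id.prodMk measurable_const))
    · rw [indicator_of_notMem hr]
      have : ∀ y, cv b δ L x y (x + r) = 0 := fun y => by
        rw [cv, if_neg]; rintro ⟨-, -, h3, h4⟩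
        exact hr ⟨by linarith, by linarith⟩
      simp [this]
  simp_rw [step]
  rw [lintegral_lintegral_swap]
  swap
  · refine Measurable.aemeasurable ?_
    refine Measurable.lintegral_prod_right' (f := fun q : (ℝ × ℝ) × ℝ => W q.2 q.1.2 q.1.1) ?_
    exact meas3 hWm (fun q : (ℝ × ℝ) × ℝ => q.2) (fun q => q.1.2) (fun q => q.1.1) (by fun_prop) (by fun_prop) (by fun_prop)
  have sw2 : ∀ r, ∫⁻ x, ∫⁻ t in Ioo (0:ℝ) 1, W t r x = ∫⁻ t in Ioo (0:ℝ) 1, ∫⁻ x, W t r x := fun r => by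
    rw [lintegral_lintegral_swap]; exact (meas3 hWm (fun q : ℝ × ℝ => q.2) (fun q => r) (fun q => q.1) (by fun_prop) (by fun_prop)
      (by fun_prop)).aemeasurable
  simp_rw [sw2]
  rw [lintegral_lintegral_swap]
  swap
  · refine Measurable.aemeasurable ?_
    refine Measurable.lintegral_prod_right' (f := fun q : (ℝ × ℝ) × ℝ => W q.1.2 q.1.1 q.2) ?_
    exact meas3 hWm (fun q : (ℝ × ℝ) × ℝ => q.1.2) (fun q => q.1.1) (fun q => q.2) (by fun_prop) (by fun_prop) (by fun_prop)
  have hD : ∀ t r, ∫⁻ x, W t r x = Dn b t r * ofReal (1 / r) := fun t r => by rw [hW, Dn, lintegral_mul_const' _ _ (by simp)]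
  simp_rw [hD]
  have mh : Measurable (fun t : ℝ => ofReal (t ^ (-(1/2) : ℝ))) := by fun_prop
  calc _ ≤ ∫⁻ t in Ioo (0:ℝ) 1, N * (ofReal (t ^ (-(1/2) : ℝ)) + ofReal ((1 - t) ^ (-(1/2) : ℝ))) := by
        refine setLIntegral_mono' measurableSet_Ioo fun t ht => ?_
        exact Dn_int hm hK hN hδ hL ht.1 ht.2
    _ = _ := by rw [lintegral_const_mul' _ _ hN, lintegral_add_left mh, int_rpow_half, int_rpow_half']; rw [mul_comm]; norm_num

theorem perm23 (μ : Measure ℝ) [SFinite μ] {G : ℝ → ℝ → ℝ → ℝ≥0∞}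
    (hG : Measurable (fun p : ℝ × ℝ × ℝ => G p.1 p.2.1 p.2.2)) :
    ∫⁻ x, ∫⁻ y, ∫⁻ z, G x z y ∂μ ∂μ ∂μ = ∫⁻ x, ∫⁻ y, ∫⁻ z, G x y z ∂μ ∂μ ∂μ := by
  congr 1; ext x
  rw [lintegral_lintegral_swap]
  exact (meas3 hG (fun q : ℝ × ℝ => x) (fun q => q.2) (fun q => q.1) (by fun_prop) (by fun_prop)
    (by fun_prop)).aemeasurable

theorem perm12 (μ : Measure ℝ) [SFinite μ] {G : ℝ → ℝ → ℝ → ℝ≥0∞}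
    (hG : Measurable (fun p : ℝ × ℝ × ℝ => G p.1 p.2.1 p.2.2)) :
    ∫⁻ x, ∫⁻ y, ∫⁻ z, G y x z ∂μ ∂μ ∂μ = ∫⁻ x, ∫⁻ y, ∫⁻ z, G x y z ∂μ ∂μ ∂μ := by
  rw [lintegral_lintegral_swap]
  refine Measurable.aemeasurable ?_
  refine Measurable.lintegral_prod_right' (f := fun q : (ℝ × ℝ) × ℝ => G q.1.2 q.1.1 q.2) ?_
  exact meas3 hG (fun q : (ℝ × ℝ) × ℝ => q.1.2) (fun q => q.1.1) (fun q => q.2) (by fun_prop) (by fun_prop) (by fun_prop)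

theorem sym6 (μ : Measure ℝ) [SFinite μ] {F : ℝ → ℝ → ℝ → ℝ≥0∞}
    (hF : Measurable (fun p : ℝ × ℝ × ℝ => F p.1 p.2.1 p.2.2))
    (h12 : ∀ x y z, F x y z = F y x z) (h23 : ∀ x y z, F x y z = F x z y) :
    ∫⁻ x, ∫⁻ y, ∫⁻ z, F x y z ∂μ ∂μ ∂μ ≤
      6 * ∫⁻ x, ∫⁻ y, ∫⁻ z, (if x ≤ y ∧ y ≤ z then F x y z else 0) ∂μ ∂μ ∂μ := by
  set G : ℝ → ℝ → ℝ → ℝ≥0∞ := fun x y z => if x ≤ y ∧ y ≤ z then F x y z else 0 with hG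
  have hGm : Measurable (fun p : ℝ × ℝ × ℝ => G p.1 p.2.1 p.2.2) :=
    Measurable.ite ((measurableSet_le (f := fun p : ℝ × ℝ × ℝ => p.1) (g := fun p => p.2.1)
      (by fun_prop) (by fun_prop)).inter (measurableSet_le (f := fun p : ℝ × ℝ × ℝ => p.2.1)
      (g := fun p => p.2.2) (by fun_prop) (by fun_prop))) hF measurable_const
  have cm : ∀ g1 g2 g3 : ℝ × ℝ × ℝ → ℝ, Measurable g1 → Measurable g2 → Measurable g3 →
      Measurable (fun p => G (g1 p) (g2 p) (g3 p)) := fun g1 g2 g3 h1 h2 h3 =>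
    hGm.comp (h1.prodMk (h2.prodMk h3))
  have m1 : Measurable (fun p : ℝ × ℝ × ℝ => G p.1 p.2.2 p.2.1) := cm _ _ _ (by fun_prop) (by fun_prop) (by fun_prop)
  have m2 : Measurable (fun p : ℝ × ℝ × ℝ => G p.2.1 p.1 p.2.2) := cm _ _ _ (by fun_prop) (by fun_prop) (by fun_prop)
  have m3 : Measurable (fun p : ℝ × ℝ × ℝ => G p.2.1 p.2.2 p.1) := cm _ _ _ (by fun_prop) (by fun_prop) (by fun_prop)
  have m4 : Measurable (fun p : ℝ × ℝ × ℝ => G p.2.2 p.1 p.2.1) := cm _ _ _ (by fun_prop) (by fun_prop) (by fun_prop)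
  have m5 : Measurable (fun p : ℝ × ℝ × ℝ => G p.2.2 p.2.1 p.1) := cm _ _ _ (by fun_prop) (by fun_prop) (by fun_prop)
  have p1 := perm23 μ hGm
  have p2 := perm12 μ hGm
  have p3 := (perm12 μ (G := fun x y z => G x z y) m1).trans p1
  have p4 := (perm23 μ (G := fun x y z => G y x z) m2).trans p2
  have p5 := (perm23 μ (G := fun x y z => G y z x) m3).trans p3
  have toP : ∀ H : ℝ → ℝ → ℝ → ℝ≥0∞, Measurable (fun p : ℝ × ℝ × ℝ => H p.1 p.2.1 p.2.2) →
      ∫⁻ x, ∫⁻ y, ∫⁻ z, H x y z ∂μ ∂μ ∂μ = ∫⁻ p : ℝ × ℝ × ℝ, H p.1 p.2.1 p.2.2 ∂(μ.prod (μ.prod μ)) := by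
    intro H hH; rw [lintegral_prod _ hH.aemeasurable]
    congr 1; ext x
    rw [lintegral_prod]; exact (meas3 hH (fun q : ℝ × ℝ => x) (fun q => q.1) (fun q => q.2) (by fun_prop) (by fun_prop)
      (by fun_prop)).aemeasurable
  have key : ∀ x y z, F x y z ≤ G x y z + (G x z y + (G y x z + (G y z x + (G z x y + G z y x)))) := fun x y z => by
    have e1 := h12 x y z; have e2 := h23 x y z; have e3 := h23 y x z; have e4 := h12 x z y; have e5 := h23 z x y; simp only [hG]; rcases le_total x y with hxy | hxy <;> rcases le_total y z with hyz | hyz <;>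
      rcases le_total x z with hxz | hxz
    · exact le_add_right (by simp [hxy, hyz])
    · exact le_add_right (by simp [hxy, hyz])
    · exact le_add_left (le_add_right (by simp [hxz, hyz, e2]))
    · refine le_add_left (le_add_left (le_add_left (le_add_left (le_add_right ?_))))
      simp [hxz, hxy, ← e4, ← e2]
    · refine le_add_left (le_add_left (le_add_right ?_))
      simp [hxz, hxy, ← e1]
    · refine le_add_left (le_add_left (le_add_left (le_add_right ?_)))
      simp [hxz, hyz, ← e3, ← e1]
    · refine le_add_left (le_add_left (le_add_left (le_add_left (le_add_left ?_))))
      simp [hxy, hyz, ← e5, ← e4, ← e2]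
    · refine le_add_left (le_add_left (le_add_left (le_add_left (le_add_left ?_))))
      simp [hxy, hyz, ← e5, ← e4, ← e2]
  rw [toP _ hF]
  calc _ ≤ ∫⁻ p : ℝ × ℝ × ℝ, (G p.1 p.2.1 p.2.2 + (G p.1 p.2.2 p.2.1 + (G p.2.1 p.1 p.2.2 +
        (G p.2.1 p.2.2 p.1 + (G p.2.2 p.1 p.2.1 + G p.2.2 p.2.1 p.1))))) ∂(μ.prod (μ.prod μ)) :=
        lintegral_mono fun p => key _ _ _
    _ = _ := by
        rw [lintegral_add_left hGm, lintegral_add_left m1, lintegral_add_left m2,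
          lintegral_add_left m3, lintegral_add_left m4, ← toP _ hGm,
          ← toP (fun x y z => G x z y) m1, ← toP (fun x y z => G y x z) m2,
          ← toP (fun x y z => G y z x) m3, ← toP (fun x y z => G z x y) m4,
          ← toP (fun x y z => G z y x) m5, p1, p2, p3, p4, p5]
        ring

theorem Dq_affine {b : ℝ → ℝ} (h : LI b) {x y z : ℝ} (hxy : x < y) (hyz : y < z) :
    Dq b z x = (y - x) / (z - x) * Dq b y x + (1 - (y - x) / (z - x)) * Dq b z y := by
  unfold Dq; have h1 : y - x ≠ 0 := (sub_pos.2 hxy).ne'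
  have h2 : z - y ≠ 0 := (sub_pos.2 hyz).ne'
  have h3 : z - x ≠ 0 := (sub_pos.2 (hxy.trans hyz)).ne'
  rw [Adiff_add h z y x]
  field_simp
  ring

noncomputable def er1 (δ x y z : ℝ) : ℝ≥0∞ :=
  if x ≤ y ∧ y ≤ x + δ ∧ δ < z - y then ofReal (1 / (z - y) ^ 2) else 0

noncomputable def er2 (δ x y z : ℝ) : ℝ≥0∞ :=
  if y ≤ z ∧ z ≤ y + δ ∧ δ < y - x then ofReal (1 / (y - x) ^ 2) else 0

theorem er1_meas (δ : ℝ) : Measurable (fun p : ℝ × ℝ × ℝ => er1 δ p.1 p.2.1 p.2.2) := by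
  unfold er1; refine Measurable.ite ?_ (by fun_prop) measurable_const
  have s1 : MeasurableSet {p : ℝ × ℝ × ℝ | p.1 ≤ p.2.1} := measurableSet_le (by fun_prop) (by fun_prop)
  have s2 : MeasurableSet {p : ℝ × ℝ × ℝ | p.2.1 ≤ p.1 + δ} := measurableSet_le (by fun_prop) (by fun_prop)
  have s3 : MeasurableSet {p : ℝ × ℝ × ℝ | δ < p.2.2 - p.2.1} := measurableSet_lt (by fun_prop) (by fun_prop)
  exact s1.inter (s2.inter s3)

theorem tail_shift {δ : ℝ} (hδ : 0 < δ) (y : ℝ) :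
    ∫⁻ z, (if δ < z - y then ofReal (1 / (z - y) ^ 2) else 0) = ofReal (1 / δ) := by
  rw [← tail_sq hδ, ← lintegral_indicator measurableSet_Ioi,
    lintegral_sub_right_eq_self (fun w => if δ < w then ofReal (1 / w ^ 2) else 0) y]
  congr 1

theorem er1_int {δ : ℝ} (hδ : 0 < δ) (x : ℝ) : ∫⁻ y, ∫⁻ z, er1 δ x y z ≤ 1 := by
  have : ∀ y, ∫⁻ z, er1 δ x y z ≤ (Icc x (x + δ)).indicator (fun _ => ofReal (1 / δ)) y := fun y => by
    by_cases h : y ∈ Icc x (x + δ)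
    · rw [indicator_of_mem h, ← tail_shift hδ y]
      refine lintegral_mono fun z => ?_
      unfold er1; split_ifs with h1 h2 h2 <;> simp_all
    · rw [indicator_of_notMem h]
      simp only [mem_Icc, not_and] at h
      refine le_of_eq ?_; rw [lintegral_eq_zero_of_ae_eq_zero]
      refine ae_of_all _ fun z => ?_
      unfold er1; rw [if_neg]; rfl
      tauto
  refine (lintegral_mono this).trans ?_
  rw [lintegral_indicator measurableSet_Icc, setLIntegral_const, Real.volume_Icc, ← ofReal_mul (by positivity)]
  rw [add_sub_cancel_left, one_div_mul_cancel hδ.ne']; simp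

theorem er2_int {δ : ℝ} (hδ : 0 < δ) (x : ℝ) : ∫⁻ y, ∫⁻ z, er2 δ x y z ≤ 1 := by
  have : ∀ y, ∫⁻ z, er2 δ x y z ≤ ofReal δ *
      (if δ < y - x then ofReal (1 / (y - x) ^ 2) else 0) := by
    intro y
    calc ∫⁻ z, er2 δ x y z ≤ ∫⁻ z, (Icc y (y + δ)).indicator (fun _ =>
          (if δ < y - x then ofReal (1 / (y - x) ^ 2) else 0)) z := by
          refine lintegral_mono fun z => ?_
          unfold er2
          by_cases h : z ∈ Icc y (y + δ)
          · rw [indicator_of_mem h]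
            split_ifs with h1 h2 h2 <;> simp_all
          · rw [indicator_of_notMem h, if_neg]
            intro h'; exact h ⟨h'.1, h'.2.1⟩
      _ = _ := by
          rw [lintegral_indicator measurableSet_Icc, setLIntegral_const, Real.volume_Icc, mul_comm]
          simp
  refine (lintegral_mono this).trans ?_
  rw [lintegral_const_mul' _ _ (by simp), tail_shift hδ, ← ofReal_mul hδ.le, mul_one_div_cancel hδ.ne']
  simp

theorem kT_small (s : Finset ι) (b : ι → ℝ → ℝ) {δ x y : ℝ} (h : ¬ δ < |x - y|) : kT s b δ x y = 0 := by unfold kT; rw [if_neg h]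

set_option maxHeartbeats 1000000 in
theorem pt_bound {ι : Type} (s : Finset ι) (K : ℝ) (hK : 0 ≤ K) : ∃ C : ℝ, 0 < C ∧
    ∀ (b : ι → ℝ → ℝ), (∀ j, Measurable (b j)) → (∀ j x, |b j x| ≤ K) → ∀ δ L x y z : ℝ, 0 < δ →
      x ≤ y → y ≤ z → z - x ≤ L →
      ofReal |kT s b δ x y * kT s b δ x z + kT s b δ y z * kT s b δ y x +
        kT s b δ z x * kT s b δ z y| ≤
      ofReal C * ((∑ j ∈ s, cv (b j) δ L x y z) + er1 δ x y z + er2 δ x y z) := by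
  obtain ⟨C, hC, H⟩ := approx_affine s K hK
  refine ⟨C + C * C + K ^ s.card * K ^ s.card, by positivity, fun b hbm hbK δ L x y z hδ hxy hyz hL => ?_⟩
  have hP : ∀ x y, |Pk s b x y| ≤ K ^ s.card := fun x y => Pk_bound (fun j _ => hbK j) x y
  set D := C + C * C + K ^ s.card * K ^ s.card with hD
  have hDK : K ^ s.card * K ^ s.card ≤ D := by rw [hD]; nlinarith [mul_pos hC hC]
  have hDC : C + C * C ≤ D := by rw [hD]; have : 0 ≤ K ^ s.card * K ^ s.card := by positivity
                                 linarith
  have hD0 : 0 < D := lt_of_lt_of_le (by positivity) hDC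
  have a1 : |x - y| = y - x := by rw [abs_sub_comm]; exact abs_of_nonneg (by linarith)
  have a2 : |y - z| = z - y := by rw [abs_sub_comm]; exact abs_of_nonneg (by linarith)
  have a3 : |x - z| = z - x := by rw [abs_sub_comm]; exact abs_of_nonneg (by linarith)
  by_cases p1 : δ < y - x
  · by_cases p2 : δ < z - y
    · -- main case
      have hxy' : x < y := by linarith
      have hyz' : y < z := by linarith
      have hLI : ∀ j, LI (b j) := fun j => LI_of_bdd (hbm j) (hbK j)
      have hzx : 0 < z - x := by linarith
      set τ := (y - x) / (z - x) with hτ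
      have t0 : 0 ≤ τ := by rw [hτ]; exact div_nonneg (by linarith) hzx.le
      have t1 : τ ≤ 1 := by rw [hτ, div_le_one hzx]; linarith
      obtain ⟨q1, q2, q3, q4, q5⟩ := H (fun j => Dq (b j) y x) (fun j => Dq (b j) z y) τ t0 t1
        (fun j _ => Dq_bound (hbK j) _ _) (fun j _ => Dq_bound (hbK j) _ _)
      have hg : Pk s b z x = ∏ j ∈ s, (τ * Dq (b j) y x + (1 - τ) * Dq (b j) z y) := by unfold Pk; exact Finset.prod_congr rfl fun j _ => Dq_affine (hLI j) hxy' hyz'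
      rw [← hg] at q1 q5
      have k1 : kT s b δ x y = - (Pk s b y x / (y - x)) := by rw [kT_anti, kT, if_pos (by rw [abs_sub_comm, a1]; exact p1)]
      have k2 : kT s b δ y z = - (Pk s b z y / (z - y)) := by rw [kT_anti, kT, if_pos (by rw [abs_sub_comm, a2]; exact p2)]
      have k3 : kT s b δ x z = - (Pk s b z x / (z - x)) := by rw [kT_anti, kT, if_pos (by rw [abs_sub_comm, a3]; linarith)]
      rw [kT_anti s b δ y x, kT_anti s b δ z x, kT_anti s b δ z y, k1, k2, k3]; set E := ∑ j ∈ s, (Dq (b j) y x - Dq (b j) z y) ^ 2 with hE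
      have hE0 : 0 ≤ E := Finset.sum_nonneg fun j _ => sq_nonneg _
      change |Pk s b z x - τ * Pk s b y x - (1 - τ) * Pk s b z y| ≤ _ at q1
      change (Pk s b y x - Pk s b z y) ^ 2 ≤ _ at q2
      change |Pk s b y x| ≤ _ at q3
      change |Pk s b z y| ≤ _ at q4
      have hsum : ∑ j ∈ s, cv (b j) δ L x y z = ofReal (E / (z - x) ^ 2) := by
        rw [hE, Finset.sum_div, ENNReal.ofReal_sum_of_nonneg (fun j _ => by positivity)]
        refine Finset.sum_congr rfl fun j _ => ?_
        unfold cv; rw [if_pos ⟨hxy', hyz', by linarith, hL⟩]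
      refine le_trans ?_ (mul_le_mul' le_rfl (le_self_add.trans le_self_add))
      rw [hsum, ← ofReal_mul hD0.le]; refine ofReal_le_ofReal ?_
      generalize Pk s b z x = G at *
      generalize Pk s b y x = F at *
      generalize Pk s b z y = B at *
      have hpq : 0 < (y - x) * (z - y) := mul_pos (by linarith) (by linarith)
      have e1 : -(F / (y - x)) * -(G / (z - x)) + -(B / (z - y)) * - -(F / (y - x)) +
          - -(G / (z - x)) * - -(B / (z - y)) =
          (τ * (1 - τ) * (F - B) ^ 2 + (G - τ * F - (1 - τ) * B) * ((1 - τ) * F + τ * B)) / ((y - x) * (z - y)) := by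
        have h1 : y - x ≠ 0 := (sub_pos.2 hxy').ne'
        have h2 : z - y ≠ 0 := (sub_pos.2 hyz').ne'
        rw [hτ]; field_simp; ring
      have e2 : τ * (1 - τ) = ((y - x) * (z - y)) / (z - x) ^ 2 := by rw [hτ]; field_simp; ring
      rw [e1, abs_div, abs_of_pos hpq, div_le_iff₀ hpq]; have e3 : D * (E / (z - x) ^ 2) * ((y - x) * (z - y)) = D * (τ * (1 - τ) * E) := by rw [e2]; ring
      rw [e3]; have htt : 0 ≤ τ * (1 - τ) := mul_nonneg t0 (by linarith)
      have b1 : |(1 - τ) * F + τ * B| ≤ C := by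
        refine (abs_add_le _ _).trans ?_; rw [abs_mul, abs_mul, abs_of_nonneg t0, abs_of_nonneg (by linarith : 0 ≤ 1 - τ)]
        nlinarith
      have hX : 0 ≤ τ * (1 - τ) * E := by positivity
      calc _ ≤ |τ * (1 - τ) * (F - B) ^ 2| + |(G - τ * F - (1 - τ) * B)| * |((1 - τ) * F + τ * B)| := by rw [← abs_mul]; exact abs_add_le _ _
        _ ≤ C * (τ * (1 - τ) * E) + C * (τ * (1 - τ) * E) * C := by
            refine add_le_add ?_ (mul_le_mul q1 b1 (abs_nonneg _) (by positivity))
            rw [abs_of_nonneg (by positivity)]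
            nlinarith
        _ = (C + C * C) * (τ * (1 - τ) * E) := by ring
        _ ≤ _ := mul_le_mul_of_nonneg_right hDC hX
    · have hz : kT s b δ y z = 0 := kT_small s b (by rw [a2]; exact p2)
      have hz' : kT s b δ z y = 0 := by rw [kT_anti, hz, neg_zero]
      rw [hz, hz', zero_mul, mul_zero, add_zero, add_zero]; refine le_trans ?_ (mul_le_mul' le_rfl le_add_self)
      rw [er2, if_pos ⟨hyz, by linarith, p1⟩, ← ofReal_mul hD0.le]
      refine ofReal_le_ofReal ?_; rw [kT, if_pos (by rw [a1]; exact p1), kT, if_pos (by rw [a3]; linarith), abs_mul, abs_div, abs_div, a1, a3]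
      have hp : 0 < y - x := by linarith
      calc _ ≤ K ^ s.card / (y - x) * (K ^ s.card / (y - x)) := by
            refine mul_le_mul (div_le_div_of_nonneg_right (hP _ _) hp.le) ?_ (div_nonneg (abs_nonneg _) (by linarith)) (by positivity)
            exact div_le_div₀ (by positivity) (hP _ _) hp (by linarith)
        _ = K ^ s.card * K ^ s.card * (1 / (y - x) ^ 2) := by field_simp
        _ ≤ _ := by gcongr
  · have hz : kT s b δ x y = 0 := kT_small s b (by rw [a1]; exact p1)
    have hz' : kT s b δ y x = 0 := by rw [kT_anti, hz, neg_zero]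
    rw [hz, hz', zero_mul, mul_zero, zero_add, zero_add]; by_cases p2 : δ < z - y
    · refine le_trans ?_ (mul_le_mul' le_rfl (le_add_self.trans le_self_add))
      rw [er1, if_pos ⟨hxy, by linarith, p2⟩, ← ofReal_mul hD0.le]
      refine ofReal_le_ofReal ?_; rw [kT, if_pos (by rw [abs_sub_comm, a3]; linarith), kT, if_pos (by rw [abs_sub_comm, a2]; linarith),
        abs_mul, abs_div, abs_div, abs_sub_comm z x, abs_sub_comm z y, a2, a3]
      have hp : 0 < z - y := by linarith
      calc _ ≤ K ^ s.card / (z - y) * (K ^ s.card / (z - y)) := by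
            refine mul_le_mul ?_ (div_le_div_of_nonneg_right (hP _ _) hp.le) (by positivity) (by positivity)
            exact div_le_div₀ (by positivity) (hP _ _) hp (by linarith)
        _ = K ^ s.card * K ^ s.card * (1 / (z - y) ^ 2) := by field_simp
        _ ≤ _ := by gcongr
    · have hz : kT s b δ z y = 0 := kT_small s b (by rw [abs_sub_comm, a2]; exact p2)
      rw [hz]; simp

theorem L2_bounded_aux {ι : Type} (s : Finset ι) (K : ℝ) (hK : 0 ≤ K) : ∃ C : ℝ, 0 < C ∧
    ∀ (b : ι → ℝ → ℝ), (∀ j, Measurable (b j)) → (∀ j x, |b j x| ≤ K) → ∀ f : ℝ → ℝ, Measurable f →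
      (∀ x, |f x| ≤ 1) → ∀ u v δ : ℝ, u < v → 0 < δ →
      (∀ j, ∫⁻ x, ofReal (b j x ^ 2) ≤ ofReal (K ^ 2 * (v - u))) →
      ∫ x in Ioc u v, (∫ y in Ioc u v, kT s b δ x y * f y) ^ 2 ≤ C * (v - u) := by
  obtain ⟨C, hC, H⟩ := pt_bound s K hK
  refine ⟨4 * (6 * (C * (s.card * (4 * K ^ 2) + 1 + 1))), by positivity,
    fun b hbm hbK f hfm hf1 u v δ huv hδ hN => ?_⟩
  have hLI : ∀ j, LI (b j) := fun j => LI_of_bdd (hbm j) (hbK j)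
  have hvu : 0 < v - u := by linarith
  set V : ℝ := 6 * (C * (s.card * (4 * K ^ 2) + 1 + 1)) * (v - u) with hV
  rw [show 4 * (6 * (C * (s.card * (4 * K ^ 2) + 1 + 1))) * (v - u) = 4 * V by rw [hV]; ring]
  set μ : Measure ℝ := volume.restrict (Ioc u v) with hμ
  have hkm := kT_meas (s := s) (fun j _ => hLI j) δ
  have km : ∀ (X : Type) [MeasurableSpace X] (g1 g2 : X → ℝ), Measurable g1 → Measurable g2 →
      Measurable (fun p => kT s b δ (g1 p) (g2 p)) := fun X _ g1 g2 h1 h2 => hkm.comp (h1.prodMk h2)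
  have hle : μ ≤ volume := Measure.restrict_le_self
  refine symm_L2 μ (k := kT s b δ) hkm (kT_bound (fun j _ => hbK j) hδ) (by positivity) ?_ hfm hf1
  refine (sym6 μ (F := fun x y z => ofReal |kT s b δ x y * kT s b δ x z +
    kT s b δ y z * kT s b δ y x + kT s b δ z x * kT s b δ z y|) ?_ ?_ ?_).trans ?_
  · have m1 := km (ℝ × ℝ × ℝ) (fun p => p.1) (fun p => p.2.1) (by fun_prop) (by fun_prop)
    have m2 := km (ℝ × ℝ × ℝ) (fun p => p.1) (fun p => p.2.2) (by fun_prop) (by fun_prop)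
    have m3 := km (ℝ × ℝ × ℝ) (fun p => p.2.1) (fun p => p.2.2) (by fun_prop) (by fun_prop)
    have m4 := km (ℝ × ℝ × ℝ) (fun p => p.2.1) (fun p => p.1) (by fun_prop) (by fun_prop)
    have m5 := km (ℝ × ℝ × ℝ) (fun p => p.2.2) (fun p => p.1) (by fun_prop) (by fun_prop)
    have m6 := km (ℝ × ℝ × ℝ) (fun p => p.2.2) (fun p => p.2.1) (by fun_prop) (by fun_prop)
    have m7 := ((m1.mul m2).add (m3.mul m4)).add (m5.mul m6)
    exact (continuous_abs.measurable.comp m7).ennreal_ofReal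
  · intro x y z; congr 2; ring
  · intro x y z; congr 2; ring
  have hcurv : ∀ j, ∫⁻ x, ∫⁻ y, ∫⁻ z, cv (b j) δ (δ + (v - u)) x y z ≤ 4 * ofReal (K ^ 2 * (v - u)) :=
    fun j => (curv (hbm j) (hbK j) (ne_top_of_le_ne_top ofReal_ne_top (hN j)) hδ
      (by linarith)).trans (mul_le_mul' le_rfl (hN j))
  have mono3 : ∀ G : ℝ → ℝ → ℝ → ℝ≥0∞, ∫⁻ x, ∫⁻ y, ∫⁻ z, G x y z ∂μ ∂μ ∂μ ≤ ∫⁻ x, ∫⁻ y, ∫⁻ z, G x y z :=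
    fun G => lintegral_mono' hle fun x => lintegral_mono' hle fun y => lintegral_mono' hle fun z => le_rfl
  have mono3' : ∀ G : ℝ → ℝ → ℝ → ℝ≥0∞, (∀ x, ∫⁻ y, ∫⁻ z, G x y z ≤ 1) →
      ∫⁻ x, ∫⁻ y, ∫⁻ z, G x y z ∂μ ∂μ ∂μ ≤ ofReal (v - u) := by
    intro G hG
    calc _ ≤ ∫⁻ x, 1 ∂μ := lintegral_mono fun x =>
          le_trans (lintegral_mono' hle fun y => lintegral_mono' hle fun z => le_rfl) (hG x)
      _ = _ := by simp [hμ]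
  set W : ℝ → ℝ → ℝ → ℝ≥0∞ := fun x y z =>
    ((∑ j ∈ s, cv (b j) δ (δ + (v - u)) x y z) + er1 δ x y z) + er2 δ x y z with hW
  have hA : ∫⁻ x, ∫⁻ y, ∫⁻ z, (if x ≤ y ∧ y ≤ z then ofReal |kT s b δ x y * kT s b δ x z +
      kT s b δ y z * kT s b δ y x + kT s b δ z x * kT s b δ z y| else 0) ∂μ ∂μ ∂μ ≤
      ∫⁻ x, ∫⁻ y, ∫⁻ z, ofReal C * W x y z ∂μ ∂μ ∂μ := by
    refine setLIntegral_mono' measurableSet_Ioc fun x hx => ?_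
    refine lintegral_mono fun y => ?_
    refine setLIntegral_mono' measurableSet_Ioc fun z hz => ?_
    split_ifs with h
    · exact H b hbm hbK δ _ x y z hδ h.1 h.2 (by linarith [hx.1, hz.2])
    · simp
  refine (mul_le_mul' le_rfl hA).trans ?_
  have hcm : ∀ j, Measurable (fun p : ℝ × ℝ × ℝ => cv (b j) δ (δ + (v - u)) p.1 p.2.1 p.2.2) :=
    fun j => cv_meas (hLI j) _ _
  -- additivity of triple integrals
  have add3 : ∀ G1 G2 : ℝ → ℝ → ℝ → ℝ≥0∞, Measurable (fun p : ℝ × ℝ × ℝ => G1 p.1 p.2.1 p.2.2) →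
      ∫⁻ x, ∫⁻ y, ∫⁻ z, (G1 x y z + G2 x y z) ∂μ ∂μ ∂μ =
        ∫⁻ x, ∫⁻ y, ∫⁻ z, G1 x y z ∂μ ∂μ ∂μ + ∫⁻ x, ∫⁻ y, ∫⁻ z, G2 x y z ∂μ ∂μ ∂μ := by
    intro G1 G2 h1
    rw [← lintegral_add_left]
    · congr 1; ext x
      rw [← lintegral_add_left]
      · congr 1; ext y
        rw [← lintegral_add_left]
        exact meas3 h1 (fun _ : ℝ => x) (fun _ => y) (fun z => z) (by fun_prop) (by fun_prop) (by fun_prop)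
      · exact Measurable.lintegral_prod_right' (f := fun q : ℝ × ℝ => G1 x q.1 q.2)
          (meas3 h1 (fun _ : ℝ × ℝ => x) (fun q => q.1) (fun q => q.2) (by fun_prop) (by fun_prop) (by fun_prop))
    · refine Measurable.lintegral_prod_right' (f := fun q : ℝ × ℝ => ∫⁻ z, G1 q.1 q.2 z ∂μ) ?_
      exact Measurable.lintegral_prod_right' (f := fun q : (ℝ × ℝ) × ℝ => G1 q.1.1 q.1.2 q.2)
        (meas3 h1 (fun q : (ℝ × ℝ) × ℝ => q.1.1) (fun q => q.1.2) (fun q => q.2) (by fun_prop) (by fun_prop) (by fun_prop))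
  have sum3 : ∀ t : Finset ι, ∫⁻ x, ∫⁻ y, ∫⁻ z, (∑ j ∈ t, cv (b j) δ (δ + (v - u)) x y z) ∂μ ∂μ ∂μ ≤
      t.card * (4 * ofReal (K ^ 2 * (v - u))) := by
    intro t
    classical
    induction t using Finset.induction_on with
    | empty => simp
    | insert i t hi ih =>
      simp_rw [Finset.sum_insert hi]
      rw [add3 _ _ (hcm i), Finset.card_insert_of_notMem hi]
      push_cast
      rw [add_mul, one_mul, add_comm]
      exact add_le_add ih ((mono3 _).trans (hcurv i))
  have hsm : Measurable (fun p : ℝ × ℝ × ℝ => ∑ j ∈ s, cv (b j) δ (δ + (v - u)) p.1 p.2.1 p.2.2) :=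
    Finset.measurable_sum _ fun j _ => hcm j
  have hWi : ∫⁻ x, ∫⁻ y, ∫⁻ z, W x y z ∂μ ∂μ ∂μ ≤
      s.card * (4 * ofReal (K ^ 2 * (v - u))) + ofReal (v - u) + ofReal (v - u) := by
    rw [hW]
    rw [add3 (fun x y z => (∑ j ∈ s, cv (b j) δ (δ + (v - u)) x y z) + er1 δ x y z) (fun x y z => er2 δ x y z)
      (hsm.add (er1_meas δ)), add3 (fun x y z => (∑ j ∈ s, cv (b j) δ (δ + (v - u)) x y z)) _ hsm]
    exact add_le_add (add_le_add (sum3 s) (mono3' _ (er1_int hδ))) (mono3' _ (er2_int hδ))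
  have hpull : ∫⁻ x, ∫⁻ y, ∫⁻ z, ofReal C * W x y z ∂μ ∂μ ∂μ =
      ofReal C * ∫⁻ x, ∫⁻ y, ∫⁻ z, W x y z ∂μ ∂μ ∂μ := by
    rw [← lintegral_const_mul' _ _ (by simp)]
    congr 1; ext x
    rw [← lintegral_const_mul' _ _ (by simp)]
    congr 1; ext y
    rw [← lintegral_const_mul' _ _ (by simp)]
  rw [hpull]
  refine (mul_le_mul' le_rfl (mul_le_mul' le_rfl hWi)).trans (le_of_eq ?_)
  rw [hV, show (6 : ℝ≥0∞) = ofReal 6 by norm_num, show (4 : ℝ≥0∞) = ofReal 4 by norm_num,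
    show (s.card : ℝ≥0∞) = ofReal s.card by simp]
  rw [← ofReal_mul (by norm_num), ← ofReal_mul (by positivity),
    ← ofReal_add (by positivity) hvu.le, ← ofReal_add (by positivity) hvu.le,
    ← ofReal_mul hC.le, ← ofReal_mul (by norm_num)]
  congr 1; ring

theorem Dq_congr {b b' : ℝ → ℝ} {u v : ℝ} (h : ∀ x ∈ Ioc u v, b x = b' x) {x y : ℝ} (hx : x ∈ Ioc u v)
    (hy : y ∈ Ioc u v) : Dq b x y = Dq b' x y := by
  unfold Dq Adiff; congr 1
  refine intervalIntegral.integral_congr fun t ht => h t ?_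
  rw [uIcc] at ht
  exact ⟨lt_of_lt_of_le (lt_min hy.1 hx.1) ht.1, ht.2.trans (max_le hy.2 hx.2)⟩

theorem Pk_congr {s : Finset ι} {b b' : ι → ℝ → ℝ} {u v : ℝ} (h : ∀ j ∈ s, ∀ x ∈ Ioc u v, b j x = b' j x)
    {x y : ℝ} (hx : x ∈ Ioc u v) (hy : y ∈ Ioc u v) : Pk s b x y = Pk s b' x y := by
  unfold Pk; exact Finset.prod_congr rfl fun j hj => Dq_congr (h j hj) hx hy

theorem L2_bounded {ι : Type} (s : Finset ι) (K : ℝ) (hK : 0 ≤ K) : ∃ C : ℝ, 0 < C ∧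
    ∀ (b : ι → ℝ → ℝ), (∀ j, Measurable (b j)) → (∀ j x, |b j x| ≤ K) → ∀ f : ℝ → ℝ, Measurable f →
      (∀ x, |f x| ≤ 1) → ∀ u v δ : ℝ, u < v → 0 < δ → (∀ x, x ∉ Ioc u v → f x = 0) →
      ∫⁻ x in Ioc u v, ofReal (Cop s b δ f x ^ 2) ≤ ofReal (C * (v - u)) := by
  obtain ⟨C, hC, H⟩ := L2_bounded_aux s K hK
  refine ⟨C, hC, fun b hbm hbK f hfm hf1 u v δ huv hδ hf0 => ?_⟩
  set b' : ι → ℝ → ℝ := fun j => (Ioc u v).indicator (b j) with hb'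
  have hbm' : ∀ j, Measurable (b' j) := fun j => (hbm j).indicator measurableSet_Ioc
  have hbK' : ∀ j x, |b' j x| ≤ K := fun j x => by
    by_cases h : x ∈ Ioc u v
    · simp only [hb', indicator_of_mem h]; exact hbK j x
    · simp only [hb', indicator_of_notMem h]; simpa using hK
  have hN : ∀ j, ∫⁻ x, ofReal (b' j x ^ 2) ≤ ofReal (K ^ 2 * (v - u)) := fun j => by
    calc ∫⁻ x, ofReal (b' j x ^ 2) ≤ ∫⁻ x, (Ioc u v).indicator (fun _ => ofReal (K ^ 2)) x := by
          refine lintegral_mono fun x => ?_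
          by_cases h : x ∈ Ioc u v
          · simp only [hb', indicator_of_mem h]
            exact ofReal_le_ofReal (sq_le_sq' (by linarith [abs_le.1 (hbK j x)]) (abs_le.1 (hbK j x)).2)
          · simp only [hb', indicator_of_notMem h]; simp
      _ = _ := by
          rw [lintegral_indicator measurableSet_Ioc, setLIntegral_const, volume_Ioc,
            ← ofReal_mul (by positivity)]
  have h1 := H b' hbm' hbK' f hfm hf1 u v δ huv hδ hN
  have hLI : ∀ j ∈ s, LI (b' j) := fun j _ => LI_of_bdd (hbm' j) (hbK' j)
  have hkm := kT_meas (s := s) hLI δ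
  have hTm : Measurable (fun x => ∫ y in Ioc u v, kT s b' δ x y * f y) := by
    have : StronglyMeasurable (fun p : ℝ × ℝ => kT s b' δ p.1 p.2 * f p.2) :=
      (hkm.mul (hfm.comp measurable_snd)).stronglyMeasurable
    exact this.integral_prod_right.measurable
  have hTb : ∀ x, |∫ y in Ioc u v, kT s b' δ x y * f y| ≤ |K| ^ s.card / δ * (v - u) := fun x => by
    have := norm_integral_le_of_norm_le_const (μ := volume.restrict (Ioc u v)) (f := fun y => kT s b' δ x y * f y)
      (C := |K| ^ s.card / δ) (ae_of_all _ fun y => ?_)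
    · refine this.trans (le_of_eq ?_)
      simp [Measure.real, huv.le]
    · rw [norm_eq_abs, abs_mul]
      calc |kT s b' δ x y| * |f y| ≤ |K| ^ s.card / δ * 1 := mul_le_mul (kT_bound (fun j _ => hbK' j) hδ x y)
            (hf1 y) (abs_nonneg _) (by positivity)
        _ = _ := mul_one _
  have heq : ∀ x ∈ Ioc u v, Cop s b δ f x = ∫ y in Ioc u v, kT s b' δ x y * f y := fun x hx => by
    rw [Cop_eq, ← integral_indicator measurableSet_Ioc]; congr 1; ext y
    by_cases hy : y ∈ Ioc u v
    · rw [indicator_of_mem hy]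
      unfold kT; rw [Pk_congr (b' := b') (fun j _ t ht => by simp only [hb', indicator_of_mem ht]) hx hy]
    · rw [indicator_of_notMem hy, hf0 y hy, mul_zero]
  rw [setLIntegral_congr_fun measurableSet_Ioc (g := fun x => ofReal ((∫ y in Ioc u v, kT s b' δ x y * f y) ^ 2))
    (fun x hx => by simp only [heq x hx])]
  rw [← ofReal_integral_eq_lintegral_ofReal]
  · exact ofReal_le_ofReal h1
  · refine Measure.integrableOn_of_bounded (M := (|K| ^ s.card / δ * (v - u)) ^ 2) (by simp)
      (hTm.pow_const 2).aestronglyMeasurable (ae_of_all _ fun x => ?_)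
    rw [norm_eq_abs, abs_pow]; exact pow_le_pow_left₀ (abs_nonneg _) (hTb x) 2
  · exact ae_of_all _ fun x => sq_nonneg _

theorem prod_diff {ι : Type} (s : Finset ι) {α β : ι → ℝ} {K e : ℝ} (hK : 1 ≤ K) (he : 0 ≤ e)
    (hα : ∀ j ∈ s, |α j| ≤ K) (hβ : ∀ j ∈ s, |β j| ≤ K) (hd : ∀ j ∈ s, |α j - β j| ≤ e) :
    |∏ j ∈ s, α j - ∏ j ∈ s, β j| ≤ s.card * K ^ s.card * e := by
  classical
  induction s using Finset.induction_on with
  | empty => simp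
  | insert i s hi ih =>
    have ih' := ih (fun j hj => hα j (Finset.mem_insert_of_mem hj))
      (fun j hj => hβ j (Finset.mem_insert_of_mem hj)) (fun j hj => hd j (Finset.mem_insert_of_mem hj))
    have hPb : |∏ j ∈ s, β j| ≤ K ^ s.card := by rw [Finset.abs_prod, ← Finset.prod_const]; exact Finset.prod_le_prod (fun j _ => abs_nonneg _) fun j hj => hβ j (Finset.mem_insert_of_mem hj)
    have h1 := hα i (Finset.mem_insert_self i s); have h2 := hd i (Finset.mem_insert_self i s); rw [Finset.prod_insert hi, Finset.prod_insert hi, Finset.card_insert_of_notMem hi]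
    have hKp : 0 ≤ K ^ s.card := by positivity
    calc |α i * ∏ j ∈ s, α j - β i * ∏ j ∈ s, β j|
        = |α i * (∏ j ∈ s, α j - ∏ j ∈ s, β j) + (α i - β i) * ∏ j ∈ s, β j| := by congr 1; ring
      _ ≤ |α i| * |∏ j ∈ s, α j - ∏ j ∈ s, β j| + |α i - β i| * |∏ j ∈ s, β j| := by rw [← abs_mul, ← abs_mul]; exact abs_add_le _ _
      _ ≤ K * (s.card * K ^ s.card * e) + e * K ^ s.card :=
          add_le_add (mul_le_mul h1 ih' (abs_nonneg _) (by linarith)) (mul_le_mul h2 hPb (abs_nonneg _) he)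
      _ ≤ K * (s.card * K ^ s.card * e) + K * (e * K ^ s.card) := by
          have : 0 ≤ e * K ^ s.card := by positivity
          nlinarith
      _ = _ := by push_cast; ring

theorem Dq_av {α : ℝ → ℝ} {x y : ℝ} (h : y < x) : Dq α x y = av α y x := by unfold Dq Adiff av; rw [intervalIntegral.integral_of_le h.le, div_eq_inv_mul]

theorem Kbound : ∃ C : ℝ, 0 < C ∧ ∀ α : ℝ → ℝ, BMO1 α → ∀ l r x y q R : ℝ, l < r → q = r - l →
    R = |x - (l + r) / 2| → 3 / 2 * q ≤ R → y ∈ Ioc l r →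
    |Dq α x y - av α l r| ≤ C * √(R / q) := by
  obtain ⟨C, hC, H⟩ := av_diff
  refine ⟨2 * C * √2, by positivity, fun α hα l r x y q R hlr hq hR hRq hy => ?_⟩
  have hq0 : 0 < q := by linarith
  have hR0 : 0 < R := by linarith
  have key : ∀ a b c d : ℝ, a < b → c < d → d - c ≤ 2 * R → q ≤ b - a → c ≤ a → b ≤ d → |av α a b - av α c d| ≤ C * (√2 * √(R / q)) := fun a b c d hab hcd h1 h2 h3 h4 => by
    refine (H α hα c d a b hab h3 h4).trans ?_; refine mul_le_mul_of_nonneg_left ?_ hC.le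
    rw [← Real.sqrt_mul (by norm_num)]
    refine Real.sqrt_le_sqrt ?_; rw [mul_div_assoc']
    exact div_le_div₀ (by linarith) h1 hq0 h2
  have fin : ∀ X Y Z : ℝ, |X - Z| ≤ C * (√2 * √(R / q)) → |Y - Z| ≤ C * (√2 * √(R / q)) →
      |X - Y| ≤ 2 * C * √2 * √(R / q) := by
    intro X Y Z h1 h2; have := abs_sub_le X Z Y
    rw [abs_sub_comm Z Y] at this; linarith
  rcases le_total x ((l + r) / 2) with h | h
  · rw [abs_of_nonpos (by linarith)] at hR
    rw [Dq_symm, Dq_av (by linarith [hy.1])]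
    exact fin _ _ (av α x r) (key _ _ _ _ (by linarith [hy.1]) (by linarith) (by linarith) (by linarith [hy.1]) le_rfl hy.2)
      (key _ _ _ _ hlr (by linarith) (by linarith) (by linarith) (by linarith) le_rfl)
  · rw [abs_of_nonneg (by linarith)] at hR
    rw [Dq_av (by linarith [hy.2])]
    exact fin _ _ (av α l x) (key _ _ _ _ (by linarith [hy.2]) (by linarith) (by linarith) (by linarith [hy.2]) hy.1.le le_rfl)
      (key _ _ _ _ hlr (by linarith) (by linarith) (by linarith) le_rfl (by linarith))

theorem Dq_move {β : ℝ → ℝ} (h : LI β) {x y y0 : ℝ} (hxy : x ≠ y) (hx0 : x ≠ y0) :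
    Dq β x y - Dq β x y0 = (Dq β x y0 * (y - y0) + Adiff β y0 y) / (x - y) := by
  unfold Dq; rw [Adiff_add h x y0 y]
  have h1 := sub_ne_zero.2 hxy
  have h2 := sub_ne_zero.2 hx0
  field_simp
  ring

theorem alg_main {kk k0 P Pt P0 U U0 a f fI h A t q : ℝ} (ht : 0 < t) (ht1 : t ≤ 1) (hq : 0 < q) (hA : 1 ≤ A)
    (h1 : |kk| ≤ A / t) (h2 : |k0| ≤ A / t) (h3 : |P - Pt| ≤ A * t ^ 2) (h5 : |Pt| ≤ A)
    (h6 : |P0| ≤ A) (h7 : |U| ≤ A * t ^ 2 / q) (h8 : |kk - k0| ≤ A * t) (h9 : |Pt - P0| ≤ A * t ^ 2)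
    (h10 : |U - U0| ≤ A * t ^ 4 / q) :
    |((kk - a) * (P * f - Pt * fI) + Pt * h) * U - k0 * P0 * U0 * (f - fI) + P0 * U0 * (a * (f - fI) - h)|
      ≤ 3 * A ^ 3 * t ^ 3 / q * ((1 + |a|) * |f| + |f - fI| + |a * (f - fI) - h|) := by
  have hA0 : 0 < A := by linarith
  have e : ((kk - a) * (P * f - Pt * fI) + Pt * h) * U - k0 * P0 * U0 * (f - fI) + P0 * U0 * (a * (f - fI) - h)
    = (kk - a) * (P - Pt) * U * f + (((kk - k0) * Pt * U + k0 * (Pt - P0) * U + k0 * P0 * (U - U0)) * (f - fI))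
      - ((Pt - P0) * U + P0 * (U - U0)) * (a * (f - fI) - h) := by ring
  rw [e]
  have hAt : A / t + |a| ≤ A / t * (1 + |a|) := by
    have : 1 ≤ A / t := by rw [le_div_iff₀ ht]; linarith
    nlinarith [abs_nonneg a]
  have b1 : |(kk - a) * (P - Pt) * U * f| ≤ A ^ 3 * t ^ 3 / q * ((1 + |a|) * |f|) := by
    rw [abs_mul, abs_mul, abs_mul]; have : |kk - a| ≤ A / t * (1 + |a|) := by have := abs_sub kk a; linarith
    calc |kk - a| * |P - Pt| * |U| * |f| ≤ (A / t * (1 + |a|)) * (A * t ^ 2) * (A * t ^ 2 / q) * |f| := by gcongr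
      _ = _ := by field_simp
  have b2 : |(kk - k0) * Pt * U + k0 * (Pt - P0) * U + k0 * P0 * (U - U0)| ≤ 3 * (A ^ 3 * t ^ 3 / q) := by
    have c1 : |(kk - k0) * Pt * U| ≤ A ^ 3 * t ^ 3 / q := by
      rw [abs_mul, abs_mul]; calc _ ≤ (A * t) * A * (A * t ^ 2 / q) := by gcongr
        _ = _ := by ring
    have c2 : |k0 * (Pt - P0) * U| ≤ A ^ 3 * t ^ 3 / q := by
      rw [abs_mul, abs_mul]; calc _ ≤ (A / t) * (A * t ^ 2) * (A * t ^ 2 / q) := by gcongr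
        _ = _ := by field_simp
    have c3 : |k0 * P0 * (U - U0)| ≤ A ^ 3 * t ^ 3 / q := by
      rw [abs_mul, abs_mul]; calc _ ≤ (A / t) * A * (A * t ^ 4 / q) := by gcongr
        _ = _ := by field_simp
    have := abs_add_three ((kk - k0) * Pt * U) (k0 * (Pt - P0) * U) (k0 * P0 * (U - U0)); linarith
  have b3 : |(Pt - P0) * U + P0 * (U - U0)| ≤ 3 * (A ^ 3 * t ^ 3 / q) := by
    have c0 : A ^ 2 * t ^ 4 / q ≤ A ^ 3 * t ^ 3 / q := by
      refine div_le_div_of_nonneg_right ?_ hq.le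
      refine mul_le_mul (pow_le_pow_right₀ hA (by norm_num)) (pow_le_pow_of_le_one ht.le ht1 (by norm_num))
        (by positivity) (by positivity)
    have c1 : |(Pt - P0) * U| ≤ A ^ 2 * t ^ 4 / q := by
      rw [abs_mul]; calc _ ≤ (A * t ^ 2) * (A * t ^ 2 / q) := by gcongr
        _ = _ := by ring
    have c2 : |P0 * (U - U0)| ≤ A ^ 2 * t ^ 4 / q := by
      rw [abs_mul]; calc _ ≤ A * (A * t ^ 4 / q) := by gcongr
        _ = _ := by ring
    have := abs_add_le ((Pt - P0) * U) (P0 * (U - U0)); have : 0 ≤ A ^ 3 * t ^ 3 / q := by positivity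
    linarith
  have b2' : |((kk - k0) * Pt * U + k0 * (Pt - P0) * U + k0 * P0 * (U - U0)) * (f - fI)| ≤
      3 * (A ^ 3 * t ^ 3 / q) * |f - fI| := by
    rw [abs_mul]; exact mul_le_mul_of_nonneg_right b2 (abs_nonneg _)
  have b3' : |((Pt - P0) * U + P0 * (U - U0)) * (a * (f - fI) - h)| ≤
      3 * (A ^ 3 * t ^ 3 / q) * |a * (f - fI) - h| := by
    rw [abs_mul]; exact mul_le_mul_of_nonneg_right b3 (abs_nonneg _)
  refine (abs_sub _ _).trans ?_
  refine (add_le_add (abs_add_le _ _) le_rfl).trans ?_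
  have : 0 ≤ A ^ 3 * t ^ 3 / q * ((1 + |a|) * |f|) := by positivity
  have e2 : 3 * A ^ 3 * t ^ 3 / q * ((1 + |a|) * |f| + |f - fI| + |a * (f - fI) - h|) =
    3 * (A ^ 3 * t ^ 3 / q * ((1 + |a|) * |f|)) + 3 * (A ^ 3 * t ^ 3 / q) * |f - fI|
      + 3 * (A ^ 3 * t ^ 3 / q) * |a * (f - fI) - h| := by ring
  linarith

theorem alg_size {kk P Pt U a f fI h A t q M : ℝ} (ht : 0 < t) (ht1 : t ≤ 1) (hq : 0 < q) (hA : 1 ≤ A) (hM : 0 ≤ M)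
    (h1 : |kk| ≤ A / t) (h4 : |P| ≤ A) (h5 : |Pt| ≤ A) (h7 : |U| ≤ A * t ^ 2 / q) (hfI : |fI| ≤ 3) (hh : |h| ≤ M) :
    |((kk - a) * (P * f - Pt * fI) + Pt * h) * U| ≤ (3 + M) * A ^ 3 * t / q * ((1 + |a|) * (|f| + 1)) := by
  have hA0 : 0 < A := by linarith
  have hAt : A / t + |a| ≤ A / t * (1 + |a|) := by
    have : 1 ≤ A / t := by rw [le_div_iff₀ ht]; linarith
    nlinarith [abs_nonneg a]
  have b1 : |kk - a| ≤ A / t * (1 + |a|) := by have := abs_sub kk a; linarith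
  have b2 : |P * f - Pt * fI| ≤ 3 * A * (|f| + 1) := by
    have := abs_sub (P * f) (Pt * fI); rw [abs_mul, abs_mul] at this; have c1 : |P| * |f| ≤ A * |f| := by gcongr
    have c2 : |Pt| * |fI| ≤ A * 3 := by gcongr
    nlinarith [abs_nonneg f]
  have b3 : |Pt * h| ≤ M * (A ^ 2 / t) * ((1 + |a|) * (|f| + 1)) := by
    rw [abs_mul]; have c1 : A ≤ A ^ 2 / t := by rw [le_div_iff₀ ht]; nlinarith
    have c2 : 1 ≤ (1 + |a|) * (|f| + 1) := by nlinarith [abs_nonneg a, abs_nonneg f, mul_nonneg (abs_nonneg a) (abs_nonneg f)]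
    calc |Pt| * |h| ≤ A * M := by gcongr
      _ ≤ A ^ 2 / t * M * 1 := by rw [mul_one]; gcongr
      _ ≤ A ^ 2 / t * M * ((1 + |a|) * (|f| + 1)) := by gcongr
      _ = _ := by ring
  rw [abs_mul]
  calc _ ≤ (A / t * (1 + |a|) * (3 * A * (|f| + 1)) + M * (A ^ 2 / t) * ((1 + |a|) * (|f| + 1))) * (A * t ^ 2 / q) := by
        refine mul_le_mul ?_ h7 (abs_nonneg _) (by positivity)
        refine (abs_add_le _ _).trans (add_le_add ?_ b3)
        rw [abs_mul]; gcongr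
    _ = _ := by field_simp

/-- difference integrand -/
noncomputable def Hf {ι : Type} (lam : ℝ) (α : ℝ → ℝ) (s : Finset ι) (b bt : ι → ℝ → ℝ) (f ft h : ℝ → ℝ) (x y : ℝ) : ℝ :=
  (Kap lam α x y * (Pk s b x y * f y - Pk s bt x y * ft y) + Pk s bt x y * h y) / (x - y)

theorem Dq_meas_r {b : ℝ → ℝ} (h : LI b) (x : ℝ) : Measurable (fun y => Dq b x y) := by
  have m0 : Measurable (fun y : ℝ => (x, y)) := by fun_prop
  exact (Dq_meas h).comp m0

theorem Pk_meas_r {ι : Type} {s : Finset ι} {b : ι → ℝ → ℝ} (h : ∀ j ∈ s, LI (b j)) (x : ℝ) :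
    Measurable (fun y => Pk s b x y) := by
  unfold Pk; exact Finset.measurable_prod _ fun j hj => Dq_meas_r (h j hj) x

theorem Hf_meas {ι : Type} {lam : ℝ} {α : ℝ → ℝ} {s : Finset ι} {b bt : ι → ℝ → ℝ} {f ft h : ℝ → ℝ}
    (hα : LI α) (hαm : Measurable α) (hb : ∀ j, LI (b j)) (hbt : ∀ j, LI (bt j)) (hf : Measurable f)
    (hft : Measurable ft) (hh : Measurable h) (x : ℝ) : Measurable (Hf lam α s b bt f ft h x) := by
  have m1 : Measurable (fun y => Dq α x y) := Dq_meas_r hα x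
  have m2 : Measurable (fun y => Pk s b x y) := Pk_meas_r (s := s) (b := b) (fun j _ => hb j) x
  have m3 : Measurable (fun y => Pk s bt x y) := Pk_meas_r (s := s) (b := bt) (fun j _ => hbt j) x
  have m4 : Measurable (fun y => Kap lam α x y) := by unfold Kap; exact (measurable_const.add m1).sub hαm
  have m5 : Measurable (fun y => Pk s b x y * f y - Pk s bt x y * ft y) := (m2.mul hf).sub (m3.mul hft)
  have m6 : Measurable (fun y => Kap lam α x y * (Pk s b x y * f y - Pk s bt x y * ft y)) := m4.mul m5
  have m7 : Measurable (fun y => Kap lam α x y * (Pk s b x y * f y - Pk s bt x y * ft y) + Pk s bt x y * h y) :=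
    m6.add (m3.mul hh)
  have m8 : Measurable (fun y : ℝ => x - y) := by fun_prop
  exact m7.div m8

set_option maxHeartbeats 1000000 in
theorem one_int {ι : Type} (s : Finset ι) (M : ℝ) (hM : 0 ≤ M) : ∃ C : ℝ, 0 < C ∧
    ∀ (lam : ℝ) (α : ℝ → ℝ) (b bt : ι → ℝ → ℝ) (f ft h : ℝ → ℝ) (l r x q R : ℝ),
    |lam| ≤ 1 → BMO1 α → Measurable α → (∀ j, LI (b j)) → (∀ j, Measurable (bt j)) → (∀ j x, |bt j x| ≤ 3) →
    Measurable f → Measurable ft → Measurable h → l < r → q = r - l → R = |x - (l + r) / 2| → 3 / 2 * q ≤ R →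
    (∀ j, ∀ y ∈ Ioc l r, |Adiff (b j) x y - Adiff (bt j) x y| ≤ 6 * q) →
    IntegrableOn f (Ioc l r) → IntegrableOn (fun y => α y * f y) (Ioc l r) →
    ∫ y in Ioc l r, |f y| ≤ 3 * q → ∫ y in Ioc l r, |α y - av α l r| * |f y| ≤ M * q →
    (∀ y ∈ Ioc l r, ft y = av f l r) → (∀ y ∈ Ioc l r, h y = av (fun y => (α y - av α l r) * f y) l r) →
    IntegrableOn (Hf lam α s b bt f ft h x) (Ioc l r) ∧
    |∫ y in Ioc l r, Hf lam α s b bt f ft h x y| ≤ C * √(q / R) ^ 3 ∧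
    ∫ y in Ioc l r, |Hf lam α s b bt f ft h x y| ≤ C * √(q / R) := by
  obtain ⟨C0, hC0, HK⟩ := Kbound
  obtain ⟨A, hAd⟩ : ∃ A : ℝ, A = 9 ^ s.card * (1 + s.card * 9) + 2 * (1 + C0) + 9 / 4 := ⟨_, rfl⟩
  have hB0 : (1:ℝ) ≤ 9 ^ s.card := one_le_pow₀ (by norm_num)
  have hA1 : 1 ≤ A := by rw [hAd]; nlinarith [(Nat.cast_nonneg s.card : (0:ℝ) ≤ s.card)]
  have hA2 : (9:ℝ) ^ s.card ≤ A := by rw [hAd]; nlinarith [(Nat.cast_nonneg s.card : (0:ℝ) ≤ s.card)]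
  have hA3 : s.card * 9 ^ s.card * 9 ≤ A := by rw [hAd]; nlinarith [(Nat.cast_nonneg s.card : (0:ℝ) ≤ s.card)]
  have hA4 : 2 * (1 + C0) ≤ A := by rw [hAd]; have : (0:ℝ) ≤ 9 ^ s.card * (1 + s.card * 9) := by positivity
                                    linarith
  have hA5 : 9 / 4 ≤ A := by rw [hAd]; have : (0:ℝ) ≤ 9 ^ s.card * (1 + s.card * 9) := by positivity
                             linarith
  refine ⟨3 * A ^ 3 * (3 + M) * (5 + M), by positivity, ?_⟩
  intro lam α b bt f ft h l r x q R hlam hα hαm hb hbtm hbt hfm hftm hhm hlr hq hR hRq hAd6 hfi hαf hf3 hfM hft hh; have hA0 : 0 < A := by linarith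
  have hq0 : 0 < q := by linarith
  have hR0 : 0 < R := by linarith
  have hbtL : ∀ j, LI (bt j) := fun j => LI_of_bdd (hbtm j) (hbt j)
  obtain ⟨t, htd⟩ : ∃ t : ℝ, t = √(q / R) := ⟨_, rfl⟩
  rw [← htd]
  have ht0 : 0 < t := by rw [htd]; exact Real.sqrt_pos.2 (by positivity)
  have ht2 : t ^ 2 = q / R := by rw [htd]; exact Real.sq_sqrt (by positivity)
  have ht23 : t ^ 2 ≤ 2 / 3 := by rw [ht2, div_le_iff₀ hR0]; linarith
  have ht1 : t ≤ 1 := by nlinarith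
  have hti : √(R / q) = 1 / t := by rw [htd, ← Real.sqrt_one, ← Real.sqrt_div (by norm_num), one_div_div]
  have hdist : ∀ y ∈ Ioc l r, 2 / 3 * R ≤ |x - y| := fun y hy => by
    have h1 : |y - (l + r) / 2| ≤ q / 2 := by rw [abs_le]; constructor <;> linarith [hy.1, hy.2]
    have h2 := abs_sub_le x y ((l + r) / 2); rw [← hR] at h2; linarith
  have hne : ∀ y ∈ Ioc l r, x ≠ y := fun y hy hxy => by have := hdist y hy; rw [hxy, sub_self, abs_zero] at this; linarith
  have hU : ∀ y ∈ Ioc l r, |1 / (x - y)| ≤ 3 / 2 * t ^ 2 / q := fun y hy => by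
    rw [abs_div, abs_one, ht2]; have := hdist y hy
    rw [show 3 / 2 * (q / R) / q = 1 / (2 / 3 * R) by field_simp]
    exact one_div_le_one_div_of_le (by positivity) this
  have hav0 : |av f l r| ≤ 3 := by
    unfold av; rw [abs_mul, abs_of_pos (by rw [← hq]; positivity), ← hq]
    rw [inv_mul_le_iff₀ hq0]; have := abs_integral_le_integral_abs (μ := volume.restrict (Ioc l r)) (f := f)
    linarith
  have hav1 : |av (fun y => (α y - av α l r) * f y) l r| ≤ M := by
    rw [av]; rw [abs_mul, abs_of_pos (by rw [← hq]; positivity), ← hq]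
    rw [inv_mul_le_iff₀ hq0]; have := abs_integral_le_integral_abs (μ := volume.restrict (Ioc l r)) (f := fun y => (α y - av α l r) * f y)
    simp only [abs_mul] at this
    linarith
  have hr : r ∈ Ioc l r := ⟨hlr, le_rfl⟩
  -- pointwise bounds
  have pDt : ∀ j y, |Dq (bt j) x y| ≤ 9 := fun j y => (Dq_bound (hbt j) x y).trans (by norm_num)
  have pDd : ∀ j, ∀ y ∈ Ioc l r, |Dq (b j) x y - Dq (bt j) x y| ≤ 9 * t ^ 2 := fun j y hy => by
    unfold Dq; rw [← sub_div, div_eq_mul_one_div, abs_mul]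
    calc _ ≤ 6 * q * (3 / 2 * t ^ 2 / q) := mul_le_mul (hAd6 j y hy) (hU y hy) (abs_nonneg _) (by positivity)
      _ = _ := by field_simp; ring
  have pDb : ∀ j, ∀ y ∈ Ioc l r, |Dq (b j) x y| ≤ 9 := fun j y hy => by
    have h1 := pDd j y hy; have h2 := Dq_bound (hbt j) x y; have h3 := abs_add_le (Dq (b j) x y - Dq (bt j) x y) (Dq (bt j) x y); rw [sub_add_cancel] at h3
    linarith
  have prodb : ∀ β : ι → ℝ, (∀ j ∈ s, |β j| ≤ 9) → |∏ j ∈ s, β j| ≤ A := fun β hβ => by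
    refine le_trans ?_ hA2
    rw [Finset.abs_prod, ← Finset.prod_const]; exact Finset.prod_le_prod (fun j _ => abs_nonneg _) fun j hj => hβ j hj
  have pPb : ∀ y ∈ Ioc l r, |Pk s b x y| ≤ A := fun y hy => prodb _ fun j _ => pDb j y hy
  have pPt : ∀ y, |Pk s bt x y| ≤ A := fun y => prodb _ fun j _ => pDt j y
  have pPd : ∀ y ∈ Ioc l r, |Pk s b x y - Pk s bt x y| ≤ A * t ^ 2 := fun y hy => by
    refine (prod_diff s (K := 9) (e := 9 * t ^ 2) (by norm_num) (by positivity) (fun j _ => pDb j y hy)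
      (fun j _ => pDt j y) (fun j _ => pDd j y hy)).trans ?_
    rw [← mul_assoc]; gcongr
  have pP0 : ∀ y ∈ Ioc l r, |Pk s bt x y - Pk s bt x r| ≤ A * t ^ 2 := fun y hy => by
    refine (prod_diff s (K := 9) (e := 9 * t ^ 2) (by norm_num) (by positivity) (fun j _ => pDt j y)
      (fun j _ => pDt j r) (fun j _ => ?_)).trans ?_
    · rw [Dq_move (hbtL j) (hne y hy) (hne r hr), div_eq_mul_one_div, abs_mul]
      have hyr : |y - r| ≤ q := by rw [abs_le]; constructor <;> linarith [hy.1, hy.2]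
      have c1 : |Dq (bt j) x r * (y - r)| ≤ 3 * q := by rw [abs_mul]; exact mul_le_mul (Dq_bound (hbt j) x r) hyr (abs_nonneg _) (by norm_num)
      have c2 : |Adiff (bt j) r y| ≤ 3 * q := by refine (Adiff_bound (hbt j) r y).trans ?_; rw [abs_sub_comm]; linarith
      have c3 := abs_add_le (Dq (bt j) x r * (y - r)) (Adiff (bt j) r y); calc _ ≤ 6 * q * (3 / 2 * t ^ 2 / q) := mul_le_mul (by linarith) (hU y hy) (abs_nonneg _) (by positivity)
        _ = _ := by field_simp; ring
    · rw [← mul_assoc]; gcongr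
  have pK : ∀ y ∈ Ioc l r, |Dq α x y - av α l r| ≤ C0 / t := fun y hy => by have := HK α hα l r x y q R hlr hq hR hRq hy; rw [hti, mul_one_div] at this; exact this
  have pk : ∀ y ∈ Ioc l r, |lam + Dq α x y - av α l r| ≤ A / t := fun y hy => by
    have h1 := pK y hy; have h2 := abs_add_le lam (Dq α x y - av α l r); rw [← add_sub_assoc] at h2; have h3 : 1 ≤ 1 / t := by rw [le_div_iff₀ ht0]; linarith
    calc _ ≤ 1 / t + C0 / t := by linarith
      _ = (1 + C0) / t := by ring
      _ ≤ A / t := by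
        refine div_le_div_of_nonneg_right ?_ ht0.le
        linarith
  have pk0 : ∀ y ∈ Ioc l r, |lam + Dq α x y - av α l r - (lam + Dq α x r - av α l r)| ≤ A * t := fun y hy => by
    have e1 : lam + Dq α x y - av α l r - (lam + Dq α x r - av α l r) =
        ((Dq α x r - av α l r) * (y - r) + (Adiff α r y - av α l r * (r - y))) / (x - y) := by
      have := Dq_move hα.li (hne y hy) (hne r hr); rw [show lam + Dq α x y - av α l r - (lam + Dq α x r - av α l r) = Dq α x y - Dq α x r by ring, this]
      congr 1; ring
    rw [e1, div_eq_mul_one_div, abs_mul]; have hyr : |y - r| ≤ q := by rw [abs_le]; constructor <;> linarith [hy.1, hy.2]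
    have c1 : |(Dq α x r - av α l r) * (y - r)| ≤ C0 / t * q := by rw [abs_mul]; exact mul_le_mul (pK r hr) hyr (abs_nonneg _) (by positivity)
    have c2 : |Adiff α r y - av α l r * (r - y)| ≤ q := by
      have e2 : Adiff α r y - av α l r * (r - y) = ∫ z in Ioc y r, (α z - av α l r) := by
        rw [integral_sub (hα.1 _ _) (by simp)]
        simp only [integral_const, MeasurableSet.univ, measureReal_restrict_apply, univ_inter, smul_eq_mul]; rw [Adiff, intervalIntegral.integral_of_le hy.2, volume_real_Ioc_of_le hy.2]
        ring
      rw [e2]; have h2 := hα.2 l r hlr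
      rw [← hq] at h2; have h3 : ∫ z in Ioc l r, |α z - av α l r| ≤ q := by rw [av, ← hq]; exact h2
      refine (abs_integral_le_integral_abs).trans (le_trans ?_ h3)
      refine setIntegral_mono_set ?_ (ae_of_all _ fun z => abs_nonneg (α z - av α l r)) (Ioc_subset_Ioc_left hy.1.le).eventuallyLE
      exact ((hα.1 l r).sub (by simp)).abs
    have c3 := abs_add_le ((Dq α x r - av α l r) * (y - r)) (Adiff α r y - av α l r * (r - y)); have c4 : C0 / t * q + q ≤ (1 + C0) / t * q := by
      have h3 : 1 ≤ 1 / t := by rw [le_div_iff₀ ht0]; linarith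
      have : (1 + C0) / t * q = C0 / t * q + 1 / t * q := by ring
      rw [this]; nlinarith
    calc _ ≤ (1 + C0) / t * q * (3 / 2 * t ^ 2 / q) := mul_le_mul (by linarith) (hU y hy) (abs_nonneg _) (by positivity)
      _ = (1 + C0) * (3 / 2) * t := by field_simp
      _ ≤ A * t := by gcongr; linarith
  have pU : ∀ y ∈ Ioc l r, |1 / (x - y)| ≤ A * t ^ 2 / q := fun y hy => by refine (hU y hy).trans ?_; gcongr; linarith
  have pU0 : ∀ y ∈ Ioc l r, |1 / (x - y) - 1 / (x - r)| ≤ A * t ^ 4 / q := fun y hy => by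
    have h1 := sub_ne_zero.2 (hne y hy); have h2 := sub_ne_zero.2 (hne r hr); have e1 : 1 / (x - y) - 1 / (x - r) = (y - r) * (1 / (x - y)) * (1 / (x - r)) := by field_simp; ring
    have hyr : |y - r| ≤ q := by rw [abs_le]; constructor <;> linarith [hy.1, hy.2]
    rw [e1, abs_mul, abs_mul]; calc _ ≤ q * (3 / 2 * t ^ 2 / q) * (3 / 2 * t ^ 2 / q) := by refine mul_le_mul (mul_le_mul hyr (hU y hy) (abs_nonneg _) hq0.le) (hU r hr) (abs_nonneg _) (by positivity)
      _ = 9 / 4 * t ^ 4 / q := by field_simp; ring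
      _ ≤ _ := by gcongr
  -- rewriting of H
  have eH : ∀ y ∈ Ioc l r, Hf lam α s b bt f ft h x y =
      (((lam + Dq α x y - av α l r) - (α y - av α l r)) * (Pk s b x y * f y - Pk s bt x y * av f l r) +
        Pk s bt x y * av (fun y => (α y - av α l r) * f y) l r) * (1 / (x - y)) := by
    intro y hy; unfold Hf Kap
    rw [hft y hy, hh y hy]; ring
  -- dominating function
  have hαI : IntegrableOn (fun y => |α y - av α l r|) (Ioc l r) := ((hα.1 l r).sub (by simp)).abs
  have hfI : IntegrableOn (fun y => |f y|) (Ioc l r) := hfi.abs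
  have hαfI0 : IntegrableOn (fun y => (α y - av α l r) * f y) (Ioc l r) := by
    have : (fun y => (α y - av α l r) * f y) = fun y => α y * f y - av α l r * f y := by ext y; ring
    rw [this]; exact hαf.sub (hfi.const_mul _)
  have hαfI : IntegrableOn (fun y => |α y - av α l r| * |f y|) (Ioc l r) := by simp_rw [← abs_mul]; exact hαfI0.abs
  have hconst : IntegrableOn (fun _ : ℝ => (1:ℝ)) (Ioc l r) := by simp
  have hDe : (fun y => (1 + |α y - av α l r|) * (|f y| + 1)) =
      fun y => ((|f y| + 1) + |α y - av α l r| * |f y|) + |α y - av α l r| := by ext y; ring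
  have s1 : IntegrableOn (fun y => |f y| + 1) (Ioc l r) := hfI.add hconst
  have s2 : IntegrableOn (fun y => (|f y| + 1) + |α y - av α l r| * |f y|) (Ioc l r) := s1.add hαfI
  have hDI : IntegrableOn (fun y => (1 + |α y - av α l r|) * (|f y| + 1)) (Ioc l r) := by rw [hDe]; exact s2.add hαI
  have hD : ∫ y in Ioc l r, (1 + |α y - av α l r|) * (|f y| + 1) ≤ (5 + M) * q := by
    rw [hDe, integral_add s2 hαI, integral_add s1 hαfI, integral_add hfI hconst]; have h2 : ∫ y in Ioc l r, |α y - av α l r| ≤ q := hq ▸ hα.2 l r hlr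
    simp only [integral_const, MeasurableSet.univ, measureReal_restrict_apply, univ_inter, smul_eq_mul, mul_one]; rw [volume_real_Ioc_of_le hlr.le]
    linarith
  have hHm := Hf_meas (lam := lam) (s := s) hα.li hαm hb hbtL hfm hftm hhm x
  have hsz : ∀ y ∈ Ioc l r, |Hf lam α s b bt f ft h x y| ≤
      (3 + M) * A ^ 3 * t / q * ((1 + |α y - av α l r|) * (|f y| + 1)) := by
    intro y hy; rw [eH y hy]
    exact alg_size ht0 ht1 hq0 hA1 hM (pk y hy) (pPb y hy) (pPt y) (pU y hy) hav0 hav1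
  have hHI : IntegrableOn (Hf lam α s b bt f ft h x) (Ioc l r) := by
    refine Integrable.mono' (hDI.const_mul ((3 + M) * A ^ 3 * t / q)) hHm.aestronglyMeasurable ?_; filter_upwards [ae_restrict_mem measurableSet_Ioc] with y hy
    exact hsz y hy
  refine ⟨hHI, ?_, ?_⟩
  · set k0 := lam + Dq α x r - av α l r with hk0
    set P0 := Pk s bt x r with hP0
    set U0 := 1 / (x - r) with hU0
    set fI := av f l r with hfId
    set hI := av (fun y => (α y - av α l r) * f y) l r with hhI
    set αI := av α l r with hαId
    have z1i : IntegrableOn (fun y => f y - fI) (Ioc l r) := hfi.sub (by simp)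
    have z2i : IntegrableOn (fun y => (α y - αI) * (f y - fI) - hI) (Ioc l r) := by
      have e : (fun y => (α y - αI) * (f y - fI) - hI) = fun y => ((α y - αI) * f y - fI * (α y - αI)) - hI := by ext y; ring
      rw [e]; exact (hαfI0.sub (((hα.1 l r).sub (by simp)).const_mul _)).sub (by simp)
    have avz : ∀ g : ℝ → ℝ, IntegrableOn g (Ioc l r) → ∫ y in Ioc l r, (g y - av g l r) = 0 := fun g hg => by
      rw [integral_sub hg (by simp)]
      simp only [integral_const, MeasurableSet.univ, measureReal_restrict_apply, univ_inter, smul_eq_mul]; rw [volume_real_Ioc_of_le hlr.le, av, mul_inv_cancel_left₀ (by linarith), sub_self]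
    have z1 : ∫ y in Ioc l r, (f y - fI) = 0 := avz f hfi
    have z2 : ∫ y in Ioc l r, ((α y - αI) * (f y - fI) - hI) = 0 := by
      have e : (fun y => (α y - αI) * (f y - fI) - hI) = fun y => ((α y - αI) * f y - hI) - fI * (α y - αI) := by ext y; ring
      have i1 : IntegrableOn (fun y => (α y - αI) * f y - hI) (Ioc l r) := hαfI0.sub (by simp)
      have i2 : IntegrableOn (fun y => fI * (α y - αI)) (Ioc l r) := ((hα.1 l r).sub (by simp)).const_mul _
      rw [e, integral_sub i1 i2, avz _ hαfI0, integral_const_mul, avz α (hα.1 l r)]; simp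
    have eqI : ∫ y in Ioc l r, Hf lam α s b bt f ft h x y = ∫ y in Ioc l r,
        (Hf lam α s b bt f ft h x y - k0 * P0 * U0 * (f y - fI) + P0 * U0 * ((α y - αI) * (f y - fI) - hI)) := by
      have i1 : IntegrableOn (fun y => k0 * P0 * U0 * (f y - fI)) (Ioc l r) := z1i.const_mul _
      have i2 : IntegrableOn (fun y => P0 * U0 * ((α y - αI) * (f y - fI) - hI)) (Ioc l r) := z2i.const_mul _
      have i3 : IntegrableOn (fun y => Hf lam α s b bt f ft h x y - k0 * P0 * U0 * (f y - fI)) (Ioc l r) := hHI.sub i1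
      rw [integral_add i3 i2, integral_sub hHI i1, integral_const_mul, integral_const_mul, z1, z2]; simp
    rw [eqI]; have hbd : ∀ y ∈ Ioc l r, ‖Hf lam α s b bt f ft h x y - k0 * P0 * U0 * (f y - fI) +
        P0 * U0 * ((α y - αI) * (f y - fI) - hI)‖ ≤
        3 * A ^ 3 * t ^ 3 / q * (3 + M) * ((1 + |α y - αI|) * (|f y| + 1)) := by
      intro y hy; rw [eH y hy, norm_eq_abs]
      refine (alg_main ht0 ht1 hq0 hA1 (pk y hy) (pk r hr) (pPd y hy) (pPt y) (pPt r) (pU y hy) (pk0 y hy)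
        (pP0 y hy) (pU0 y hy)).trans ?_
      rw [mul_assoc _ (3 + M)]; refine mul_le_mul_of_nonneg_left ?_ (by positivity)
      generalize α y - αI = a
      generalize f y = g
      have c1 : |g - fI| ≤ |g| + 3 := (abs_sub _ _).trans (by linarith)
      have c2 : |a * (g - fI) - hI| ≤ |a| * (|g| + 3) + M := by
        refine (abs_sub _ _).trans ?_; rw [abs_mul]
        exact add_le_add (mul_le_mul_of_nonneg_left c1 (abs_nonneg _)) hav1
      have c3 := abs_nonneg a; have c4 := abs_nonneg g; have c5 := mul_nonneg c3 c4; nlinarith [mul_nonneg hM c3, mul_nonneg hM c4, mul_nonneg hM c5]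
    have hn := norm_integral_le_of_norm_le (μ := volume.restrict (Ioc l r)) (hDI.const_mul (3 * A ^ 3 * t ^ 3 / q * (3 + M)))
      ((ae_restrict_mem measurableSet_Ioc).mono hbd)
    rw [norm_eq_abs, integral_const_mul] at hn; refine hn.trans ?_
    calc _ ≤ 3 * A ^ 3 * t ^ 3 / q * (3 + M) * ((5 + M) * q) := mul_le_mul_of_nonneg_left hD (by positivity)
      _ = _ := by field_simp
  · calc _ ≤ ∫ y in Ioc l r, (3 + M) * A ^ 3 * t / q * ((1 + |α y - av α l r|) * (|f y| + 1)) := by refine setIntegral_mono_on hHI.abs (hDI.const_mul _) measurableSet_Ioc hsz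
      _ ≤ (3 + M) * A ^ 3 * t / q * ((5 + M) * q) := by rw [integral_const_mul]; exact mul_le_mul_of_nonneg_left hD (by positivity)
      _ = 1 * ((3 + M) * A ^ 3 * t * (5 + M)) := by field_simp
      _ ≤ 3 * ((3 + M) * A ^ 3 * t * (5 + M)) := mul_le_mul_of_nonneg_right (by norm_num) (by positivity)
      _ = _ := by ring

theorem ind_sum {κ : Type} {l r : κ → ℝ} (hdisj : Pairwise (fun i j => Disjoint (Ioc (l i) (r i)) (Ioc (l j) (r j))))
    {c : κ → ℝ} {M : ℝ} (hc0 : ∀ i, 0 ≤ c i) (hcM : ∀ i, c i ≤ M) (hM : 0 ≤ M) (p : ℝ) :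
    ∃ S ≤ M, HasSum (fun i => (Ioc (l i) (r i)).indicator (fun _ => c i) p) S := by
  by_cases h : ∃ i, p ∈ Ioc (l i) (r i)
  · obtain ⟨i, hi⟩ := h
    refine ⟨c i, hcM i, ?_⟩; have := hasSum_single (f := fun j => (Ioc (l j) (r j)).indicator (fun _ => c j) p) i (fun j hj => by
      refine indicator_of_notMem (fun hj' => ?_) _
      exact (Set.disjoint_left.1 (hdisj hj)) hj' hi)
    simpa [indicator_of_mem hi] using this
  · refine ⟨0, hM, ?_⟩
    have : (fun i => (Ioc (l i) (r i)).indicator (fun _ => c i) p) = fun _ => 0 := by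
      ext i
      exact indicator_of_notMem (fun hj' => h ⟨i, hj'⟩) _
    rw [this]; exact hasSum_zero

set_option maxHeartbeats 1000000 in
theorem sumS {κ : Type} [Countable κ] {l r : κ → ℝ}
    (hdisj : Pairwise (fun i j => Disjoint (Ioc (l i) (r i)) (Ioc (l j) (r j))))
    {H : ℝ → ℝ} {x C : ℝ} (hC : 0 < C) {σ : κ → ℝ} (hσ0 : ∀ i, 0 ≤ σ i) (hσ1 : ∀ i, σ i ≤ 1)
    (hHT : ∀ ε > 0, IntegrableOn H {y | ε < |x - y|})
    (hH0 : ∀ᵐ y, y ∉ ⋃ i, Ioc (l i) (r i) → H y = 0)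
    (hI : ∀ i, IntegrableOn H (Ioc (l i) (r i)))
    (h1 : ∀ i, |∫ y in Ioc (l i) (r i), H y| ≤ C * σ i ^ 3)
    (h2 : ∀ i, ∫ y in Ioc (l i) (r i), |H y| ≤ C * σ i)
    (hd : ∀ i, ∃ ρ > 0, ∀ y ∈ Ioc (l i) (r i), ρ ≤ |x - y|) :
    (∀ ε > 0, ofReal |∫ y in {y | ε < |x - y|}, H y| ≤
      ofReal C * ((∑' i, ofReal (σ i ^ 3)) + 2)) ∧
    ((∑' i, ofReal (σ i ^ 3)) ≠ ⊤ →
      ∃ L, Tendsto (fun ε => ∫ y in {y | ε < |x - y|}, H y) (𝓝[>] 0) (𝓝 L)) := by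
  set I : κ → Set ℝ := fun i => Ioc (l i) (r i) with hIdef
  set T : ℝ → Set ℝ := fun ε => {y | ε < |x - y|} with hTdef
  have hTm : ∀ ε, MeasurableSet (T ε) := fun ε => meas_trunc x ε
  have hIm : ∀ i, MeasurableSet (I i) := fun i => measurableSet_Ioc
  set d : ℝ → κ → ℝ := fun ε i => ∫ y in T ε ∩ I i, H y with hddef
  have hsum : ∀ ε > 0, HasSum (d ε) (∫ y in T ε, H y) := fun ε hε => by
    have e1 : ∫ y in T ε, H y = ∫ y in ⋃ i, T ε ∩ I i, H y := by
      rw [← inter_iUnion]; refine setIntegral_eq_of_subset_of_ae_sdiff_eq_zero (hTm ε).nullMeasurableSet inter_subset_left ?_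
      filter_upwards [hH0] with y hy hy2
      refine hy fun h => hy2.2 ⟨hy2.1, h⟩
    rw [e1]; refine hasSum_integral_iUnion (fun i => (hTm ε).inter (hIm i)) (fun i j hij => ?_) ?_
    · exact (hdisj hij).mono inter_subset_right inter_subset_right
    · exact (hHT ε hε).mono_set (iUnion_subset fun i => inter_subset_left)
  -- term bounds
  have hd1 : ∀ ε i, I i ⊆ T ε → d ε i = ∫ y in I i, H y := fun ε i h => by simp only [hddef, inter_eq_right.2 h]
  have hdb : ∀ ε i, |d ε i| ≤ C * σ i ^ 3 + C * ((I i).indicator (fun _ => σ i) (x - ε) +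
      (I i).indicator (fun _ => σ i) (x + ε)) := by
    intro ε i; have n1 : 0 ≤ (I i).indicator (fun _ => σ i) (x - ε) := indicator_nonneg (fun _ _ => hσ0 i) _
    have n2 : 0 ≤ (I i).indicator (fun _ => σ i) (x + ε) := indicator_nonneg (fun _ _ => hσ0 i) _
    have n3 : 0 ≤ C * σ i ^ 3 := mul_nonneg hC.le (pow_nonneg (hσ0 i) 3)
    by_cases h : I i ⊆ T ε
    · rw [hd1 ε i h]
      refine (h1 i).trans ?_; have : 0 ≤ C * ((I i).indicator (fun _ => σ i) (x - ε) + (I i).indicator (fun _ => σ i) (x + ε)) := by positivity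
      linarith
    · by_cases h' : T ε ∩ I i = ∅
      · simp only [hddef, h']
        simp
        positivity
      · obtain ⟨y', hy'I, hy'T⟩ := not_subset.1 h
        obtain ⟨y, hyT, hyI⟩ := nonempty_iff_ne_empty.2 h'
        have hb : |d ε i| ≤ C * σ i := by
          refine (abs_integral_le_integral_abs).trans (le_trans ?_ (h2 i))
          exact setIntegral_mono_set (hI i).abs (ae_of_all _ fun z => abs_nonneg (H z)) inter_subset_right.eventuallyLE
        have hT1 : ε < |x - y| := hyT
        have hT2 : |x - y'| ≤ ε := not_lt.1 hy'T
        rw [abs_le] at hT2; rcases lt_abs.1 hT1 with h3 | h3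
        · have : x - ε ∈ I i := ⟨by linarith [hyI.1], by linarith [hy'I.2]⟩
          rw [indicator_of_mem this]; nlinarith
        · have : x + ε ∈ I i := ⟨by linarith [hy'I.1], by linarith [hyI.2]⟩
          rw [indicator_of_mem this]; nlinarith
  have hsumm : (∑' i, ofReal (σ i ^ 3)) ≠ ⊤ → Summable (fun i => σ i ^ 3) := fun h => by have := ENNReal.summable_toReal h; simpa [ENNReal.toReal_ofReal (pow_nonneg (hσ0 _) 3)] using this
  constructor
  · intro ε hε
    by_cases hE : (∑' i, ofReal (σ i ^ 3)) = ⊤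
    · rw [hE]; simp [hC]
    have hs := hsumm hE; obtain ⟨S1, hS1, hh1⟩ := ind_sum hdisj hσ0 hσ1 zero_le_one (x - ε); obtain ⟨S2, hS2, hh2⟩ := ind_sum hdisj hσ0 hσ1 zero_le_one (x + ε)
    have hb := HasSum.norm_le_of_bounded (hsum ε hε) ((hs.hasSum.mul_left C).add ((hh1.add hh2).mul_left C)) (hdb ε); rw [← ENNReal.ofReal_tsum_of_nonneg (fun i => pow_nonneg (hσ0 i) 3) hs, show (2 : ℝ≥0∞) = ofReal 2 by norm_num,
      ← ofReal_add (tsum_nonneg fun i => pow_nonneg (hσ0 i) 3) (by norm_num), ← ofReal_mul hC.le]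
    refine ofReal_le_ofReal ?_; rw [norm_eq_abs] at hb
    refine hb.trans ?_; rw [← mul_add]
    refine mul_le_mul_of_nonneg_left ?_ hC.le
    linarith
  · intro hE
    have hs := hsumm hE; rw [← cauchy_map_iff_exists_tendsto, Metric.cauchy_iff]; refine ⟨inferInstance, fun e he => ?_⟩
    obtain ⟨η, hη0, hη1, hηe⟩ : ∃ η : ℝ, 0 < η ∧ η ≤ 1 ∧ 6 * C * η < e := by
      refine ⟨min 1 (e / (12 * C)), by positivity, min_le_left _ _, ?_⟩
      calc 6 * C * min 1 (e / (12 * C)) ≤ 6 * C * (e / (12 * C)) := by gcongr; exact min_le_right _ _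
        _ = e / 2 := by field_simp; norm_num
        _ < e := by linarith
    classical
    obtain ⟨F, hF⟩ : ∃ F : Finset κ, |∑ i ∈ F, σ i ^ 3 - ∑' i, σ i ^ 3| < η ^ 3 := by
      have := (Metric.tendsto_nhds.1 hs.hasSum (η ^ 3) (by positivity)).exists
      simpa [dist_eq] using this
    set w : κ → ℝ := fun i => if i ∈ F then 0 else σ i with hw
    have hw0 : ∀ i, 0 ≤ w i := by intro i; simp only [hw]; split_ifs <;> simp [hσ0]
    have hws : HasSum (fun i => w i ^ 3) (∑' i, σ i ^ 3 - ∑ i ∈ F, σ i ^ 3) := by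
      have h3 : HasSum (fun i => if i ∈ F then σ i ^ 3 else 0) (∑ i ∈ F, σ i ^ 3) := by
        have : HasSum (fun i => if i ∈ F then σ i ^ 3 else 0) (∑ i ∈ F, if i ∈ F then σ i ^ 3 else 0) :=
          hasSum_sum_of_ne_finset_zero (fun i hi => by simp [hi])
        rwa [Finset.sum_congr rfl (fun i hi => if_pos hi)] at this
      have h4 := hs.hasSum.sub h3; have e4 : (fun i => w i ^ 3) = fun i => σ i ^ 3 - if i ∈ F then σ i ^ 3 else 0 := by
        funext i
        by_cases hi : i ∈ F <;> simp [hw, hi]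
      rw [e4]; exact h4
    have hwS : ∑' i, σ i ^ 3 - ∑ i ∈ F, σ i ^ 3 ≤ η ^ 3 := by rw [abs_sub_comm] at hF; exact (le_abs_self _).trans hF.le
    have hwη : ∀ i, w i ≤ η := fun i => by
      have := le_hasSum hws i (fun j _ => pow_nonneg (hw0 j) 3)
      exact le_of_pow_le_pow_left₀ (by norm_num : 3 ≠ 0) hη0.le (this.trans hwS)
    -- eventually no F interval is cut
    have hev : ∀ᶠ ε in 𝓝[>] (0:ℝ), 0 < ε ∧ ∀ i ∈ F, I i ⊆ T ε := by
      refine (eventually_mem_nhdsWithin).and ?_; rw [Finset.eventually_all]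
      intro i _; obtain ⟨ρ, hρ, hρ2⟩ := hd i
      have : ∀ᶠ ε in 𝓝[>] (0:ℝ), ε < ρ := eventually_nhdsWithin_of_eventually_nhds (eventually_lt_nhds hρ)
      filter_upwards [this] with ε hε y hy
      exact lt_of_lt_of_le hε (hρ2 y hy)
    refine ⟨(fun ε => ∫ y in T ε, H y) '' {ε | 0 < ε ∧ ∀ i ∈ F, I i ⊆ T ε}, image_mem_map hev, ?_⟩
    rintro _ ⟨ε, ⟨hε, hεF⟩, rfl⟩ _ ⟨ε', ⟨hε', hεF'⟩, rfl⟩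
    have hws1 : ∀ i, w i ≤ 1 := fun i => (hwη i).trans hη1
    obtain ⟨S1, hS1, hh1⟩ := ind_sum hdisj hw0 hwη hη0.le (x - ε)
    obtain ⟨S2, hS2, hh2⟩ := ind_sum hdisj hw0 hwη hη0.le (x + ε)
    obtain ⟨S3, hS3, hh3⟩ := ind_sum hdisj hw0 hwη hη0.le (x - ε')
    obtain ⟨S4, hS4, hh4⟩ := ind_sum hdisj hw0 hwη hη0.le (x + ε')
    have hb := HasSum.norm_le_of_bounded ((hsum ε hε).sub (hsum ε' hε'))
      (((hws.mul_left C).add ((hh1.add hh2).mul_left C)).add ((hws.mul_left C).add ((hh3.add hh4).mul_left C)))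
      (fun i => ?_)
    · rw [dist_eq]
      rw [norm_eq_abs] at hb; refine lt_of_le_of_lt hb ?_
      have hη3 : η ^ 3 ≤ η := pow_le_of_le_one hη0.le hη1 (by norm_num)
      set W := ∑' i, σ i ^ 3 - ∑ i ∈ F, σ i ^ 3 with hW
      have e1 : C * W + C * (S1 + S2) + (C * W + C * (S3 + S4)) = C * (2 * W + S1 + S2 + S3 + S4) := by ring
      rw [e1]; refine lt_of_le_of_lt (mul_le_mul_of_nonneg_left (?_ : _ ≤ 6 * η) hC.le) (by linarith)
      linarith
    · rw [norm_eq_abs]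
      by_cases hi : i ∈ F
      · rw [hd1 ε i (hεF i hi), hd1 ε' i (hεF' i hi), sub_self, abs_zero]
        have n : ∀ p, 0 ≤ (Ioc (l i) (r i)).indicator (fun _ => w i) p := fun p => indicator_nonneg (fun _ _ => hw0 i) _
        have := n (x - ε); have := n (x + ε); have := n (x - ε'); have := n (x + ε'); have := pow_nonneg (hw0 i) 3; positivity
      · have hwi : w i = σ i := by simp [hw, hi]
        rw [hwi]; exact (abs_sub _ _).trans (add_le_add (hdb ε i) (hdb ε' i))

noncomputable def pw {κ : Type} (l r : κ → ℝ) (c : κ → ℝ) (g : ℝ → ℝ) (x : ℝ) : ℝ :=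
  open Classical in if h : ∃ i, x ∈ Ioc (l i) (r i) then c h.choose else g x

theorem pw_mem {κ : Type} {l r : κ → ℝ} (hdisj : Pairwise (fun i j => Disjoint (Ioc (l i) (r i)) (Ioc (l j) (r j))))
    (c : κ → ℝ) (g : ℝ → ℝ) {x : ℝ} {i : κ} (hx : x ∈ Ioc (l i) (r i)) : pw l r c g x = c i := by
  unfold pw; have h : ∃ i, x ∈ Ioc (l i) (r i) := ⟨i, hx⟩
  rw [dif_pos h]
  congr 1
  by_contra hne
  exact Set.disjoint_left.1 (hdisj hne) h.choose_spec hx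

theorem pw_off {κ : Type} {l r : κ → ℝ} (c : κ → ℝ) (g : ℝ → ℝ) {x : ℝ} (hx : x ∉ ⋃ i, Ioc (l i) (r i)) :
    pw l r c g x = g x := by
  unfold pw; rw [dif_neg]
  simpa using hx

theorem pw_meas {κ : Type} [Countable κ] {l r : κ → ℝ}
    (hdisj : Pairwise (fun i j => Disjoint (Ioc (l i) (r i)) (Ioc (l j) (r j))))
    (c : κ → ℝ) {g : ℝ → ℝ} (hg : Measurable g) : Measurable (pw l r c g) := by
  intro t ht; have : pw l r c g ⁻¹' t = (⋃ i, Ioc (l i) (r i) ∩ {_x | c i ∈ t}) ∪ ((⋃ i, Ioc (l i) (r i))ᶜ ∩ g ⁻¹' t) := by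
    ext x
    by_cases hx : x ∈ ⋃ i, Ioc (l i) (r i)
    · obtain ⟨i, hi⟩ := mem_iUnion.1 hx
      rw [mem_preimage, pw_mem hdisj c g hi]; constructor
      · intro h; exact Or.inl (mem_iUnion.2 ⟨i, hi, h⟩)
      · rintro (h | h)
        · obtain ⟨j, hj, hjt⟩ := mem_iUnion.1 h
          rcases eq_or_ne i j with rfl | hne
          · exact hjt
          · exact (Set.disjoint_left.1 (hdisj hne) hi hj).elim
        · exact (h.1 hx).elim
    · rw [mem_preimage, pw_off c g hx]
      constructor
      · intro h; exact Or.inr ⟨hx, h⟩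
      · rintro (h | h)
        · obtain ⟨j, hj, hjt⟩ := mem_iUnion.1 h
          exact (hx (mem_iUnion.2 ⟨j, hj⟩)).elim
        · exact h.2
  rw [this]
  refine (MeasurableSet.iUnion fun i => measurableSet_Ioc.inter (MeasurableSet.const _)).union
    ((MeasurableSet.iUnion fun i => measurableSet_Ioc).compl.inter (hg ht))

theorem pw_bound {κ : Type} {l r : κ → ℝ}
    (hdisj : Pairwise (fun i j => Disjoint (Ioc (l i) (r i)) (Ioc (l j) (r j))))
    {c : κ → ℝ} {g : ℝ → ℝ} {M : ℝ} (hc : ∀ i, l i < r i → |c i| ≤ M) (hg : ∀ x, |g x| ≤ M) (x : ℝ) : |pw l r c g x| ≤ M := by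
  by_cases hx : x ∈ ⋃ i, Ioc (l i) (r i)
  · obtain ⟨i, hi⟩ := mem_iUnion.1 hx
    rw [pw_mem hdisj c g hi]; exact hc i (hi.1.trans_le hi.2)
  · rw [pw_off c g hx]; exact hg x

theorem canc_eq {κ : Type} [Countable κ] {l r : κ → ℝ}
    (hdisj : Pairwise (fun i j => Disjoint (Ioc (l i) (r i)) (Ioc (l j) (r j))))
    {g : ℝ → ℝ} (hg : LI g) (hg0 : ∀ᵐ x, x ∉ ⋃ i, Ioc (l i) (r i) → g x = 0)
    (hgI : ∀ i, ∫ x in Ioc (l i) (r i), g x = 0) {x y : ℝ} (i0 : κ)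
    (hx : ∀ i, i ≠ i0 → x ∉ Ioc (l i) (r i)) (hy : ∀ i, i ≠ i0 → y ∉ Ioc (l i) (r i)) :
    ∫ t in Ioc y x, g t = ∫ t in Ioc y x ∩ Ioc (l i0) (r i0), g t := by
  have e1 : ∫ t in Ioc y x, g t = ∫ t in ⋃ i, (Ioc y x ∩ Ioc (l i) (r i)), g t := by
    refine setIntegral_eq_of_subset_of_ae_sdiff_eq_zero (measurableSet_Ioc (a := y) (b := x)).nullMeasurableSet
      (iUnion_subset fun i => inter_subset_left) ?_
    filter_upwards [hg0] with t ht ht2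
    refine ht fun h => ht2.2 ?_
    rw [← inter_iUnion]; exact ⟨ht2.1, h⟩
  have hs := hasSum_integral_iUnion (μ := volume) (f := g) (s := fun i => Ioc y x ∩ Ioc (l i) (r i))
    (fun i => measurableSet_Ioc.inter measurableSet_Ioc)
    (fun i j hij => (hdisj hij).mono inter_subset_right inter_subset_right)
    ((hg.on y x).mono_set (iUnion_subset fun i => inter_subset_left))
  rw [e1]
  refine hs.unique (hasSum_single i0 fun i hi => ?_)
  have h1 := hx i hi
  have h2 := hy i hi
  by_cases h : (Ioc y x ∩ Ioc (l i) (r i)).Nonempty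
  · obtain ⟨t, ht1, ht2⟩ := h
    have : Ioc y x ∩ Ioc (l i) (r i) = Ioc (l i) (r i) := by
      rw [inter_eq_right]; simp only [mem_Ioc, not_and_or, not_lt, not_le] at h1 h2
      intro z hz; constructor
      · rcases h2 with h | h
        · exact h.trans_lt hz.1
        · linarith [ht1.1, ht2.2]
      · rcases h1 with h | h
        · linarith [ht1.2, ht2.1]
        · exact hz.2.trans h.le
    simp only [this]; exact hgI i
  · rw [not_nonempty_iff_eq_empty] at h
    simp [h]

theorem canc {κ : Type} [Countable κ] {l r : κ → ℝ}
    (hdisj : Pairwise (fun i j => Disjoint (Ioc (l i) (r i)) (Ioc (l j) (r j))))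
    {g : ℝ → ℝ} (hg : LI g) (hg0 : ∀ᵐ x, x ∉ ⋃ i, Ioc (l i) (r i) → g x = 0)
    (hgI : ∀ i, ∫ x in Ioc (l i) (r i), g x = 0) {x : ℝ} (hx : x ∉ ⋃ i, Ioc (l i) (r i)) (y : ℝ) (i0 : κ)
    (hy : ∀ i, i ≠ i0 → y ∉ Ioc (l i) (r i)) :
    |Adiff g x y| ≤ ∫ t in Ioc (l i0) (r i0), |g t| := by
  have hx' : ∀ i, x ∉ Ioc (l i) (r i) := fun i h => hx (mem_iUnion.2 ⟨i, h⟩)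
  have key : ∀ A : Set ℝ, |∫ t in A ∩ Ioc (l i0) (r i0), g t| ≤ ∫ t in Ioc (l i0) (r i0), |g t| := fun A => by
    refine (abs_integral_le_integral_abs).trans ?_; exact setIntegral_mono_set (hg.on _ _).abs (ae_of_all _ fun z => abs_nonneg (g z)) inter_subset_right.eventuallyLE
  unfold Adiff; rcases le_total y x with h | h
  · rw [intervalIntegral.integral_of_le h, canc_eq hdisj hg hg0 hgI i0 (fun i _ => hx' i) hy]
    exact key _
  · rw [intervalIntegral.integral_of_ge h, canc_eq hdisj hg hg0 hgI i0 hy (fun i _ => hx' i), abs_neg]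
    exact key _

theorem canc0 {κ : Type} [Countable κ] {l r : κ → ℝ}
    (hdisj : Pairwise (fun i j => Disjoint (Ioc (l i) (r i)) (Ioc (l j) (r j))))
    {g : ℝ → ℝ} (hg : LI g) (hg0 : ∀ᵐ x, x ∉ ⋃ i, Ioc (l i) (r i) → g x = 0)
    (hgI : ∀ i, ∫ x in Ioc (l i) (r i), g x = 0) {x y : ℝ} (hx : x ∉ ⋃ i, Ioc (l i) (r i)) 
    (hy : y ∉ ⋃ i, Ioc (l i) (r i)) : Adiff g x y = 0 := by
  -- add an empty interval
  have hx' : ∀ i, x ∉ Ioc (l i) (r i) := fun i h => hx (mem_iUnion.2 ⟨i, h⟩)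
  have hy' : ∀ i, y ∉ Ioc (l i) (r i) := fun i h => hy (mem_iUnion.2 ⟨i, h⟩)
  have := canc (κ := Option κ) (l := fun o => o.elim 0 l) (r := fun o => o.elim 0 r) ?_ hg ?_ ?_ (x := x) ?_ y none ?_
  · simpa using this
  · rintro (_ | i) (_ | j) hij
    · exact (hij rfl).elim
    · simp
    · simp
    · exact hdisj fun h => hij (by rw [h])
  · simpa [iUnion_option] using hg0
  · rintro (_ | i)
    · simp
    · exact hgI i
  · simpa [iUnion_option] using hx
  · rintro (_ | i) h
    · exact (h rfl).elim
    · exact hy' i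

noncomputable def Eg (l r : ℕ × ℕ → ℝ) (x : ℝ) : ℝ≥0∞ :=
  ∑' i, ofReal (√((r i - l i) / |x - (l i + r i) / 2|) ^ 3)

/-- good points -/
def Good (l r : ℕ × ℕ → ℝ) : Set ℝ := {x | (∀ i, 3 / 2 * (r i - l i) ≤ |x - (l i + r i) / 2|) ∧ Eg l r x ≤ 1}

theorem Eg_meas (l r : ℕ × ℕ → ℝ) : Measurable (Eg l r) := by unfold Eg; exact Measurable.tsum fun i => by fun_prop

theorem one_tail {q : ℝ} (hq : 0 ≤ q) (c : ℝ) :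
    ∫⁻ x in {x | 3 / 2 * q ≤ |x - c|}, ofReal (√(q / |x - c|) ^ 3) ≤ ofReal (4 * q) := by
  rcases hq.eq_or_lt with rfl | hq
  · simp
  set ψ : ℝ → ℝ≥0∞ := (Ioi q).indicator (fun t => ofReal (q ^ (3/2 : ℝ)) * ofReal (t ^ (-(3/2) : ℝ))) with hψ
  have hψi : ∫⁻ t, ψ t = ofReal (2 * q) := by
    rw [hψ, lintegral_indicator measurableSet_Ioi, lintegral_const_mul' _ _ (by simp),
      tail_rpow (by norm_num) hq, ← ofReal_mul (by positivity)]
    congr 1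
    have e : q ^ (3/2 : ℝ) * q ^ (-(1/2) : ℝ) = q := by rw [← Real.rpow_add hq, show (3/2 : ℝ) + -(1/2) = 1 by norm_num, Real.rpow_one]
    rw [show (-(3/2) : ℝ) + 1 = -(1/2) by norm_num, neg_div_neg_eq]
    linear_combination 2 * e
  have hpt : ∀ t, q < t → ψ t = ofReal (√(q / t) ^ 3) := fun t ht => by
    have ht0 : 0 < t := hq.trans ht
    rw [hψ, indicator_of_mem (show t ∈ Ioi q from ht), ← ofReal_mul (by positivity), Real.rpow_neg ht0.le,
      ← div_eq_mul_inv, ← Real.div_rpow hq.le ht0.le, Real.sqrt_eq_rpow, ← Real.rpow_natCast, ← Real.rpow_mul (by positivity)]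
    norm_num
  have hle : ∫⁻ x in {x | 3 / 2 * q ≤ |x - c|}, ofReal (√(q / |x - c|) ^ 3) ≤ ∫⁻ x, (ψ (x - c) + ψ (c - x)) := by
    refine le_trans (setLIntegral_mono' (g := fun x => ψ (x - c) + ψ (c - x)) ?_ fun x hx => ?_) (setLIntegral_le_lintegral _ _)
    · exact measurableSet_le measurable_const (by fun_prop)
    · have hx' : q < |x - c| := lt_of_lt_of_le (by linarith) (show 3 / 2 * q ≤ |x - c| from hx)
      rcases le_total 0 (x - c) with h | h
      · rw [abs_of_nonneg h] at hx' ⊢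
        rw [← hpt _ hx']; exact le_self_add
      · rw [abs_of_nonpos h, neg_sub] at hx' ⊢
        rw [← hpt _ hx']; exact le_add_self
  refine hle.trans ?_
  have mψ : Measurable ψ := by
    rw [hψ]; refine Measurable.indicator ?_ measurableSet_Ioi
    fun_prop
  have mψ' : Measurable (fun x => ψ (x - c)) := by fun_prop
  rw [lintegral_add_left mψ', lintegral_sub_right_eq_self ψ c, lintegral_sub_left_eq_self ψ c, hψi,
    ← ofReal_add (by positivity) (by positivity)]
  exact ofReal_le_ofReal (by linarith)

theorem bad_meas {l r : ℕ × ℕ → ℝ} (hlr : ∀ i, l i ≤ r i) :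
    volume (Good l r)ᶜ ≤ 7 * ∑' i, ofReal (r i - l i) := by
  set D : Set ℝ := ⋂ i, {x | 3 / 2 * (r i - l i) ≤ |x - (l i + r i) / 2|} with hD
  have mDi : ∀ i, MeasurableSet {x : ℝ | 3 / 2 * (r i - l i) ≤ |x - (l i + r i) / 2|} := 
    fun i => measurableSet_le measurable_const (by fun_prop)
  have mD : MeasurableSet D := MeasurableSet.iInter mDi
  have h1 : (Good l r)ᶜ ⊆ (⋃ i, Ioo ((l i + r i) / 2 - 3 / 2 * (r i - l i)) ((l i + r i) / 2 + 3 / 2 * (r i - l i))) ∪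
      {x | 1 ≤ D.indicator (Eg l r) x} := by
    intro x hx; by_cases h : x ∈ D
    · right
      rw [mem_ofPred_eq, indicator_of_mem h]; have : ∀ i, 3 / 2 * (r i - l i) ≤ |x - (l i + r i) / 2| := by simpa [hD] using h
      by_contra h2
      exact hx ⟨this, (not_le.1 h2).le⟩
    · left
      simp only [hD, mem_iInter, not_forall] at h
      obtain ⟨i, hi⟩ := h
      refine mem_iUnion.2 ⟨i, ?_⟩; have hi' : |x - (l i + r i) / 2| < 3 / 2 * (r i - l i) := not_le.1 hi
      rw [abs_lt] at hi'
      constructor <;> linarith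
  refine (measure_mono h1).trans ((measure_union_le _ _).trans ?_)
  have h2 : volume (⋃ i, Ioo ((l i + r i) / 2 - 3 / 2 * (r i - l i)) ((l i + r i) / 2 + 3 / 2 * (r i - l i))) ≤
      3 * ∑' i, ofReal (r i - l i) := by
    refine (measure_iUnion_le _).trans ?_; rw [← ENNReal.tsum_mul_left]
    refine ENNReal.tsum_le_tsum fun i => ?_
    rw [Real.volume_Ioo, show (3:ℝ≥0∞) = ofReal 3 by norm_num, ← ofReal_mul (by norm_num)]
    exact ofReal_le_ofReal (by linarith)
  have h3 : volume {x | 1 ≤ D.indicator (Eg l r) x} ≤ 4 * ∑' i, ofReal (r i - l i) := by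
    have := mul_meas_ge_le_lintegral₀ (μ := volume) ((Eg_meas l r).indicator mD).aemeasurable 1; rw [one_mul] at this; refine this.trans ?_; rw [lintegral_indicator mD]
    unfold Eg; rw [lintegral_tsum (fun i => by fun_prop), ← ENNReal.tsum_mul_left]
    refine ENNReal.tsum_le_tsum fun i => ?_
    refine (lintegral_mono_set (iInter_subset _ i)).trans ((one_tail (by linarith [hlr i]) _).trans ?_)
    rw [show (4:ℝ≥0∞) = ofReal 4 by norm_num, ← ofReal_mul (by norm_num)]
  refine (add_le_add h2 h3).trans ?_
  rw [← add_mul]; norm_num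

/-- clamp to [-1,1] -/
noncomputable def clamp (t : ℝ) : ℝ := max (-1) (min 1 t)

theorem clamp_meas : Measurable clamp := by unfold clamp; fun_prop

theorem clamp_one (t : ℝ) : |clamp t| ≤ 1 := by
  unfold clamp; rw [abs_le]
  exact ⟨le_max_left _ _, max_le (by norm_num) (min_le_left _ _)⟩

theorem clamp_eq {t : ℝ} (h : |t| ≤ 1) : clamp t = t := by rw [abs_le] at h; unfold clamp; rw [min_eq_right h.2, max_eq_right h.1]

theorem clamp_le (t : ℝ) : |clamp t| ≤ |t| := by
  rcases le_total |t| 1 with h | h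
  · rw [clamp_eq h]
  · exact (clamp_one t).trans h

theorem Adiff_abs_le {b : ℝ → ℝ} {u v x y : ℝ} (hb : IntegrableOn b (Ioc u v)) (hx : x ∈ Icc u v) (hy : y ∈ Icc u v) :
    |Adiff b x y| ≤ ∫ t in Ioc u v, |b t| := by
  unfold Adiff; refine (intervalIntegral.norm_integral_le_integral_norm_uIoc (f := b) (a := y) (b := x)).trans ?_
  refine setIntegral_mono_set hb.abs (ae_of_all _ fun z => abs_nonneg (b z)) ?_
  refine (HasSubset.Subset.eventuallyLE ?_)
  intro t ht; rw [uIoc, mem_Ioc] at ht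
  exact ⟨lt_of_le_of_lt (le_min hy.1 hx.1) ht.1, ht.2.trans (max_le hy.2 hx.2)⟩

theorem Adiff_abs_le' {b : ℝ → ℝ} (hb : Integrable b) (x y : ℝ) : |Adiff b x y| ≤ ∫ t, |b t| := by
  refine (Adiff_abs_le (u := min x y) (v := max x y) hb.integrableOn ⟨min_le_left _ _, le_max_left _ _⟩
    ⟨min_le_right _ _, le_max_right _ _⟩).trans ?_
  exact setIntegral_le_integral hb.abs (ae_of_all _ fun z => abs_nonneg (b z))

theorem Pk_int_bound {ι : Type} {s : Finset ι} {b : ι → ℝ → ℝ} (hb : ∀ j, Integrable (b j)) {ε : ℝ} (hε : 0 < ε)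
    (x y : ℝ) (h : ε < |x - y|) : |Pk s b x y| ≤ ∏ j ∈ s, ((∫ t, |b j t|) / ε) := by
  unfold Pk; rw [Finset.abs_prod]
  refine Finset.prod_le_prod (fun j _ => abs_nonneg _) fun j hj => ?_
  unfold Dq; rw [abs_div]
  exact div_le_div₀ (integral_nonneg fun t => abs_nonneg _) (Adiff_abs_le' (hb j) x y) hε h.le

theorem Uint {ι : Type} {lam : ℝ} {α : ℝ → ℝ} {s : Finset ι} {b : ι → ℝ → ℝ} {f : ℝ → ℝ} {u v x ε B : ℝ}
    (hα : LI α) (hαm : Measurable α) (hb : ∀ j, LI (b j)) (hfm : Measurable f) (hf : Integrable f)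
    (hαf : Integrable (fun y => α y * f y)) (hf0 : ∀ x ∉ Ioc u v, f x = 0) (hε : 0 < ε)
    (hB : ∀ y, ε < |x - y| → |Pk s b x y| ≤ B) :
    IntegrableOn (fun y => Kap lam α x y * Pk s b x y / (x - y) * f y) {y | ε < |x - y|} := by
  set A := ∫ t in Ioc (min u x) (max v x), |α t| with hA
  have hA0 : 0 ≤ A := integral_nonneg fun t => abs_nonneg _
  have m1 : Measurable (fun y => Kap lam α x y) := by unfold Kap; exact (measurable_const.add (Dq_meas_r hα x)).sub hαm
  have m2 : Measurable (fun y => Pk s b x y) := Pk_meas_r (fun j _ => hb j) x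
  have m3 : Measurable (fun y : ℝ => x - y) := by fun_prop
  have hdom : Integrable (fun y => (|lam| + A / ε) * (B / ε) * |f y| + (B / ε) * |α y * f y|) :=
    (hf.abs.const_mul _).add (hαf.abs.const_mul _)
  refine Integrable.mono' hdom.integrableOn (((m1.mul m2).div m3).mul hfm).aestronglyMeasurable ?_
  filter_upwards [ae_restrict_mem (meas_trunc x ε)] with y hy
  have hy' : ε < |x - y| := hy
  have hB0 := (abs_nonneg _).trans (hB y hy')
  rw [norm_eq_abs]
  by_cases hyJ : y ∈ Ioc u v
  · have hD : |Dq α x y| ≤ A / ε := by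
      unfold Dq; rw [abs_div]
      refine div_le_div₀ hA0 (Adiff_abs_le (hα.on _ _) ⟨min_le_right _ _, le_max_right _ _⟩ ?_) hε hy'.le
      exact ⟨(min_le_left _ _).trans hyJ.1.le, hyJ.2.trans (le_max_left _ _)⟩
    have hK : |Kap lam α x y| ≤ |lam| + A / ε + |α y| := by unfold Kap; refine (abs_sub _ _).trans (add_le_add ((abs_add_le _ _).trans (add_le_add le_rfl hD)) le_rfl)
    have hP : |Pk s b x y / (x - y)| ≤ B / ε := by rw [abs_div]; exact div_le_div₀ hB0 (hB y hy') hε hy'.le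
    calc |Kap lam α x y * Pk s b x y / (x - y) * f y| = |Kap lam α x y| * |Pk s b x y / (x - y)| * |f y| := by rw [mul_div_assoc, abs_mul, abs_mul]
      _ ≤ (|lam| + A / ε + |α y|) * (B / ε) * |f y| :=
          mul_le_mul_of_nonneg_right (mul_le_mul hK hP (abs_nonneg _) (by positivity)) (abs_nonneg _)
      _ = _ := by rw [abs_mul]; ring
  · rw [hf0 y hyJ]; simp

theorem int_of_bdd_supp {f : ℝ → ℝ} {u v K : ℝ} (hfm : Measurable f) (hK : ∀ x, |f x| ≤ K) (hf0 : ∀ x ∉ Ioc u v, f x = 0)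
    {g : ℝ → ℝ} (hg : LI g) : Integrable (fun y => g y * f y) := by
  have h1 : IntegrableOn (fun y => g y * f y) (Ioc u v) := by refine Integrable.mul_bdd (c := K) (hg.on u v) hfm.aestronglyMeasurable (ae_of_all _ fun x => hK x)
  refine (integrableOn_iff_integrable_of_support_subset ?_).1 h1
  intro y hy; by_contra h
  exact hy (by simp [hf0 y h])

theorem int_of_bdd_supp' {f : ℝ → ℝ} {u v K : ℝ} (hfm : Measurable f) (hK : ∀ x, |f x| ≤ K) (hf0 : ∀ x ∉ Ioc u v, f x = 0) :
    Integrable f := by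
  simpa using int_of_bdd_supp hfm hK hf0 (g := fun _ => 1) (LI_of_bdd measurable_const (K := 1) (by simp))

set_option maxHeartbeats 2000000 in
theorem lemR {ι : Type} (s : Finset ι) (M : ℝ) (hM : 0 ≤ M) : ∃ C : ℝ, 0 < C ∧
    ∀ (lam : ℝ) (α : ℝ → ℝ) (b : ι → ℝ → ℝ) (f : ℝ → ℝ) (u v : ℝ) (l r : ℕ × ℕ → ℝ),
    |lam| ≤ 1 → BMO1 α → Measurable α → (∀ j, Measurable (b j)) → (∀ j, Integrable (b j)) → Measurable f → Integrable f →
    Integrable (fun y => α y * f y) → (∀ x ∉ Ioc u v, f x = 0) → (∀ i, l i ≤ r i) → (∀ i, Ioc (l i) (r i) ⊆ Ioc u v) →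
    Pairwise (fun i j => Disjoint (Ioc (l i) (r i)) (Ioc (l j) (r j))) →
    (∀ j, ∀ᵐ x, x ∉ ⋃ i, Ioc (l i) (r i) → |b j x| ≤ 1) → (∀ᵐ x, x ∉ ⋃ i, Ioc (l i) (r i) → |f x| ≤ 1) →
    (∀ j i, ∫ x in Ioc (l i) (r i), |b j x| ≤ 3 * (r i - l i)) → (∀ i, ∫ x in Ioc (l i) (r i), |f x| ≤ 3 * (r i - l i)) →
    (∀ i, ∫ x in Ioc (l i) (r i), |α x - av α (l i) (r i)| * |f x| ≤ M * (r i - l i)) →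
    ∃ (bt : ι → ℝ → ℝ) (ft h : ℝ → ℝ), (∀ j, Measurable (bt j)) ∧ (∀ j x, |bt j x| ≤ 3) ∧ Measurable ft ∧
      (∀ x, |ft x| ≤ 3) ∧ Measurable h ∧ (∀ x, |h x| ≤ M) ∧ (∀ x ∉ Ioc u v, ft x = 0) ∧ (∀ x ∉ Ioc u v, h x = 0) ∧
      (∀ x ∉ ⋃ i, Ioc (l i) (r i), |ft x| ≤ |f x| ∧ h x = 0) ∧
      ∀ x ∈ Good l r, (∀ ε > 0, |Uop lam α s b ε f x - Uop lam α s bt ε ft x + Cop s bt ε h x| ≤ C) ∧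
        ∃ L, Tendsto (fun ε => Uop lam α s b ε f x - Uop lam α s bt ε ft x + Cop s bt ε h x) (𝓝[>] 0) (𝓝 L) := by
  obtain ⟨C, hC, HC⟩ := one_int s M hM
  refine ⟨3 * C, by positivity, ?_⟩
  intro lam α b f u v l r hlam hα hαm hbm hbi hfm hfi hαf hf0 hlr hIJ hdisj hb1 hf1 hb3 hf3 hfM; set Ω := ⋃ i, Ioc (l i) (r i) with hΩ
  have hΩJ : ∀ x ∉ Ioc u v, x ∉ Ω := fun x hx h => hx (iUnion_subset hIJ h)
  obtain ⟨bt, hbt⟩ : ∃ bt : ι → ℝ → ℝ, bt = fun j => pw l r (fun i => av (b j) (l i) (r i)) (fun x => clamp (b j x)) := ⟨_, rfl⟩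
  obtain ⟨ft, hft⟩ : ∃ ft : ℝ → ℝ, ft = pw l r (fun i => av f (l i) (r i)) (fun x => clamp (f x)) := ⟨_, rfl⟩
  obtain ⟨h, hh⟩ : ∃ h : ℝ → ℝ, h = pw l r (fun i => av (fun y => (α y - av α (l i) (r i)) * f y) (l i) (r i)) (fun _ => 0) := ⟨_, rfl⟩
  have avb : ∀ (g : ℝ → ℝ) (i : ℕ × ℕ) (K : ℝ), l i < r i → ∫ x in Ioc (l i) (r i), |g x| ≤ K * (r i - l i) →
      |av g (l i) (r i)| ≤ K := by
    intro g i K hi hK; have h0 : 0 < r i - l i := by linarith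
    unfold av; rw [abs_mul, abs_of_pos (inv_pos.2 h0), inv_mul_le_iff₀ h0, mul_comm]
    exact (abs_integral_le_integral_abs).trans hK
  have btm : ∀ j, Measurable (bt j) := fun j => by rw [hbt]; exact pw_meas hdisj _ (clamp_meas.comp (hbm j))
  have bt3 : ∀ j x, |bt j x| ≤ 3 := fun j x => by rw [hbt]; exact pw_bound hdisj (fun i hi => avb _ i 3 hi (hb3 j i)) (fun x => (clamp_one _).trans (by norm_num)) x
  have ftm : Measurable ft := by rw [hft]; exact pw_meas hdisj _ (clamp_meas.comp hfm)
  have ft3 : ∀ x, |ft x| ≤ 3 := fun x => by rw [hft]; exact pw_bound hdisj (fun i hi => avb _ i 3 hi (hf3 i)) (fun x => (clamp_one _).trans (by norm_num)) x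
  have hm : Measurable h := by rw [hh]; exact pw_meas hdisj _ measurable_const
  have hhM : ∀ x, |h x| ≤ M := fun x => by
    rw [hh]; refine pw_bound hdisj (fun i hi => avb _ i M hi ?_) (fun x => by simpa using hM) x
    simp only [abs_mul]; exact hfM i
  have ftoff : ∀ x ∉ Ω, ft x = clamp (f x) := fun x hx => by rw [hft]; exact pw_off _ _ hx
  have hoff : ∀ x ∉ Ω, h x = 0 := fun x hx => by rw [hh]; exact pw_off _ _ hx
  have btoff : ∀ j, ∀ x ∉ Ω, bt j x = clamp (b j x) := fun j x hx => by rw [hbt]; exact pw_off _ _ hx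
  have ft0 : ∀ x ∉ Ioc u v, ft x = 0 := fun x hx => by rw [ftoff x (hΩJ x hx), hf0 x hx, clamp_eq (by simp)]
  have h0 : ∀ x ∉ Ioc u v, h x = 0 := fun x hx => hoff x (hΩJ x hx)
  refine ⟨bt, ft, h, btm, bt3, ftm, ft3, hm, hhM, ft0, h0, fun x hx => ⟨by rw [ftoff x hx]; exact clamp_le _, hoff x hx⟩, ?_⟩
  intro x hx; have hLIb : ∀ j, LI (b j) := fun j => LI_of_integrable (hbi j)
  have hLIbt : ∀ j, LI (bt j) := fun j => LI_of_bdd (btm j) (bt3 j)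
  have hxΩ : x ∉ Ω := fun hx2 => by
    obtain ⟨i, hi⟩ := mem_iUnion.1 hx2
    have h1 := hx.1 i; have h2 : |x - (l i + r i) / 2| ≤ (r i - l i) / 2 := by rw [abs_le]; constructor <;> linarith [hi.1, hi.2]
    linarith [hi.1, hi.2]
  -- the differences
  have gI : ∀ j, LI (fun t => b j t - bt j t) := fun j p q => (hLIb j p q).sub (hLIbt j p q)
  have g0 : ∀ j, ∀ᵐ x, x ∉ Ω → b j x - bt j x = 0 := fun j => by
    filter_upwards [hb1 j] with y hy hy2
    rw [btoff j y hy2, clamp_eq (hy hy2), sub_self]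
  have bton : ∀ j i, ∀ t ∈ Ioc (l i) (r i), bt j t = av (b j) (l i) (r i) := fun j i t ht => by rw [hbt]; exact pw_mem hdisj _ _ ht
  have gm : ∀ j i, ∫ t in Ioc (l i) (r i), (b j t - bt j t) = 0 := fun j i => by
    rw [setIntegral_congr_fun (g := fun t => b j t - av (b j) (l i) (r i)) measurableSet_Ioc
      (fun t ht => by rw [bton j i t ht]), integral_sub ((hLIb j).on _ _) (integrable_const _)]
    rw [setIntegral_const, volume_real_Ioc_of_le (hlr i), smul_eq_mul]; rcases (hlr i).eq_or_lt with h | h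
    · simp [h]
    · unfold av
      have : r i - l i ≠ 0 := by linarith
      field_simp
      ring
  have gabs : ∀ j i, ∫ t in Ioc (l i) (r i), |b j t - bt j t| ≤ 6 * (r i - l i) := fun j i => by
    have i1 : IntegrableOn (fun t => |b j t|) (Ioc (l i) (r i)) := ((hLIb j).on _ _).abs
    have i2 : IntegrableOn (fun _ => (3:ℝ)) (Ioc (l i) (r i)) := by simp
    calc ∫ t in Ioc (l i) (r i), |b j t - bt j t| ≤ ∫ t in Ioc (l i) (r i), (|b j t| + 3) :=
          integral_mono ((gI j).on _ _).abs (i1.add i2) fun t => (abs_sub _ _).trans (add_le_add le_rfl (bt3 j t))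
      _ ≤ _ := by rw [integral_add i1 i2, setIntegral_const, volume_real_Ioc_of_le (hlr i), smul_eq_mul]; linarith [hb3 j i]
  have Asub : ∀ j y, Adiff (fun t => b j t - bt j t) x y = Adiff (b j) x y - Adiff (bt j) x y := fun j y => by unfold Adiff; exact intervalIntegral.integral_sub (hLIb j _ _) (hLIbt j _ _)
  have hA6 : ∀ i, ∀ j, ∀ y ∈ Ioc (l i) (r i), |Adiff (b j) x y - Adiff (bt j) x y| ≤ 6 * (r i - l i) := fun i j y hy => by
    rw [← Asub]; refine (canc hdisj (gI j) (g0 j) (gm j) hxΩ y i fun k hk hk2 => ?_).trans (gabs j i)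
    exact Set.disjoint_left.1 (hdisj hk) hk2 hy
  have hA0 : ∀ j, ∀ y ∉ Ω, Dq (b j) x y = Dq (bt j) x y := fun j y hy => by
    unfold Dq; have := canc0 hdisj (gI j) (g0 j) (gm j) hxΩ hy
    rw [Asub, sub_eq_zero] at this; rw [this]
  have hHm := Hf_meas (lam := lam) (s := s) hα.li hαm hLIb hLIbt hfm ftm hm x
  -- integrability of pieces
  have ftI : Integrable ft := int_of_bdd_supp' ftm ft3 ft0
  have hI' : Integrable h := int_of_bdd_supp' hm hhM h0
  have aft : Integrable (fun y => α y * ft y) := int_of_bdd_supp ftm ft3 ft0 hα.li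
  have I1 : ∀ ε > 0, IntegrableOn (fun y => Kap lam α x y * Pk s b x y / (x - y) * f y) {y | ε < |x - y|} :=
    fun ε hε => Uint hα.li hαm hLIb hfm hfi hαf hf0 hε (Pk_int_bound hbi hε x)
  have I2 : ∀ ε > 0, IntegrableOn (fun y => Kap lam α x y * Pk s bt x y / (x - y) * ft y) {y | ε < |x - y|} :=
    fun ε hε => Uint hα.li hαm hLIbt ftm ftI aft ft0 hε (fun y _ => Pk_bound (fun j _ => bt3 j) x y)
  have I3 : ∀ ε > 0, IntegrableOn (fun y => Pk s bt x y / (x - y) * h y) {y | ε < |x - y|} := fun ε hε => by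
    have := Uint (lam := 1) (α := fun _ => 0) (s := s) BMO1_zero.li measurable_const hLIbt hm hI' (by simp) h0 hε (fun y _ => Pk_bound (fun j _ => bt3 j) x y)
    simpa only [Kap_one_zero, one_mul] using this
  have I12 : ∀ ε > 0, IntegrableOn (fun y => Kap lam α x y * Pk s b x y / (x - y) * f y - Kap lam α x y * Pk s bt x y / (x - y) * ft y) {y | ε < |x - y|} :=
    fun ε hε => (I1 ε hε).sub (I2 ε hε)
  have eH : Hf lam α s b bt f ft h x = fun y => Kap lam α x y * Pk s b x y / (x - y) * f y - Kap lam α x y * Pk s bt x y / (x - y) * ft y + Pk s bt x y / (x - y) * h y := by funext y; unfold Hf; ring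
  have IH : ∀ ε > 0, IntegrableOn (Hf lam α s b bt f ft h x) {y | ε < |x - y|} := by intro ε hε; rw [eH]; exact (I12 ε hε).add (I3 ε hε)
  have hD : ∀ ε > 0, ∫ y in {y | ε < |x - y|}, Hf lam α s b bt f ft h x y =
      Uop lam α s b ε f x - Uop lam α s bt ε ft x + Cop s bt ε h x := by
    intro ε hε; rw [eH, integral_add (I12 ε hε) (I3 ε hε), integral_sub (I1 ε hε) (I2 ε hε)]
    rfl
  have hH0 : ∀ᵐ y, y ∉ Ω → Hf lam α s b bt f ft h x y = 0 := by
    filter_upwards [hf1] with y hy hy2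
    have : Pk s b x y = Pk s bt x y := Finset.prod_congr rfl fun j _ => hA0 j y hy2
    unfold Hf; rw [this, hoff y hy2, ftoff y hy2, clamp_eq (hy hy2)]
    simp
  have hone : ∀ i, IntegrableOn (Hf lam α s b bt f ft h x) (Ioc (l i) (r i)) ∧
      |∫ y in Ioc (l i) (r i), Hf lam α s b bt f ft h x y| ≤ C * √((r i - l i) / |x - (l i + r i) / 2|) ^ 3 ∧
      ∫ y in Ioc (l i) (r i), |Hf lam α s b bt f ft h x y| ≤ C * √((r i - l i) / |x - (l i + r i) / 2|) := by
    intro i; rcases (hlr i).eq_or_lt with he | hlt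
    · simp [he]
    refine HC lam α b bt f ft h (l i) (r i) x _ _ hlam hα hαm hLIb btm bt3 hfm ftm hm hlt rfl rfl (hx.1 i) (hA6 i)
      hfi.integrableOn hαf.integrableOn (hf3 i) (hfM i) (fun y hy => ?_) (fun y hy => ?_)
    · rw [hft]; exact pw_mem hdisj _ _ hy
    · rw [hh]; exact pw_mem hdisj _ _ hy
  have hs1 : ∀ i, √((r i - l i) / |x - (l i + r i) / 2|) ≤ 1 := fun i => by
    rw [Real.sqrt_le_one]; refine div_le_one_of_le₀ ?_ (abs_nonneg _)
    have := hx.1 i; have := hlr i; linarith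
  have hs2 : ∀ i, ∃ ρ > 0, ∀ y ∈ Ioc (l i) (r i), ρ ≤ |x - y| := fun i => by
    rcases (hlr i).eq_or_lt with he | hlt
    · exact ⟨1, one_pos, by simp [he]⟩
    · refine ⟨r i - l i, by linarith, fun y hy => ?_⟩
      have h1 := hx.1 i; have h2 : |y - (l i + r i) / 2| ≤ (r i - l i) / 2 := by rw [abs_le]; constructor <;> linarith [hy.1, hy.2]
      have h3 : |x - (l i + r i) / 2| ≤ |x - y| + |y - (l i + r i) / 2| := abs_sub_le _ _ _
      linarith
  obtain ⟨R1, R2⟩ := sumS hdisj hC (σ := fun i => √((r i - l i) / |x - (l i + r i) / 2|)) (fun i => Real.sqrt_nonneg _)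
    hs1 IH hH0 (fun i => (hone i).1) (fun i => (hone i).2.1) (fun i => (hone i).2.2) hs2
  have hE : ∑' i, ofReal (√((r i - l i) / |x - (l i + r i) / 2|) ^ 3) ≤ 1 := hx.2
  constructor
  · intro ε hε
    have h1 := R1 ε hε; rw [hD ε hε] at h1; have h2 := h1.trans (mul_le_mul' le_rfl (add_le_add hE le_rfl)); rw [show (1 + 2 : ℝ≥0∞) = ofReal 3 by norm_num, ← ofReal_mul hC.le,
      ofReal_le_ofReal_iff (by positivity)] at h2
    linarith
  · obtain ⟨L, hL⟩ := R2 (ne_top_of_le_ne_top (by simp) hE)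
    refine ⟨L, hL.congr' ?_⟩; filter_upwards [self_mem_nhdsWithin] with ε hε
    exact hD ε hε

theorem Uop_eq {ι : Type} (lam : ℝ) (α : ℝ → ℝ) (s : Finset ι) (b : ι → ℝ → ℝ) (δ : ℝ) (f : ℝ → ℝ) (x : ℝ) :
    Uop lam α s b δ f x = ∫ y, {p : ℝ × ℝ | δ < |p.1 - p.2|}.indicator
      (fun p => Kap lam α p.1 p.2 * Pk s b p.1 p.2 / (p.1 - p.2) * f p.2) (x, y) := by
  unfold Uop; rw [← integral_indicator (meas_trunc x δ)]
  congr 1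

theorem Uop_meas {ι : Type} {lam : ℝ} {α : ℝ → ℝ} {s : Finset ι} {b : ι → ℝ → ℝ} {f : ℝ → ℝ}
    (hα : LI α) (hαm : Measurable α) (hb : ∀ j ∈ s, LI (b j)) (hfm : Measurable f) (δ : ℝ) :
    Measurable (fun x => Uop lam α s b δ f x) := by
  simp_rw [Uop_eq]
  have m1 : Measurable (fun p : ℝ × ℝ => Kap lam α p.1 p.2) := by unfold Kap; exact (measurable_const.add (Dq_meas hα)).sub (hαm.comp measurable_snd)
  have m2 : Measurable (fun p : ℝ × ℝ => Pk s b p.1 p.2) := Pk_meas hb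
  have m3 : Measurable (fun p : ℝ × ℝ => p.1 - p.2) := by fun_prop
  have m4 : Measurable (fun p : ℝ × ℝ => Kap lam α p.1 p.2 * Pk s b p.1 p.2 / (p.1 - p.2) * f p.2) :=
    ((m1.mul m2).div m3).mul (hfm.comp measurable_snd)
  have := (m4.indicator (meas_trunc2 δ)).stronglyMeasurable.integral_prod_right' (ν := (volume : Measure ℝ))
  exact this.measurable

theorem Cop_meas {ι : Type} {s : Finset ι} {b : ι → ℝ → ℝ} {f : ℝ → ℝ}
    (hb : ∀ j ∈ s, LI (b j)) (hfm : Measurable f) (δ : ℝ) : Measurable (fun x => Cop s b δ f x) := by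
  simp_rw [← Uop_zero]
  exact Uop_meas BMO1_zero.li measurable_const hb hfm δ

theorem Uop_congr {ι : Type} {lam : ℝ} {α : ℝ → ℝ} {s : Finset ι} {b b' : ι → ℝ → ℝ} {f : ℝ → ℝ} {u v δ x : ℝ}
    (h : ∀ j ∈ s, ∀ x ∈ Ioc u v, b j x = b' j x) (hf : ∀ x ∉ Ioc u v, f x = 0) (hx : x ∈ Ioc u v) :
    Uop lam α s b δ f x = Uop lam α s b' δ f x := by
  unfold Uop; congr 1; funext y
  by_cases hy : y ∈ Ioc u v
  · rw [Pk_congr h hx hy]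
  · rw [hf y hy]; simp

theorem Cop_congr {ι : Type} {s : Finset ι} {b b' : ι → ℝ → ℝ} {f : ℝ → ℝ} {u v δ x : ℝ}
    (h : ∀ j ∈ s, ∀ x ∈ Ioc u v, b j x = b' j x) (hf : ∀ x ∉ Ioc u v, f x = 0) (hx : x ∈ Ioc u v) :
    Cop s b δ f x = Cop s b' δ f x := by
  simp_rw [← Uop_zero]; exact Uop_congr h hf hx

theorem Pk_smul {ι : Type} (s : Finset ι) (b : ι → ℝ → ℝ) (c x y : ℝ) :
    Pk s (fun j x => c * b j x) x y = c ^ s.card * Pk s b x y := by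
  unfold Pk Dq Adiff; simp_rw [intervalIntegral.integral_const_mul, mul_div_assoc]
  rw [Finset.prod_mul_distrib, Finset.prod_const]

theorem Cop_smul {ι : Type} (s : Finset ι) (b : ι → ℝ → ℝ) (c d δ : ℝ) (f : ℝ → ℝ) (x : ℝ) :
    Cop s (fun j x => c * b j x) δ (fun x => d * f x) x = c ^ s.card * d * Cop s b δ f x := by
  unfold Cop; rw [← integral_const_mul]
  congr 1; funext y
  rw [Pk_smul]; ring

theorem Uop_smul {ι : Type} (lam : ℝ) (α : ℝ → ℝ) (s : Finset ι) (b : ι → ℝ → ℝ) (c d δ : ℝ) (f : ℝ → ℝ) (x : ℝ) :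
    Uop lam α s (fun j x => c * b j x) δ (fun x => d * f x) x = c ^ s.card * d * Uop lam α s b δ f x := by
  unfold Uop; rw [← integral_const_mul]
  congr 1; funext y
  rw [Pk_smul]; ring

theorem ofReal_int {g : ℝ → ℝ} {u v : ℝ} (hg : IntegrableOn g (Ioc u v)) :
    ∫⁻ x in Ioc u v, ofReal |g x| = ofReal (∫ x in Ioc u v, |g x|) := by
  rw [ofReal_integral_eq_lintegral_ofReal hg.abs (ae_of_all _ fun x => abs_nonneg _)]

/-- bounding real integral by lintegral -/
theorem int_le_of_lint {g : ℝ → ℝ} {u v K : ℝ} (hK : 0 ≤ K) (hg : IntegrableOn g (Ioc u v))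
    (h : ∫⁻ x in Ioc u v, ofReal |g x| ≤ ofReal K) : ∫ x in Ioc u v, |g x| ≤ K := by
  rw [ofReal_int hg, ofReal_le_ofReal_iff hK] at h
  exact h

theorem tsum_len_le {l r : ℕ × ℕ → ℝ} {u v : ℝ} {G : ℝ → ℝ≥0∞} (hIJ : ∀ i, Ioc (l i) (r i) ⊆ Ioc u v)
    (hdisj : Pairwise (fun i j => Disjoint (Ioc (l i) (r i)) (Ioc (l j) (r j))))
    (h : ∀ i, ofReal (r i - l i) ≤ ∫⁻ x in Ioc (l i) (r i), G x) :
    ∑' i, ofReal (r i - l i) ≤ ∫⁻ x in Ioc u v, G x := by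
  refine (ENNReal.tsum_le_tsum h).trans ?_
  rw [← lintegral_iUnion (fun i => measurableSet_Ioc) hdisj]
  exact lintegral_mono_set (iUnion_subset hIJ)

/-- Chebyshev for the L2 bound -/
theorem cheb_sq {g : ℝ → ℝ} (hg : Measurable g) {S : Set ℝ} {T D : ℝ} (hT : 0 < T) (h : ∫⁻ x in S, ofReal (g x ^ 2) ≤ ofReal D) :
    volume.restrict S {x | T < |g x|} ≤ ofReal (D / T ^ 2) := by
  have m : Measurable fun x => ofReal (g x ^ 2) := by fun_prop
  have h1 := mul_meas_ge_le_lintegral (μ := volume.restrict S) m (ofReal (T ^ 2))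
  have h2 : volume.restrict S {x | T < |g x|} ≤ volume.restrict S {x | ofReal (T ^ 2) ≤ ofReal (g x ^ 2)} := by
    refine measure_mono fun x hx => ?_
    have hx' : T < |g x| := hx
    exact ofReal_le_ofReal (by rw [← sq_abs (g x)]; exact pow_le_pow_left₀ hT.le hx'.le 2)
  rw [ENNReal.ofReal_div_of_pos (by positivity), ENNReal.le_div_iff_mul_le (by left; simp; positivity) (by left; simp), mul_comm]
  exact (mul_le_mul' le_rfl h2).trans (h1.trans h)

set_option maxHeartbeats 1000000 in
theorem lemW {ι : Type} (s : Finset ι) (τ K : ℝ) (hτ : 0 < τ) (hK : 0 < K) : ∃ C : ℝ, 0 < C ∧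
    ∀ (b : ι → ℝ → ℝ) (f : ℝ → ℝ) (u v δ F : ℝ), u < v → 0 < δ → 0 < F → (∀ j ∈ s, Measurable (b j)) →
    (∀ j ∈ s, IntegrableOn (b j) (Ioc u v)) → Measurable f → IntegrableOn f (Ioc u v) → (∀ x ∉ Ioc u v, f x = 0) →
    (∀ j ∈ s, ∫ x in Ioc u v, |b j x| ≤ K * (v - u)) → ∫ x in Ioc u v, |f x| ≤ F * (v - u) →
    volume {x ∈ Ioc u v | C * F < |Cop s b δ f x|} ≤ ofReal (τ * (v - u)) := by
  classical
  obtain ⟨C1, hC1, HR⟩ := lemR s 0 le_rfl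
  obtain ⟨C2, hC2, H2⟩ := L2_bounded s 3 (by norm_num)
  obtain ⟨Λ, hΛ⟩ : ∃ Λ : ℝ, Λ = (1 + 14 / τ) * (s.card * K + 1) := ⟨_, rfl⟩
  have hcK : 1 ≤ s.card * K + 1 := by nlinarith [(Nat.cast_nonneg s.card : (0:ℝ) ≤ s.card)]
  have hΛ0 : 0 < Λ := by rw [hΛ]; positivity
  have hΛ1 : (s.card * K + 1) / Λ ≤ 1 := by
    rw [div_le_one hΛ0, hΛ]; have : 0 < 14 / τ := by positivity
    nlinarith
  have hΛ2 : (s.card * K + 1) / Λ ≤ τ / 14 := by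
    rw [div_le_iff₀ hΛ0, hΛ]; have : τ / 14 * ((1 + 14 / τ) * (s.card * K + 1)) = (s.card * K + 1) * (τ / 14 + 1) := by field_simp
    rw [this]; nlinarith
  obtain ⟨T, hT⟩ : ∃ T : ℝ, T = √(2 * C2 / τ) := ⟨_, rfl⟩
  have hT0 : 0 < T := by rw [hT]; positivity
  have hT2 : C2 / T ^ 2 = τ / 2 := by rw [hT, Real.sq_sqrt (by positivity)]; field_simp
  refine ⟨Λ ^ s.card * Λ * (C1 + 3 * T), by positivity, ?_⟩
  intro b f u v δ F huv hδ hF hbm hbi hfm hfi hf0 hbK hfK; obtain ⟨b', hb'⟩ : ∃ b' : ι → ℝ → ℝ, b' = fun j => if j ∈ s then (Ioc u v).indicator (fun x => Λ⁻¹ * b j x) else fun _ => 0 := ⟨_, rfl⟩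
  obtain ⟨f', hf'⟩ : ∃ f' : ℝ → ℝ, f' = fun x => (Λ * F)⁻¹ * f x := ⟨_, rfl⟩
  have hbs : ∀ j ∈ s, b' j = (Ioc u v).indicator (fun x => Λ⁻¹ * b j x) := fun j hj => by simp [hb', hj]
  have hbn : ∀ j ∉ s, b' j = fun _ => 0 := fun j hj => by simp [hb', hj]
  have b'm : ∀ j, Measurable (b' j) := fun j => by
    by_cases hj : j ∈ s
    · rw [hbs j hj]; exact ((hbm j hj).const_mul _).indicator measurableSet_Ioc
    · rw [hbn j hj]; exact measurable_const
  have b'i : ∀ j, Integrable (b' j) := fun j => by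
    by_cases hj : j ∈ s
    · rw [hbs j hj, integrable_indicator_iff measurableSet_Ioc]; exact (hbi j hj).const_mul _
    · rw [hbn j hj]; simp
  have f'm : Measurable f' := by rw [hf']; exact hfm.const_mul _
  have hfint : Integrable f := by
    refine (integrableOn_iff_integrable_of_support_subset (s := Ioc u v) fun y hy => ?_).1 hfi
    by_contra h; exact hy (hf0 y h)
  have f'i : Integrable f' := by rw [hf']; exact hfint.const_mul _
  have f'0 : ∀ x ∉ Ioc u v, f' x = 0 := fun x hx => by rw [hf']; simp [hf0 x hx]
  have b'L : ∀ j ∈ s, ∫ x in Ioc u v, |b' j x| ≤ K / Λ * (v - u) := fun j hj => by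
    rw [setIntegral_congr_fun (g := fun x => Λ⁻¹ * |b j x|) measurableSet_Ioc (fun x hx => by rw [hbs j hj, indicator_of_mem hx, abs_mul, abs_of_pos (inv_pos.2 hΛ0)]), integral_const_mul]
    calc Λ⁻¹ * ∫ x in Ioc u v, |b j x| ≤ Λ⁻¹ * (K * (v - u)) := by gcongr; exact hbK j hj
      _ = _ := by ring
  have f'L : ∫ x in Ioc u v, |f' x| ≤ 1 / Λ * (v - u) := by
    simp only [hf', abs_mul, integral_const_mul]; rw [abs_of_pos (by positivity)]
    calc (Λ * F)⁻¹ * ∫ x in Ioc u v, |f x| ≤ (Λ * F)⁻¹ * (F * (v - u)) := by gcongr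
      _ = _ := by field_simp
  obtain ⟨G, hG⟩ : ∃ G : ℝ → ℝ≥0∞, G = fun x => ofReal (∑ j ∈ s, |b' j x| + |f' x|) := ⟨_, rfl⟩
  have hGr : Integrable (fun x => ∑ j ∈ s, |b' j x| + |f' x|) :=
    (integrable_finsetSum _ fun j _ => (b'i j).abs).add f'i.abs
  have hGm : Measurable G := by rw [hG]; exact ((Finset.measurable_sum _ fun j _ => (b'm j).abs).add f'm.abs).ennreal_ofReal
  have hG0 : ∀ x, 0 ≤ ∑ j ∈ s, |b' j x| + |f' x| := fun x => by positivity
  have hGJ : ∫⁻ x in Ioc u v, G x ≤ ofReal ((s.card * K + 1) / Λ * (v - u)) := by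
    rw [hG, ← ofReal_integral_eq_lintegral_ofReal hGr.integrableOn (ae_of_all _ hG0)]; refine ofReal_le_ofReal ?_
    have i1 : IntegrableOn (fun x => ∑ j ∈ s, |b' j x|) (Ioc u v) := (integrable_finsetSum _ fun j _ => (b'i j).abs).integrableOn
    rw [integral_add i1 f'i.abs.integrableOn, integral_finset_sum _ (fun j _ => (b'i j).abs.integrableOn)]
    have := Finset.sum_le_sum b'L; rw [Finset.sum_const, nsmul_eq_mul] at this; calc _ ≤ s.card * (K / Λ * (v - u)) + 1 / Λ * (v - u) := add_le_add this f'L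
      _ = _ := by ring
  obtain ⟨l, r, hlr, hIJ, hdisj, hI1, hI2, hG1⟩ := CZ_lemma huv G hGm.aemeasurable
    (hGJ.trans (ofReal_le_ofReal (by nlinarith)))
  have dom : ∀ (g : ℝ → ℝ), Integrable g → (∀ x, |g x| ≤ ∑ j ∈ s, |b' j x| + |f' x|) → ∀ i, ∫ x in Ioc (l i) (r i), |g x| ≤ 3 * (r i - l i) := fun g hg hgG i => by
    have hq : 0 ≤ r i - l i := by linarith [hlr i]
    refine int_le_of_lint (by positivity) hg.integrableOn ?_
    refine (lintegral_mono fun x => ?_).trans ((hI2 i).trans ?_)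
    · rw [hG]; exact ofReal_le_ofReal (hgG x)
    · rw [show (2:ℝ≥0∞) = ofReal 2 by norm_num, ← ofReal_mul (by norm_num)]
      exact ofReal_le_ofReal (by linarith)
  have bG : ∀ j x, |b' j x| ≤ ∑ j ∈ s, |b' j x| + |f' x| := fun j x => by
    by_cases hj : j ∈ s
    · exact (Finset.single_le_sum (f := fun j => |b' j x|) (fun j _ => abs_nonneg _) hj).trans (le_add_of_nonneg_right (abs_nonneg _))
    · rw [hbn j hj]; simp; exact hG0 x
  have fG : ∀ x, |f' x| ≤ ∑ j ∈ s, |b' j x| + |f' x| := fun x => le_add_of_nonneg_left (by positivity)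
  have offJ : ∀ x ∉ Ioc u v, (∑ j ∈ s, |b' j x| + |f' x|) = 0 := fun x hx => by
    rw [f'0 x hx, Finset.sum_eq_zero fun j hj => by rw [hbs j hj, indicator_of_notMem hx, abs_zero]]
    simp
  have off1 : ∀ᵐ x, x ∉ ⋃ i, Ioc (l i) (r i) → (∑ j ∈ s, |b' j x| + |f' x|) ≤ 1 := by
    filter_upwards [hG1] with x hx hx2
    by_cases hxJ : x ∈ Ioc u v
    · have := hx hxJ hx2
      rw [hG] at this; simpa using this
    · rw [offJ x hxJ]; norm_num
  obtain ⟨bt, ft, h, btm, bt3, ftm, ft3, hm, hhM, ft0, h0, hoff, hgood⟩ := HR 1 (fun _ => 0) b' f' u v l r (by simp) BMO1_zero measurable_const b'm b'i f'm f'i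
    (by simp) f'0 hlr hIJ hdisj (fun j => off1.mono fun x hx hx2 => (bG j x).trans (hx hx2))
    (off1.mono fun x hx hx2 => (fG x).trans (hx hx2)) (fun j => dom _ (b'i j) (bG j)) (dom _ f'i fG) (by simp [av])
  have hh0 : ∀ x, Cop s bt δ h x = 0 := fun x => by
    have : h = fun _ => 0 := funext fun y => by simpa using hhM y
    simp [Cop, this]
  simp only [Uop_zero] at hgood
  have hL := H2 bt btm bt3 (fun x => 3⁻¹ * ft x) (ftm.const_mul _) (fun x => by rw [abs_mul, abs_of_pos (by norm_num)]; linarith [ft3 x]) u v δ huv hδ (fun x hx => by rw [ft0 x hx, mul_zero])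
  have hch := cheb_sq (Cop_meas (fun j _ => LI_of_bdd (btm j) (bt3 j)) (ftm.const_mul _) δ) hT0 hL
  have hsub : {x ∈ Ioc u v | Λ ^ s.card * Λ * (C1 + 3 * T) * F < |Cop s b δ f x|} ⊆
      (Good l r)ᶜ ∪ ({x | T < |Cop s bt δ (fun x => 3⁻¹ * ft x) x|} ∩ Ioc u v) := by
    rintro x ⟨hxJ, hx⟩
    by_cases hg : x ∈ Good l r
    · right
      refine ⟨?_, hxJ⟩
      rw [mem_ofPred_eq]; have e1 : Cop s bt δ (fun x => 3⁻¹ * ft x) x = 3⁻¹ * Cop s bt δ ft x := by have := Cop_smul s bt 1 3⁻¹ δ ft x; simpa using this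
      have e2 : Cop s b' δ f' x = (Λ⁻¹) ^ s.card * (Λ * F)⁻¹ * Cop s b δ f x := by rw [← Cop_smul, hf']; refine Cop_congr (u := u) (v := v) (fun j hj y hy => by rw [hbs j hj, indicator_of_mem hy]) (fun y hy => by rw [hf0 y hy, mul_zero]) hxJ
      have e3 := (hgood x hg).1 δ hδ; rw [e2, hh0, add_zero] at e3; rw [e1, abs_mul, abs_of_pos (by norm_num : (0:ℝ) < 3⁻¹)]
      set X := Cop s b δ f x
      set Y := Cop s bt δ ft x
      have e4 : C1 + 3 * T < Λ⁻¹ ^ s.card * (Λ * F)⁻¹ * |X| := by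
        have : Λ⁻¹ ^ s.card * (Λ * F)⁻¹ * (Λ ^ s.card * Λ * (C1 + 3 * T) * F) = C1 + 3 * T := by rw [inv_pow]; field_simp
        rw [← this]; exact mul_lt_mul_of_pos_left hx (by positivity)
      have e5 : |Λ⁻¹ ^ s.card * (Λ * F)⁻¹ * X| = Λ⁻¹ ^ s.card * (Λ * F)⁻¹ * |X| := by rw [abs_mul, abs_of_pos (by positivity)]
      have := abs_sub_abs_le_abs_sub (Λ⁻¹ ^ s.card * (Λ * F)⁻¹ * X) Y; linarith
    · left; exact hg
  have h7 : (7 : ℝ≥0∞) * ∑' i, ofReal (r i - l i) ≤ ofReal (τ / 2 * (v - u)) := by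
    refine (mul_le_mul' le_rfl ((tsum_len_le hIJ hdisj hI1).trans hGJ)).trans ?_; rw [show (7:ℝ≥0∞) = ofReal 7 by norm_num, ← ofReal_mul (by norm_num)]
    refine ofReal_le_ofReal ?_; nlinarith
  calc _ ≤ _ := measure_mono hsub
    _ ≤ volume (Good l r)ᶜ + volume.restrict (Ioc u v) {x | T < |Cop s bt δ (fun x => 3⁻¹ * ft x) x|} := by rw [Measure.restrict_apply' measurableSet_Ioc]; exact measure_union_le _ _
    _ ≤ ofReal (τ / 2 * (v - u)) + ofReal (C2 * (v - u) / T ^ 2) := add_le_add ((bad_meas hlr).trans h7) hch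
    _ = _ := by
        have h0 : 0 < v - u := by linarith
        rw [mul_div_right_comm, hT2, ← ofReal_add (by positivity) (by positivity)]; congr 1; ring

theorem Dq_ball : ∃ C : ℝ, 0 < C ∧ ∀ α : ℝ → ℝ, BMO1 α → ∀ c y ρ : ℝ, c ≠ y → |c - y| ≤ ρ →
    |Dq α c y - av α (c - ρ) (c + ρ)| ≤ C * √(ρ / |c - y|) := by
  obtain ⟨C, hC, H⟩ := av_diff
  refine ⟨2 * C, by positivity, fun α hα c y ρ hcy hρ => ?_⟩
  have hd : 0 < |c - y| := abs_pos.2 (sub_ne_zero.2 hcy)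
  have key : |Dq α c y - av α (c - ρ) (c + ρ)| ≤ C * √((2 * ρ) / |c - y|) := by
    rcases lt_or_gt_of_ne hcy with h | h
    · rw [Dq_symm, Dq_av h]
      have e : |c - y| = y - c := by rw [abs_of_neg (by linarith)]; ring
      rw [e] at hρ ⊢
      have := H α hα (c - ρ) (c + ρ) c y h (by linarith) (by linarith)
      rwa [show c + ρ - (c - ρ) = 2 * ρ by ring] at this
    · rw [Dq_av h]
      have e : |c - y| = c - y := abs_of_pos (by linarith)
      rw [e] at hρ ⊢
      have := H α hα (c - ρ) (c + ρ) y c h (by linarith) (by linarith)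
      rwa [show c + ρ - (c - ρ) = 2 * ρ by ring] at this
  refine key.trans ?_
  have : √((2 * ρ) / |c - y|) ≤ 2 * √(ρ / |c - y|) := by
    rw [show (2:ℝ) * √(ρ / |c - y|) = √(4 * (ρ / |c - y|)) by rw [Real.sqrt_mul (by norm_num), show (4:ℝ) = 2 ^ 2 by norm_num, Real.sqrt_sq (by norm_num)]]
    apply Real.sqrt_le_sqrt
    rw [mul_div_assoc]; have : 0 ≤ ρ / |c - y| := div_nonneg (hd.le.trans hρ) hd.le
    linarith
  nlinarith

theorem Kap_ball : ∃ C : ℝ, 0 < C ∧ ∀ (lam : ℝ) (α : ℝ → ℝ), |lam| ≤ 1 → BMO1 α → ∀ c y ρ : ℝ, c ≠ y → |c - y| ≤ ρ →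
    |Kap lam α c y| ≤ 1 + C * √(ρ / |c - y|) + |α y - av α (c - ρ) (c + ρ)| := by
  obtain ⟨C, hC, H⟩ := Dq_ball
  refine ⟨C, hC, fun lam α hlam hα c y ρ hcy hρ => ?_⟩
  have h1 := H α hα c y ρ hcy hρ
  have : Kap lam α c y = lam + (Dq α c y - av α (c - ρ) (c + ρ)) - (α y - av α (c - ρ) (c + ρ)) := by unfold Kap; ring
  rw [this]
  exact (abs_sub _ _).trans (add_le_add ((abs_add_le _ _).trans (add_le_add hlam h1)) le_rfl)

/-- full kernel -/
noncomputable def KK {ι : Type} (lam : ℝ) (α : ℝ → ℝ) (s : Finset ι) (b : ι → ℝ → ℝ) (x y : ℝ) : ℝ :=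
  Kap lam α x y * Pk s b x y / (x - y)

set_option maxHeartbeats 1000000 in
theorem far1 {ι : Type} (s : Finset ι) : ∃ C : ℝ, 0 < C ∧ ∀ (lam : ℝ) (α : ℝ → ℝ) (b : ι → ℝ → ℝ), |lam| ≤ 1 → BMO1 α →
    (∀ j, Measurable (b j)) → (∀ j x, |b j x| ≤ 3) → ∀ c q x y : ℝ, 0 < q → |x - c| ≤ q / 2 → 3 / 2 * q ≤ |c - y| →
    |KK lam α s b x y - KK lam α s b c y| ≤
      C * (q / |c - y| ^ 2 * (√(|c - y| / q) + |α y - av α (c - q / 2) (c + q / 2)|)) := by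
  obtain ⟨C, hC, HD⟩ := Dq_ball
  obtain ⟨C', hC', HA⟩ := av_diff
  obtain ⟨n, hn⟩ : ∃ n : ℝ, n = 3 ^ s.card := ⟨_, rfl⟩
  have hn0 : 0 < n := by rw [hn]; positivity
  obtain ⟨A, hA⟩ : ∃ A : ℝ, A = s.card * n * 7 + n := ⟨_, rfl⟩
  have hA0 : 0 < A := by rw [hA]; positivity
  refine ⟨5 * C * n + A * (1 + C + 2 * C') + A, by positivity, ?_⟩
  intro lam α b hlam hα hbm hb3 c q x y hq hxc hcy; obtain ⟨d, hd⟩ : ∃ d, d = |c - y| := ⟨_, rfl⟩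
  obtain ⟨e, he⟩ : ∃ e, e = |x - c| := ⟨_, rfl⟩
  obtain ⟨D, hD⟩ : ∃ D, D = |x - y| := ⟨_, rfl⟩
  rw [← hd] at hcy ⊢
  rw [← he] at hxc
  have hd0 : 0 < d := by linarith
  have he0 : 0 ≤ e := he ▸ abs_nonneg _
  have hDd : 2 / 3 * d ≤ D := by
    have h1 : |c - y| ≤ |c - x| + |x - y| := abs_sub_le _ _ _
    rw [abs_sub_comm c x, ← he, ← hd, ← hD] at h1; linarith
  have hD0 : 0 < D := by linarith
  have hcy0 : c ≠ y := by rintro rfl; simp at hd; linarith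
  have hxy0 : x ≠ y := by rintro rfl; simp at hD; linarith
  have hxy1 : x - y ≠ 0 := sub_ne_zero.2 hxy0
  have hcy1 : c - y ≠ 0 := sub_ne_zero.2 hcy0
  obtain ⟨t, ht⟩ : ∃ t, t = √(d / q) := ⟨_, rfl⟩
  have ht1 : 1 ≤ t := by rw [ht, Real.one_le_sqrt, le_div_iff₀ hq]; linarith
  have ht2 : q * t ^ 2 = d := by rw [ht, Real.sq_sqrt (by positivity)]; field_simp
  rw [← ht]
  have mv : ∀ β : ℝ → ℝ, LI β → Dq β x y - Dq β c y = (Dq β c y * (x - c) + Adiff β c x) / (y - x) := fun β hβ => by rw [Dq_symm β x y, Dq_symm β c y]; exact Dq_move hβ hxy0.symm hcy0.symm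
  have hyx : |y - x| = D := by rw [abs_sub_comm, hD]
  -- (1)
  have s1 : ∀ j ∈ s, |Dq (b j) x y - Dq (b j) c y| ≤ 9 / 2 * (q / d) := fun j _ => by
    rw [mv _ (LI_of_bdd (hbm j) (hb3 j)), abs_div, hyx]; have h1 : |Dq (b j) c y * (x - c)| ≤ 3 * e := by rw [abs_mul, ← he]; exact mul_le_mul_of_nonneg_right (Dq_bound (hb3 j) c y) he0
    have h2 : |Adiff (b j) c x| ≤ 3 * e := by have := Adiff_bound (hb3 j) c x; rwa [abs_sub_comm, ← he] at this
    rw [div_le_iff₀ hD0]; have h3 := (abs_add_le (Dq (b j) c y * (x - c)) (Adiff (b j) c x))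
    calc _ ≤ 3 * q := by linarith
      _ = 9 / 2 * (q / d) * (2 / 3 * d) := by field_simp; norm_num
      _ ≤ _ := by gcongr
  have hP : ∀ z, |Pk s b z y| ≤ n := fun z => by rw [hn]; exact Pk_bound (fun j _ => hb3 j) z y
  have s2 : |Pk s b x y - Pk s b c y| ≤ s.card * n * (9 / 2 * (q / d)) := by
    have := prod_diff s (α := fun j => Dq (b j) x y) (β := fun j => Dq (b j) c y) (K := 3) (e := 9 / 2 * (q / d)) (by norm_num) (by positivity)
      (fun j _ => Dq_bound (hb3 j) x y) (fun j _ => Dq_bound (hb3 j) c y) s1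
    rw [hn]; exact this
  have iD : 1 / D ≤ 3 / 2 * (1 / d) := by
    rw [div_le_iff₀ hD0]; calc (1:ℝ) = 3 / 2 * (1 / d) * (2 / 3 * d) := by field_simp
      _ ≤ _ := by gcongr
  have s3 : |Pk s b x y / (x - y) - Pk s b c y / (c - y)| ≤ A * (q / d ^ 2) := by
    have e1 : Pk s b x y / (x - y) - Pk s b c y / (c - y) = (Pk s b x y - Pk s b c y) * (1 / (x - y)) +
        Pk s b c y * (c - x) * (1 / (x - y)) * (1 / (c - y)) := by field_simp; ring
    rw [e1]; refine (abs_add_le _ _).trans ?_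
    simp only [abs_mul, abs_div, abs_one]; rw [← hD, ← hd, abs_sub_comm c x, ← he]
    calc _ ≤ s.card * n * (9 / 2 * (q / d)) * (3 / 2 * (1 / d)) + n * (q / 2) * (3 / 2 * (1 / d)) * (1 / d) := by
          gcongr
          exact hP c
      _ = (s.card * n * (27 / 4) + n * (3 / 4)) * (q / d ^ 2) := by field_simp; ring
      _ ≤ _ := by
          rw [hA]; have : 0 ≤ (s.card:ℝ) * n := by positivity
          gcongr
          · norm_num
          · linarith
  -- (4)
  have s4 : |Kap lam α x y - Kap lam α c y| ≤ 3 * C * (q * t / d) := by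
    have e1 : Kap lam α x y - Kap lam α c y = Dq α x y - Dq α c y := by unfold Kap; ring
    rw [e1]; by_cases hx : x = c
    · subst hx; simp; positivity
    have hcx : c ≠ x := Ne.symm hx
    have hcx1 : c - x ≠ 0 := sub_ne_zero.2 hcx
    have hyx1 : y - x ≠ 0 := sub_ne_zero.2 hxy0.symm
    have e2 : Dq α x y - Dq α c y = (x - c) * ((Dq α c y - av α (c - d) (c + d)) - (Dq α c x - av α (c - d) (c + d))) / (y - x) := by rw [mv α hα.li, show Adiff α c x = Dq α c x * (c - x) by unfold Dq; field_simp]; ring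
    have hep : 0 < e := by rw [he]; exact abs_pos.2 (sub_ne_zero.2 hx)
    have h1 := HD α hα c y d hcy0 hd.ge; have h2 := HD α hα c x d hcx (by rw [abs_sub_comm, ← he]; linarith)
    rw [← hd, div_self hd0.ne', Real.sqrt_one, mul_one] at h1; rw [abs_sub_comm c x, ← he] at h2
    have h3 : e * √(d / e) ≤ q * t := by
      have : e * √(d / e) = √(d * e) := by rw [show d * e = e ^ 2 * (d / e) by field_simp, Real.sqrt_mul (by positivity), Real.sqrt_sq he0]
      rw [this]; apply Real.sqrt_le_iff.2 ⟨by positivity, ?_⟩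
      calc d * e ≤ d * q := by gcongr; linarith
        _ = _ := by rw [← ht2]; ring
    have h4 : e ≤ q * t := by nlinarith
    rw [e2, abs_div, abs_mul, hyx, ← he, div_le_iff₀ hD0]; have h5 := (abs_sub (Dq α c y - av α (c - d) (c + d)) (Dq α c x - av α (c - d) (c + d))).trans (add_le_add h1 h2)
    calc _ ≤ e * (C + C * √(d / e)) := by gcongr
      _ = C * (e + e * √(d / e)) := by ring
      _ ≤ C * (q * t + q * t) := by gcongr
      _ = 3 * C * (q * t / d) * (2 / 3 * d) := by field_simp; norm_num
      _ ≤ _ := by gcongr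
  have s5 : |Pk s b x y / (x - y)| ≤ n * (3 / 2 * (1 / d)) := by
    rw [abs_div, ← hD, div_eq_mul_one_div]; gcongr
    exact hP x
  have s6 : |Kap lam α c y| ≤ (1 + C + 2 * C') * t + |α y - av α (c - q / 2) (c + q / 2)| := by
    have h1 := HD α hα c y d hcy0 hd.ge; rw [← hd, div_self hd0.ne', Real.sqrt_one, mul_one] at h1; have h2 := HA α hα (c - d) (c + d) (c - q / 2) (c + q / 2) (by linarith) (by linarith) (by linarith)
    have h3 : √((c + d - (c - d)) / (c + q / 2 - (c - q / 2))) ≤ 2 * t := by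
      apply Real.sqrt_le_iff.2 ⟨by positivity, ?_⟩
      rw [show (c + d - (c - d)) / (c + q / 2 - (c - q / 2)) = 2 * (d / q) by ring, mul_pow, ht, Real.sq_sqrt (by positivity)]
      have : 0 ≤ d / q := by positivity
      linarith
    have h4 := h2.trans (mul_le_mul_of_nonneg_left h3 hC'.le); unfold Kap; rw [abs_le] at hlam h1 h4 ⊢; have h5 := neg_abs_le (α y - av α (c - q / 2) (c + q / 2))
    have h6 := le_abs_self (α y - av α (c - q / 2) (c + q / 2)); have h7 : C ≤ C * t := by nlinarith
    constructor <;> linarith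
  have e1 : KK lam α s b x y - KK lam α s b c y = (Kap lam α x y - Kap lam α c y) * (Pk s b x y / (x - y)) +
      Kap lam α c y * (Pk s b x y / (x - y) - Pk s b c y / (c - y)) := by unfold KK; ring
  rw [e1]
  refine (abs_add_le _ _).trans ?_
  rw [abs_mul, abs_mul]
  set w := |α y - av α (c - q / 2) (c + q / 2)| with hw
  have hw0 : 0 ≤ w := abs_nonneg _
  calc _ ≤ 3 * C * (q * t / d) * (n * (3 / 2 * (1 / d))) + ((1 + C + 2 * C') * t + w) * (A * (q / d ^ 2)) := by gcongr
    _ = (q / d ^ 2) * ((9 / 2 * C * n + A * (1 + C + 2 * C')) * t + A * w) := by field_simp; ring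
    _ ≤ (q / d ^ 2) * ((5 * C * n + A * (1 + C + 2 * C') + A) * (t + w)) := by
        gcongr
        have h1 : 0 ≤ C * n * t := by positivity
        have h2 : 0 ≤ (5 * C * n + A * (1 + C + 2 * C')) * w := by positivity
        have h3 : 0 ≤ A * t := by positivity
        nlinarith
    _ = _ := by ring

theorem sint : ∃ C : ℝ, 1 ≤ C ∧ ∀ (α f : ℝ → ℝ), BMO1 α → Measurable α → Measurable f → ∀ a b σ : ℝ, a < b → 0 < σ →
    ∫⁻ x in Ioc a b, ofReal (f x ^ 2) ≤ ofReal (σ ^ 2 * (b - a)) →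
    ∫⁻ x in Ioc a b, ofReal |f x| ≤ ofReal (σ * (b - a)) ∧
    ∫⁻ x in Ioc a b, ofReal (|α x - av α a b| * |f x|) ≤ ofReal (C * σ * (b - a)) := by
  obtain ⟨C, hC, H⟩ := JN_sq
  refine ⟨C + 1, by linarith, fun α f hα hαm hfm a b σ hab hσ hf => ?_⟩
  have hL : 0 < b - a := by linarith
  have key : ∀ (g : ℝ → ℝ) (K : ℝ), Measurable g → 0 ≤ K → ∫⁻ x in Ioc a b, ofReal (g x ^ 2) ≤ ofReal (K * (b - a)) →
      ∫⁻ x in Ioc a b, ofReal (|g x| * |f x|) ≤ ofReal ((K + 1) / 2 * σ * (b - a)) := by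
    intro g K hg hK h; have : ∀ x, ofReal (|g x| * |f x|) ≤ ofReal (σ / 2) * ofReal (g x ^ 2) + ofReal (1 / (2 * σ)) * ofReal (f x ^ 2) := fun x => by
      rw [← ofReal_mul (by positivity), ← ofReal_mul (by positivity), ← ofReal_add (by positivity) (by positivity)]
      refine ofReal_le_ofReal ?_; rw [← sq_abs (g x), ← sq_abs (f x)]
      have : σ / 2 * |g x| ^ 2 + 1 / (2 * σ) * |f x| ^ 2 - |g x| * |f x| = 1 / (2 * σ) * (σ * |g x| - |f x|) ^ 2 := by field_simp; ring
      have h2 : 0 ≤ 1 / (2 * σ) * (σ * |g x| - |f x|) ^ 2 := by positivity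
      linarith
    refine (lintegral_mono this).trans ?_; have m1 : Measurable fun x => ofReal (σ / 2) * ofReal (g x ^ 2) := by fun_prop
    rw [lintegral_add_left m1, lintegral_const_mul' _ _ (by simp), lintegral_const_mul' _ _ (by simp)]
    refine (add_le_add (mul_le_mul' le_rfl h) (mul_le_mul' le_rfl hf)).trans ?_; rw [← ofReal_mul (by positivity), ← ofReal_mul (by positivity), ← ofReal_add (by positivity) (by positivity)]
    refine ofReal_le_ofReal (le_of_eq ?_); field_simp
  constructor
  · have := key (fun _ => 1) 1 measurable_const (by norm_num) (by simp)
    simpa using this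
  · obtain ⟨h1, h2⟩ := H α hα a b hab
    refine (key (fun x => α x - av α a b) C (hαm.sub measurable_const) hC.le ?_).trans (ofReal_le_ofReal ?_)
    · rw [← ofReal_integral_eq_lintegral_ofReal h1 (ae_of_all _ fun x => sq_nonneg _)]
      exact ofReal_le_ofReal h2
    · have : (C + 1) / 2 ≤ C + 1 := by linarith
      gcongr

/-- annuli lemma -/
theorem annuli {g : ℝ → ℝ≥0∞} (hg : Measurable g) {c q H : ℝ} (hq : 0 < q) (hH : 0 ≤ H)
    (h : ∀ R, q ≤ R → ∫⁻ y in Ioc (c - R) (c + R), g y ≤ ofReal (H * (R * √(R / q)))) :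
    ∫⁻ y in {y | q ≤ |c - y|}, ofReal (q / |c - y| ^ 2) * g y ≤ ofReal (4 * H) := by
  have e1 : ∀ y, q ≤ |c - y| → ofReal (q / |c - y| ^ 2) * g y =
      ∫⁻ R in Ioi q, ({p : ℝ × ℝ | |c - p.2| < p.1}.indicator (fun p => ofReal (2 * q * p.1 ^ (-3:ℝ)) * g p.2) (R, y)) := by
    intro y hy; have hd : 0 < |c - y| := by linarith
    have h1 : ∀ R, ({p : ℝ × ℝ | |c - p.2| < p.1}.indicator (fun p => ofReal (2 * q * p.1 ^ (-3:ℝ)) * g p.2) (R, y)) =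
        (Ioi |c - y|).indicator (fun R => ofReal (2 * q) * ofReal (R ^ (-3:ℝ)) * g y) R := by
      intro R; simp only [indicator]
      congr 1
      rw [ofReal_mul (by positivity)]
    simp_rw [h1]
    rw [lintegral_indicator measurableSet_Ioi, Measure.restrict_restrict measurableSet_Ioi,
      inter_eq_left.2 (Ioi_subset_Ioi hy)]
    have m : Measurable fun R : ℝ => ofReal (2 * q) * ofReal (R ^ (-3:ℝ)) := by fun_prop
    rw [lintegral_mul_const _ m, lintegral_const_mul' _ _ ofReal_ne_top, tail_rpow (by norm_num) hd, ← ofReal_mul (by positivity)]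
    congr 2
    rw [show (-3:ℝ) + 1 = -2 by norm_num, Real.rpow_neg hd.le, show (2:ℝ) = ((2:ℕ):ℝ) by norm_num, Real.rpow_natCast]
    field_simp
  have mS : MeasurableSet {p : ℝ × ℝ | |c - p.2| < p.1} := measurableSet_lt (by fun_prop) (by fun_prop)
  have mF : Measurable ({p : ℝ × ℝ | |c - p.2| < p.1}.indicator (fun p => ofReal (2 * q * p.1 ^ (-3:ℝ)) * g p.2)) := by
    refine Measurable.indicator ?_ mS
    have : Measurable (fun p : ℝ × ℝ => g p.2) := hg.comp measurable_snd
    fun_prop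
  have mT : MeasurableSet {y : ℝ | q ≤ |c - y|} := measurableSet_le measurable_const (by fun_prop)
  rw [setLIntegral_congr_fun mT (fun y hy => e1 y hy)]
  rw [lintegral_lintegral_swap (f := fun y R => ({p : ℝ × ℝ | |c - p.2| < p.1}.indicator (fun p => ofReal (2 * q * p.1 ^ (-3:ℝ)) * g p.2) (R, y)))
    (mF.comp measurable_swap).aemeasurable]
  have e2 : ∀ R ∈ Ioi q, ∫⁻ y in {y | q ≤ |c - y|}, ({p : ℝ × ℝ | |c - p.2| < p.1}.indicator (fun p => ofReal (2 * q * p.1 ^ (-3:ℝ)) * g p.2) (R, y))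
      ≤ ofReal (2 * H * √q) * ofReal (R ^ (-(3/2):ℝ)) := by
    intro R hR; have hR' : q < R := hR
    have hR0 : 0 < R := hq.trans hR'
    calc _ ≤ ∫⁻ y, (Ioc (c - R) (c + R)).indicator (fun y => ofReal (2 * q * R ^ (-3:ℝ)) * g y) y := by
          refine (setLIntegral_le_lintegral _ _).trans (lintegral_mono fun y => ?_)
          by_cases hy : |c - y| < R
          · have : y ∈ Ioc (c - R) (c + R) := by rw [abs_lt] at hy; exact ⟨by linarith, by linarith⟩
            rw [indicator_of_mem this, indicator_of_mem (show (R, y) ∈ {p : ℝ × ℝ | |c - p.2| < p.1} from hy)]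
          · rw [indicator_of_notMem (show (R, y) ∉ {p : ℝ × ℝ | |c - p.2| < p.1} from hy)]; exact zero_le
      _ = ofReal (2 * q * R ^ (-3:ℝ)) * ∫⁻ y in Ioc (c - R) (c + R), g y := by rw [lintegral_indicator measurableSet_Ioc, lintegral_const_mul' _ _ (by simp)]
      _ ≤ ofReal (2 * q * R ^ (-3:ℝ)) * ofReal (H * (R * √(R / q))) := mul_le_mul' le_rfl (h R hR'.le)
      _ = _ := by
          rw [← ofReal_mul (by positivity), ← ofReal_mul (by positivity)]
          congr 1
          have e3 : R ^ (-(3/2):ℝ) = R ^ (-3:ℝ) * R * √R := by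
            rw [Real.sqrt_eq_rpow]; nth_rewrite 3 [← Real.rpow_one R]
            rw [← Real.rpow_add hR0, ← Real.rpow_add hR0]; norm_num
          rw [e3, Real.sqrt_div hR0.le]; have : √q ≠ 0 := by positivity
          field_simp
          rw [Real.sq_sqrt hq.le]; ring
  refine (setLIntegral_mono' measurableSet_Ioi e2).trans ?_
  rw [lintegral_const_mul' _ _ (by simp), tail_rpow (by norm_num) hq, ← ofReal_mul (by positivity)]
  refine ofReal_le_ofReal (le_of_eq ?_)
  rw [show (-(3/2):ℝ) + 1 = -(1/2) by norm_num, Real.rpow_neg hq.le, ← Real.sqrt_eq_rpow]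
  have : √q ≠ 0 := by positivity
  field_simp
  ring

/-- integral of the far weight over a ball -/
theorem ball_int : ∃ C : ℝ, 0 < C ∧ ∀ (α f : ℝ → ℝ), BMO1 α → Measurable α → Measurable f → ∀ c q σ : ℝ, 0 < q → 0 < σ →
    (∀ R, q ≤ R → ∫⁻ y in Ioc (c - R) (c + R), ofReal (f y ^ 2) ≤ ofReal (σ ^ 2 * (2 * R))) → ∀ R, q ≤ R →
    ∫⁻ y in Ioc (c - R) (c + R), ofReal ((√(|c - y| / q) + |α y - av α (c - q / 2) (c + q / 2)|) * |f y|)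
      ≤ ofReal (C * σ * (R * √(R / q))) := by
  obtain ⟨C0, hC0, hs⟩ := sint
  obtain ⟨C', hC', HA⟩ := av_diff
  refine ⟨2 + 2 * C0 + 4 * C', by linarith, fun α f hα hαm hfm c q σ hq hσ h R hR => ?_⟩
  have hR0 : 0 < R := hq.trans_le hR
  have hl : c + R - (c - R) = 2 * R := by ring
  obtain ⟨h1, h2⟩ := hs α f hα hαm hfm (c - R) (c + R) σ (by linarith) hσ (by rw [hl]; exact h R hR)
  rw [hl] at h1 h2
  have h3 := HA α hα (c - R) (c + R) (c - q / 2) (c + q / 2) (by linarith) (by linarith) (by linarith)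
  obtain ⟨t, ht⟩ : ∃ t, t = √(R / q) := ⟨_, rfl⟩
  have ht1 : 1 ≤ t := by rw [ht]; apply Real.one_le_sqrt.2; rw [le_div_iff₀ hq]; linarith
  have h4 : √((c + R - (c - R)) / (c + q / 2 - (c - q / 2))) ≤ 2 * t := by
    apply Real.sqrt_le_iff.2 ⟨by positivity, ?_⟩
    rw [show (c + R - (c - R)) / (c + q / 2 - (c - q / 2)) = 2 * (R / q) by ring, mul_pow, ht, Real.sq_sqrt (by positivity)]
    have : 0 ≤ R / q := by positivity
    linarith
  have h5 := h3.trans (mul_le_mul_of_nonneg_left h4 hC'.le)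
  have pt : ∀ y ∈ Ioc (c - R) (c + R), ofReal ((√(|c - y| / q) + |α y - av α (c - q / 2) (c + q / 2)|) * |f y|) ≤
      ofReal (t + C' * (2 * t)) * ofReal |f y| + ofReal (|α y - av α (c - R) (c + R)| * |f y|) := by
    intro y hy; rw [← ofReal_mul (by positivity), ← ofReal_add (by positivity) (by positivity), ← add_mul]
    refine ofReal_le_ofReal (mul_le_mul_of_nonneg_right ?_ (abs_nonneg _))
    have a1 : √(|c - y| / q) ≤ t := by rw [ht]; apply Real.sqrt_le_sqrt; gcongr; rw [abs_le]; exact ⟨by linarith [hy.2], by linarith [hy.1]⟩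
    have a2 := abs_add_le (α y - av α (c - R) (c + R)) (av α (c - R) (c + R) - av α (c - q / 2) (c + q / 2)); rw [sub_add_sub_cancel, abs_sub_comm (av α (c - R) (c + R))] at a2
    linarith
  refine (setLIntegral_mono' measurableSet_Ioc pt).trans ?_
  have m1 : Measurable fun y => ofReal (t + C' * (2 * t)) * ofReal |f y| := by fun_prop
  rw [lintegral_add_left m1, lintegral_const_mul' _ _ ofReal_ne_top]
  refine (add_le_add (mul_le_mul' le_rfl h1) h2).trans ?_
  rw [← ofReal_mul (by positivity), ← ofReal_add (by positivity) (by positivity), ← ht]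
  refine ofReal_le_ofReal ?_
  have : C0 * σ * (2 * R) * 1 ≤ C0 * σ * (2 * R) * t := by gcongr
  linarith

set_option maxHeartbeats 1000000 in
theorem far_osc {ι : Type} (s : Finset ι) : ∃ C : ℝ, 0 < C ∧ ∀ (lam : ℝ) (α : ℝ → ℝ) (b : ι → ℝ → ℝ) (f : ℝ → ℝ) (u v δ c q σ : ℝ),
    |lam| ≤ 1 → BMO1 α → Measurable α → (∀ j, Measurable (b j)) → (∀ j x, |b j x| ≤ 3) → Measurable f → (∀ x, |f x| ≤ 1) →
    (∀ x, x ∉ Ioc u v → f x = 0) → 0 < δ → 0 < q → 0 < σ →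
    (∀ R, q ≤ R → ∫⁻ y in Ioc (c - R) (c + R), ofReal (f y ^ 2) ≤ ofReal (σ ^ 2 * (2 * R))) →
    (∀ y, |c - y| < 3 / 2 * q → f y = 0) → ∀ x, |x - c| ≤ q / 2 →
    |Uop lam α s b δ f x - Uop lam α s b δ f c| ≤ C * σ := by
  obtain ⟨C1, hC1, H1⟩ := far1 s
  obtain ⟨C2, hC2, H2⟩ := ball_int
  obtain ⟨C3, hC3, H3⟩ := Kap_ball
  obtain ⟨C0, hC0, hs⟩ := sint
  obtain ⟨n, hn⟩ : ∃ n : ℝ, n = 3 ^ s.card := ⟨_, rfl⟩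
  have hn0 : 0 < n := by rw [hn]; positivity
  refine ⟨C1 * (4 * C2) + 4 * n * (1 + 2 * C3 + C0), by positivity, ?_⟩
  intro lam α b f u v δ c q σ hlam hα hαm hbm hb3 hfm hf1 hf0 hδ hq hσ hσ2 hfq x hxc; have hLI : ∀ j, LI (b j) := fun j => LI_of_bdd (hbm j) (hb3 j)
  have hfi : Integrable f := int_of_bdd_supp' hfm hf1 hf0
  have hαf : Integrable (fun y => α y * f y) := int_of_bdd_supp hfm hf1 hf0 hα.li
  have hP : ∀ x y, |Pk s b x y| ≤ n := by intro x y; rw [hn]; exact Pk_bound (fun j _ => hb3 j) x y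
  have hI : ∀ z, Integrable ({y | δ < |z - y|}.indicator (fun y => KK lam α s b z y * f y)) := fun z => by rw [integrable_indicator_iff (meas_trunc z δ)]; exact Uint hα.li hαm hLI hfm hfi hαf hf0 hδ (fun y _ => hP z y)
  have hU : ∀ z, Uop lam α s b δ f z = ∫ y, {y | δ < |z - y|}.indicator (fun y => KK lam α s b z y * f y) y := fun z => by rw [integral_indicator (meas_trunc z δ)]; rfl
  obtain ⟨ρ, hρ⟩ : ∃ ρ, ρ = 3 / 2 * δ := ⟨_, rfl⟩
  have hρ0 : 0 < ρ := by rw [hρ]; positivity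
  obtain ⟨w, hw⟩ : ∃ w : ℝ → ℝ, w = fun y => (√(|c - y| / q) + |α y - av α (c - q / 2) (c + q / 2)|) * |f y| := ⟨_, rfl⟩
  have hw0 : ∀ y, 0 ≤ w y := fun y => by rw [hw]; positivity
  have hwm : Measurable w := by rw [hw]; fun_prop
  obtain ⟨w2, hw2⟩ : ∃ w2 : ℝ → ℝ, w2 = fun y => 2 * n / ρ * ((1 + 2 * C3) * |f y| + |α y - av α (c - ρ) (c + ρ)| * |f y|) := ⟨_, rfl⟩
  have hw20 : ∀ y, 0 ≤ w2 y := fun y => by rw [hw2]; positivity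
  have mT : MeasurableSet {y : ℝ | q ≤ |c - y|} := measurableSet_le measurable_const (by fun_prop)
  obtain ⟨S2, hS2⟩ : ∃ S2 : Set ℝ, S2 = {y | y ∈ Icc (c - ρ) (c + ρ) ∧ q ≤ ρ} := ⟨_, rfl⟩
  have mS2 : MeasurableSet S2 := by rw [hS2]; exact measurableSet_Icc.inter (MeasurableSet.const _)
  have pt : ∀ y, ‖{y | δ < |x - y|}.indicator (fun y => KK lam α s b x y * f y) y - {y | δ < |c - y|}.indicator (fun y => KK lam α s b c y * f y) y‖ₑ
      ≤ {y : ℝ | q ≤ |c - y|}.indicator (fun y => ofReal C1 * (ofReal (q / |c - y| ^ 2) * ofReal (w y))) y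
        + S2.indicator (fun y => ofReal (w2 y)) y := by
    intro y; by_cases hy : |c - y| < 3 / 2 * q
    · have := hfq y hy
      simp [indicator, this]
    push Not at hy
    have hd0 : 0 < |c - y| := by linarith
    have hcy : c ≠ y := fun h => by rw [h] at hd0; simp at hd0
    rw [indicator_of_mem (show y ∈ {y : ℝ | q ≤ |c - y|} by show q ≤ |c - y|; linarith)]
    have k1 : |KK lam α s b x y * f y - KK lam α s b c y * f y| ≤ C1 * (q / |c - y| ^ 2 * w y) := by
      rw [← sub_mul, abs_mul, hw]; refine (mul_le_mul_of_nonneg_right (H1 lam α b hlam hα hbm hb3 c q x y hq hxc hy) (abs_nonneg _)).trans (le_of_eq ?_)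
      ring
    have k2 : ofReal (C1 * (q / |c - y| ^ 2 * w y)) = ofReal C1 * (ofReal (q / |c - y| ^ 2) * ofReal (w y)) := by rw [ofReal_mul hC1.le, ofReal_mul (by positivity)]
    rw [← k2]; have D1 : |x - y| ≤ |x - c| + |c - y| := abs_sub_le _ _ _
    have D2 : |c - y| ≤ |c - x| + |x - y| := abs_sub_le _ _ _
    rw [abs_sub_comm c x] at D2; have k3 : |c - y| ≤ ρ → ρ / 2 ≤ |c - y| → y ∈ S2 ∧ |KK lam α s b c y * f y| ≤ w2 y := fun g1 g2 => by
      have g3 : q ≤ ρ := by linarith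
      constructor
      · rw [hS2]
        rw [abs_le] at g1; exact ⟨⟨by linarith, by linarith⟩, g3⟩
      have a1 := H3 lam α hlam hα c y ρ hcy g1; have a2 : √(ρ / |c - y|) ≤ 2 := by
        apply Real.sqrt_le_iff.2 ⟨by norm_num, ?_⟩
        rw [div_le_iff₀ hd0]; linarith
      have a3 : |KK lam α s b c y| ≤ (1 + 2 * C3 + |α y - av α (c - ρ) (c + ρ)|) * n / (ρ / 2) := by
        unfold KK; rw [abs_div, abs_mul]
        gcongr
        · refine a1.trans ?_
          nlinarith
        · exact hP c y
      rw [abs_mul, hw2]; refine (mul_le_mul_of_nonneg_right a3 (abs_nonneg _)).trans (le_of_eq ?_)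
      field_simp
    by_cases i1 : δ < |x - y| <;> by_cases i2 : δ < |c - y|
    · rw [indicator_of_mem (show y ∈ {y | δ < |x - y|} from i1), indicator_of_mem (show y ∈ {y | δ < |c - y|} from i2), ← ofReal_norm_eq_enorm]
      exact (ofReal_le_ofReal k1).trans le_self_add
    · push Not at i2
      obtain ⟨g1, g2⟩ := k3 (by linarith) (by linarith)
      rw [indicator_of_mem (show y ∈ {y | δ < |x - y|} from i1), indicator_of_notMem (show y ∉ {y | δ < |c - y|} from not_lt.2 i2), indicator_of_mem g1,
        ← ofReal_norm_eq_enorm, ← ofReal_add ((abs_nonneg _).trans k1) (hw20 y)]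
      refine ofReal_le_ofReal ?_; rw [sub_zero, norm_eq_abs]
      have := abs_add_le (KK lam α s b x y * f y - KK lam α s b c y * f y) (KK lam α s b c y * f y); rw [sub_add_cancel] at this; linarith
    · push Not at i1
      obtain ⟨g1, g2⟩ := k3 (by linarith) (by linarith)
      rw [indicator_of_notMem (show y ∉ {y | δ < |x - y|} from not_lt.2 i1), indicator_of_mem (show y ∈ {y | δ < |c - y|} from i2), indicator_of_mem g1,
        ← ofReal_norm_eq_enorm]
      refine (ofReal_le_ofReal ?_).trans le_add_self
      rw [zero_sub, norm_neg, norm_eq_abs]; exact g2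
    · rw [indicator_of_notMem (show y ∉ {y | δ < |x - y|} from i1), indicator_of_notMem (show y ∉ {y | δ < |c - y|} from i2)]
      simp
  rw [← norm_eq_abs, ← ofReal_le_ofReal_iff (by positivity), ofReal_norm_eq_enorm, hU, hU, ← integral_sub (hI x) (hI c)]
  refine (enorm_integral_le_lintegral_enorm _).trans ((lintegral_mono pt).trans ?_)
  have mA : Measurable ({y : ℝ | q ≤ |c - y|}.indicator (fun y => ofReal C1 * (ofReal (q / |c - y| ^ 2) * ofReal (w y)))) := by
    refine Measurable.indicator ?_ mT
    fun_prop
  rw [lintegral_add_left mA, lintegral_indicator mT, lintegral_indicator mS2, lintegral_const_mul' _ _ ofReal_ne_top]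
  have b1 := annuli (g := fun y => ofReal (w y)) (by fun_prop) (c := c) hq (H := C2 * σ) (by positivity) (by
    intro R hR; rw [hw]
    exact H2 α f hα hαm hfm c q σ hq hσ hσ2 R hR)
  have b2 : ∫⁻ y in S2, ofReal (w2 y) ≤ ofReal (4 * n * (1 + 2 * C3 + C0) * σ) := by
    by_cases hqρ : q ≤ ρ
    · have : S2 = Icc (c - ρ) (c + ρ) := by rw [hS2]; ext y; simp [hqρ]
      rw [this, setLIntegral_congr Ioc_ae_eq_Icc.symm]; have hl : c + ρ - (c - ρ) = 2 * ρ := by ring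
      obtain ⟨h1, h2⟩ := hs α f hα hαm hfm (c - ρ) (c + ρ) σ (by linarith) hσ (by rw [hl]; exact hσ2 ρ hqρ)
      rw [hl] at h1 h2
      have e : ∀ y, ofReal (w2 y) = ofReal (2 * n / ρ) * (ofReal (1 + 2 * C3) * ofReal |f y| + ofReal (|α y - av α (c - ρ) (c + ρ)| * |f y|)) := fun y => by
        rw [← ofReal_mul (by positivity), ← ofReal_add (by positivity) (by positivity), ← ofReal_mul (by positivity), hw2]
      simp_rw [e]
      have m1 : Measurable fun y => ofReal (1 + 2 * C3) * ofReal |f y| := by fun_prop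
      rw [lintegral_const_mul' _ _ ofReal_ne_top, lintegral_add_left m1, lintegral_const_mul' _ _ ofReal_ne_top]; refine (mul_le_mul' le_rfl (add_le_add (mul_le_mul' le_rfl h1) h2)).trans ?_
      rw [← ofReal_mul (by positivity), ← ofReal_add (by positivity) (by positivity), ← ofReal_mul (by positivity)]
      refine ofReal_le_ofReal (le_of_eq ?_); field_simp
      ring
    · have : S2 = ∅ := by rw [hS2]; ext y; simp [hqρ]
      rw [this]; simp
  refine (add_le_add (mul_le_mul' le_rfl b1) b2).trans ?_
  rw [← ofReal_mul (by positivity), ← ofReal_add (by positivity) (by positivity)]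
  refine ofReal_le_ofReal (le_of_eq ?_)
  ring

theorem Dq_shift {α : ℝ → ℝ} (h : LI α) (k : ℝ) {x y : ℝ} (hxy : x ≠ y) : Dq (fun z => α z - k) x y = Dq α x y - k := by
  have h1 : Adiff (fun z => α z - k) x y = Adiff α x y - (x - y) * k := by unfold Adiff; rw [intervalIntegral.integral_sub (h y x) intervalIntegrable_const, intervalIntegral.integral_const, smul_eq_mul]
  unfold Dq; rw [h1, sub_div, mul_div_cancel_left₀ _ (sub_ne_zero.2 hxy)]

/-- splitting of `U` into three multilinear commutators -/
theorem Uop_split {ι : Type} {lam : ℝ} {α : ℝ → ℝ} {s : Finset ι} {b : ι → ℝ → ℝ} {f : ℝ → ℝ} {u v x ε B : ℝ}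
    (hα : LI α) (hαm : Measurable α) (hb : ∀ j, LI (b j)) (hfm : Measurable f) (hf : Integrable f)
    (hαf : Integrable (fun y => α y * f y)) (hf0 : ∀ x ∉ Ioc u v, f x = 0) (hε : 0 < ε)
    (hB : ∀ y, ε < |x - y| → |Pk s b x y| ≤ B) (k : ℝ) :
    Uop lam α s b ε f x = lam * Cop s b ε f x + Cop (insertNone s) (fun o => o.elim (fun z => α z - k) b) ε f x
      - Cop s b ε (fun y => (α y - k) * f y) x := by
  have hT := Uint (lam := lam) hα hαm hb hfm hf hαf hf0 hε hB
  have hl0 : LI (fun _ => (0:ℝ)) := BMO1_zero.li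
  have hF : IntegrableOn (fun y => Pk s b x y / (x - y) * f y) {y | ε < |x - y|} := by
    have := Uint (lam := 1) hl0 measurable_const hb hfm hf (by simp) hf0 hε hB
    simpa only [Kap_one_zero, one_mul] using this
  have hkf : Integrable (fun y => (α y - k) * f y) := by
    have := hαf.sub (hf.const_mul k); refine this.congr (ae_of_all _ fun y => ?_)
    simp only [Pi.sub_apply]; ring
  have hG : IntegrableOn (fun y => Pk s b x y / (x - y) * ((α y - k) * f y)) {y | ε < |x - y|} := by
    have := Uint (lam := 1) (f := fun y => (α y - k) * f y) (u := u) (v := v) hl0 measurable_const hb ((hαm.sub measurable_const).mul hfm) hkf (by simp)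
      (fun x hx => by simp only [hf0 x hx, mul_zero]) hε hB
    simpa only [Kap_one_zero, one_mul] using this
  have e : ∀ y ∈ {y | ε < |x - y|}, Pk (insertNone s) (fun o => o.elim (fun z => α z - k) b) x y / (x - y) * f y =
      Kap lam α x y * Pk s b x y / (x - y) * f y - lam * (Pk s b x y / (x - y) * f y) + Pk s b x y / (x - y) * ((α y - k) * f y) := by
    intro y hy; have hxy : x ≠ y := fun h => by
      have : ε < |x - y| := hy
      rw [h] at this; simp at this; linarith
    have : Pk (insertNone s) (fun o => o.elim (fun z => α z - k) b) x y = Dq (fun z => α z - k) x y * Pk s b x y := by unfold Pk; rw [Finset.prod_insertNone]; rfl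
    rw [this, Dq_shift hα k hxy]; unfold Kap
    ring
  have e2 : Cop (insertNone s) (fun o => o.elim (fun z => α z - k) b) ε f x = Uop lam α s b ε f x - lam * Cop s b ε f x
      + Cop s b ε (fun y => (α y - k) * f y) x := by
    unfold Cop Uop; have hS : IntegrableOn (fun y => Kap lam α x y * Pk s b x y / (x - y) * f y - lam * (Pk s b x y / (x - y) * f y)) {y | ε < |x - y|} :=
      hT.sub (hF.const_mul lam)
    rw [setIntegral_congr_fun (meas_trunc x ε) e, integral_add hS hG, integral_sub hT (hF.const_mul lam),
      integral_const_mul]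
  rw [e2]; ring

set_option maxHeartbeats 1000000 in
theorem loc_osc {ι : Type} (s : Finset ι) : ∃ C : ℝ, 0 < C ∧ ∀ (lam : ℝ) (α : ℝ → ℝ) (b : ι → ℝ → ℝ) (f : ℝ → ℝ) (l r δ σ : ℝ),
    |lam| ≤ 1 → BMO1 α → Measurable α → (∀ j, Measurable (b j)) → (∀ j x, |b j x| ≤ 3) → Measurable f → (∀ x, |f x| ≤ 1) →
    (∀ x, x ∉ Ioc l r → f x = 0) → 0 < δ → l < r → 0 < σ →
    ∫⁻ y in Ioc l r, ofReal (f y ^ 2) ≤ ofReal (σ ^ 2 * (r - l)) →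
    volume {x ∈ Ioc l r | C * σ < |Uop lam α s b δ f x|} ≤ ofReal (1 / 48 * (r - l)) := by
  obtain ⟨W1, hW1, H1⟩ := lemW s (1 / 144) 3 (by norm_num) (by norm_num)
  obtain ⟨W2, hW2, H2⟩ := lemW (insertNone s) (1 / 144) 3 (by norm_num) (by norm_num)
  obtain ⟨C0, hC0, hs⟩ := sint
  refine ⟨W1 + W2 + W1 * C0, by positivity, ?_⟩
  intro lam α b f l r δ σ hlam hα hαm hbm hb3 hfm hf1 hf0 hδ hlr hσ hσ2; have hL : 0 < r - l := by linarith
  have hLI : ∀ j, LI (b j) := fun j => LI_of_bdd (hbm j) (hb3 j)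
  have hfi : Integrable f := int_of_bdd_supp' hfm hf1 hf0
  have hαf : Integrable (fun y => α y * f y) := int_of_bdd_supp hfm hf1 hf0 hα.li
  obtain ⟨h1, h2⟩ := hs α f hα hαm hfm l r σ hlr hσ hσ2
  obtain ⟨k, hk⟩ : ∃ k, k = av α l r := ⟨_, rfl⟩
  rw [← hk] at h2
  have hkf : Integrable (fun y => (α y - k) * f y) := by
    have := hαf.sub (hfi.const_mul k); refine this.congr (ae_of_all _ fun y => ?_)
    simp only [Pi.sub_apply]; ring
  have f1 : ∫ y in Ioc l r, |f y| ≤ σ * (r - l) := int_le_of_lint (by positivity) hfi.integrableOn h1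
  have f2 : ∫ y in Ioc l r, |(α y - k) * f y| ≤ (C0 * σ) * (r - l) := by
    refine int_le_of_lint (by positivity) hkf.integrableOn ?_
    simpa only [abs_mul] using h2
  have b1 : ∀ j, ∫ y in Ioc l r, |b j y| ≤ 3 * (r - l) := fun j => by
    calc _ ≤ ∫ y in Ioc l r, (3:ℝ) := integral_mono ((hLI j).on l r).abs (by simp) (fun y => hb3 j y)
      _ = _ := by simp [hlr.le, mul_comm]
  have A1 := H1 b f l r δ σ hlr hδ hσ (fun j _ => hbm j) (fun j _ => (hLI j).on l r) hfm hfi.integrableOn hf0 (fun j _ => b1 j) f1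
  have A3 := H1 b (fun y => (α y - k) * f y) l r δ (C0 * σ) hlr hδ (by positivity) (fun j _ => hbm j) (fun j _ => (hLI j).on l r)
    ((hαm.sub measurable_const).mul hfm) hkf.integrableOn (fun x hx => by simp only [hf0 x hx, mul_zero]) (fun j _ => b1 j) f2
  have hαk : IntegrableOn (fun z => α z - k) (Ioc l r) := (hα.1 l r).sub (by simp)
  have A2 := H2 (fun o => o.elim (fun z => α z - k) b) f l r δ σ hlr hδ hσ (fun o _ => by
      cases o with
      | none => exact hαm.sub measurable_const
      | some j => exact hbm j) (fun o _ => by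
      cases o with
      | none => exact hαk
      | some j => exact (hLI j).on l r) hfm hfi.integrableOn hf0 (fun o _ => by
      cases o with
      | none =>
        have := hα.2 l r hlr; rw [hk]; show ∫ y in Ioc l r, |α y - av α l r| ≤ _
        unfold av; linarith
      | some j => exact b1 j) f1
  have sub : {x ∈ Ioc l r | (W1 + W2 + W1 * C0) * σ < |Uop lam α s b δ f x|} ⊆ {x ∈ Ioc l r | W1 * σ < |Cop s b δ f x|} ∪
      ({x ∈ Ioc l r | W2 * σ < |Cop (insertNone s) (fun o => o.elim (fun z => α z - k) b) δ f x|} ∪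
      {x ∈ Ioc l r | W1 * (C0 * σ) < |Cop s b δ (fun y => (α y - k) * f y) x|}) := by
    rintro x ⟨hx, hxU⟩
    rw [Uop_split hα.li hαm hLI hfm hfi hαf hf0 hδ (fun y _ => Pk_bound (fun j _ => hb3 j) x y) k] at hxU
    by_contra hcon
    simp only [mem_union, mem_ofPred_eq, hx, true_and, not_or, not_lt] at hcon
    obtain ⟨a1, a2, a3⟩ := hcon
    have a4 : |lam * Cop s b δ f x| ≤ W1 * σ := by rw [abs_mul]; nlinarith [abs_nonneg (Cop s b δ f x), abs_nonneg lam]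
    have := (abs_sub (lam * Cop s b δ f x + Cop (insertNone s) (fun o => o.elim (fun z => α z - k) b) δ f x) (Cop s b δ (fun y => (α y - k) * f y) x)).trans
      (add_le_add (abs_add_le _ _) le_rfl)
    linarith
  refine (measure_mono sub).trans ((measure_union_le _ _).trans ((add_le_add A1 ((measure_union_le _ _).trans (add_le_add A2 A3))).trans ?_))
  rw [← ofReal_add (by positivity) (by positivity), ← ofReal_add (by positivity) (by positivity)]
  refine ofReal_le_ofReal (le_of_eq ?_)
  ring

/-- uncentred (enlarged) maximal function -/
noncomputable def MM (g : ℝ → ℝ≥0∞) (x : ℝ) : ℝ≥0∞ :=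
  ⨆ (c : ℝ) (R : ℝ) (_ : 0 < R ∧ |x - c| < 3 * R), (∫⁻ y in Ioc (c - R) (c + R), g y) / ofReal (2 * R)

theorem MM_le_of {g : ℝ → ℝ≥0∞} {c R x : ℝ} (hR : 0 < R) (hx : |x - c| < 3 * R) :
    (∫⁻ y in Ioc (c - R) (c + R), g y) / ofReal (2 * R) ≤ MM g x :=
  le_iSup_of_le c (le_iSup_of_le R (le_iSup_of_le ⟨hR, hx⟩ le_rfl))

theorem lt_MM {g : ℝ → ℝ≥0∞} {x : ℝ} {t : ℝ≥0∞} : t < MM g x ↔ ∃ c R : ℝ, (0 < R ∧ |x - c| < 3 * R) ∧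
    t < (∫⁻ y in Ioc (c - R) (c + R), g y) / ofReal (2 * R) := by
  unfold MM; simp only [lt_iSup_iff]
  simp only [exists_prop]

theorem MM_meas (g : ℝ → ℝ≥0∞) : Measurable (MM g) := by
  refine measurable_of_Ioi fun t => IsOpen.measurableSet ?_
  rw [isOpen_iff_mem_nhds]
  intro x hx; obtain ⟨c, R, ⟨hR, hxR⟩, h⟩ := lt_MM.1 (show t < MM g x from hx)
  have : {z : ℝ | |z - c| < 3 * R} ∈ 𝓝 x := (isOpen_lt (by fun_prop) continuous_const).mem_nhds hxR
  filter_upwards [this] with z hz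
  exact lt_MM.2 ⟨c, R, ⟨hR, hz⟩, h⟩

theorem MM_le_one {g : ℝ → ℝ≥0∞} (hg : ∀ x, g x ≤ 1) (x : ℝ) : MM g x ≤ 1 := by
  refine iSup_le fun c => iSup_le fun R => iSup_le fun h => ?_
  refine ENNReal.div_le_of_le_mul ?_
  calc _ ≤ ∫⁻ y in Ioc (c - R) (c + R), 1 := lintegral_mono hg
    _ = _ := by simp only [setLIntegral_one, volume_Ioc, one_mul]; congr 1; ring

theorem MM_weak (g : ℝ → ℝ≥0∞) {t : ℝ≥0∞} (ht0 : t ≠ 0) (htt : t ≠ ⊤) :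
    t * volume {x | t < MM g x} ≤ 15 * ∫⁻ y, g y := by
  by_cases hg : ∫⁻ y, g y = ⊤
  · rw [hg]; simp
  let T : Set (ℝ × ℝ) := {p | 0 < p.2 ∧ t < (∫⁻ y in Ioc (p.1 - p.2) (p.1 + p.2), g y) / ofReal (2 * p.2)}
  have hT : ∀ p ∈ T, t * ofReal (2 * p.2) ≤ ∫⁻ y in Ioc (p.1 - p.2) (p.1 + p.2), g y := fun p hp => by
    have h0 : ofReal (2 * p.2) ≠ 0 := by have := hp.1; rw [Ne, ofReal_eq_zero, not_le]; linarith
    exact (ENNReal.le_div_iff_mul_le (Or.inl h0) (Or.inl ofReal_ne_top)).1 hp.2.le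
  have hbd : ∀ p ∈ T, 3 * p.2 ≤ 3 * ((∫⁻ y, g y) / t).toReal := fun p hp => by
    have h1 : ofReal p.2 ≤ (∫⁻ y, g y) / t := by
      rw [ENNReal.le_div_iff_mul_le (Or.inl ht0) (Or.inl htt), mul_comm]; refine le_trans (mul_le_mul' le_rfl (ofReal_le_ofReal ?_)) ((hT p hp).trans (setLIntegral_le_lintegral _ _))
      have := hp.1; linarith
    have h2 := (ENNReal.ofReal_le_iff_le_toReal (ENNReal.div_ne_top hg ht0)).1 h1; linarith
  obtain ⟨U, hUT, hdis, hcov⟩ := Vitali.exists_disjoint_subfamily_covering_enlargement_closedBall T (fun p => p.1) (fun p => 3 * p.2) _ hbd 5 (by norm_num)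
  have hUc : U.Countable := by
    refine hdis.countable_of_nonempty_interior fun p hp => ?_
    rw [interior_closedBall _ (by have := (hUT hp).1; positivity)]
    exact ⟨p.1, Metric.mem_ball_self (by have := (hUT hp).1; positivity)⟩
  have hsub : {x | t < MM g x} ⊆ ⋃ p ∈ U, Metric.closedBall p.1 (5 * (3 * p.2)) := fun x hx => by
    obtain ⟨c, R, ⟨hR, hxR⟩, h⟩ := lt_MM.1 (show t < MM g x from hx)
    obtain ⟨p, hpU, hp⟩ := hcov (c, R) ⟨hR, h⟩
    refine mem_biUnion hpU (hp ?_); rw [Metric.mem_closedBall, dist_eq]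
    exact hxR.le
  have hsum : ∑' p : U, ∫⁻ y in Ioc (p.1.1 - p.1.2) (p.1.1 + p.1.2), g y ≤ ∫⁻ y, g y := by
    have := hUc.to_subtype; rw [← lintegral_iUnion (fun p => measurableSet_Ioc)]
    · exact setLIntegral_le_lintegral _ _
    · intro p q hpq
      have hd := hdis p.2 q.2 (fun h => hpq (Subtype.ext h))
      refine hd.mono ?_ ?_
      · intro y hy
        have := (hUT p.2).1; rw [Metric.mem_closedBall, dist_eq, abs_le]; exact ⟨by linarith [hy.1], by linarith [hy.2]⟩
      · intro y hy
        have := (hUT q.2).1; rw [Metric.mem_closedBall, dist_eq, abs_le]; exact ⟨by linarith [hy.1], by linarith [hy.2]⟩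
  calc t * volume {x | t < MM g x} ≤ t * ∑' p : U, volume (Metric.closedBall p.1.1 (5 * (3 * p.1.2))) := by refine mul_le_mul' le_rfl ((measure_mono hsub).trans ?_); exact measure_biUnion_le _ hUc _
    _ = ∑' p : U, 15 * (t * ofReal (2 * p.1.2)) := by
        rw [← ENNReal.tsum_mul_left]; congr 1; ext p
        rw [Real.volume_closedBall, show 2 * (5 * (3 * p.1.2)) = 15 * (2 * p.1.2) by ring, ofReal_mul (by norm_num)]
        rw [show ofReal 15 = 15 by norm_num]
        ring
    _ ≤ 15 * ∑' p : U, ∫⁻ y in Ioc (p.1.1 - p.1.2) (p.1.1 + p.1.2), g y := by rw [ENNReal.tsum_mul_left]; exact mul_le_mul' le_rfl (ENNReal.tsum_le_tsum fun p => hT p.1 (hUT p.2))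
    _ ≤ _ := mul_le_mul' le_rfl hsum

theorem MM_sq {g : ℝ → ℝ≥0∞} (hg : ∀ x, g x ≤ 1) : ∫⁻ x, MM g x ^ 2 ≤ 30 * ∫⁻ y, g y := by
  have hfin : ∀ x, MM g x ≠ ⊤ := fun x => ((MM_le_one hg x).trans_lt ENNReal.one_lt_top).ne
  have e1 : ∀ x, MM g x ^ 2 = ofReal ((MM g x).toReal ^ (2:ℝ)) := fun x => by rw [Real.rpow_two, ENNReal.ofReal_pow ENNReal.toReal_nonneg, ofReal_toReal (hfin x)]
  simp_rw [e1]
  rw [lintegral_rpow_eq_lintegral_meas_lt_mul volume (ae_of_all _ fun x => ENNReal.toReal_nonneg) (MM_meas g).ennreal_toReal.aemeasurable (by norm_num)]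
  have e2 : ∀ t ∈ Ioi (0:ℝ), volume {a | t < (MM g a).toReal} * ofReal (t ^ ((2:ℝ) - 1)) ≤ (Ioc (0:ℝ) 1).indicator (fun _ => 15 * ∫⁻ y, g y) t := fun t ht => by
    have ht0 : 0 < t := ht
    by_cases h1 : t ≤ 1
    · rw [indicator_of_mem (show t ∈ Ioc (0:ℝ) 1 from ⟨ht0, h1⟩)]
      have := MM_weak g (t := ofReal t) (by simpa using ht0) ofReal_ne_top
      rw [mul_comm, show (2:ℝ) - 1 = 1 by norm_num, Real.rpow_one]
      convert this using 3
      ext a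
      rw [mem_ofPred_eq, mem_ofPred_eq, ENNReal.ofReal_lt_iff_lt_toReal ht0.le (hfin a)]
    · have : {a | t < (MM g a).toReal} = ∅ := by
        ext a
        simp only [mem_ofPred_eq, mem_empty_iff_false, iff_false, not_lt]; have := ENNReal.toReal_mono ENNReal.one_ne_top (MM_le_one hg a)
        rw [ENNReal.toReal_one] at this; linarith
      rw [this]; simp
  refine (mul_le_mul' le_rfl (setLIntegral_mono' measurableSet_Ioi e2)).trans ?_
  rw [lintegral_indicator measurableSet_Ioc]
  simp only [lintegral_const, Measure.restrict_apply MeasurableSet.univ, univ_inter, Measure.restrict_apply measurableSet_Ioc]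
  rw [inter_eq_left.2 Ioc_subset_Ioi_self, volume_Ioc]
  simp only [sub_zero, ofReal_one, mul_one]
  rw [← mul_assoc]
  refine mul_le_mul' (le_of_eq ?_) le_rfl
  rw [show ofReal 2 = 2 by norm_num]
  norm_num

/-- supremum of averages over intervals containing `Ioc l r` -/
noncomputable def SS (g : ℝ → ℝ≥0∞) (l r : ℝ) : ℝ≥0∞ :=
  ⨆ (a : ℝ) (b : ℝ) (_ : a ≤ l ∧ r ≤ b), (∫⁻ y in Ioc a b, g y) / ofReal (b - a)

theorem SS_le_MM {g : ℝ → ℝ≥0∞} {l r x : ℝ} (hx : x ∈ Ioc l r) : SS g l r ≤ MM g x := by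
  refine iSup_le fun a => iSup_le fun b => iSup_le fun h => ?_
  have hx1 := hx.1
  have hx2 := hx.2
  have := MM_le_of (g := g) (c := (a + b) / 2) (R := (b - a) / 2) (x := x) (by linarith) (by
    rw [abs_lt]; exact ⟨by linarith, by linarith⟩)
  rwa [show (a + b) / 2 - (b - a) / 2 = a by ring, show (a + b) / 2 + (b - a) / 2 = b by ring, show 2 * ((b - a) / 2) = b - a by ring] at this

theorem le_SS {g : ℝ → ℝ≥0∞} {l r a b : ℝ} (hlr : l < r) (ha : a ≤ l) (hb : r ≤ b) : ∫⁻ y in Ioc a b, g y ≤ SS g l r * ofReal (b - a) := by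
  have h0 : ofReal (b - a) ≠ 0 := by rw [Ne, ofReal_eq_zero, not_le]; linarith
  rw [← ENNReal.div_le_iff_le_mul (Or.inl h0) (Or.inl ofReal_ne_top)]
  exact le_iSup_of_le a (le_iSup_of_le b (le_iSup_of_le ⟨ha, hb⟩ le_rfl))

theorem Uop_add {ι : Type} {lam : ℝ} {α : ℝ → ℝ} {s : Finset ι} {b : ι → ℝ → ℝ} {f g : ℝ → ℝ} {x ε : ℝ}
    (hf : IntegrableOn (fun y => Kap lam α x y * Pk s b x y / (x - y) * f y) {y | ε < |x - y|})
    (hg : IntegrableOn (fun y => Kap lam α x y * Pk s b x y / (x - y) * g y) {y | ε < |x - y|}) :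
    Uop lam α s b ε (fun y => f y + g y) x = Uop lam α s b ε f x + Uop lam α s b ε g x := by
  unfold Uop; rw [← integral_add hf hg]
  simp only [mul_add]

theorem Uop_bdd {ι : Type} {lam : ℝ} {α : ℝ → ℝ} {s : Finset ι} {b : ι → ℝ → ℝ} {f : ℝ → ℝ} {u v δ : ℝ}
    (hlam : |lam| ≤ 1) (hα : LI α) (hb3 : ∀ j x, |b j x| ≤ 3) (hf1 : ∀ x, |f x| ≤ 1) (hf0 : ∀ x ∉ Ioc u v, f x = 0) (hδ : 0 < δ) :
    ∃ L, 0 ≤ L ∧ ∀ x ∈ Ioc u v, |Uop lam α s b δ f x| ≤ L := by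
  obtain ⟨A, hA⟩ : ∃ A, A = ∫ t in Ioc u v, |α t| := ⟨_, rfl⟩
  have hA0 : 0 ≤ A := by rw [hA]; exact integral_nonneg fun t => abs_nonneg _
  have hi : Integrable ((Ioc u v).indicator (fun y => (1 + A / δ + |α y|) * 3 ^ s.card / δ)) := by rw [integrable_indicator_iff measurableSet_Ioc]; exact ((Integrable.add (by simp) (hα.on u v).abs).mul_const _).div_const _
  refine ⟨∫ y, (Ioc u v).indicator (fun y => (1 + A / δ + |α y|) * 3 ^ s.card / δ) y, integral_nonneg fun y => ?_, fun x hx => ?_⟩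
  · exact indicator_nonneg (fun y _ => by positivity) y
  unfold Uop; rw [← integral_indicator (meas_trunc x δ), ← norm_eq_abs]
  refine norm_integral_le_of_norm_le hi (ae_of_all _ fun y => ?_)
  by_cases hy : y ∈ Ioc u v
  · rw [indicator_of_mem hy]
    by_cases hd : δ < |x - y|
    · rw [indicator_of_mem (show y ∈ {y | δ < |x - y|} from hd), norm_eq_abs, abs_mul, abs_div, abs_mul]
      have h1 : |Kap lam α x y| ≤ 1 + A / δ + |α y| := by
        unfold Kap; refine (abs_sub _ _).trans (add_le_add ((abs_add_le _ _).trans (add_le_add hlam ?_)) le_rfl)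
        unfold Dq; rw [abs_div]
        gcongr
        rw [hA]; exact Adiff_abs_le (hα.on u v) (Ioc_subset_Icc_self hx) (Ioc_subset_Icc_self hy)
      have h2 : |Kap lam α x y| * |Pk s b x y| / |x - y| ≤ (1 + A / δ + |α y|) * 3 ^ s.card / δ := by
        gcongr
        exact Pk_bound (fun j _ => hb3 j) x y
      calc _ ≤ (1 + A / δ + |α y|) * 3 ^ s.card / δ * 1 := by
            gcongr
            exact hf1 y
        _ = _ := mul_one _
    · rw [indicator_of_notMem (show y ∉ {y | δ < |x - y|} from hd), norm_zero]
      positivity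
  · rw [indicator_of_notMem hy]
    simp [indicator, hf0 y hy]

set_option maxHeartbeats 1000000 in
theorem L6 {ι : Type} (s : Finset ι) : ∃ C : ℝ, 0 < C ∧ ∀ (lam : ℝ) (α : ℝ → ℝ) (b : ι → ℝ → ℝ) (f : ℝ → ℝ) (u v δ : ℝ),
    |lam| ≤ 1 → BMO1 α → Measurable α → (∀ j, Measurable (b j)) → (∀ j x, |b j x| ≤ 3) → Measurable f → (∀ x, |f x| ≤ 1) →
    (∀ x, x ∉ Ioc u v → f x = 0) → 0 < δ → u < v →
    ∫⁻ x in Ioc u v, ofReal (|Uop lam α s b δ f x| ^ 4) ≤ ofReal C * ∫⁻ x in Ioc u v, ofReal |f x| := by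
  obtain ⟨C1, hC1, H1⟩ := far_osc s
  obtain ⟨C2, hC2, H2⟩ := loc_osc s
  obtain ⟨C, hC⟩ : ∃ C, C = C1 + C2 := ⟨_, rfl⟩
  have hC0 : 0 < C := by rw [hC]; positivity
  refine ⟨9000 * (C ^ 4 * 30), by positivity, ?_⟩
  intro lam α b f u v δ hlam hα hαm hbm hb3 hfm hf1 hf0 hδ huv; have hLI : ∀ j, LI (b j) := fun j => LI_of_bdd (hbm j) (hb3 j)
  obtain ⟨g, hg⟩ : ∃ g : ℝ → ℝ≥0∞, g = fun y => ofReal (f y ^ 2) := ⟨_, rfl⟩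
  have hg1 : ∀ x, g x ≤ 1 := by
    intro x; rw [hg]
    refine ENNReal.ofReal_le_one.2 ?_; rw [← sq_abs]; exact pow_le_one₀ (abs_nonneg _) (hf1 x)
  have hgf : ∫⁻ y, g y ≤ ∫⁻ x in Ioc u v, ofReal |f x| := by
    rw [← lintegral_indicator measurableSet_Ioc]; refine lintegral_mono fun x => ?_
    by_cases hx : x ∈ Ioc u v
    · rw [indicator_of_mem hx, hg]
      refine ofReal_le_ofReal ?_; rw [← sq_abs]; nlinarith [hf1 x, abs_nonneg (f x)]
    · rw [hg]; simp [hf0 x hx]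
  by_cases hz : ∫⁻ y, g y = 0
  · have hgm : Measurable g := by rw [hg]; fun_prop
    have h0 := (lintegral_eq_zero_iff hgm).1 hz; have h1 : ∀ᵐ y, f y = 0 := by
      filter_upwards [h0] with y hy
      rw [hg] at hy; simp only [Pi.zero_apply, ofReal_eq_zero] at hy
      exact pow_eq_zero_iff (two_ne_zero) |>.1 (le_antisymm hy (sq_nonneg _))
    have h2 : ∀ x, Uop lam α s b δ f x = 0 := fun x => by
      unfold Uop; refine integral_eq_zero_of_ae (ae_restrict_of_ae ?_)
      filter_upwards [h1] with y hy
      simp [hy]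
    simp [h2]
  have hfi : ∀ g' : ℝ → ℝ, Measurable g' → (∀ x, |g' x| ≤ 1) → (∀ x ∉ Ioc u v, g' x = 0) → ∀ x,
      IntegrableOn (fun y => Kap lam α x y * Pk s b x y / (x - y) * g' y) {y | δ < |x - y|} := by
    intro g' m1 m2 m3 x; exact Uint hα.li hαm hLI m1 (int_of_bdd_supp' m1 m2 m3) (int_of_bdd_supp m1 m2 m3 hα.li) m3 hδ (fun y _ => Pk_bound (fun j _ => hb3 j) x y)
  obtain ⟨L0, hL0, HL⟩ := Uop_bdd (lam := lam) (α := α) (s := s) hlam hα.li hb3 hf1 hf0 hδ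
  let f1 : ℝ → ℝ → ℝ → ℝ := fun l r y => if |(l + r) / 2 - y| < 3 / 2 * (r - l) then f y else 0
  let f2 : ℝ → ℝ → ℝ → ℝ := fun l r y => if |(l + r) / 2 - y| < 3 / 2 * (r - l) then 0 else f y
  have hS1 : ∀ l r, l < r → SS g l r ≤ 1 := fun l r h => (SS_le_MM (right_mem_Ioc.2 h)).trans (MM_le_one hg1 r)
  have hStop : ∀ l r, l < r → SS g l r ≠ ⊤ := fun l r h => ((hS1 l r h).trans_lt ENNReal.one_lt_top).ne
  have hf12 : ∀ l r y, |f1 l r y| ≤ |f y| ∧ |f2 l r y| ≤ |f y| ∧ f y = f1 l r y + f2 l r y := fun l r y => by by_cases h : |(l + r) / 2 - y| < 3 / 2 * (r - l) <;> simp [f1, f2, h]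
  have mset : ∀ l r : ℝ, MeasurableSet {y | |(l + r) / 2 - y| < 3 / 2 * (r - l)} := fun l r => measurableSet_lt (by fun_prop) measurable_const
  have mf1 : ∀ l r, Measurable (f1 l r) := fun l r => Measurable.ite (mset l r) hfm measurable_const
  have mf2 : ∀ l r, Measurable (f2 l r) := fun l r => Measurable.ite (mset l r) measurable_const hfm
  have h10 : ∀ l r, ∀ x ∉ Ioc u v, f1 l r x = 0 := fun l r x hx => by have := (hf12 l r x).1; rw [hf0 x hx, abs_zero] at this; exact abs_nonpos_iff.1 this
  have h20 : ∀ l r, ∀ x ∉ Ioc u v, f2 l r x = 0 := fun l r x hx => by have := (hf12 l r x).2.1; rw [hf0 x hx, abs_zero] at this; exact abs_nonpos_iff.1 this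
  have key := FS (a0 := u) (b0 := v) (L := max L0 C) huv (u := Uop lam α s b δ f)
    (Uop_meas hα.li hαm (fun j _ => hLI j) hfm δ).aemeasurable (fun x hx => (HL x hx).trans (le_max_left _ _))
    (M4 := fun x => ofReal (C ^ 4) * MM g x ^ 2) (c := fun l r => Uop lam α s b δ (f2 l r) ((l + r) / 2))
    (ω := fun l r => C * √(SS g l r).toReal) (by
      intro l r hl hlr hr; have hSr : (SS g l r).toReal ≤ 1 := by have := ENNReal.toReal_mono ENNReal.one_ne_top (hS1 l r hlr); rwa [ENNReal.toReal_one] at this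
      obtain ⟨σ, hσ⟩ : ∃ σ, σ = √(SS g l r).toReal := ⟨_, rfl⟩
      have hσ2 : ofReal (σ ^ 2) = SS g l r := by rw [hσ, Real.sq_sqrt ENNReal.toReal_nonneg, ofReal_toReal (hStop l r hlr)]
      have hSint : ∀ a b, a ≤ l → r ≤ b → ∫⁻ y in Ioc a b, g y ≤ ofReal (σ ^ 2 * (b - a)) := fun a b ha hb => by rw [ofReal_mul (sq_nonneg _), hσ2]; exact le_SS hlr ha hb
      have hσ0 : 0 < σ := by
        rcases (show 0 ≤ σ by rw [hσ]; exact Real.sqrt_nonneg _).lt_or_eq with h | h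
        · exact h
        exfalso
        have := hSint u v hl hr; rw [← h] at this; simp only [ne_eq, OfNat.ofNat_ne_zero, not_false_eq_true, zero_pow, zero_mul, ENNReal.ofReal_zero, nonpos_iff_eq_zero] at this
        apply hz
        rw [← this, ← lintegral_indicator measurableSet_Ioc]; congr 1; ext x
        by_cases hx : x ∈ Ioc u v
        · rw [indicator_of_mem hx]
        · rw [indicator_of_notMem hx, hg]; simp [hf0 x hx]
      simp only [← hσ]; refine ⟨by positivity, ?_, ?_, ?_⟩
      · refine le_trans ?_ (le_max_right _ _)
        have : σ ≤ 1 := by rw [hσ]; exact Real.sqrt_le_one.2 hSr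
        nlinarith
      · have A2 := H2 lam α b (f1 l r) ((l + r) / 2 - 3 / 2 * (r - l)) ((l + r) / 2 + 3 / 2 * (r - l)) δ σ hlam hα hαm hbm hb3 (mf1 l r)
          (fun x => (hf12 l r x).1.trans (hf1 x)) (fun x hx => by
            simp only [f1]; rw [if_neg]
            intro h; rw [abs_lt] at h
            exact hx ⟨by linarith, by linarith⟩) hδ (by linarith) hσ0 (by
            refine le_trans (lintegral_mono fun y => ?_) (hSint _ _ (by linarith) (by linarith))
            rw [hg]; exact ofReal_le_ofReal (sq_le_sq.2 (hf12 l r y).1))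
        have A1 := H1 lam α b (f2 l r) u v δ ((l + r) / 2) (r - l) σ hlam hα hαm hbm hb3 (mf2 l r)
          (fun x => (hf12 l r x).2.1.trans (hf1 x)) (h20 l r) hδ (by linarith) hσ0 (by
            intro R hR; have := hSint ((l + r) / 2 - R) ((l + r) / 2 + R) (by linarith) (by linarith)
            rw [show (l + r) / 2 + R - ((l + r) / 2 - R) = 2 * R by ring] at this
            refine le_trans (lintegral_mono fun y => ?_) this
            rw [hg]; exact ofReal_le_ofReal (sq_le_sq.2 (hf12 l r y).2.1)) (fun y hy => by
            simp only [f2]; rw [if_pos hy])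
        refine le_trans (measure_mono ?_) (A2.trans (le_of_eq (by congr 1; ring)))
        rintro x ⟨hx, hxω⟩
        refine ⟨⟨by linarith [hx.1], by linarith [hx.2]⟩, ?_⟩
        have e : Uop lam α s b δ f x = Uop lam α s b δ (f1 l r) x + Uop lam α s b δ (f2 l r) x := by
          rw [← Uop_add (hfi _ (mf1 l r) (fun x => (hf12 l r x).1.trans (hf1 x)) (h10 l r) x)
            (hfi _ (mf2 l r) (fun x => (hf12 l r x).2.1.trans (hf1 x)) (h20 l r) x)]
          congr 1; ext y; exact (hf12 l r y).2.2
        have a1 := A1 x (by rw [abs_le]; exact ⟨by linarith [hx.1], by linarith [hx.2]⟩)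
        rw [e, hC] at hxω; have := abs_add_le (Uop lam α s b δ (f1 l r) x) (Uop lam α s b δ (f2 l r) x - Uop lam α s b δ (f2 l r) ((l + r) / 2))
        rw [← add_sub_assoc] at this; show C2 * σ < _
        linarith
      · intro x hx
        rw [mul_pow, ofReal_mul (by positivity), show σ ^ 4 = (σ ^ 2) ^ 2 by ring, ENNReal.ofReal_pow (sq_nonneg _), hσ2]
        exact mul_le_mul' le_rfl (pow_le_pow_left' (SS_le_MM hx) 2))
  have c0 : Uop lam α s b δ (f2 u v) ((u + v) / 2) = 0 := by
    have : f2 u v = fun _ => 0 := by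
      ext y
      by_cases hy : y ∈ Ioc u v
      · simp only [f2]
        rw [if_pos]; rw [abs_lt]; exact ⟨by linarith [hy.2], by linarith [hy.1]⟩
      · exact h20 u v y hy
    rw [this]; simp [Uop]
  rw [c0] at key
  simp only [sub_zero] at key
  refine key.trans ?_
  rw [lintegral_const_mul' _ _ ofReal_ne_top]
  calc _ ≤ ofReal 9000 * (ofReal (C ^ 4) * (30 * ∫⁻ x in Ioc u v, ofReal |f x|)) := by refine mul_le_mul' le_rfl (mul_le_mul' le_rfl ?_); exact (setLIntegral_le_lintegral _ _).trans ((MM_sq hg1).trans (mul_le_mul' le_rfl hgf))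
    _ = _ := by
        rw [ofReal_mul (by norm_num), ofReal_mul (by positivity), show ofReal 30 = 30 by norm_num]
        ring

/-- maximal function of `|g|` -/
noncomputable def Mx (g : ℝ → ℝ) (x : ℝ) : ℝ≥0∞ := MM (fun y => ofReal |g y|) x

theorem Mx_int {g : ℝ → ℝ} (hg : Integrable g) {F x l r : ℝ} (hF : 0 ≤ F) (h : Mx g x ≤ ofReal F) (hx : x ∈ Icc l r) :
    ∫ y in Ioc l r, |g y| ≤ F * (r - l) := by
  rcases (hx.1.trans hx.2).lt_or_eq with hlr | hlr
  · refine int_le_of_lint (by nlinarith) hg.integrableOn ?_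
    have h1 := MM_le_of (g := fun y => ofReal |g y|) (c := (l + r) / 2) (R := (r - l) / 2) (x := x) (by linarith) (by
      rw [abs_lt]; exact ⟨by linarith [hx.1], by linarith [hx.2]⟩)
    rw [show (l + r) / 2 - (r - l) / 2 = l by ring, show (l + r) / 2 + (r - l) / 2 = r by ring, show 2 * ((r - l) / 2) = r - l by ring] at h1
    have h0 : ofReal (r - l) ≠ 0 := by rw [Ne, ofReal_eq_zero, not_le]; linarith
    rw [ENNReal.div_le_iff_le_mul (Or.inl h0) (Or.inl ofReal_ne_top)] at h1; refine h1.trans ?_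
    rw [ofReal_mul hF]; exact mul_le_mul' h le_rfl
  · rw [hlr]; simp

theorem Cint {ι : Type} {s : Finset ι} {b : ι → ℝ → ℝ} {f : ℝ → ℝ} {x ε : ℝ}
    (hb : ∀ j, Integrable (b j)) (hfm : Measurable f) (hf : Integrable f) (hε : 0 < ε) :
    IntegrableOn (fun y => Pk s b x y / (x - y) * f y) {y | ε < |x - y|} := by
  have m2 : Measurable (fun y => Pk s b x y) := Pk_meas_r (fun j _ => LI_of_integrable (hb j)) x
  have m3 : Measurable (fun y : ℝ => x - y) := by fun_prop
  refine Integrable.mono' (g := fun y => (∏ j ∈ s, ((∫ t, |b j t|) / ε)) / ε * |f y|) (hf.abs.const_mul _).integrableOn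
    ((m2.div m3).mul hfm).aestronglyMeasurable ?_
  rw [ae_restrict_iff' (meas_trunc x ε)]
  refine ae_of_all _ fun y hy => ?_
  have hy' : ε < |x - y| := hy
  rw [norm_eq_abs, abs_mul, abs_div]
  have h1 := Pk_int_bound (s := s) hb hε x y hy'
  have h0 := (abs_nonneg _).trans h1
  gcongr

theorem Cop_add {ι : Type} {s : Finset ι} {b : ι → ℝ → ℝ} {f g : ℝ → ℝ} {x ε : ℝ}
    (hb : ∀ j, Integrable (b j)) (hfm : Measurable f) (hf : Integrable f) (hgm : Measurable g) (hg : Integrable g) (hε : 0 < ε) :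
    Cop s b ε (fun y => f y + g y) x = Cop s b ε f x + Cop s b ε g x := by
  unfold Cop; rw [← integral_add (Cint hb hfm hf hε) (Cint hb hgm hg hε)]
  simp only [mul_add]

theorem Dq_le_of {b : ℝ → ℝ} (hb : Integrable b) {x l r y z : ℝ} (h : Mx b x ≤ 1) (hx : x ∈ Icc l r) (hy : y ∈ Icc l r) (hz : z ∈ Icc l r) :
    |Adiff b y z| ≤ r - l := by
  have := Mx_int hb zero_le_one (by simpa using h) hx
  rw [one_mul] at this
  exact (Adiff_abs_le hb.integrableOn hy hz).trans this

theorem Adiff_le_dist {b : ℝ → ℝ} (hb : Integrable b) {x y : ℝ} (h : Mx b x ≤ 1) : |Adiff b x y| ≤ |x - y| := by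
  rcases le_total x y with hxy | hxy
  · rw [abs_sub_comm x y, abs_of_nonneg (sub_nonneg.2 hxy)]
    exact Dq_le_of hb h (left_mem_Icc.2 hxy) (left_mem_Icc.2 hxy) (right_mem_Icc.2 hxy)
  · rw [abs_of_nonneg (sub_nonneg.2 hxy)]
    exact Dq_le_of hb h (right_mem_Icc.2 hxy) (right_mem_Icc.2 hxy) (left_mem_Icc.2 hxy)

theorem Dq_le_one {b : ℝ → ℝ} (hb : Integrable b) {x y : ℝ} (h : Mx b x ≤ 1) : |Dq b x y| ≤ 1 := by
  unfold Dq; rw [abs_div]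
  exact div_le_one_of_le₀ (Adiff_le_dist hb h) (abs_nonneg _)

/-- kernel regularity at a good point -/
theorem kerdiff {ι : Type} (s : Finset ι) {b : ι → ℝ → ℝ} (hb : ∀ j, Integrable (b j)) {x x' y ε : ℝ} (hx : ∀ j ∈ s, Mx (b j) x ≤ 1)
    (hε : 0 < ε) (hxx : |x - x'| ≤ ε / 4) (hy : 2 * ε ≤ |x - y|) :
    |Pk s b x y / (x - y) - Pk s b x' y / (x' - y)| ≤ (2 * (s.card * 2 ^ s.card) + 1) * (2 * ε / |x - y| ^ 2) := by
  obtain ⟨d, hd⟩ : ∃ d, d = |x - y| := ⟨_, rfl⟩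
  have hd0 : 0 < d := by rw [hd]; linarith
  rw [← hd] at hy ⊢
  have hD : 7 / 8 * d ≤ |x' - y| := by have := abs_sub_le x x' y; rw [← hd] at this; linarith
  have hD0 : 0 < |x' - y| := by linarith
  have hxy : x ≠ y := fun h => by rw [h, sub_self, abs_zero] at hd; linarith
  have hxy' : x' ≠ y := fun h => by rw [h, sub_self, abs_zero] at hD0; linarith
  have h1 : ∀ j ∈ s, |Dq (b j) x y - Dq (b j) x' y| ≤ ε / d := fun j hj => by
    have e := Dq_move (LI_of_integrable (hb j)) (x := y) (y := x') (y0 := x) hxy'.symm hxy.symm; rw [Dq_symm (b j) x y, Dq_symm (b j) x' y, abs_sub_comm, e, abs_div, abs_sub_comm y x', div_le_div_iff₀ hD0 hd0]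
    have a1 : |Dq (b j) y x * (x' - x)| ≤ ε / 4 := by
      rw [abs_mul, Dq_symm, abs_sub_comm x' x]; have := Dq_le_one (hb j) (y := y) (hx j hj)
      nlinarith [abs_nonneg (x - x')]
    have a2 := (Adiff_le_dist (hb j) (y := x') (hx j hj)).trans hxx; have a3 := (abs_add_le (Dq (b j) y x * (x' - x)) (Adiff (b j) x x')).trans (add_le_add a1 a2)
    nlinarith
  have h2 : ∀ j ∈ s, |Dq (b j) x y| ≤ 2 := fun j hj => (Dq_le_one (hb j) (hx j hj)).trans (by norm_num)
  have hεd : ε / d ≤ 1 / 2 := by rw [div_le_iff₀ hd0]; linarith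
  have h3 : ∀ j ∈ s, |Dq (b j) x' y| ≤ 2 := fun j hj => by have a := abs_sub_abs_le_abs_sub (Dq (b j) x' y) (Dq (b j) x y); rw [abs_sub_comm] at a; have := Dq_le_one (hb j) (y := y) (hx j hj); linarith [h1 j hj]
  have h4 := prod_diff s (K := 2) (by norm_num) (by positivity : 0 ≤ ε / d) h2 h3 h1
  have h5 : |Pk s b x y| ≤ 1 := by
    unfold Pk; rw [Finset.abs_prod]
    exact Finset.prod_le_one (fun j _ => abs_nonneg _) fun j hj => Dq_le_one (hb j) (hx j hj)
  have e : Pk s b x y / (x - y) - Pk s b x' y / (x' - y) = (Pk s b x y - Pk s b x' y) / (x' - y) + Pk s b x y * (x' - x) / ((x - y) * (x' - y)) := by have a1 := sub_ne_zero.2 hxy; have a2 := sub_ne_zero.2 hxy'; field_simp; ring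
  rw [e]
  refine (abs_add_le _ _).trans ?_
  rw [abs_div, abs_div, abs_mul, abs_mul, ← hd, abs_sub_comm x' x]
  have b1 : |Pk s b x y - Pk s b x' y| / |x' - y| ≤ (s.card * 2 ^ s.card * (ε / d)) / (7 / 8 * d) := by
    gcongr
    exact h4
  have b2 : |Pk s b x y| * |x - x'| / (d * |x' - y|) ≤ 1 * (ε / 4) / (d * (7 / 8 * d)) := by gcongr
  refine (add_le_add b1 b2).trans ?_
  rw [show (s.card * 2 ^ s.card * (ε / d)) / (7 / 8 * d) + 1 * (ε / 4) / (d * (7 / 8 * d)) = (4 / 7 * (s.card * 2 ^ s.card) + 1 / 7) * (2 * ε / d ^ 2) by field_simp; ring]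
  have : (0:ℝ) ≤ s.card * 2 ^ s.card := by positivity
  gcongr <;> linarith

/-- Cotlar type comparison -/
theorem cotlar {ι : Type} (s : Finset ι) {b : ι → ℝ → ℝ} (hb : ∀ j, Integrable (b j)) {f : ℝ → ℝ} (hfm : Measurable f) (hf : Integrable f)
    {x x' ε δ F : ℝ} (hx : ∀ j ∈ s, Mx (b j) x ≤ 1) (hF : 0 ≤ F) (hfx : Mx f x ≤ ofReal F) (hδ : 0 < δ) (hδε : δ < ε) (hxx : |x - x'| ≤ ε / 4) :
    |Cop s b ε f x - Cop s b δ f x'| ≤ (8 * (2 * (s.card * 2 ^ s.card) + 1) + 4) * F +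
      |Cop s b δ ((Ioc (x - 2 * ε) (x + 2 * ε)).indicator f) x'| := by
  have hε : 0 < ε := hδ.trans hδε
  obtain ⟨N, hN⟩ : ∃ N : ℝ, N = 2 * (s.card * 2 ^ s.card) + 1 := ⟨_, rfl⟩
  have hN0 : 0 ≤ N := by rw [hN]; positivity
  rw [← hN]
  obtain ⟨B, hB⟩ : ∃ B, B = Ioc (x - 2 * ε) (x + 2 * ε) := ⟨_, rfl⟩
  have mB : MeasurableSet B := by rw [hB]; exact measurableSet_Ioc
  rw [← hB]
  have m1 := hfm.indicator mB
  have m2 := hfm.indicator mB.compl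
  have i1 := hf.indicator mB
  have i2 := hf.indicator mB.compl
  have hsp : ∀ η z, 0 < η → Cop s b η f z = Cop s b η (B.indicator f) z + Cop s b η (Bᶜ.indicator f) z := fun η z hη => by
    rw [← Cop_add hb m1 i1 m2 i2 hη]; congr 1; ext y
    exact (congrFun (indicator_self_add_compl B f) y).symm
  have hfar : ∀ η z, 0 < η → (∀ y ∈ Bᶜ, η < |z - y|) → Cop s b η (Bᶜ.indicator f) z = ∫ y in Bᶜ, Pk s b z y / (z - y) * f y ∧
      IntegrableOn (fun y => Pk s b z y / (z - y) * f y) Bᶜ := by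
    intro η z hη h; constructor
    · unfold Cop
      have : ∀ y, Pk s b z y / (z - y) * Bᶜ.indicator f y = Bᶜ.indicator (fun y => Pk s b z y / (z - y) * f y) y := by
        intro y; by_cases hy : y ∈ Bᶜ
        · rw [indicator_of_mem hy, indicator_of_mem hy]
        · rw [indicator_of_notMem hy, indicator_of_notMem hy, mul_zero]
      simp_rw [this]
      have hsub : Bᶜ ⊆ {y | η < |z - y|} := fun y hy => h y hy
      rw [integral_indicator mB.compl, Measure.restrict_restrict mB.compl, inter_eq_left.2 hsub]
    · exact (Cint hb hfm hf hη).mono_set (fun y hy => h y hy)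
  have hBc : ∀ y ∈ Bᶜ, 2 * ε ≤ |x - y| := fun y hy => by
    by_contra hcon
    rw [not_le, abs_lt] at hcon; exact hy (by rw [hB]; exact ⟨by linarith, by linarith⟩)
  have hBf := Mx_int hf hF hfx (show x ∈ Icc (x - 2 * ε) (x + 2 * ε) from ⟨by linarith, by linarith⟩)
  obtain ⟨A1, A2⟩ := hfar ε x hε (fun y hy => by linarith [hBc y hy])
  obtain ⟨A3, A4⟩ := hfar δ x' hδ (fun y hy => by have := abs_sub_le x x' y; linarith [hBc y hy])
  have near : |Cop s b ε (B.indicator f) x| ≤ 4 * F := by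
    unfold Cop; rw [← integral_indicator (meas_trunc x ε), ← norm_eq_abs]
    have hi : Integrable (B.indicator fun y => 1 / ε * |f y|) := (hf.abs.const_mul _).indicator mB
    refine (norm_integral_le_of_norm_le hi (ae_of_all _ fun y => ?_)).trans ?_
    · by_cases hy : y ∈ B
      · rw [indicator_of_mem hy]
        by_cases hd : ε < |x - y|
        · rw [indicator_of_mem (show y ∈ {y | ε < |x - y|} from hd), indicator_of_mem hy, norm_eq_abs, abs_mul, abs_div]
          have h5 : |Pk s b x y| ≤ 1 := by
            unfold Pk; rw [Finset.abs_prod]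
            exact Finset.prod_le_one (fun j _ => abs_nonneg _) fun j hj => Dq_le_one (hb j) (hx j hj)
          gcongr
        · rw [indicator_of_notMem (show y ∉ {y | ε < |x - y|} from hd), norm_zero]; positivity
      · rw [indicator_of_notMem hy]; simp [indicator, hy]
    · rw [integral_indicator mB, integral_const_mul, hB]
      calc _ ≤ 1 / ε * (F * (x + 2 * ε - (x - 2 * ε))) := by gcongr
        _ = 4 * F := by field_simp; ring
  have far : |Cop s b ε (Bᶜ.indicator f) x - Cop s b δ (Bᶜ.indicator f) x'| ≤ 8 * N * F := by
    rw [A1, A3, ← integral_sub A2 A4, ← norm_eq_abs, ← ofReal_le_ofReal_iff (by positivity), ofReal_norm_eq_enorm]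
    refine (enorm_integral_le_lintegral_enorm _).trans ?_; have g1 : ∀ y ∈ Bᶜ, ‖Pk s b x y / (x - y) * f y - Pk s b x' y / (x' - y) * f y‖ₑ ≤
        ofReal N * (ofReal (2 * ε / |x - y| ^ 2) * ofReal |f y|) := by
      intro y hy; rw [← ofReal_norm_eq_enorm, ← ofReal_mul (by positivity), ← ofReal_mul hN0, ← sub_mul, norm_eq_abs, abs_mul]
      refine ofReal_le_ofReal ?_; rw [← mul_assoc]
      refine mul_le_mul_of_nonneg_right ?_ (abs_nonneg _)
      rw [hN]; exact kerdiff s hb hx hε hxx (hBc y hy)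
    refine (setLIntegral_mono' mB.compl g1).trans ((lintegral_mono_set (show Bᶜ ⊆ {y | 2 * ε ≤ |x - y|} from hBc)).trans ?_); rw [lintegral_const_mul' _ _ ofReal_ne_top]
    have := annuli (g := fun y => ofReal |f y|) (by fun_prop) (c := x) (q := 2 * ε) (H := 2 * F) (by positivity) (by positivity) (by
      intro R hR; have hR0 : 0 < R := by linarith
      have h1 := Mx_int hf hF hfx (show x ∈ Icc (x - R) (x + R) from ⟨by linarith, by linarith⟩)
      rw [ofReal_int hf.integrableOn]; refine ofReal_le_ofReal (h1.trans ?_)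
      have : 1 ≤ √(R / (2 * ε)) := by apply Real.one_le_sqrt.2; rw [le_div_iff₀ (by positivity)]; linarith
      have h2 : 2 * F * R * 1 ≤ 2 * F * R * √(R / (2 * ε)) := by gcongr
      linarith)
    refine (mul_le_mul' le_rfl this).trans ?_; rw [← ofReal_mul hN0]
    exact ofReal_le_ofReal (le_of_eq (by ring))
  rw [hsp ε x hε, hsp δ x' hδ]
  have := abs_add_three (Cop s b ε (B.indicator f) x) (Cop s b ε (Bᶜ.indicator f) x - Cop s b δ (Bᶜ.indicator f) x') (-Cop s b δ (B.indicator f) x')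
  rw [abs_neg] at this
  rw [show Cop s b ε (B.indicator f) x + Cop s b ε (Bᶜ.indicator f) x - (Cop s b δ (B.indicator f) x' + Cop s b δ (Bᶜ.indicator f) x') =
    Cop s b ε (B.indicator f) x + (Cop s b ε (Bᶜ.indicator f) x - Cop s b δ (Bᶜ.indicator f) x') + (-Cop s b δ (B.indicator f) x') by ring]
  linarith

set_option maxHeartbeats 1000000 in
theorem Max {ι : Type} (s : Finset ι) (τ : ℝ) (hτ : 0 < τ) : ∃ C : ℝ, 0 < C ∧
    ∀ (b : ι → ℝ → ℝ) (f : ℝ → ℝ) (u v F : ℝ), u < v → 0 < F → (∀ j, Measurable (b j)) →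
    (∀ j, Integrable (b j)) → Measurable f → Integrable f → (∀ x ∉ Ioc u v, f x = 0) →
    volume {x ∈ Ioc u v | (∀ j ∈ s, Mx (b j) x ≤ 1) ∧ Mx f x ≤ ofReal F ∧ ∃ ε, 0 < ε ∧ ε ≤ 1 ∧ C * F < |Cop s b ε f x|}
      ≤ ofReal (τ * (v - u + 2)) := by
  obtain ⟨C1, hC1, H1⟩ := lemW s (1 / 64) 1 (by norm_num) one_pos
  obtain ⟨C2, hC2, H2⟩ := lemW s (τ / 60) 1 (by positivity) one_pos
  obtain ⟨N, hN⟩ : ∃ N : ℝ, N = 8 * (2 * (s.card * 2 ^ s.card) + 1) + 4 := ⟨_, rfl⟩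
  have hN0 : 0 ≤ N := by rw [hN]; positivity
  refine ⟨N + C1 + C2, by positivity, ?_⟩
  intro b f u v F huv hF hbm hb hfm hf hf0; let Z : ℕ → Set ℝ := fun n => {x ∈ Ioc u v | (∀ j ∈ s, Mx (b j) x ≤ 1) ∧ Mx f x ≤ ofReal F ∧
    ∃ ε, 1 / ((n:ℝ) + 1) < ε ∧ ε ≤ 1 ∧ (N + C1 + C2) * F < |Cop s b ε f x|}
  have hmono : Monotone Z := by
    rintro n k hnk x ⟨h1, h2, h3, ε, h4, h5⟩
    exact ⟨h1, h2, h3, ε, (one_div_le_one_div_of_le (by positivity) (by exact_mod_cast Nat.succ_le_succ hnk)).trans_lt h4, h5⟩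
  have hsub : {x ∈ Ioc u v | (∀ j ∈ s, Mx (b j) x ≤ 1) ∧ Mx f x ≤ ofReal F ∧
      ∃ ε, 0 < ε ∧ ε ≤ 1 ∧ (N + C1 + C2) * F < |Cop s b ε f x|} ⊆ ⋃ n, Z n := by
    rintro x ⟨h1, h2, h3, ε, h4, h5⟩
    obtain ⟨n, hn⟩ := exists_nat_one_div_lt h4
    exact mem_iUnion.2 ⟨n, h1, h2, h3, ε, hn, h5⟩
  refine (measure_mono hsub).trans ?_
  rw [hmono.measure_iUnion]
  refine iSup_le fun n => ?_
  rcases (Z n).eq_empty_or_nonempty with h0 | ⟨x0, hx0, hx1, hx2, -⟩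
  · rw [h0]; simp
  obtain ⟨δ, hδe⟩ : ∃ δ : ℝ, δ = 1 / ((n:ℝ) + 1) := ⟨_, rfl⟩
  have hδ : 0 < δ := by rw [hδe]; positivity
  have hx0' : x0 ∈ Icc (u - 1) (v + 1) := ⟨by linarith [hx0.1], by linarith [hx0.2]⟩
  have one : ∀ g x, Mx g x ≤ 1 → Mx g x ≤ ofReal 1 := fun g x h => by simpa using h
  have hE := H2 b f (u - 1) (v + 1) δ F (by linarith) hδ hF (fun j _ => hbm j) (fun j _ => (hb j).integrableOn) hfm hf.integrableOn
    (fun x hx => hf0 x fun h => hx ⟨by linarith [h.1], by linarith [h.2]⟩)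
    (fun j hj => Mx_int (hb j) zero_le_one (one _ _ (hx1 j hj)) hx0') (Mx_int hf hF.le hx2 hx0')
  obtain ⟨E, hEe⟩ : ∃ E, E = {x ∈ Ioc (u - 1) (v + 1) | C2 * F < |Cop s b δ f x|} := ⟨_, rfl⟩
  have mE : MeasurableSet E := by rw [hEe]; exact measurableSet_Ioc.inter (measurableSet_lt measurable_const (Cop_meas (fun j _ => LI_of_integrable (hb j)) hfm δ).abs)
  rw [← hEe] at hE
  have hZE : Z n ⊆ {x | 1 / 4 < MM (E.indicator 1) x} := by
    rintro x ⟨hx, hxb, hxf, ε, hε1, hε2, hc⟩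
    rw [← hδe] at hε1; have hε : 0 < ε := hδ.trans hε1
    have hxB : x ∈ Icc (x - 2 * ε) (x + 2 * ε) := ⟨by linarith, by linarith⟩
    have hW := H1 b ((Ioc (x - 2 * ε) (x + 2 * ε)).indicator f) (x - 2 * ε) (x + 2 * ε) δ F (by linarith) hδ hF (fun j _ => hbm j)
      (fun j _ => (hb j).integrableOn) (hfm.indicator measurableSet_Ioc) (hf.indicator measurableSet_Ioc).integrableOn
      (fun y hy => indicator_of_notMem hy _) (fun j hj => Mx_int (hb j) zero_le_one (one _ _ (hxb j hj)) hxB) (by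
        rw [setIntegral_congr_fun (g := fun y => |f y|) measurableSet_Ioc (fun y hy => by simp only [indicator_of_mem hy])]
        exact Mx_int hf hF.le hxf hxB)
    have hQ : Ioc (x - ε / 4) (x + ε / 4) ⊆ (E ∩ Ioc (x - ε / 4) (x + ε / 4)) ∪ {x' ∈ Ioc (x - 2 * ε) (x + 2 * ε) |
        C1 * F < |Cop s b δ ((Ioc (x - 2 * ε) (x + 2 * ε)).indicator f) x'|} := by
      intro x' hx'; by_cases hbad : C1 * F < |Cop s b δ ((Ioc (x - 2 * ε) (x + 2 * ε)).indicator f) x'|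
      · exact Or.inr ⟨⟨by linarith [hx'.1], by linarith [hx'.2]⟩, hbad⟩
      · refine Or.inl ⟨?_, hx'⟩
        have hc1 := cotlar s hb hfm hf hxb hF.le hxf hδ hε1 (x' := x') (abs_le.2 ⟨by linarith [hx'.2], by linarith [hx'.1]⟩)
        rw [← hN] at hc1; have := abs_sub_abs_le_abs_sub (Cop s b ε f x) (Cop s b δ f x')
        rw [hEe]; exact ⟨⟨by linarith [hx'.1, hx.1], by linarith [hx'.2, hx.2]⟩, by nlinarith⟩
    have h1 := (measure_mono (μ := volume) hQ).trans (measure_union_le _ _); have h2 : ofReal (ε / 2) ≤ volume (E ∩ Ioc (x - ε / 4) (x + ε / 4)) + ofReal (ε / 16) := by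
      rw [volume_Ioc, show x + ε / 4 - (x - ε / 4) = ε / 2 by ring] at h1
      refine h1.trans (add_le_add le_rfl (hW.trans (ofReal_le_ofReal (by linarith))))
    have h3 : ofReal (7 * ε / 16) ≤ volume (E ∩ Ioc (x - ε / 4) (x + ε / 4)) := by
      rw [show ε / 2 = 7 * ε / 16 + ε / 16 by ring, ofReal_add (by positivity) (by positivity)] at h2
      exact (ENNReal.add_le_add_iff_right ofReal_ne_top).1 h2
    have h4 := MM_le_of (g := E.indicator 1) (c := x) (R := ε / 4) (x := x) (by positivity) (by simp; positivity)
    rw [lintegral_indicator_one mE] at h4; refine lt_of_lt_of_le ?_ h4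
    rw [ENNReal.lt_div_iff_mul_lt (Or.inl (by simp; positivity)) (Or.inl ofReal_ne_top), Measure.restrict_apply mE]
    refine lt_of_lt_of_le ?_ h3
    rw [show (1:ℝ≥0∞) / 4 = ofReal (1 / 4) by rw [ENNReal.ofReal_div_of_pos (by norm_num)]; simp, ← ofReal_mul (by norm_num)]
    exact (ENNReal.ofReal_lt_ofReal_iff (by positivity)).2 (by linarith)
  have hw := MM_weak (E.indicator 1) (t := 1 / 4) (by simp) (by simp)
  rw [lintegral_indicator_one mE] at hw
  calc volume (Z n) ≤ volume {x | 1 / 4 < MM (E.indicator 1) x} := measure_mono hZE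
    _ = 4 * (1 / 4 * volume {x | 1 / 4 < MM (E.indicator 1) x}) := by rw [← mul_assoc, ENNReal.mul_div_cancel (by simp) (by simp), one_mul]
    _ ≤ 4 * (15 * ofReal (τ / 60 * (v + 1 - (u - 1)))) := mul_le_mul' le_rfl (hw.trans (mul_le_mul' le_rfl hE))
    _ = _ := by
      rw [show (4:ℝ≥0∞) = ofReal 4 by simp, show (15:ℝ≥0∞) = ofReal 15 by simp, ← ofReal_mul (by norm_num), ← ofReal_mul (by norm_num)]
      congr 1; ring

noncomputable def VV {ι : Type} (s : Finset ι) (h : Option ι → ℝ → ℝ) (ε x : ℝ) : ℝ :=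
  Cop s (fun j => h (some j)) ε (h none) x

theorem VV_smul {ι : Type} (s : Finset ι) (h : Option ι → ℝ → ℝ) (w : Option ι → ℝ) (ε x : ℝ) :
    VV s (fun o y => w o * h o y) ε x = (∏ o ∈ insertNone s, w o) * VV s h ε x := by
  have hP : ∀ y, Pk s (fun j y => w (some j) * h (some j) y) x y = (∏ j ∈ s, w (some j)) * Pk s (fun j => h (some j)) x y := fun y => by
    unfold Pk; rw [← Finset.prod_mul_distrib]
    refine Finset.prod_congr rfl fun j _ => ?_
    unfold Dq Adiff; rw [intervalIntegral.integral_const_mul, mul_div_assoc]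
  rw [Finset.prod_insertNone]
  unfold VV Cop; rw [← integral_const_mul]
  congr 1; ext y
  rw [hP]; ring

theorem VV_update {ι : Type} [DecidableEq ι] {s : Finset ι} {h : Option ι → ℝ → ℝ} (hm : ∀ o, Measurable (h o)) (hi : ∀ o, Integrable (h o))
    {o : Option ι} (ho : o ∈ insertNone s) {g : ℝ → ℝ} (gm : Measurable g) (gi : Integrable g) {ε : ℝ} (hε : 0 < ε) (x : ℝ) :
    VV s h ε x = VV s (Function.update h o g) ε x + VV s (Function.update h o (fun y => h o y - g y)) ε x := by
  have dm : Measurable (fun y => h o y - g y) := (hm o).sub gm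
  have di : Integrable (fun y => h o y - g y) := (hi o).sub gi
  cases o with
  | none =>
    unfold VV; simp only [Function.update_self, ne_eq, reduceCtorEq, not_false_eq_true, Function.update_of_ne]
    rw [← Cop_add (fun j => hi (some j)) gm gi dm di hε]
    congr 1; ext y; ring
  | some j =>
    have hj : j ∈ s := by simpa using ho
    have key : ∀ k : ℝ → ℝ, ∀ y, Pk s (fun i => Function.update h (some j) k (some i)) x y = Dq k x y * Pk (s.erase j) (fun i => h (some i)) x y := fun k y => by
      unfold Pk; rw [← Finset.mul_prod_erase _ _ hj]
      simp only [Function.update_self]; congr 1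
      refine Finset.prod_congr rfl fun i hi => ?_
      rw [Function.update_of_ne (by simpa using Finset.ne_of_mem_erase hi)]
    have int : ∀ k : ℝ → ℝ, Measurable k → Integrable k → IntegrableOn (fun y => Pk s (fun i => Function.update h (some j) k (some i)) x y / (x - y) * h none y) {y | ε < |x - y|} := fun k km ki => by
      refine Cint (fun i => ?_) (hm none) (hi none) hε
      by_cases hij : i = j
      · subst hij; simpa using ki
      · rw [Function.update_of_ne (by simpa using hij)]; exact hi _
    unfold VV Cop; rw [Function.update_of_ne (by simp), Function.update_of_ne (by simp), ← integral_add (int g gm gi) (int _ dm di)]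
    congr 1; ext y
    rw [key, key]; have := key (h (some j)) y
    rw [Function.update_eq_self] at this; rw [this]
    have e : Dq (h (some j)) x y = Dq g x y + Dq (fun y => h (some j) y - g y) x y := by unfold Dq Adiff; rw [intervalIntegral.integral_sub (hi _).intervalIntegrable gi.intervalIntegrable]; ring
    rw [e]; ring

theorem Max_w {ι : Type} (s : Finset ι) (τ : ℝ) (hτ : 0 < τ) : ∃ C : ℝ, 0 < C ∧
    ∀ (h : Option ι → ℝ → ℝ) (w : Option ι → ℝ) (u v : ℝ), u < v → (∀ o, 0 < w o) → (∀ o, Measurable (h o)) → (∀ o, Integrable (h o)) →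
    (∀ x ∉ Ioc u v, h none x = 0) →
    volume {x ∈ Ioc u v | ∃ ε, 0 < ε ∧ ε ≤ 1 ∧ C * ∏ o ∈ insertNone s, w o < |VV s h ε x|}
      ≤ ofReal (τ * (v - u + 2) + ∑ o ∈ insertNone s, 15 * ((w o)⁻¹ * ∫ y, |h o y|)) := by
  obtain ⟨C, hC, H⟩ := Max s τ hτ
  refine ⟨C, hC, ?_⟩
  intro h w u v huv hw hm hi h0; obtain ⟨k, hk⟩ : ∃ k : Option ι → ℝ → ℝ, k = fun o y => (w o)⁻¹ * h o y := ⟨_, rfl⟩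
  have km : ∀ o, Measurable (k o) := fun o => by rw [hk]; exact (hm o).const_mul _
  have ki : ∀ o, Integrable (k o) := fun o => by rw [hk]; exact (hi o).const_mul _
  have hM := H (fun j => k (some j)) (k none) u v 1 huv one_pos (fun j => km _) (fun j => ki _) (km _) (ki _) (fun x hx => by rw [hk]; simp [h0 x hx])
  have hP : 0 < ∏ o ∈ insertNone s, w o := Finset.prod_pos fun o _ => hw o
  have hweak : ∀ o, volume {x | 1 < Mx (k o) x} ≤ ofReal (15 * ((w o)⁻¹ * ∫ y, |h o y|)) := fun o => by
    have := MM_weak (fun y => ofReal |k o y|) (t := 1) (by simp) (by simp)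
    rw [one_mul, ← ofReal_integral_eq_lintegral_ofReal (ki o).abs (ae_of_all _ fun y => abs_nonneg _)] at this
    refine this.trans (le_of_eq ?_); rw [ofReal_mul (by norm_num)]
    congr 2
    · simp
    · rw [← integral_const_mul]; congr 1; ext y; simp only [hk]; rw [abs_mul, abs_of_pos (inv_pos.2 (hw o))]
  have hsub : {x ∈ Ioc u v | ∃ ε, 0 < ε ∧ ε ≤ 1 ∧ C * ∏ o ∈ insertNone s, w o < |VV s h ε x|} ⊆
      {x ∈ Ioc u v | (∀ j ∈ s, Mx (k (some j)) x ≤ 1) ∧ Mx (k none) x ≤ ofReal 1 ∧ ∃ ε, 0 < ε ∧ ε ≤ 1 ∧ C * 1 < |Cop s (fun j => k (some j)) ε (k none) x|}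
      ∪ ⋃ o ∈ insertNone s, {x | 1 < Mx (k o) x} := by
    rintro x ⟨hx, ε, he1, he2, hc⟩
    by_cases hgood : ∀ o ∈ insertNone s, Mx (k o) x ≤ 1
    · refine Or.inl ⟨hx, fun j hj => hgood _ (by simpa using hj), by simpa using hgood none (by simp), ε, he1, he2, ?_⟩
      have := VV_smul s h (fun o => (w o)⁻¹) ε x
      rw [← hk] at this; unfold VV at this hc
      rw [this, abs_mul, Finset.prod_inv_distrib, abs_of_pos (inv_pos.2 hP), mul_one, inv_mul_eq_div, lt_div_iff₀ hP]; exact hc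
    · push Not at hgood
      obtain ⟨o, ho, h1⟩ := hgood
      exact Or.inr (mem_iUnion₂.2 ⟨o, ho, h1⟩)
  have nn : ∀ o, 0 ≤ 15 * ((w o)⁻¹ * ∫ y, |h o y|) := fun o =>
    mul_nonneg (by norm_num) (mul_nonneg (inv_pos.2 (hw o)).le (integral_nonneg fun y => abs_nonneg _))
  rw [ofReal_add (mul_nonneg hτ.le (by linarith)) (Finset.sum_nonneg fun o _ => nn o), ENNReal.ofReal_sum_of_nonneg (fun o _ => nn o)]
  exact (measure_mono hsub).trans ((measure_union_le _ _).trans (add_le_add hM ((measure_biUnion_finset_le _ _).trans (Finset.sum_le_sum fun o _ => hweak o))))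

theorem small_update {ι : Type} [DecidableEq ι] (s : Finset ι) {h : Option ι → ℝ → ℝ} (hm : ∀ o, Measurable (h o)) (hi : ∀ o, Integrable (h o))
    {u v : ℝ} (huv : u < v) (h0 : ∀ o, ∀ x ∉ Ioc u v, h o x = 0) {o : Option ι} (ho : o ∈ insertNone s) {η τ : ℝ} (hη : 0 < η) (hτ : 0 < τ) :
    ∃ ν > 0, ∀ d : ℝ → ℝ, Measurable d → Integrable d → (∀ x ∉ Ioc u v, d x = 0) → ∫ y, |d y| ≤ ν →
      volume {x ∈ Ioc u v | ∃ ε, 0 < ε ∧ ε ≤ 1 ∧ η < |VV s (Function.update h o d) ε x|} ≤ ofReal τ := by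
  have hL : 0 < v - u + 2 := by linarith
  obtain ⟨C, hC, H⟩ := Max_w s (τ / (3 * (v - u + 2))) (by positivity)
  obtain ⟨K, hK⟩ : ∃ K : ℝ, K = ∑ o' ∈ (insertNone s).erase o, ∫ y, |h o' y| := ⟨_, rfl⟩
  have hK0 : 0 ≤ K := by rw [hK]; exact Finset.sum_nonneg fun o _ => integral_nonneg fun y => abs_nonneg _
  obtain ⟨Λ, hΛ⟩ : ∃ Λ : ℝ, Λ = 45 * (K + 1) / τ := ⟨_, rfl⟩
  have hΛ0 : 0 < Λ := by rw [hΛ]; positivity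
  obtain ⟨μ, hμ⟩ : ∃ μ : ℝ, μ = η / (C * Λ ^ ((insertNone s).erase o).card) := ⟨_, rfl⟩
  have hμ0 : 0 < μ := by rw [hμ]; positivity
  refine ⟨μ * τ / 45, by positivity, ?_⟩
  intro d dm di d0 hd; have hne : ∀ o' ∈ (insertNone s).erase o, o' ≠ o := fun o' h => Finset.ne_of_mem_erase h
  have up : ∀ P : (ℝ → ℝ) → Prop, (∀ o', P (h o')) → P d → ∀ o', P (Function.update h o d o') := fun P h1 h2 o' => by
    by_cases hoo : o' = o
    · subst hoo; simpa using h2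
    · rw [Function.update_of_ne hoo]; exact h1 o'
  have := H (Function.update h o d) (Function.update (fun _ => Λ) o μ) u v huv (by
    intro o'; by_cases hoo : o' = o
    · subst hoo; simpa using hμ0
    · rw [Function.update_of_ne hoo]; exact hΛ0) (up Measurable hm dm) (up (fun g => Integrable g) hi di) (up (fun g => ∀ x ∉ Ioc u v, g x = 0) h0 d0 none)
  rw [← Finset.mul_prod_erase _ _ ho, ← Finset.add_sum_erase _ _ ho, Finset.prod_congr rfl (fun o' h' => Function.update_of_ne (hne o' h') _ _),
    Finset.prod_const, Finset.sum_congr rfl (fun o' h' => by rw [Function.update_of_ne (hne o' h'), Function.update_of_ne (hne o' h')]),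
    ← Finset.mul_sum, ← Finset.mul_sum, ← hK, Function.update_self, Function.update_self] at this
  have e : C * (μ * Λ ^ ((insertNone s).erase o).card) = η := by rw [hμ]; field_simp
  rw [e] at this
  refine this.trans (ofReal_le_ofReal ?_)
  have h1 : τ / (3 * (v - u + 2)) * (v - u + 2) = τ / 3 := by field_simp
  have h2 : 15 * (μ⁻¹ * ∫ y, |d y|) ≤ τ / 3 := by
    calc _ ≤ 15 * (μ⁻¹ * (μ * τ / 45)) := by gcongr
      _ = _ := by field_simp; norm_num
  have h3 : 15 * (Λ⁻¹ * K) ≤ τ / 3 := by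
    calc _ ≤ 15 * (Λ⁻¹ * (K + 1)) := by gcongr; linarith
      _ = _ := by rw [hΛ]; field_simp; norm_num
  linarith

theorem closure_conv {V : ℝ → ℝ → ℝ} {S : Set ℝ}
    (H : ∀ η > 0, ∀ τ > 0, ∃ A R : ℝ → ℝ → ℝ, (∀ ε > 0, ∀ x, V ε x = A ε x + R ε x) ∧
      (∀ᵐ x, x ∈ S → ∃ L, Tendsto (fun ε => A ε x) (𝓝[>] 0) (𝓝 L)) ∧
      volume {x ∈ S | ∃ ε, 0 < ε ∧ ε ≤ 1 ∧ η < |R ε x|} ≤ ofReal τ) :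
    ∀ᵐ x, x ∈ S → ∃ L, Tendsto (fun ε => V ε x) (𝓝[>] 0) (𝓝 L) := by
  have key : ∀ n : ℕ, ∀ᵐ x, x ∈ S → ∃ t ∈ 𝓝[>] (0:ℝ), ∀ ε ∈ t, ∀ ε' ∈ t, |V ε x - V ε' x| < 3 * (1 / ((n:ℝ) + 1)) := fun n => by
    obtain ⟨η, hη⟩ : ∃ η : ℝ, η = 1 / ((n:ℝ) + 1) := ⟨_, rfl⟩
    rw [← hη]; have hη0 : 0 < η := by rw [hη]; positivity
    rw [ae_iff]; refine le_antisymm (ENNReal.le_of_forall_pos_le_add fun τ hτ _ => ?_) zero_le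
    obtain ⟨A, R, h1, h2, h3⟩ := H η hη0 τ hτ
    rw [zero_add]; rw [ae_iff] at h2
    have hsub : {x | ¬ (x ∈ S → ∃ t ∈ 𝓝[>] (0:ℝ), ∀ ε ∈ t, ∀ ε' ∈ t, |V ε x - V ε' x| < 3 * η)} ⊆
        {x | ¬ (x ∈ S → ∃ L, Tendsto (fun ε => A ε x) (𝓝[>] 0) (𝓝 L))} ∪ {x ∈ S | ∃ ε, 0 < ε ∧ ε ≤ 1 ∧ η < |R ε x|} := by
      intro x hx; by_contra hcon
      rw [mem_union, not_or] at hcon; obtain ⟨hA, hR⟩ := hcon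
      apply hx
      intro hxS; obtain ⟨L, hL⟩ := not_not.1 hA hxS
      have hR' : ∀ ε, 0 < ε → ε ≤ 1 → |R ε x| ≤ η := by intro ε e1 e2; by_contra hc; exact hR ⟨hxS, ε, e1, e2, not_le.1 hc⟩
      refine ⟨{ε | |A ε x - L| < η / 2} ∩ Ioc 0 1, inter_mem ?_ (Ioc_mem_nhdsGT one_pos), ?_⟩
      · have := (Metric.tendsto_nhds.1 hL) (η / 2) (by positivity)
        simp only [dist_eq] at this
        exact this
      · rintro ε ⟨e1, e2⟩ ε' ⟨e3, e4⟩
        rw [h1 ε e2.1, h1 ε' e4.1]; have a1 := hR' ε e2.1 e2.2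
        have a2 := hR' ε' e4.1 e4.2; have e1' : |A ε x - L| < η / 2 := e1; have e3' : |A ε' x - L| < η / 2 := e3; rw [abs_lt] at *; rw [abs_le] at a1 a2; constructor <;> linarith [e1'.1, e1'.2, e3'.1, e3'.2, a1.1, a1.2, a2.1, a2.2]
    refine (measure_mono hsub).trans ((measure_union_le _ _).trans ?_); rw [h2, zero_add]
    refine h3.trans (le_of_eq (ENNReal.ofReal_coe_nnreal))
  filter_upwards [ae_all_iff.2 key] with x hx hxS
  have : Cauchy (map (fun ε => V ε x) (𝓝[>] 0)) := by
    rw [Metric.cauchy_iff]; refine ⟨inferInstance, fun e he => ?_⟩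
    obtain ⟨n, hn⟩ := exists_nat_one_div_lt (show 0 < e / 3 by positivity)
    obtain ⟨t, ht, h⟩ := hx n hxS
    refine ⟨_, image_mem_map ht, ?_⟩; rintro _ ⟨ε, h1, rfl⟩ _ ⟨ε', h2, rfl⟩
    rw [dist_eq]; linarith [h ε h1 ε' h2]
  exact cauchy_map_iff_exists_tendsto.1 this

def Nice (g : ℝ → ℝ) : Prop := ∀ᵐ x, ∀ᶠ y in 𝓝 x, g y = g x

theorem nice_dense {g : ℝ → ℝ} (gi : Integrable g) {u v : ℝ} (huv : u < v) (g0 : ∀ x ∉ Ioc u v, g x = 0) {ν : ℝ} (hν : 0 < ν) :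
    ∃ k : ℝ → ℝ, Measurable k ∧ Integrable k ∧ (∀ x ∉ Ioc u v, k x = 0) ∧ Nice k ∧ ∫ y, |g y - k y| ≤ ν := by
  obtain ⟨φ, hc, hφ, hcont, hInt⟩ := gi.exists_hasCompactSupport_integral_sub_le (show 0 < ν / 2 by positivity)
  have huc := hc.uniformContinuous_of_continuous hcont
  obtain ⟨η, hη, H⟩ := Metric.uniformContinuous_iff.1 huc (ν / (2 * (v - u))) (by have := sub_pos.2 huv; positivity)
  obtain ⟨q, hq⟩ : ∃ q : ℝ → ℝ, q = fun y => (η / 2) * ⌊y / (η / 2)⌋ := ⟨_, rfl⟩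
  have hqd : ∀ y, |φ y - φ (q y)| ≤ ν / (2 * (v - u)) := fun y => by
    refine (H ?_).le
    rw [dist_eq, hq]; have h1 := Int.floor_le (y / (η / 2))
    have h2 := Int.lt_floor_add_one (y / (η / 2)); rw [le_div_iff₀ (by positivity)] at h1
    rw [div_lt_iff₀ (by positivity)] at h2
    rw [abs_of_nonneg] <;> nlinarith
  have qm : Measurable q := by rw [hq]; fun_prop
  obtain ⟨B, hB⟩ := hc.exists_bound_of_continuous hcont
  have km : Measurable ((Ioc u v).indicator fun y => φ (q y)) := (hcont.measurable.comp qm).indicator measurableSet_Ioc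
  have ki : Integrable ((Ioc u v).indicator fun y => φ (q y)) := by rw [integrable_indicator_iff measurableSet_Ioc]; exact Measure.integrableOn_of_bounded (by simp) (hcont.measurable.comp qm).aestronglyMeasurable (ae_of_all _ fun y => hB (q y))
  refine ⟨_, km, ki, fun x hx => indicator_of_notMem hx _, ?_, ?_⟩
  · have hcount : (({u, v} : Set ℝ) ∪ range (fun z : ℤ => (η / 2) * z)).Countable := (Set.toFinite _).countable.union (countable_range _)
    filter_upwards [hcount.ae_notMem volume] with x hx
    simp only [mem_union, mem_insert_iff, mem_singleton_iff, mem_range, not_or, not_exists] at hx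
    have hqx : ∀ᶠ y in 𝓝 x, q y = q x := by
      have h1 : (⌊x / (η / 2)⌋ : ℝ) < x / (η / 2) := lt_of_le_of_ne (Int.floor_le _) fun h => hx.2 ⌊x / (η / 2)⌋ (by rw [h]; field_simp)
      have h2 := Int.lt_floor_add_one (x / (η / 2)); have hcd : Continuous fun y : ℝ => y / (η / 2) := by fun_prop
      filter_upwards [hcd.continuousAt.eventually (Ioo_mem_nhds h1 h2)] with y hy
      rw [hq]; simp only
      rw [Int.floor_eq_iff.2 ⟨hy.1.le, hy.2⟩]
    have hJ : ∀ᶠ y in 𝓝 x, (y ∈ Ioc u v ↔ x ∈ Ioc u v) := by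
      rcases lt_trichotomy x u with h | h | h
      · filter_upwards [Iio_mem_nhds h] with y hy
        exact ⟨fun h' => absurd h'.1 (not_lt.2 (le_of_lt hy)), fun h' => absurd h'.1 (not_lt.2 h.le)⟩
      · exact absurd h hx.1.1
      · rcases lt_trichotomy x v with h' | h' | h'
        · filter_upwards [Ioo_mem_nhds h h'] with y hy
          exact ⟨fun _ => ⟨h, h'.le⟩, fun _ => ⟨hy.1, hy.2.le⟩⟩
        · exact absurd h' hx.1.2
        · filter_upwards [Ioi_mem_nhds h'] with y hy
          exact ⟨fun h'' => absurd h''.2 (not_le.2 hy), fun h'' => absurd h''.2 (not_le.2 h')⟩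
    filter_upwards [hqx, hJ] with y h1 h2
    by_cases hxJ : x ∈ Ioc u v
    · rw [indicator_of_mem hxJ, indicator_of_mem (h2.2 hxJ), h1]
    · rw [indicator_of_notMem hxJ, indicator_of_notMem (fun h => hxJ (h2.1 h))]
  · have hle : ∀ y, |g y - (Ioc u v).indicator (fun y => φ (q y)) y| ≤ |g y - φ y| + (Ioc u v).indicator (fun _ => ν / (2 * (v - u))) y := by
      intro y; by_cases hy : y ∈ Ioc u v
      · rw [indicator_of_mem hy, indicator_of_mem hy]
        exact (abs_sub_le _ (φ y) _).trans (add_le_add le_rfl (hqd y))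
      · rw [indicator_of_notMem hy, indicator_of_notMem hy, g0 y hy]; simp
    have i1 : Integrable fun y => |g y - φ y| := (gi.sub hInt).abs
    have i2 : Integrable ((Ioc u v).indicator fun _ => ν / (2 * (v - u))) := by rw [integrable_indicator_iff measurableSet_Ioc]; exact integrableOn_const (by simp)
    refine (integral_mono (gi.sub ki).abs (i1.add i2) hle).trans ?_; have e := integral_add i1 i2
    simp only [Pi.add_apply] at e ⊢
    rw [e, integral_indicator measurableSet_Ioc, setIntegral_const, measureReal_def, volume_Ioc, ENNReal.toReal_ofReal (by linarith), smul_eq_mul]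
    have : (v - u) * (ν / (2 * (v - u))) = ν / 2 := by have := sub_pos.2 huv; field_simp
    have h' : ∫ y, |g y - φ y| ≤ ν / 2 := by simpa only [norm_eq_abs] using hφ
    linarith

theorem meas_ann (x ε ρ : ℝ) : MeasurableSet {y : ℝ | ε < |x - y| ∧ |x - y| ≤ ρ} := by
  have : {y : ℝ | ε < |x - y| ∧ |x - y| ≤ ρ} = {y : ℝ | ε < |x - y|} \ {y : ℝ | ρ < |x - y|} := by ext y; exact and_congr_right fun _ => not_lt.symm
  rw [this]; exact (meas_trunc x ε).diff (meas_trunc x ρ)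

theorem annulus_zero (x c : ℝ) (ε ρ : ℝ) : ∫ y in {y | ε < |x - y| ∧ |x - y| ≤ ρ}, c / (x - y) = 0 := by
  have ms := meas_ann x ε ρ
  rw [← integral_indicator ms]
  obtain ⟨F, hF⟩ : ∃ F, F = {y : ℝ | ε < |x - y| ∧ |x - y| ≤ ρ}.indicator fun y => c / (x - y) := ⟨_, rfl⟩
  rw [← hF]
  have h1 := integral_sub_left_eq_self F volume (2 * x)
  have h2 : ∀ y, F (2 * x - y) = -F y := fun y => by
    have e : x - (2 * x - y) = -(x - y) := by ring
    rw [hF]; simp only [indicator, mem_ofPred_eq, e, abs_neg]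
    split_ifs
    · rw [div_neg]
    · simp
  simp_rw [h2] at h1
  rw [integral_neg] at h1
  linarith

theorem nice_conv {ι : Type} {s : Finset ι} {h : Option ι → ℝ → ℝ} (hm : ∀ o, Measurable (h o)) (hi : ∀ o, Integrable (h o))
    (hn : ∀ o ∈ insertNone s, Nice (h o)) : ∀ᵐ x, ∃ L, Tendsto (fun ε => VV s h ε x) (𝓝[>] 0) (𝓝 L) := by
  have := (Finset.eventually_all (insertNone s)).2 hn
  filter_upwards [this] with x hx
  obtain ⟨r, hr, H⟩ := Metric.eventually_nhds_iff.1 ((Finset.eventually_all (insertNone s)).2 hx)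
  refine ⟨VV s h (r / 2) x, tendsto_nhds_of_eventually_eq ?_⟩
  filter_upwards [Ioo_mem_nhdsGT (show 0 < r / 2 by positivity)] with ε hε
  have ms : MeasurableSet {y : ℝ | r / 2 < |x - y|} := meas_trunc x (r / 2)
  have hU : {y : ℝ | ε < |x - y|} = {y | ε < |x - y| ∧ |x - y| ≤ r / 2} ∪ {y | r / 2 < |x - y|} := by
    ext y
    simp only [mem_union, mem_ofPred_eq]; constructor
    · intro h; by_cases h' : |x - y| ≤ r / 2
      · exact Or.inl ⟨h, h'⟩
      · exact Or.inr (not_le.1 h')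
    · rintro (h | h)
      · exact h.1
      · exact hε.2.trans h
  have ci := Cint (s := s) (x := x) (fun j => hi (some j)) (hm none) (hi none) hε.1
  unfold VV Cop; rw [hU] at ci ⊢
  have hdis : Disjoint {y : ℝ | ε < |x - y| ∧ |x - y| ≤ r / 2} {y | r / 2 < |x - y|} := disjoint_left.2 fun y h1 h2 => absurd h1.2 (not_le.2 h2)
  rw [setIntegral_union hdis ms (ci.mono_set subset_union_left) (ci.mono_set subset_union_right)]
  have ms' := meas_ann x ε (r / 2)
  rw [setIntegral_congr_fun (g := fun y => ((∏ j ∈ s, h (some j) x) * h none x) / (x - y)) ms', annulus_zero, zero_add]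
  intro y hy; have hy0 : x - y ≠ 0 := abs_pos.1 (hε.1.trans hy.1)
  have hd : |x - y| < r := by linarith [hy.2]
  have hP : Pk s (fun j => h (some j)) x y = ∏ j ∈ s, h (some j) x := by
    unfold Pk; refine Finset.prod_congr rfl fun j hj => ?_
    unfold Dq Adiff; rw [intervalIntegral.integral_congr (g := fun _ => h (some j) x), intervalIntegral.integral_const, smul_eq_mul, mul_div_assoc, mul_comm, div_mul_cancel₀ _ hy0]
    intro t ht; refine H ?_ (some j) (by simpa using hj)
    rw [dist_eq, abs_sub_comm]; refine lt_of_le_of_lt ?_ hd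
    rw [abs_sub_comm x t, abs_sub_comm x y]; rw [uIcc_comm] at ht
    rw [abs_sub_comm y x]; exact (abs_sub_left_of_mem_uIcc ht).trans (abs_sub_comm y x).le
  simp only
  rw [hP, H (by rw [dist_eq, abs_sub_comm]; exact hd) none (by simp)]
  ring

theorem pv_ae {ι : Type} (s : Finset ι) [Fintype ι] {h : Option ι → ℝ → ℝ} (hm : ∀ o, Measurable (h o)) (hi : ∀ o, Integrable (h o))
    {u v : ℝ} (huv : u < v) (h0 : ∀ o, ∀ x ∉ Ioc u v, h o x = 0) :
    ∀ᵐ x, x ∈ Ioc u v → ∃ L, Tendsto (fun ε => VV s h ε x) (𝓝[>] 0) (𝓝 L) := by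
  classical
  suffices P : ∀ t : Finset (Option ι), ∀ h : Option ι → ℝ → ℝ, (∀ o, Measurable (h o)) → (∀ o, Integrable (h o)) → (∀ o, ∀ x ∉ Ioc u v, h o x = 0) →
      (∀ o ∈ insertNone s, o ∉ t → Nice (h o)) → ∀ᵐ x, x ∈ Ioc u v → ∃ L, Tendsto (fun ε => VV s h ε x) (𝓝[>] 0) (𝓝 L) from
    P Finset.univ h hm hi h0 (fun o _ ho => absurd (Finset.mem_univ o) ho)
  intro t; induction t using Finset.induction_on with
  | empty =>
    intro h hm hi h0 hn; filter_upwards [nice_conv hm hi (s := s) (fun o ho => hn o ho (by simp))] with x hx _ using hx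
  | insert o t hot ih =>
    intro h hm hi h0 hn; by_cases ho : o ∈ insertNone s
    swap
    · refine ih h hm hi h0 fun o' h1 h2 => hn o' h1 ?_
      rw [Finset.mem_insert, not_or]; exact ⟨fun h => ho (h ▸ h1), h2⟩
    refine closure_conv fun η hη τ hτ => ?_
    obtain ⟨ν, hν, H⟩ := small_update s hm hi huv h0 ho hη hτ
    obtain ⟨k, km, ki, k0, kn, hk⟩ := nice_dense (hi o) huv (h0 o) hν
    refine ⟨_, _, fun ε hε x => VV_update hm hi ho km ki hε x, ?_, H _ ((hm o).sub km) ((hi o).sub ki) (fun x hx => by simp [h0 o x hx, k0 x hx]) hk⟩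
    have up : ∀ P : Option ι → (ℝ → ℝ) → Prop, (∀ o', o' ≠ o → P o' (h o')) → P o k → ∀ o', P o' (Function.update h o k o') := fun P h1 h2 o' => by
      by_cases hoo : o' = o
      · subst hoo; simpa using h2
      · rw [Function.update_of_ne hoo]; exact h1 o' hoo
    exact ih _ (up (fun _ g => Measurable g) (fun o _ => hm o) km) (up (fun _ g => Integrable g) (fun o _ => hi o) ki)
      (up (fun _ g => ∀ x ∉ Ioc u v, g x = 0) (fun o _ => h0 o) k0)
      (up (fun o g => o ∈ insertNone s → o ∉ t → Nice g) (fun o' hne h1 h2 => hn o' h1 (by simp [hne, h2])) (fun _ _ => kn))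

noncomputable def Gg {m : ℕ} (p : Fin m → ℝ) (a : Fin m → ℝ → ℝ) (f : ℝ → ℝ) (x : ℝ) : ℝ≥0∞ :=
  (∑ j, ofReal (|a j x| ^ p j)) + ofReal (Phi |f x|)

theorem gA {m : ℕ} {p : Fin m → ℝ} (hp : ∀ j, 1 < p j) (a : Fin m → ℝ → ℝ) (f : ℝ → ℝ) (j : Fin m) (x : ℝ) :
    ofReal |a j x| ≤ 1 + Gg p a f x := by
  have h1 : |a j x| ≤ 1 + |a j x| ^ p j := by
    rcases le_total |a j x| 1 with h | h
    · linarith [Real.rpow_nonneg (abs_nonneg (a j x)) (p j)]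
    · have := Real.self_le_rpow_of_one_le h (hp j).le
      linarith
  refine (ofReal_le_ofReal h1).trans ?_
  rw [ofReal_add zero_le_one (Real.rpow_nonneg (abs_nonneg _) _), ofReal_one]
  exact add_le_add le_rfl ((Finset.single_le_sum (f := fun j => ofReal (|a j x| ^ p j)) (fun _ _ => zero_le) (Finset.mem_univ j)).trans le_self_add)

theorem gF {m : ℕ} (p : Fin m → ℝ) (a : Fin m → ℝ → ℝ) (f : ℝ → ℝ) (x : ℝ) : ofReal |f x| ≤ Gg p a f x :=
  (ofReal_le_ofReal (Phi_ge (abs_nonneg _))).trans le_add_self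

theorem int_J {g : ℝ → ℝ} (gm : Measurable g) {u v : ℝ} (g0 : ∀ x ∉ Ioc u v, g x = 0) (h : ∫⁻ x in Ioc u v, ofReal |g x| ≠ ⊤) : Integrable g := by
  have h1 : IntegrableOn g (Ioc u v) := by
    refine ⟨gm.aestronglyMeasurable, ?_⟩; rw [hasFiniteIntegral_iff_norm]
    simpa only [norm_eq_abs] using h.lt_top
  exact (integrableOn_iff_integrable_of_support_subset (fun x hx => by by_contra hc; exact hx (g0 x hc))).1 h1

theorem af_int {α f : ℝ → ℝ} (hα : BMO1 α) (hαm : Measurable α) (hfm : Measurable f) {u v : ℝ} (huv : u < v) (f0 : ∀ x ∉ Ioc u v, f x = 0)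
    (h : ∫⁻ x in Ioc u v, ofReal (Phi |f x|) ≠ ⊤) : Integrable f ∧ Integrable (fun y => α y * f y) := by
  have hf : Integrable f := int_J hfm f0 (ne_top_of_le_ne_top h (lintegral_mono fun x => ofReal_le_ofReal (Phi_ge (abs_nonneg _))))
  refine ⟨hf, ?_⟩
  obtain ⟨C, hC, H⟩ := JN_LlogL
  have h1 : Integrable fun y => f y * (α y - av α u v) := by
    refine int_J (hfm.mul (hαm.sub measurable_const)) (u := u) (v := v) (fun x hx => by simp [f0 x hx]) ?_
    simp_rw [abs_mul]
    exact ne_top_of_le_ne_top (ENNReal.mul_ne_top ofReal_ne_top (ENNReal.add_ne_top.2 ⟨h, ofReal_ne_top⟩)) (H α hα f u v huv)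
  refine (h1.add (hf.const_mul (av α u v))).congr (ae_of_all _ fun y => ?_)
  simp only [Pi.add_apply]; ring

theorem Phi_scale {c s : ℝ} (hc : 1 ≤ c) (hs : 0 ≤ s) : Phi (c * s) ≤ c * (1 + log c) * Phi s := by
  unfold Phi; have h1 := log_ge_one hs
  have hlc := Real.log_nonneg hc
  have he := Real.exp_pos 1
  have h2 : log (exp 1 + c * s) ≤ log c + log (exp 1 + s) := by
    rw [← Real.log_mul (by positivity) (by positivity)]
    exact Real.log_le_log (by positivity) (by nlinarith)
  have h3 : log (exp 1 + c * s) ≤ (1 + log c) * log (exp 1 + s) := by nlinarith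
  calc c * s * log (exp 1 + c * s) ≤ c * s * ((1 + log c) * log (exp 1 + s)) := mul_le_mul_of_nonneg_left h3 (by positivity)
    _ = _ := by ring

theorem cheb4 {ι : Type} (s : Finset ι) (B : ℝ) (hB : 1 ≤ B) : ∃ C : ℝ, 0 < C ∧ ∀ (lam : ℝ) (α : ℝ → ℝ) (b : ι → ℝ → ℝ) (f : ℝ → ℝ) (u v δ : ℝ),
    |lam| ≤ 1 → BMO1 α → Measurable α → (∀ j, Measurable (b j)) → (∀ j x, |b j x| ≤ 3) → Measurable f → (∀ x, |f x| ≤ B) →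
    (∀ x, x ∉ Ioc u v → f x = 0) → 0 < δ → u < v →
    volume {x ∈ Ioc u v | 1 < |Uop lam α s b δ f x|} ≤ ofReal C * ∫⁻ x in Ioc u v, ofReal |f x| := by
  obtain ⟨C, hC, H⟩ := L6 s
  have hB0 : 0 < B := by linarith
  refine ⟨B ^ 4 * C, by positivity, ?_⟩
  intro lam α b f u v δ hlam hα hαm hbm hb hfm hf hf0 hδ huv; have hU : ∀ x, Uop lam α s b δ (fun y => B⁻¹ * f y) x = B⁻¹ * Uop lam α s b δ f x := fun x => by have := Uop_smul lam α s b 1 B⁻¹ δ f x; simpa using this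
  have h6 := H lam α b (fun y => B⁻¹ * f y) u v δ hlam hα hαm hbm hb (hfm.const_mul _) (fun x => by rw [abs_mul, abs_of_pos (inv_pos.2 hB0), inv_mul_le_iff₀ hB0, mul_one]; exact hf x) (fun x hx => by simp [hf0 x hx]) hδ huv
  simp only [hU] at h6
  have um : Measurable fun x => ofReal (|B⁻¹ * Uop lam α s b δ f x| ^ 4) :=
    (((Uop_meas hα.li hαm (fun j _ => LI_of_bdd (hbm j) (hb j)) hfm δ).const_mul _).abs.pow_const 4).ennreal_ofReal
  have h1 := mul_meas_ge_le_lintegral (μ := volume.restrict (Ioc u v)) um (ofReal ((B⁻¹) ^ 4))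
  have h2 : volume {x ∈ Ioc u v | 1 < |Uop lam α s b δ f x|} ≤ volume.restrict (Ioc u v) {x | ofReal ((B⁻¹) ^ 4) ≤ ofReal (|B⁻¹ * Uop lam α s b δ f x| ^ 4)} := by
    rw [Measure.restrict_apply (measurableSet_le measurable_const um)]; refine measure_mono ?_
    rintro x ⟨hx, h⟩
    refine ⟨ofReal_le_ofReal ?_, hx⟩
    rw [abs_mul, abs_of_pos (inv_pos.2 hB0)]; exact pow_le_pow_left₀ (inv_pos.2 hB0).le (le_mul_of_one_le_right (inv_pos.2 hB0).le h.le) 4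
  calc _ ≤ ofReal (B ^ 4) * (ofReal ((B⁻¹) ^ 4) * volume.restrict (Ioc u v) {x | ofReal ((B⁻¹) ^ 4) ≤ ofReal (|B⁻¹ * Uop lam α s b δ f x| ^ 4)}) := by
        rw [← mul_assoc, ← ofReal_mul (by positivity), ← mul_pow, mul_inv_cancel₀ hB0.ne', one_pow, ofReal_one, one_mul]; exact h2
    _ ≤ ofReal (B ^ 4) * (ofReal C * ∫⁻ x in Ioc u v, ofReal |f x|) := by
        refine mul_le_mul' le_rfl (h1.trans (h6.trans (mul_le_mul' le_rfl (lintegral_mono fun x => ofReal_le_ofReal ?_))))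
        rw [abs_mul, abs_of_pos (inv_pos.2 hB0)]; exact mul_le_of_le_one_left (abs_nonneg _) (inv_le_one_of_one_le₀ hB)
    _ = _ := by rw [← mul_assoc, ← ofReal_mul (by positivity)]

set_option maxHeartbeats 1000000 in
theorem L8 {m : ℕ} {p : Fin m → ℝ} (hp : ∀ j, 1 < p j) : ∃ C0 C : ℝ, 1 ≤ C0 ∧ 0 < C ∧ ∀ (α : ℝ → ℝ) (a : Fin m → ℝ → ℝ) (f : ℝ → ℝ) (u v δ : ℝ),
    BMO1 α → Measurable α → (∀ j, Measurable (a j)) → Measurable f → (∀ j, ∀ x ∉ Ioc u v, a j x = 0) → (∀ x ∉ Ioc u v, f x = 0) →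
    u < v → 0 < δ → ∫⁻ x in Ioc u v, Gg p a f x ≤ ofReal (v - u) →
    volume {x ∈ Ioc u v | C0 < |Uop 0 α Finset.univ a δ f x|} ≤ ofReal C * ∫⁻ x in Ioc u v, Gg p a f x := by
  obtain ⟨CJ, hCJ, HJ⟩ := JN_LlogL
  obtain ⟨M, hM⟩ : ∃ M : ℝ, M = 3 * CJ + 3 := ⟨_, rfl⟩
  obtain ⟨C1, hC1, HR⟩ := lemR (Finset.univ : Finset (Fin m)) M (by rw [hM]; positivity)
  obtain ⟨C4, hC4, H4⟩ := cheb4 (Finset.univ : Finset (Fin m)) M (by linarith)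
  refine ⟨C1 + 2, 7 + 2 * (C4 * (M + 1)), by linarith, by rw [hM]; positivity, ?_⟩
  intro α a f u v δ hα hαm ham hfm ha0 hf0 huv hδ hG; obtain ⟨ω, hω⟩ : ∃ ω, ω = ∫⁻ x in Ioc u v, Gg p a f x := ⟨_, rfl⟩
  have hωt : ω ≠ ⊤ := by rw [hω]; exact ne_top_of_le_ne_top ofReal_ne_top hG
  have Gm : Measurable (Gg p a f) := by
    unfold Gg Phi; have h2 : ∀ j, Measurable fun x => ofReal (|a j x| ^ p j) := fun j => ((ham j).abs.pow_const _).ennreal_ofReal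
    refine (Finset.measurable_sum _ fun j _ => h2 j).add ?_
    exact (hfm.abs.mul (Real.measurable_log.comp (hfm.abs.const_add _))).ennreal_ofReal
  obtain ⟨l, r, hlr, hIJ, hdisj, hlow, hup, hoff⟩ := CZ_lemma huv (Gg p a f) Gm.aemeasurable hG
  have hsum := tsum_len_le hIJ hdisj hlow
  rw [← hω] at hsum ⊢
  have hPhi : ∫⁻ x in Ioc u v, ofReal (Phi |f x|) ≠ ⊤ := by rw [hω] at hωt; exact ne_top_of_le_ne_top hωt (lintegral_mono fun x => le_add_self)
  obtain ⟨hfi, hαf⟩ := af_int hα hαm hfm huv hf0 hPhi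
  have bA : ∀ j y z, ∫⁻ x in Ioc y z, ofReal |a j x| ≤ ofReal (z - y) + ∫⁻ x in Ioc y z, Gg p a f x := fun j y z => by
    refine (lintegral_mono fun x => gA hp a f j x).trans (le_of_eq ?_)
    rw [lintegral_add_left measurable_const, setLIntegral_one, volume_Ioc]
  have hai : ∀ j, Integrable (a j) := fun j => int_J (ham j) (ha0 j) (ne_top_of_le_ne_top (by
    rw [← hω]; exact ENNReal.add_ne_top.2 ⟨ofReal_ne_top, hωt⟩) (bA j u v))
  have hlr0 : ∀ i, 0 ≤ r i - l i := fun i => sub_nonneg.2 (hlr i)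
  have three : ∀ i, ofReal (r i - l i) + 2 * ofReal (r i - l i) = ofReal (3 * (r i - l i)) := by intro i; rw [ofReal_mul (by norm_num), show ofReal 3 = 1 + 2 by rw [show (3:ℝ) = 1 + 2 by norm_num, ofReal_add] <;> norm_num]; ring
  have offJ : ∀ᵐ x, x ∉ ⋃ i, Ioc (l i) (r i) → (∀ j, |a j x| ≤ 1) ∧ |f x| ≤ 1 := by
    filter_upwards [hoff] with x hx hxΩ
    by_cases hxJ : x ∈ Ioc u v
    · have hg := hx hxJ hxΩ
      constructor
      · intro j
        have h1 : ofReal (|a j x| ^ p j) ≤ 1 := ((Finset.single_le_sum (f := fun j => ofReal (|a j x| ^ p j)) (fun _ _ => zero_le) (Finset.mem_univ j)).trans le_self_add).trans hg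
        rw [ENNReal.ofReal_le_one] at h1; by_contra hc
        exact absurd h1 (not_le.2 (Real.one_lt_rpow (not_le.1 hc) (by linarith [hp j])))
      · exact ENNReal.ofReal_le_one.1 ((gF p a f x).trans hg)
    · exact ⟨fun j => by simp [ha0 j x hxJ], by simp [hf0 x hxJ]⟩
  obtain ⟨bt, ft, h, btm, bt3, ftm, ft3, hm, hM', ft0, h0, hΩ, hgood⟩ := HR 0 α a f u v l r (by simp) hα hαm ham hai hfm hfi hαf hf0 hlr hIJ hdisj
    (fun j => by filter_upwards [offJ] with x hx h using (hx h).1 j) (by filter_upwards [offJ] with x hx h using (hx h).2)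
    (fun j i => int_le_of_lint (by linarith [hlr0 i]) (hai j).integrableOn (((bA j _ _).trans (add_le_add le_rfl (hup i))).trans (three i).le))
    (fun i => int_le_of_lint (by linarith [hlr0 i]) hfi.integrableOn ((lintegral_mono fun x => gF p a f x).trans ((hup i).trans (le_add_self.trans (three i).le))))
    (by
      intro i; rcases (hlr i).lt_or_eq with hi | hi
      swap
      · simp [hi]
      have e : ∀ x, |α x - av α (l i) (r i)| * |f x| = |f x * (α x - av α (l i) (r i))| := fun x => by rw [abs_mul, mul_comm]
      simp_rw [e]
      have hInt : Integrable fun x => f x * (α x - av α (l i) (r i)) := by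
        refine (hαf.sub (hfi.const_mul (av α (l i) (r i)))).congr (ae_of_all _ fun y => ?_)
        simp only [Pi.sub_apply]; ring
      refine int_le_of_lint (by rw [hM]; have := hlr0 i; positivity) hInt.integrableOn ?_
      simp_rw [abs_mul]
      refine (HJ α hα f (l i) (r i) hi).trans ?_; refine (mul_le_mul' le_rfl (add_le_add ((lintegral_mono fun x => le_add_self).trans (hup i)) le_rfl)).trans ?_
      rw [add_comm, three, ← ofReal_mul hCJ.le]; exact ofReal_le_ofReal (by rw [hM]; nlinarith [hlr0 i]))
  have hM3 : 3 ≤ M := by rw [hM]; linarith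
  have hΩv : volume (⋃ i, Ioc (l i) (r i)) ≤ ω := (measure_iUnion_le _).trans (by simpa only [volume_Ioc] using hsum)
  have mΩ : MeasurableSet (⋃ i, Ioc (l i) (r i)) := MeasurableSet.iUnion fun i => measurableSet_Ioc
  have kb : ∀ k : ℝ → ℝ, (∀ x, |k x| ≤ M) → (∀ x ∉ ⋃ i, Ioc (l i) (r i), |k x| ≤ |f x|) → ∫⁻ x in Ioc u v, ofReal |k x| ≤ ofReal (M + 1) * ω := fun k k1 k2 => by
    calc _ ≤ ∫⁻ x in Ioc u v, ((⋃ i, Ioc (l i) (r i)).indicator (fun _ => ofReal M) x + Gg p a f x) := by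
          refine lintegral_mono fun x => ?_
          by_cases hx : x ∈ ⋃ i, Ioc (l i) (r i)
          · simp only [indicator_of_mem hx]; exact (ofReal_le_ofReal (k1 x)).trans le_self_add
          · simp only [indicator_of_notMem hx]; exact (ofReal_le_ofReal (k2 x hx)).trans ((gF p a f x).trans le_add_self)
      _ ≤ ofReal M * ω + ω := by
          rw [lintegral_add_right _ Gm, ← hω]; refine add_le_add ((setLIntegral_le_lintegral _ _).trans ?_) le_rfl
          rw [lintegral_indicator_const mΩ]; exact mul_le_mul' le_rfl hΩv
      _ = _ := by rw [ofReal_add (by linarith) zero_le_one, ofReal_one, add_mul, one_mul]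
  have r1 := H4 0 α bt ft u v δ (by simp) hα hαm btm bt3 ftm (fun x => (ft3 x).trans hM3) ft0 hδ huv
  have r2 := H4 1 (fun _ => 0) bt h u v δ (by simp) BMO1_zero measurable_const btm bt3 hm hM' h0 hδ huv
  have s1 := r1.trans (mul_le_mul' le_rfl (kb ft (fun x => (ft3 x).trans hM3) fun x hx => (hΩ x hx).1))
  have s2 := r2.trans (mul_le_mul' le_rfl (kb h hM' fun x hx => by rw [(hΩ x hx).2]; simp))
  have hsub : {x ∈ Ioc u v | C1 + 2 < |Uop 0 α Finset.univ a δ f x|} ⊆ (Good l r)ᶜ ∪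
      ({x ∈ Ioc u v | 1 < |Uop 0 α Finset.univ bt δ ft x|} ∪ {x ∈ Ioc u v | 1 < |Uop 1 (fun _ => 0) Finset.univ bt δ h x|}) := by
    rintro x ⟨hx, hU⟩
    by_contra hc
    simp only [mem_union, not_or, mem_ofPred_eq, hx, true_and, not_lt, mem_compl_iff, not_not] at hc
    obtain ⟨c1, c2, c3⟩ := hc
    rw [Uop_zero] at c3; have c4 := (hgood x c1).1 δ hδ
    rw [abs_le] at c2 c3 c4
    rw [lt_abs] at hU; rcases hU with hU | hU <;> linarith [c2.1, c2.2, c3.1, c3.2, c4.1, c4.2]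
  refine (measure_mono hsub).trans ((measure_union_le _ _).trans ((add_le_add ((bad_meas hlr).trans (mul_le_mul' le_rfl hsum)) ((measure_union_le _ _).trans (add_le_add s1 s2))).trans (le_of_eq ?_)))
  have hM1 : 0 ≤ M + 1 := by linarith
  rw [ofReal_add (p := 7) (by norm_num) (by positivity), ofReal_mul (p := 2) (by norm_num), ofReal_mul hC4.le]
  simp only [ENNReal.ofReal_ofNat]
  ring

theorem pv_U {m : ℕ} {α : ℝ → ℝ} {a : Fin m → ℝ → ℝ} {f : ℝ → ℝ} {u v : ℝ} (hα : BMO1 α) (hαm : Measurable α) (am : ∀ j, Measurable (a j))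
    (ai : ∀ j, Integrable (a j)) (a0 : ∀ j, ∀ x ∉ Ioc u v, a j x = 0) (fm : Measurable f) (fi : Integrable f)
    (αfi : Integrable (fun y => α y * f y)) (f0 : ∀ x ∉ Ioc u v, f x = 0) (huv : u < v) :
    ∀ᵐ x, x ∈ Ioc u v → ∃ L, Tendsto (fun ε => Uop 0 α Finset.univ a ε f x) (𝓝[>] 0) (𝓝 L) := by
  have iα : Integrable ((Ioc u v).indicator α) := (integrable_indicator_iff measurableSet_Ioc).2 (hα.1 u v)
  have p1 := pv_ae (ι := Option (Fin m)) (insertNone Finset.univ) (h := fun o => o.elim f (fun o' => o'.elim ((Ioc u v).indicator α) a))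
    (by rintro (_ | _ | j); exacts [fm, hαm.indicator measurableSet_Ioc, am j]) (by rintro (_ | _ | j); exacts [fi, iα, ai j]) huv
    (by rintro (_ | _ | j); exacts [f0, fun x hx => indicator_of_notMem hx _, a0 j])
  have p2 := pv_ae (ι := Fin m) Finset.univ (h := fun o => o.elim (fun y => α y * f y) a)
    (by rintro (_ | j); exacts [hαm.mul fm, am j]) (by rintro (_ | j); exacts [αfi, ai j]) huv
    (by rintro (_ | j); exacts [fun x hx => by simp [f0 x hx], a0 j])
  filter_upwards [p1, p2] with x h1 h2 hx
  obtain ⟨L1, hL1⟩ := h1 hx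
  obtain ⟨L2, hL2⟩ := h2 hx
  refine ⟨L1 - L2, (hL1.sub hL2).congr' ?_⟩
  filter_upwards [self_mem_nhdsWithin] with ε hε
  have hε : 0 < ε := hε
  rw [Uop_split hα.li hαm (fun j => LI_of_integrable (ai j)) fm fi αfi f0 hε (fun y hy => Pk_int_bound ai hε x y hy) 0]
  simp only [sub_zero, zero_mul, zero_add]
  unfold VV; congr 1
  refine Cop_congr (fun o _ z hz => ?_) f0 hx
  cases o with
  | none => exact indicator_of_mem hz α
  | some j => rfl

theorem meas_ev {S : Set ℝ} {Z : ℕ → Set ℝ} {B : ℝ≥0∞} {n0 : ℕ} (hZ : ∀ n ≥ n0, volume (Z n) ≤ B) (hS : ∀ x ∈ S, ∀ᶠ n in atTop, x ∈ Z n) : volume S ≤ B := by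
  have hsub : S ⊆ ⋃ k : ℕ, ⋂ n ≥ k, Z n := fun x hx => by
    obtain ⟨k, hk⟩ := eventually_atTop.1 (hS x hx)
    exact mem_iUnion.2 ⟨k, mem_iInter₂.2 hk⟩
  have hmono : Monotone fun k : ℕ => ⋂ n ≥ k, Z n := fun k k' hkk x hx => mem_iInter₂.2 fun n hn => mem_iInter₂.1 hx n (le_trans hkk hn)
  refine (measure_mono hsub).trans ?_
  rw [hmono.measure_iUnion]
  exact iSup_le fun k => (measure_mono (biInter_subset_of_mem (le_max_left k n0))).trans (hZ _ (le_max_right k n0))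

/-- The kernel. -/
noncomputable def Kf {m : ℕ} (α : ℝ → ℝ) (a : Fin m → ℝ → ℝ) (x y : ℝ) : ℝ := Kap 0 α x y * Pk Finset.univ a x y / (x - y)

theorem lim_zero {F : ℝ → ℝ} {ε0 : ℝ} (h0 : 0 < ε0) (h : ∀ ε, 0 < ε → ε < ε0 → F ε = 0) : limUnder (𝓝[>] 0) F = 0 := by
  refine (tendsto_nhds_of_eventually_eq ?_).limUnder_eq
  filter_upwards [Ioo_mem_nhdsGT h0] with ε hε using h ε hε.1 hε.2

theorem not_int_lim {k : ℝ → ℝ} {x ε0 : ℝ} (h0 : 0 < ε0) (h : ¬ IntegrableOn k {y | ε0 < |x - y|}) :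
    limUnder (𝓝[>] 0) (fun ε : ℝ => ∫ y in {y | ε < |x - y|}, k y) = 0 :=
  lim_zero h0 fun _ _ h2 => integral_undef fun hc => h (IntegrableOn.mono_set hc fun _ hy => h2.trans hy)

theorem tail_lim {k : ℝ → ℝ} {x ε0 : ℝ} (h : IntegrableOn k {y | ε0 < |x - y|}) :
    Tendsto (fun N : ℕ => ∫ y in {y | ε0 < |x - y|}, ((Ioc (-(N:ℝ)) N)ᶜ).indicator k y) atTop (𝓝 0) := by
  have := tendsto_integral_of_dominated_convergence (F := fun (N : ℕ) y => ((Ioc (-(N:ℝ)) N)ᶜ).indicator k y) (f := fun _ => 0) (μ := volume.restrict {y | ε0 < |x - y|}) (fun y => |k y|)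
    (fun N => h.aestronglyMeasurable.indicator measurableSet_Ioc.compl) h.abs
    (fun N => ae_of_all _ fun y => by rw [norm_eq_abs]; unfold indicator; split_ifs <;> simp) (ae_of_all _ fun y => ?_)
  · simpa using this
  · refine tendsto_nhds_of_eventually_eq ?_
    obtain ⟨n, hn⟩ := exists_nat_gt |y|
    filter_upwards [eventually_ge_atTop n] with N hN
    have : (n:ℝ) ≤ N := by exact_mod_cast hN
    exact indicator_of_notMem (fun hc : y ∈ (Ioc (-(N:ℝ)) N)ᶜ => hc ⟨by linarith [neg_abs_le y], by linarith [le_abs_self y]⟩) _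

set_option maxHeartbeats 1000000 in
theorem Cmeas {m : ℕ} {p : Fin m → ℝ} (hp : ∀ j, 1 < p j) : ∃ C : ℝ, 0 < C ∧ ∀ (α : ℝ → ℝ) (a : Fin m → ℝ → ℝ) (f : ℝ → ℝ),
    BMO1 α → Measurable α → (∀ j, Measurable (a j)) → Measurable f → ∫⁻ x, Gg p a f x ≠ ⊤ →
    volume {x | 1 < |limUnder (𝓝[>] 0) (fun ε : ℝ => ∫ y in {y | ε < |x - y|}, Kf α a x y * f y)|} ≤ ofReal C * ∫⁻ x, Gg p a f x := by
  obtain ⟨C0, C, hC0, hC, H⟩ := L8 hp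
  obtain ⟨K, hK⟩ : ∃ K, K = C0 * (1 + log C0) := ⟨_, rfl⟩
  have hK1 : 1 ≤ K := by rw [hK]; nlinarith [Real.log_nonneg hC0]
  refine ⟨C * K, by positivity, ?_⟩
  intro α a f hα hαm ham hfm hG
  obtain ⟨J, hJ⟩ : ∃ J : ℕ → Set ℝ, J = fun N : ℕ => Ioc (-(N:ℝ)) N := ⟨_, rfl⟩
  have mJ : ∀ N, MeasurableSet (J N) := fun N => by rw [hJ]; exact measurableSet_Ioc
  obtain ⟨aN, haN⟩ : ∃ aN : ℕ → Fin m → ℝ → ℝ, aN = fun N j => (J N).indicator (a j) := ⟨_, rfl⟩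
  obtain ⟨fN, hfN⟩ : ∃ fN : ℕ → ℝ → ℝ, fN = fun N => (J N).indicator f := ⟨_, rfl⟩
  have aNm : ∀ N j, Measurable (aN N j) := fun N j => by rw [haN]; exact (ham j).indicator (mJ N)
  have fNm : ∀ N, Measurable (fN N) := fun N => by rw [hfN]; exact hfm.indicator (mJ N)
  have aN0 : ∀ (N : ℕ) j, ∀ x ∉ Ioc (-(N:ℝ)) N, aN N j x = 0 := fun N j x hx => by rw [haN]; exact indicator_of_notMem (by rw [hJ]; exact hx) _
  have fN0 : ∀ N : ℕ, ∀ x ∉ Ioc (-(N:ℝ)) N, fN N x = 0 := fun N x hx => by rw [hfN]; exact indicator_of_notMem (by rw [hJ]; exact hx) _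
  have Pm : ∀ {s t : ℝ}, 0 ≤ s → s ≤ t → Phi s ≤ Phi t := by
    intro s t h1 h2
    unfold Phi
    have := log_ge_one h1
    exact mul_le_mul h2 (Real.log_le_log (by positivity) (by linarith)) (by linarith) (by linarith)
  have Gle : ∀ N x, Gg p (aN N) (fun y => C0 * fN N y) x ≤ ofReal K * Gg p a f x := by
    intro N x
    unfold Gg
    rw [mul_add]
    refine add_le_add ?_ ?_
    · rw [Finset.mul_sum]
      refine Finset.sum_le_sum fun j _ => ?_
      rw [← ofReal_mul (by linarith)]
      refine ofReal_le_ofReal ?_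
      have h1 : |aN N j x| ≤ |a j x| := by rw [haN]; simp only [indicator]; split_ifs <;> simp
      exact (Real.rpow_le_rpow (abs_nonneg _) h1 (by linarith [hp j])).trans (le_mul_of_one_le_left (Real.rpow_nonneg (abs_nonneg _) _) hK1)
    · rw [← ofReal_mul (by linarith)]
      refine ofReal_le_ofReal ?_
      have h1 : |fN N x| ≤ |f x| := by rw [hfN]; simp only [indicator]; split_ifs <;> simp
      rw [abs_mul, abs_of_pos (by linarith), hK]
      refine (Pm (by positivity) (mul_le_mul_of_nonneg_left h1 (by linarith))).trans (Phi_scale hC0 (abs_nonneg _))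
  have GJ : ∀ N : ℕ, ∫⁻ x in Ioc (-(N:ℝ)) N, Gg p (aN N) (fun y => C0 * fN N y) x ≤ ofReal K * ∫⁻ x, Gg p a f x := by
    intro N
    rw [← lintegral_const_mul' _ _ ofReal_ne_top]
    exact (lintegral_mono (Gle N)).trans (setLIntegral_le_lintegral _ _)
  have hfin : ofReal K * ∫⁻ x, Gg p a f x ≠ ⊤ := ENNReal.mul_ne_top ofReal_ne_top hG
  have hUs : ∀ N ε x, Uop 0 α Finset.univ (aN N) ε (fun y => C0 * fN N y) x = C0 * Uop 0 α Finset.univ (aN N) ε (fN N) x := by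
    intro N ε x
    have := Uop_smul 0 α Finset.univ (aN N) 1 C0 ε (fN N) x
    simpa using this
  obtain ⟨n0, hn0⟩ := exists_nat_gt (max 1 (ofReal K * ∫⁻ x, Gg p a f x).toReal)
  have hNv : ∀ N ≥ n0, ofReal K * ∫⁻ x, Gg p a f x ≤ ofReal ((N:ℝ) - -(N:ℝ)) := by
    intro N hN
    rw [← ofReal_toReal hfin]
    refine ofReal_le_ofReal ?_
    have h1 : (n0:ℝ) ≤ N := by exact_mod_cast hN
    have := le_max_right 1 (ofReal K * ∫⁻ x, Gg p a f x).toReal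
    have := le_max_left 1 (ofReal K * ∫⁻ x, Gg p a f x).toReal
    linarith
  have hpos : ∀ N ≥ n0, -(N:ℝ) < N := by
    intro N hN
    have h1 : (n0:ℝ) ≤ N := by exact_mod_cast hN
    have := le_max_left 1 (ofReal K * ∫⁻ x, Gg p a f x).toReal
    linarith
  have hS : ∀ N ≥ n0, ∀ δ > 0, volume {x ∈ Ioc (-(N:ℝ)) N | 1 < |Uop 0 α Finset.univ (aN N) δ (fN N) x|} ≤ ofReal (C * K) * ∫⁻ x, Gg p a f x := by
    intro N hN δ hδ
    have h8 := H α (aN N) (fun y => C0 * fN N y) (-(N:ℝ)) N δ hα hαm (aNm N) ((fNm N).const_mul _) (aN0 N) (fun x hx => by simp [fN0 N x hx]) (hpos N hN) hδ ((GJ N).trans (hNv N hN))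
    rw [ofReal_mul hC.le, mul_assoc]
    refine le_trans (measure_mono ?_) (h8.trans (mul_le_mul' le_rfl (GJ N)))
    rintro x ⟨hx, h⟩
    refine ⟨hx, ?_⟩
    rw [hUs, abs_mul, abs_of_pos (by linarith)]
    nlinarith
  have hInt : ∀ N ≥ n0, Integrable (fN N) ∧ Integrable (fun y => α y * fN N y) ∧ ∀ j, Integrable (aN N j) := by
    intro N hN
    have hC0' : C0 ≠ 0 := by linarith
    have ht := ne_top_of_le_ne_top hfin (GJ N)
    obtain ⟨h1, h2⟩ := af_int hα hαm ((fNm N).const_mul C0) (hpos N hN) (fun x hx => by simp [fN0 N x hx]) (ne_top_of_le_ne_top ht (lintegral_mono fun x => le_add_self))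
    refine ⟨(h1.const_mul C0⁻¹).congr (ae_of_all _ fun y => by field_simp), (h2.const_mul C0⁻¹).congr (ae_of_all _ fun y => by field_simp), fun j => ?_⟩
    refine int_J (aNm N j) (aN0 N j) (ne_top_of_le_ne_top ?_ (lintegral_mono fun x => gA hp (aN N) (fun y => C0 * fN N y) j x))
    rw [lintegral_add_left measurable_const, setLIntegral_one, volume_Ioc]
    exact ENNReal.add_ne_top.2 ⟨ofReal_ne_top, ht⟩
  have hpv : ∀ᵐ x, ∀ N ≥ n0, x ∈ Ioc (-(N:ℝ)) N → ∃ L, Tendsto (fun ε => Uop 0 α Finset.univ (aN N) ε (fN N) x) (𝓝[>] 0) (𝓝 L) := by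
    rw [ae_all_iff]
    intro N
    by_cases hN : N ≥ n0
    · obtain ⟨h1, h2, h3⟩ := hInt N hN
      filter_upwards [pv_U hα hαm (aNm N) h3 (aN0 N) (fNm N) h1 h2 (fN0 N) (hpos N hN)] with x hx _ using hx
    · exact ae_of_all _ fun x h => absurd h hN
  obtain ⟨bad, hbad⟩ : ∃ bad, bad = {x | ¬ ∀ N ≥ n0, x ∈ Ioc (-(N:ℝ)) N → ∃ L, Tendsto (fun ε => Uop 0 α Finset.univ (aN N) ε (fN N) x) (𝓝[>] 0) (𝓝 L)} := ⟨_, rfl⟩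
  have hbad0 : volume bad = 0 := by rw [hbad]; exact ae_iff.1 hpv
  rw [← measure_sdiff_null hbad0]
  refine meas_ev (n0 := n0) (Z := fun N => {x ∈ Ioc (-(N:ℝ)) N | ∀ᶠ n : ℕ in atTop, 1 < |Uop 0 α Finset.univ (aN N) (1 / ((n:ℝ) + 1)) (fN N) x|}) (fun N hN => ?_) ?_
  · exact meas_ev (n0 := 0) (Z := fun n => {x ∈ Ioc (-(N:ℝ)) N | 1 < |Uop 0 α Finset.univ (aN N) (1 / ((n:ℝ) + 1)) (fN N) x|}) (fun n _ => hS N hN _ (by positivity))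
      fun x hx => by filter_upwards [hx.2] with n hn using ⟨hx.1, hn⟩
  rintro x ⟨hx1, hxb⟩
  have hx1 : 1 < |limUnder (𝓝[>] 0) (fun ε : ℝ => ∫ y in {y | ε < |x - y|}, Kf α a x y * f y)| := hx1
  have hI : ∀ ε > 0, IntegrableOn (fun y => Kf α a x y * f y) {y | ε < |x - y|} := by
    intro ε hε
    by_contra hc
    rw [not_int_lim hε hc] at hx1
    norm_num at hx1
  rw [hbad] at hxb
  have hxb := not_not.1 hxb
  obtain ⟨n1, hn1⟩ := exists_nat_gt (|x| + 1)
  -- the remainder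
  obtain ⟨R, hR⟩ : ∃ R : ℕ → ℝ, R = fun N : ℕ => ∫ y in {y | 1 / 2 < |x - y|}, ((Ioc (-(N:ℝ)) N)ᶜ).indicator (fun y => Kf α a x y * f y) y := ⟨_, rfl⟩
  have hR0 : Tendsto R atTop (𝓝 0) := by rw [hR]; exact tail_lim (hI _ (by norm_num))
  have hxJ : ∀ N ≥ n1, ∀ y ∉ Ioc (-(N:ℝ)) N, 1 / 2 < |x - y| := by
    intro N hN y hy
    have h1 : (n1:ℝ) ≤ N := by exact_mod_cast hN
    by_contra hc
    rw [not_lt, abs_le] at hc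
    exact hy ⟨by linarith [hc.2, neg_abs_le x], by linarith [hc.1, le_abs_self x]⟩
  have hxN : ∀ N ≥ n1, x ∈ Ioc (-(N:ℝ)) N := by
    intro N hN
    by_contra hc
    have := hxJ N hN x hc
    norm_num at this
  have hsplit : ∀ N ≥ n1, ∀ ε, 0 < ε → ε < 1 / 2 → ∫ y in {y | ε < |x - y|}, Kf α a x y * f y = Uop 0 α Finset.univ (aN N) ε (fN N) x + R N := by
    intro N hN ε h1 h2
    have e1 : Uop 0 α Finset.univ (aN N) ε (fN N) x = ∫ y in {y | ε < |x - y|}, (Ioc (-(N:ℝ)) N).indicator (fun y => Kf α a x y * f y) y := by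
      rw [Uop_congr (b' := a) (fun j _ z hz => by rw [haN]; exact indicator_of_mem (by rw [hJ]; exact hz) _) (fN0 N) (hxN N hN)]
      unfold Uop
      congr 1; ext y
      by_cases hy : y ∈ Ioc (-(N:ℝ)) N
      · rw [indicator_of_mem hy, hfN]; simp only [hJ]; rw [indicator_of_mem hy]; rfl
      · rw [indicator_of_notMem hy, fN0 N y hy, mul_zero]
    have e2 : R N = ∫ y in {y | ε < |x - y|}, ((Ioc (-(N:ℝ)) N)ᶜ).indicator (fun y => Kf α a x y * f y) y := by
      have q1 : (Ioc (-(N:ℝ)) N)ᶜ ⊆ {y | 1 / 2 < |x - y|} := fun y hy => hxJ N hN y hy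
      have q2 : (Ioc (-(N:ℝ)) N)ᶜ ⊆ {y | ε < |x - y|} := fun y hy => h2.trans (q1 hy)
      rw [hR]
      simp only
      rw [setIntegral_indicator measurableSet_Ioc.compl, setIntegral_indicator measurableSet_Ioc.compl, inter_eq_right.2 q1, inter_eq_right.2 q2]
    rw [e1, e2, ← integral_add ((hI ε h1).indicator measurableSet_Ioc) ((hI ε h1).indicator measurableSet_Ioc.compl)]
    congr 1; ext y
    exact (congrFun (indicator_self_add_compl (Ioc (-(N:ℝ)) N) (fun y => Kf α a x y * f y)) y).symm
  obtain ⟨L, hL⟩ : ∃ L, Tendsto (fun ε : ℝ => ∫ y in {y | ε < |x - y|}, Kf α a x y * f y) (𝓝[>] 0) (𝓝 L) := by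
    obtain ⟨L, hL⟩ := hxb (max n0 n1) (le_max_left _ _) (hxN _ (le_max_right _ _))
    refine ⟨L + R (max n0 n1), (hL.add_const _).congr' ?_⟩
    filter_upwards [Ioo_mem_nhdsGT (show (0:ℝ) < 1 / 2 by norm_num)] with ε hε using (hsplit _ (le_max_right _ _) ε hε.1 hε.2).symm
  rw [hL.limUnder_eq] at hx1
  have hLR : Tendsto (fun N => |L - R N|) atTop (𝓝 |L - 0|) := (tendsto_const_nhds.sub hR0).abs
  rw [sub_zero] at hLR
  filter_upwards [hLR.eventually (lt_mem_nhds hx1), eventually_ge_atTop n1] with N hN1 hN2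
  refine ⟨hxN N hN2, ?_⟩
  have hUL : Tendsto (fun ε => |Uop 0 α Finset.univ (aN N) ε (fN N) x|) (𝓝[>] 0) (𝓝 |L - R N|) := by
    refine ((hL.sub_const (R N)).abs).congr' ?_
    filter_upwards [Ioo_mem_nhdsGT (show (0:ℝ) < 1 / 2 by norm_num)] with ε hε
    rw [hsplit N hN2 ε hε.1 hε.2, add_sub_cancel_right]
  have hseq : Tendsto (fun n : ℕ => 1 / ((n:ℝ) + 1)) atTop (𝓝[>] 0) :=
    tendsto_nhdsWithin_iff.2 ⟨tendsto_one_div_add_atTop_nhds_zero_nat, Eventually.of_forall fun n => by simp only [mem_Ioi]; positivity⟩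
  exact hseq.eventually (hUL.eventually (lt_mem_nhds hN1))

/-- The right-hand side. -/
noncomputable def RR {m : ℕ} (p : Fin m → ℝ) (a : Fin m → ℝ → ℝ) (f : ℝ → ℝ) (I : Set ℝ) : ℝ≥0∞ :=
  (∑ j, ∫⁻ y in I, ofReal (|a j y| ^ p j)) + ∫⁻ y in I, ofReal (Phi |f y|)

theorem Phi_zero : Phi 0 = 0 := by simp [Phi]

theorem RR_ind {m : ℕ} {p : Fin m → ℝ} (hp : ∀ j, 1 < p j) {a b : Fin m → ℝ → ℝ} {f : ℝ → ℝ} {I : Set ℝ} (hI : MeasurableSet I) (hb : ∀ j, b j =ᵐ[volume] I.indicator (a j)) :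
    RR p b (I.indicator f) univ = RR p a f I := by
  unfold RR; simp only [Measure.restrict_univ]
  congr 1
  · refine Finset.sum_congr rfl fun j _ => ?_
    rw [← lintegral_indicator hI]; refine lintegral_congr_ae ?_
    filter_upwards [hb j] with y hy
    rw [hy]; by_cases h : y ∈ I
    · simp [h]
    · simp [h, Real.zero_rpow (by linarith [hp j] : p j ≠ 0)]
  · rw [← lintegral_indicator hI]
    congr 1; ext y
    by_cases h : y ∈ I <;> simp [h, Phi_zero]

theorem maxE (f : ℝ → ℝ) : ∃ E : Set ℝ, MeasurableSet E ∧ AEMeasurable f (volume.restrict E) ∧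
    ∀ S, MeasurableSet S → AEMeasurable f (volume.restrict S) → volume (S \ E) = 0 := by
  obtain ⟨ν, hν⟩ : ∃ ν, ν = (volume : Measure ℝ).toFinite := ⟨_, rfl⟩
  obtain ⟨u, -, hu, hm⟩ := exists_seq_tendsto_sSup (S := ν '' {S | MeasurableSet S ∧ AEMeasurable f (volume.restrict S)}) (Set.Nonempty.image _ ⟨∅, MeasurableSet.empty, by simp⟩) (OrderTop.bddAbove _)
  choose s hs hsu using hm
  have hE : MeasurableSet (⋃ n, s n) := MeasurableSet.iUnion fun n => (hs n).1
  have hEf : AEMeasurable f (volume.restrict (⋃ n, s n)) := aemeasurable_iUnion_iff.2 fun n => (hs n).2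
  refine ⟨⋃ n, s n, hE, hEf, fun S hS hSf => ?_⟩
  have h1 : ν (S ∪ ⋃ n, s n) ≤ ν (⋃ n, s n) := by
    refine (le_sSup (mem_image_of_mem ν (show (S ∪ ⋃ n, s n) ∈ {S | MeasurableSet S ∧ AEMeasurable f (volume.restrict S)} from ⟨hS.union hE, aemeasurable_union_iff.2 ⟨hSf, hEf⟩⟩))).trans ?_
    exact le_of_tendsto' hu fun n => by rw [← hsu n]; exact measure_mono (subset_iUnion _ _)
  have hfin : IsFiniteMeasure ν := by rw [hν]; infer_instance
  have h2 : ν (S \ ⋃ n, s n) = 0 := by rw [← union_diff_right, measure_diff subset_union_right hE.nullMeasurableSet (measure_ne_top _ _), tsub_eq_zero_iff_le]; exact h1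
  rw [hν] at h2
  exact absolutelyContinuous_toFinite volume h2

theorem LI_of_rpow {g : ℝ → ℝ} {q : ℝ} (hq : 1 < q) (gm : Measurable g) (h : ∫⁻ y, ofReal (|g y| ^ q) ≠ ⊤) : LI g := by
  intro u v; rw [intervalIntegrable_iff]
  have h1 : Integrable (fun y => |g y| ^ q) := ⟨(gm.abs.pow_const q).aestronglyMeasurable, by
    rw [hasFiniteIntegral_iff_ofReal (ae_of_all _ fun y => by positivity)]
    exact h.lt_top⟩
  have h2 : IntegrableOn (fun y => 1 + |g y| ^ q) (uIoc u v) := (integrableOn_const (by simp [uIoc])).add h1.integrableOn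
  refine h2.mono' gm.aestronglyMeasurable (ae_of_all _ fun y => ?_)
  rw [norm_eq_abs]
  rcases le_total |g y| 1 with hy | hy
  · linarith [Real.rpow_nonneg (abs_nonneg (g y)) q]
  · linarith [Real.self_le_rpow_of_one_le hy hq.le]

theorem Kf_meas {m : ℕ} {α : ℝ → ℝ} {a : Fin m → ℝ → ℝ} (hα : BMO1 α) (hαm : Measurable α) (ha : ∀ j, LI (a j)) (x : ℝ) : Measurable (Kf α a x) := by
  unfold Kf Kap; have h1 := Dq_meas_r hα.li x
  have h2 := Pk_meas_r (s := Finset.univ) (b := a) (fun j _ => ha j) x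
  fun_prop

theorem Cf {m : ℕ} {p : Fin m → ℝ} (hp : ∀ j, 1 < p j) : ∃ C : ℝ, 0 < C ∧ ∀ (α : ℝ → ℝ) (a : Fin m → ℝ → ℝ) (f : ℝ → ℝ),
    BMO1 α → Measurable α → (∀ j, Measurable (a j)) →
    volume {x | 1 < |limUnder (𝓝[>] 0) (fun ε : ℝ => ∫ y in {y | ε < |x - y|}, Kf α a x y * f y)|} ≤ ofReal C * RR p a f univ := by
  obtain ⟨C, hC, H⟩ := Cmeas hp
  refine ⟨C, hC, fun α a f hα hαm am => ?_⟩
  by_cases hR : RR p a f univ = ⊤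
  · rw [hR, ENNReal.mul_top (by simpa using hC)]; exact le_top
  obtain ⟨E, hE, hEf, hEmax⟩ := maxE f
  have hEi : AEMeasurable (E.indicator f) volume := (aemeasurable_indicator_iff hE).2 hEf
  obtain ⟨g, gm, hg⟩ := hEi
  have hle : RR p a g univ ≤ RR p a f univ := by
    unfold RR; refine add_le_add le_rfl ?_
    simp only [Measure.restrict_univ]; rw [lintegral_congr_ae (g := fun y => ofReal (Phi |E.indicator f y|)) (by filter_upwards [hg] with y hy; rw [hy])]
    refine lintegral_mono fun y => ?_
    by_cases h : y ∈ E <;> simp [h, Phi_zero]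
  have hGR : ∫⁻ x, Gg p a g x = RR p a g univ := by
    unfold Gg RR Phi; rw [lintegral_add_left (by fun_prop), lintegral_finset_sum _ (by fun_prop)]
    simp
  have hLI : ∀ j, LI (a j) := fun j => LI_of_rpow (hp j) (am j) (by
    have := (ENNReal.add_ne_top.1 hR).1; simp only [Measure.restrict_univ, ne_eq, ENNReal.sum_eq_top, not_exists, not_and] at this; exact this j (Finset.mem_univ j))
  refine (measure_mono ?_).trans ((H α a g hα hαm am gm (by rw [hGR]; exact ne_top_of_le_ne_top hR hle)).trans (by rw [hGR]; exact mul_le_mul' le_rfl hle))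
  intro x hx; have hx : 1 < |limUnder (𝓝[>] 0) (fun ε : ℝ => ∫ y in {y | ε < |x - y|}, Kf α a x y * f y)| := hx
  have hI : ∀ ε > 0, IntegrableOn (fun y => Kf α a x y * f y) {y | ε < |x - y|} := fun ε hε => by
    by_contra hc
    rw [not_int_lim hε hc] at hx; norm_num at hx
  have km := Kf_meas hα hαm hLI x
  have hNm : MeasurableSet {y | Kf α a x y ≠ 0} := measurableSet_eq_fun km measurable_const |>.compl
  have hNf : AEMeasurable f (volume.restrict {y | Kf α a x y ≠ 0}) := by
    have e : {y | Kf α a x y ≠ 0} = ⋃ n : ℕ, {y | Kf α a x y ≠ 0} ∩ {y | 1 / ((n:ℝ) + 1) < |x - y|} := by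
      rw [← inter_iUnion, eq_comm, inter_eq_left]; intro y hy
      have hxy : x - y ≠ 0 := fun hc => by
        apply hy
        simp [Kf, hc]
      obtain ⟨n, hn⟩ := exists_nat_one_div_lt (abs_pos.2 hxy)
      exact mem_iUnion.2 ⟨n, hn⟩
    rw [e, aemeasurable_iUnion_iff]; intro n
    have h1 : AEMeasurable (fun y => (Kf α a x y)⁻¹ * (Kf α a x y * f y)) (volume.restrict ({y | Kf α a x y ≠ 0} ∩ {y | 1 / ((n:ℝ) + 1) < |x - y|})) :=
      km.inv.aemeasurable.mul ((hI _ (by positivity)).aestronglyMeasurable.aemeasurable.mono_measure (Measure.restrict_mono inter_subset_right le_rfl))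
    refine h1.congr ((ae_restrict_iff' (hNm.inter (meas_trunc x _))).2 (ae_of_all _ fun y hy => ?_))
    have := hy.1; exact inv_mul_cancel_left₀ this _
  have h0 := hEmax _ hNm hNf
  have hae : ∀ᵐ y, Kf α a x y * f y = Kf α a x y * g y := by
    filter_upwards [hg, measure_eq_zero_iff_ae_notMem.1 h0] with y h1 h2
    by_cases hk : Kf α a x y = 0
    · rw [hk]; simp
    · have : y ∈ E := by by_contra hc; exact h2 ⟨hk, hc⟩
      rw [← h1, indicator_of_mem this]
  have e : (fun ε : ℝ => ∫ y in {y | ε < |x - y|}, Kf α a x y * f y) = fun ε : ℝ => ∫ y in {y | ε < |x - y|}, Kf α a x y * g y := by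
    ext ε
    exact integral_congr_ae (ae_restrict_of_ae hae)
  rw [e] at hx
  exact hx

/-- Mutual integrability. -/
def II {m : ℕ} (a : Fin m → ℝ → ℝ) (x y : ℝ) : Prop := ∀ j, IntervalIntegrable (a j) volume x y

theorem Kf_II {m : ℕ} {α : ℝ → ℝ} {a : Fin m → ℝ → ℝ} {x y : ℝ} (h : ¬ II a x y) : Kf α a x y = 0 := by
  unfold II at h; push Not at h
  obtain ⟨j, hj⟩ := h
  have : Dq (a j) x y = 0 := by unfold Dq Adiff; rw [intervalIntegral.integral_undef (fun hc => hj hc.symm), zero_div]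
  unfold Kf Pk; rw [Finset.prod_eq_zero (Finset.mem_univ j) this]
  simp

theorem II_ord {m : ℕ} (a : Fin m → ℝ → ℝ) (x : ℝ) : OrdConnected {y | II a x y} := by
  refine ⟨fun y hy z hz t ht j => (hy j).trans ?_⟩
  have h1 : IntervalIntegrable (a j) volume y z := (hy j).symm.trans (hz j)
  exact h1.mono_set (by rw [uIcc_of_le ht.1, uIcc_of_le (ht.1.trans ht.2)]; exact Icc_subset_Icc le_rfl ht.2)

theorem ord_ae {g : ℝ → ℝ} {I : Set ℝ} (hI : OrdConnected I) (h : ∀ u ∈ I, ∀ v ∈ I, IntervalIntegrable g volume u v) : AEMeasurable g (volume.restrict I) := by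
  have h1 : LocallyIntegrableOn g (interior I) volume := fun x hx => by
    obtain ⟨l, u, hlu, hsub⟩ := mem_nhds_iff_exists_Ioo_subset.1 (isOpen_interior.mem_nhds hx)
    obtain ⟨l', hl1, hl2⟩ := exists_between hlu.1
    obtain ⟨u', hu1, hu2⟩ := exists_between hlu.2
    have := (h l' (interior_subset (hsub ⟨hl1, by linarith⟩)) u' (interior_subset (hsub ⟨by linarith, hu2⟩))).1
    exact ⟨Ioc l' u', mem_nhdsWithin_of_mem_nhds (Ioc_mem_nhds hl2 hu1), this⟩
  have h2 := h1.aestronglyMeasurable.aemeasurable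
  have h3 : interior I =ᵐ[volume] I := by refine interior_ae_eq_of_null_frontier ?_; exact hI.convex.addHaar_frontier volume
  rwa [Measure.restrict_congr_set h3] at h2

theorem Ca {m : ℕ} {p : Fin m → ℝ} (hp : ∀ j, 1 < p j) : ∃ C : ℝ, 0 < C ∧ ∀ (α : ℝ → ℝ) (a : Fin m → ℝ → ℝ) (f : ℝ → ℝ),
    BMO1 α → Measurable α →
    volume {x | 1 < |limUnder (𝓝[>] 0) (fun ε : ℝ => ∫ y in {y | ε < |x - y|}, Kf α a x y * f y)|} ≤ ofReal C * RR p a f univ := by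
  obtain ⟨C, hC, H⟩ := Cf hp
  refine ⟨C, hC, fun α a f hα hαm => ?_⟩
  obtain ⟨B, hB⟩ : ∃ B, B = {x | 1 < |limUnder (𝓝[>] 0) (fun ε : ℝ => ∫ y in {y | ε < |x - y|}, Kf α a x y * f y)|} := ⟨_, rfl⟩
  rw [← hB]
  have hcl : ∀ q : ℝ, MeasurableSet {y | II a q y} := fun q => (II_ord a q).measurableSet
  have hone : ∀ q : ℝ, volume ({y | II a q y} ∩ B) ≤ ofReal C * RR p a f {y | II a q y} := fun q => by
    obtain ⟨I, hI⟩ : ∃ I, I = {y | II a q y} := ⟨_, rfl⟩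
    have mI : MeasurableSet I := by rw [hI]; exact hcl q
    have oI : OrdConnected I := by rw [hI]; exact II_ord a q
    have hII : ∀ x ∈ I, ∀ y, II a x y ↔ y ∈ I := fun x hx y => by
      rw [hI] at hx ⊢
      exact ⟨fun h j => (hx j).trans (h j), fun h j => (hx j).symm.trans (h j)⟩
    rw [← hI]; have hex : ∀ j, ∃ b, Measurable b ∧ b =ᵐ[volume] I.indicator (a j) := fun j => by
      obtain ⟨b, bm, hb⟩ := (aemeasurable_indicator_iff mI).2 (ord_ae oI (g := a j) fun u hu v hv => (hII u hu v).2 hv j)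
      exact ⟨b, bm, hb.symm⟩
    choose b bm hb using hex
    rw [← RR_ind hp mI hb]; refine (measure_mono ?_).trans (H α b (I.indicator f) hα hαm bm)
    rintro x ⟨hxI, hx⟩
    rw [hB] at hx; have hk : ∀ y, Kf α a x y * f y = Kf α b x y * I.indicator f y := fun y => by
      by_cases hy : y ∈ I
      · rw [indicator_of_mem hy]
        congr 1
        unfold Kf Pk Dq; congr 2
        refine Finset.prod_congr rfl fun j _ => ?_
        congr 1
        unfold Adiff; refine intervalIntegral.integral_congr_ae ?_
        filter_upwards [hb j] with t ht htI
        rw [ht, indicator_of_mem (oI.uIcc_subset hy hxI (uIoc_subset_uIcc htI))]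
      · rw [indicator_of_notMem hy, Kf_II (fun hc => hy ((hII x hxI y).1 hc))]
        simp
    have hx : 1 < |limUnder (𝓝[>] 0) (fun ε : ℝ => ∫ y in {y | ε < |x - y|}, Kf α a x y * f y)| := hx
    simp only [hk] at hx
    exact hx
  obtain ⟨S, hS⟩ : ∃ S, S = range (fun q : ℚ => {y | II a (q:ℝ) y}) := ⟨_, rfl⟩
  have cS : S.Countable := by rw [hS]; exact countable_range _
  have mS : ∀ I ∈ S, MeasurableSet I := by rw [hS]; rintro _ ⟨q, rfl⟩; exact hcl q
  have dS : S.PairwiseDisjoint id := by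
    rw [hS]; rintro _ ⟨q, rfl⟩ _ ⟨r, rfl⟩ hne
    rw [Function.onFun, Set.disjoint_left]; intro y h1 h2
    apply hne
    have h1 : II a q y := h1
    have h2 : II a r y := h2
    ext z
    exact ⟨fun hz j => ((h2 j).trans (h1 j).symm).trans (hz j), fun hz j => ((h1 j).trans (h2 j).symm).trans (hz j)⟩
  have hcov : B ⊆ ⋃ I ∈ S, I ∩ B := fun x hx => by
    have : ∃ q : ℚ, II a q x := by
      by_contra hc
      push Not at hc
      have hz : ∀ y, Kf α a x y = 0 := fun y => by
        rcases lt_trichotomy x y with h | h | h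
        · obtain ⟨q, h1, h2⟩ := exists_rat_btwn h
          refine Kf_II fun h3 => hc q fun j => ?_
          exact ((h3 j).mono_set (by rw [uIcc_of_le h.le, uIcc_of_le h1.le]; exact Icc_subset_Icc le_rfl h2.le) : IntervalIntegrable (a j) volume x q).symm
        · simp [Kf, h]
        · obtain ⟨q, h1, h2⟩ := exists_rat_btwn h
          refine Kf_II fun h3 => hc q fun j => ?_
          exact (h3 j).symm.mono_set (by rw [uIcc_of_le h.le, uIcc_of_le h2.le]; exact Icc_subset_Icc h1.le le_rfl)
      rw [hB] at hx; have hx : 1 < |limUnder (𝓝[>] 0) (fun ε : ℝ => ∫ y in {y | ε < |x - y|}, Kf α a x y * f y)| := hx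
      rw [lim_zero one_pos (fun ε _ _ => by simp [hz])] at hx
      norm_num at hx
    obtain ⟨q, hq⟩ := this
    exact mem_biUnion (by rw [hS]; exact ⟨q, rfl⟩) ⟨hq, hx⟩
  have hsum : ∀ F : ℝ → ℝ≥0∞, ∑' I : S, ∫⁻ y in (I : Set ℝ), F y ≤ ∫⁻ y in univ, F y := fun F => by have := lintegral_biUnion cS mS dS F (μ := volume); refine (le_of_eq this.symm).trans ?_; rw [Measure.restrict_univ]; exact setLIntegral_le_lintegral _ _
  calc volume B ≤ ∑' I : S, volume ((I : Set ℝ) ∩ B) := (measure_mono hcov).trans (measure_biUnion_le _ cS _)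
    _ ≤ ∑' I : S, ofReal C * RR p a f (I : Set ℝ) := by
        refine ENNReal.tsum_le_tsum fun I => ?_
        obtain ⟨q, hq⟩ : (I : Set ℝ) ∈ range (fun q : ℚ => {y | II a (q:ℝ) y}) := hS ▸ I.2
        rw [← hq]; exact hone q
    _ ≤ _ := by
        rw [ENNReal.tsum_mul_left]; refine mul_le_mul' le_rfl ?_
        unfold RR; rw [ENNReal.tsum_add, Summable.tsum_finsetSum fun _ _ => ENNReal.summable]
        exact add_le_add (Finset.sum_le_sum fun j _ => hsum _) (hsum _)

end CZ

/-- (2.17): weak type endpoint estimate for the generalized Calderón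
commutator with `L^{p_j}` control on `a_j` and `L log L` control on `f`. -/
theorem endpoint_LlogL_CcommA (m : ℕ) (A A' : ℝ → ℝ)
    (hA : ∀ x, HasDerivAt A (A' x) x) (hbmo : bmoNorm A' = 1)
    (p : Fin m → ℝ) (hp : ∀ j, 1 < p j) (ptot : ℝ)
    (hpt : 1 / ptot = (∑ j, 1 / p j) + 1)
    (hp1 : 1 / ((m : ℝ) + 1) < ptot) (hp2 : ptot < 1) :
    ∃ C : ℝ, 0 < C ∧
      ∀ (a : Fin m → ℝ → ℝ) (f : ℝ → ℝ),
        volume {x : ℝ | 1 < |CcommA m A A' a f x|} ≤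
          ENNReal.ofReal C *
            ((∑ j : Fin m, ∫⁻ y, ENNReal.ofReal (|a j y| ^ p j)) +
              ∫⁻ y, ENNReal.ofReal (|f y| * Real.log (Real.exp 1 + |f y|))) := by
  obtain ⟨C, hC, H⟩ := CZ.Ca hp
  refine ⟨C, hC, fun a f => ?_⟩
  have h := H A' a f (CZ.bmo1_of hA hbmo) (CZ.meas_deriv hA)
  unfold CZ.RR at h
  simp only [Measure.restrict_univ] at h
  have hk : ∀ x y, (P2 A A' x y * ∏ j, Adiff (a j) x y) / (x - y) ^ (m + 2) = CZ.Kf A' a x y := by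
    intro x y
    unfold CZ.Kf CZ.Kap CZ.Pk CZ.Dq P2
    rw [CZ.adiff_eq hA hbmo, Finset.prod_div_distrib, Finset.prod_const, Finset.card_univ, Fintype.card_fin]
    by_cases hxy : x - y = 0
    · simp [hxy]
    · field_simp
      ring
  unfold CcommA
  simp only [hk]
  exact h
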